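/- Let p, q ≥ 1 with gcd(p,q) = 1, and let f_p, f_q ∈ ℂ[x,y,z] be homogeneous polynomials of degrees p and q respectively such that: (i) neither f_p nor f_q is a k-th power of another polynomial for any k ≥ 2; (ii) f_p and f_q have no nonconstant common factor; (iii) there is a finite set A₀ ⊆ ℙ¹ such that for every [a:b] ∈ ℙ¹ \ A₀ the fiber {x ∈ ℙ² \ (V(f_p) ∩ V(f_q)) : b·f_p^q(x) = a·f_q^p(x)} of the pencil F = [f_p^q : f_q^p] is connected; (iv) for all nonzero a, b ∈ ℂ, the polynomial b·f_p^q − a·f_q^p is not a k-th power of another polynomial for any k ≥ 2. Then there exists a finite set A ⊆ ℙ¹ such that for every r ≥ 0 and every choice of r+1 distinct points [a₀:b₀],…,[a_r:b_r] ∈ ℙ¹ \ A, setting C = ⋃_{i=0}^{r} V(b_i·f_p^q − a_i·f_q^p), one has π₁(ℙ² \ C) ≅ 𝔽_r * ℤ_p * ℤ_q. -/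

import Mathlib

open MvPolynomial

noncomputable section

/-- The complex projective plane, as the projectivization of `ℂ³`. -/
abbrev P2 : Type := Projectivization ℂ (Fin 3 → ℂ)

/-- The complex projective line, as the projectivization of `ℂ²`. -/
abbrev P1 : Type := Projectivization ℂ (Fin 2 → ℂ)

instance : TopologicalSpace P2 :=
  inferInstanceAs (TopologicalSpace (Quotient (projectivizationSetoid ℂ (Fin 3 → ℂ))))

instance : TopologicalSpace P1 :=
  inferInstanceAs (TopologicalSpace (Quotient (projectivizationSetoid ℂ (Fin 2 → ℂ))))

/-- The zero locus in `ℙ²` of a homogeneous polynomial `g ∈ ℂ[x,y,z]`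
(for homogeneous `g` the vanishing of `g` at the chosen representative `x.rep`
is independent of the choice of representative). -/
def V (g : MvPolynomial (Fin 3) ℂ) : Set P2 :=
  {x | eval x.rep g = 0}

/-- The point `[a:b] ∈ ℙ¹`. -/
def pt (a b : ℂ) (hab : ![a, b] ≠ 0) : P1 := Projectivization.mk ℂ ![a, b] hab

open MvPolynomial

noncomputable section

namespace Oka

open unitInterval Set Topology

/-- A `Γ`-valued local system in terms of parallel transport along paths. -/
structure LS (Z : Type*) [TopologicalSpace Z] (Γ : Type*) [Group Γ] where
  f : C(I, Z) → Γ
  mul : ∀ {x y z : Z} (α : Path x y) (β : Path y z),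
    f (α.trans β).toContinuousMap = f α.toContinuousMap * f β.toContinuousMap
  hom : ∀ {x y : Z} (α β : Path x y), α.Homotopic β → f α.toContinuousMap = f β.toContinuousMap

variable {Z W : Type*} [TopologicalSpace Z] [TopologicalSpace W] {Γ Δ : Type*} [Group Γ] [Group Δ]

/-- a continuous map from the interval as a path -/
def toPath (γ : C(I, Z)) : Path (γ 0) (γ 1) := ⟨γ, rfl, rfl⟩

@[simp] lemma toPath_coe (γ : C(I, Z)) : (toPath γ).toContinuousMap = γ := rfl

/-- a path between two given points as an element of `C(I, Z)` with endpoint equalities -/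
def asPath {x y : Z} (γ : C(I, Z)) (h0 : γ 0 = x) (h1 : γ 1 = y) : Path x y := ⟨γ, h0, h1⟩

@[simp] lemma asPath_coe {x y : Z} (γ : C(I, Z)) (h0 : γ 0 = x) (h1 : γ 1 = y) :
    (asPath γ h0 h1).toContinuousMap = γ := rfl

theorem path_induction (P : C(I, Z) → Prop)
    (hloc : ∀ z : Z, ∃ O ∈ 𝓝 z, ∀ γ : C(I, Z), (∀ t, γ t ∈ O) → P γ)
    (htrans : ∀ {x y z : Z} (α : Path x y) (β : Path y z), P α.toContinuousMap →
      P β.toContinuousMap → P (α.trans β).toContinuousMap)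
    (hhom : ∀ {x y : Z} (α β : Path x y), α.Homotopic β → P α.toContinuousMap →
      P β.toContinuousMap) (γ : C(I, Z)) : P γ := by
  choose O hO hP using hloc
  have h1 : ∀ i : Z, IsOpen (γ ⁻¹' interior (O i)) := fun i =>
    isOpen_interior.preimage γ.continuous
  obtain ⟨t, ht0, hmono, ⟨n, hn⟩, hsub⟩ := exists_monotone_Icc_subset_open_cover_unitInterval h1
    (fun s _ => mem_iUnion.2 ⟨γ s, mem_interior_iff_mem_nhds.2 (hO _)⟩)
  have key : ∀ k, P ((toPath γ).subpath 0 (t k)).toContinuousMap := by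
    intro k
    induction k with
    | zero =>
      rw [ht0, Path.subpath_self]
      apply hP (γ 0)
      intro t
      exact mem_of_mem_nhds (hO _)
    | succ k ih =>
      refine hhom _ _ ⟨Path.Homotopy.subpathTransSubpath (toPath γ) 0 (t k) (t (k+1))⟩
        (htrans _ _ ih ?_)
      obtain ⟨i, hi⟩ := hsub k
      apply hP i
      intro s
      have : ((toPath γ).subpath (t k) (t (k+1))) s ∈ range ((toPath γ).subpath (t k) (t (k+1))) :=
        ⟨s, rfl⟩
      rw [Path.range_subpath_of_le _ _ _ (hmono (Nat.le_succ k))] at this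
      obtain ⟨s', hs', h⟩ := this
      have h2 := hi hs'
      have : ((toPath γ).subpath (t k) (t (k+1))).toContinuousMap s = γ s' := h.symm
      rw [this]
      exact interior_subset h2
  have := key n
  rw [hn n le_rfl, Path.subpath_zero_one] at this
  exact this

/-- convex sets are simply connected -/
lemma convex_sc {E : Type*} [AddCommGroup E] [Module ℝ E] [TopologicalSpace E] [ContinuousAdd E]
    [ContinuousSMul ℝ E] {s : Set E} (hs : Convex ℝ s) (hne : s.Nonempty) :
    SimplyConnectedSpace s := by
  have := hs.contractibleSpace hne
  infer_instance

lemma starConvex_sc {E : Type*} [AddCommGroup E] [Module ℝ E] [TopologicalSpace E] [ContinuousAdd E]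
    [ContinuousSMul ℝ E] {s : Set E} {x : E} (hs : StarConvex ℝ x s) (hne : s.Nonempty) :
    SimplyConnectedSpace s := by
  have := hs.contractibleSpace hne
  infer_instance

lemma sq_contractible : ContractibleSpace (I × I) := by
  have h : ContractibleSpace I := (convex_Icc (0:ℝ) 1).contractibleSpace ⟨0, by simp⟩
  infer_instance

namespace LS

variable (L : LS Z Γ)

lemma f_const (z : Z) : L.f (ContinuousMap.const I z) = 1 := by
  have h := L.mul (Path.refl z) (Path.refl z)
  rw [Path.refl_trans_refl] at h
  exact (mul_eq_left (a := L.f (Path.refl z).toContinuousMap)).1 h.symm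

lemma f_refl (z : Z) : L.f (Path.refl z).toContinuousMap = 1 := L.f_const z

lemma f_eq_one_of_const (γ : C(I, Z)) (h : ∀ t, γ t = γ 0) : L.f γ = 1 := by
  rw [← L.f_const (γ 0)]
  congr 1
  ext t
  exact h t

lemma f_symm {x y : Z} (α : Path x y) : L.f α.symm.toContinuousMap = (L.f α.toContinuousMap)⁻¹ := by
  rw [eq_inv_iff_mul_eq_one, ← L.mul, ← L.f_refl y]
  apply L.hom
  exact ⟨(Path.Homotopy.reflSymmTrans α).symm⟩

/-- pull back -/
def comap (g : C(W, Z)) : LS W Γ where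
  f γ := L.f (g.comp γ)
  mul α β := by
    have := L.mul (α.map g.continuous) (β.map g.continuous)
    rw [← Path.map_trans] at this
    exact this
  hom α β h := L.hom (α.map g.continuous) (β.map g.continuous) (h.map g)

@[simp] lemma comap_f (g : C(W, Z)) (γ : C(I, W)) : (L.comap g).f γ = L.f (g.comp γ) := rfl

/-- push forward under a homomorphism -/
def push (φ : Γ →* Δ) : LS Z Δ where
  f γ := φ (L.f γ)
  mul α β := by rw [L.mul, map_mul]
  hom α β h := by rw [L.hom α β h]

@[simp] lemma push_f (φ : Γ →* Δ) (γ : C(I, Z)) : (L.push φ).f γ = φ (L.f γ) := rfl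

/-- pairing of two local systems -/
def pair (L' : LS Z Δ) : LS Z (Γ × Δ) where
  f γ := (L.f γ, L'.f γ)
  mul α β := by rw [L.mul, L'.mul]; rfl
  hom α β h := by rw [L.hom α β h, L'.hom α β h]

/-- trivialised: transport determined by the endpoints. -/
theorem triv [SimplyConnectedSpace Z] : ∃ b : Z → Γ, ∀ γ, L.f γ = (b (γ 0))⁻¹ * b (γ 1) := by
  obtain ⟨z0⟩ : Nonempty Z := inferInstance
  have hp : ∀ z, Nonempty (Path z0 z) := fun z => PathConnectedSpace.joined z0 z
  refine ⟨fun z => L.f (hp z).some.toContinuousMap, fun γ => ?_⟩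
  rw [eq_inv_mul_iff_mul_eq]
  have := L.mul (hp (γ 0)).some (toPath γ)
  rw [toPath_coe] at this
  rw [← this]
  exact L.hom _ _ (SimplyConnectedSpace.paths_homotopic _ _)

lemma f_eq_of_sc [SimplyConnectedSpace W] (g : C(W, Z)) (γ γ' : C(I, W)) (h0 : γ 0 = γ' 0)
    (h1 : γ 1 = γ' 1) : L.f (g.comp γ) = L.f (g.comp γ') := by
  obtain ⟨b, hb⟩ := (L.comap g).triv
  have e1 := hb γ
  have e2 := hb γ'
  rw [comap_f] at e1 e2
  rw [e1, e2, h0, h1]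

/-- commuting square for homotopies -/
lemma square (H : C(I × I, Z)) (a b c d : C(I, Z)) (ha : ∀ t, a t = H (t, 0))
    (hb : ∀ t, b t = H (1, t)) (hc : ∀ t, c t = H (0, t)) (hd : ∀ t, d t = H (t, 1)) :
    L.f a * L.f b = L.f c * L.f d := by
  have : ContractibleSpace (I × I) := sq_contractible
  obtain ⟨β, hβ⟩ := (L.comap H).triv
  have e1 := hβ ⟨fun t => (t, 0), by fun_prop⟩
  have e2 := hβ ⟨fun t => (1, t), by fun_prop⟩
  have e3 := hβ ⟨fun t => (0, t), by fun_prop⟩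
  have e4 := hβ ⟨fun t => (t, 1), by fun_prop⟩
  rw [comap_f] at e1 e2 e3 e4
  have a1 : a = H.comp ⟨fun t => (t, 0), by fun_prop⟩ := by ext t; exact ha t
  have a2 : b = H.comp ⟨fun t => (1, t), by fun_prop⟩ := by ext t; exact hb t
  have a3 : c = H.comp ⟨fun t => (0, t), by fun_prop⟩ := by ext t; exact hc t
  have a4 : d = H.comp ⟨fun t => (t, 1), by fun_prop⟩ := by ext t; exact hd t
  rw [a1, a2, a3, a4, e1, e2, e3, e4]
  simp

/-- local to global with a gauge and a subgroup -/
theorem locGlob (b : Z → Γ) (H : Subgroup Γ)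
    (hloc : ∀ z : Z, ∃ O ∈ 𝓝 z, ∀ γ : C(I, Z), (∀ t, γ t ∈ O) → b (γ 0) * L.f γ * (b (γ 1))⁻¹ ∈ H)
    (γ : C(I, Z)) : b (γ 0) * L.f γ * (b (γ 1))⁻¹ ∈ H := by
  refine path_induction (fun γ => b (γ 0) * L.f γ * (b (γ 1))⁻¹ ∈ H) hloc ?_ ?_ γ
  · intro x y z α β h1 h2
    have h := H.mul_mem h1 h2
    simp only [Path.coe_toContinuousMap, Path.source, Path.target] at h ⊢
    rw [L.mul]
    convert h using 1
    group
  · intro x y α β h h1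
    simp only [Path.coe_toContinuousMap, Path.source, Path.target] at h1 ⊢
    rw [← L.hom _ _ h]
    exact h1

/-- local to global: two local systems that are locally gauge equivalent (by a global gauge) -/
theorem locGlob2 (L' : LS Z Γ) (b : Z → Γ)
    (hloc : ∀ z : Z, ∃ O ∈ 𝓝 z, ∀ γ : C(I, Z), (∀ t, γ t ∈ O) →
      b (γ 0) * L.f γ * (b (γ 1))⁻¹ = L'.f γ)
    (γ : C(I, Z)) : b (γ 0) * L.f γ * (b (γ 1))⁻¹ = L'.f γ := by
  have key := (L.pair L').locGlob (fun z => (b z, 1))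
    ((MonoidHom.fst Γ Γ).eqLocus (MonoidHom.snd Γ Γ)) ?_ γ
  · have : ((b (γ 0), (1:Γ)) * (L.f γ, L'.f γ) * (b (γ 1), (1:Γ))⁻¹).1 =
      ((b (γ 0), (1:Γ)) * (L.f γ, L'.f γ) * (b (γ 1), (1:Γ))⁻¹).2 := key
    simpa using this
  · intro z
    obtain ⟨O, hO, h⟩ := hloc z
    refine ⟨O, hO, fun γ hγ => ?_⟩
    have h2 := h γ hγ
    change ((b (γ 0), (1:Γ)) * (L.f γ, L'.f γ) * (b (γ 1), (1:Γ))⁻¹).1 =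
      ((b (γ 0), (1:Γ)) * (L.f γ, L'.f γ) * (b (γ 1), (1:Γ))⁻¹).2
    simpa using h2

end LS

open CategoryTheory in
/-- the tautological local system with values in the fundamental group -/
theorem exists_univ (U : Type) [TopologicalSpace U] [PathConnectedSpace U] (x0 : U) :
    ∃ τ : LS U (FundamentalGroup U x0),
      (∀ n, ∃ α : Path x0 x0, τ.f α.toContinuousMap = n) ∧
      (∀ (G : Type) [Group G] (L : LS U G), ∃ φ : FundamentalGroup U x0 →* G, ∃ b : U → G,
        ∀ γ, L.f γ = (b (γ 0))⁻¹ * φ (τ.f γ) * b (γ 1)) := by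
  have hp : ∀ z, Nonempty (Path x0 z) := fun z => PathConnectedSpace.joined x0 z
  let c : ∀ z, Path x0 z := fun z => (hp z).some
  let A : ∀ {x y : U}, Path x y → (FundamentalGroupoid.mk x ⟶ FundamentalGroupoid.mk y) :=
    fun {x y} α => Path.Homotopic.Quotient.mk α
  let T : ∀ {x y : U}, Path x y → FundamentalGroup U x0 := fun {x y} α =>
    A (c y) ≫ CategoryTheory.inv (A α) ≫ CategoryTheory.inv (A (c x))
  have hT : ∀ {x y x' y' : U} (α : Path x y) (β : Path x' y') (hx : x = x') (hy : y = y'),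
      α.toContinuousMap = β.toContinuousMap → T α = T β := by
    rintro x y x' y' α β rfl rfl h
    have : α = β := by ext t; exact congrArg (fun g : C(I, U) => g t) h
    rw [this]
  have hA : ∀ {x y z : U} (α : Path x y) (β : Path y z), A (α.trans β) = A α ≫ A β :=
    fun α β => rfl
  let τ : LS U (FundamentalGroup U x0) :=
  { f := fun γ => T (toPath γ)
    mul := by
      intro x y z α β
      rw [hT (toPath (α.trans β).toContinuousMap) (α.trans β) (by simp) (by simp) rfl,
        hT (toPath α.toContinuousMap) α (by simp) (by simp) rfl,
        hT (toPath β.toContinuousMap) β (by simp) (by simp) rfl]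
      change _ ≫ _ ≫ _ = (_ ≫ _ ≫ _) ≫ (_ ≫ _ ≫ _)
      rw [hA]
      simp
    hom := by
      intro x y α β h
      rw [hT (toPath α.toContinuousMap) α (by simp) (by simp) rfl,
        hT (toPath β.toContinuousMap) β (by simp) (by simp) rfl]
      have : A α = A β := Path.Homotopic.Quotient.eq.2 h
      change _ ≫ _ ≫ _ = _ ≫ _ ≫ _
      rw [this] }
  have hτ : ∀ {x y : U} (α : Path x y), τ.f α.toContinuousMap = T α := fun α =>
    hT (toPath α.toContinuousMap) α (by simp) (by simp) rfl
  refine ⟨τ, ?_, ?_⟩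
  · intro n
    obtain ⟨β, hβ⟩ := Path.Homotopic.Quotient.mk_surjective n
    refine ⟨((c x0).symm.trans β.symm).trans (c x0), ?_⟩
    rw [hτ]
    change _ ≫ _ ≫ _ = _
    rw [hA, hA]
    have h1 : A (c x0).symm = CategoryTheory.inv (A (c x0)) := by
      rw [← CategoryTheory.Groupoid.inv_eq_inv]; rfl
    have h2 : A β.symm = CategoryTheory.inv (A β) := by
      rw [← CategoryTheory.Groupoid.inv_eq_inv]; rfl
    rw [h1, h2]
    simp
    exact hβ
  · intro G _ L
    let F : FundamentalGroup U x0 → G := fun n => Quotient.lift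
      (fun β : Path x0 x0 => (L.f β.toContinuousMap)⁻¹) (fun α β h => by
        change (L.f _)⁻¹ = (L.f _)⁻¹
        rw [L.hom α β h]) n
    have hF : ∀ β : Path x0 x0, F (A β) = (L.f β.toContinuousMap)⁻¹ := fun β => rfl
    refine ⟨MonoidHom.mk' F ?_, fun x => L.f (c x).toContinuousMap, ?_⟩
    · intro m n
      obtain ⟨α, rfl⟩ := Path.Homotopic.Quotient.mk_surjective m
      obtain ⟨β, rfl⟩ := Path.Homotopic.Quotient.mk_surjective n
      change F (A (β.trans α)) = F (A α) * F (A β)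
      rw [hF, hF, hF, L.mul, mul_inv_rev]
    · intro γ
      have h1 : ∀ {x y : U} (α : Path x y), A α.symm = CategoryTheory.inv (A α) := by
        intro x y α
        rw [← CategoryTheory.Groupoid.inv_eq_inv]; rfl
      have : τ.f γ = A ((c (γ 1)).trans ((toPath γ).symm.trans (c (γ 0)).symm)) := by
        rw [hA, hA, h1, h1]
      rw [this]
      change _ = _ * F (A _) * _
      rw [hF, L.mul, L.mul, L.f_symm, L.f_symm, toPath_coe]
      group

end Oka

end

open MvPolynomial

noncomputable section

namespace Oka

open unitInterval Set Topology Filter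

set_option linter.unusedSectionVars false

section COV

variable {Z : Type*} [TopologicalSpace Z] {Γ : Type*} [Group Γ] {ι : Type*}

/-- `s` is a flat section along the map `γ` (with respect to local frames `u i` on `O i`). -/
def Flat (O : ι → Set Z) (u : ι → Z → Γ) {W : Type*} [TopologicalSpace W] (γ : W → Z) (s : W → Γ) :
    Prop :=
  ∀ i w, γ w ∈ O i → ∀ᶠ w' in 𝓝 w, (u i (γ w'))⁻¹ * s w' = (u i (γ w))⁻¹ * s w

variable {O : ι → Set Z} {u : ι → Z → Γ} {W W' : Type*} [TopologicalSpace W] [TopologicalSpace W']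

lemma Flat.comp {γ : W → Z} {s : W → Γ} (h : Flat O u γ s) {φ : W' → W} (hφ : Continuous φ) :
    Flat O u (γ ∘ φ) (s ∘ φ) := fun i w hw =>
  (hφ.tendsto w).eventually (h i (φ w) hw)

lemma Flat.unique (hcov : ∀ z, ∃ i, z ∈ O i) [PreconnectedSpace W]
    {γ : W → Z} {s s' : W → Γ}
    (h : Flat O u γ s) (h' : Flat O u γ s') (w w' : W) : s w * (s w')⁻¹ = s' w * (s' w')⁻¹ := by
  have : IsLocallyConstant (fun w => (s w)⁻¹ * s' w) := by
    rw [IsLocallyConstant.iff_eventually_eq]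
    intro w
    obtain ⟨i, hi⟩ := hcov (γ w)
    filter_upwards [h i w hi, h' i w hi] with w' h1 h2
    have : (s w')⁻¹ * s' w' = ((u i (γ w'))⁻¹ * s w')⁻¹ * ((u i (γ w'))⁻¹ * s' w') := by group
    rw [this, h1, h2]
    group
  have h1 := this.apply_eq_of_preconnectedSpace w w'
  have h2 : s' w = s w * ((s w')⁻¹ * s' w') := by rw [← h1]; group
  rw [h2]
  group

lemma Flat.const_of_const (hcov : ∀ z, ∃ i, z ∈ O i) [PreconnectedSpace W]
    {γ : W → Z} {s : W → Γ}
    (h : Flat O u γ s) (hγ : ∀ w w', γ w = γ w') (w w' : W) : s w = s w' := by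
  have h2 : Flat O u γ (fun _ => (1 : Γ)) := by
    intro i w _
    exact Eventually.of_forall fun w' => by rw [hγ w' w]
  have := h.unique hcov h2 w w'
  simpa [mul_inv_eq_one] using this

lemma exists_flat (hO : ∀ i, IsOpen (O i)) (hcov : ∀ z, ∃ i, z ∈ O i)
    (hloc : ∀ i j, ∀ z, z ∈ O i → z ∈ O j → ∀ᶠ z' in 𝓝 z,
      (u j z')⁻¹ * u i z' = (u j z)⁻¹ * u i z) [SimplyConnectedSpace W]
    [LocallyPathConnectedSpace W] (γ : C(W, Z)) : ∃ s : W → Γ, Flat O u γ s := by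
  let _ : TopologicalSpace Γ := ⊥
  have _ : DiscreteTopology Γ := ⟨rfl⟩
  choose idx hidx using hcov
  let core : FiberBundleCore ι Z Γ :=
  { baseSet := O
    isOpen_baseSet := hO
    indexAt := idx
    mem_baseSet_at := hidx
    coordChange := fun i j z v => (u j z)⁻¹ * u i z * v
    coordChange_self := by intros; group
    continuousOn_coordChange := by
      rintro i j ⟨z, v⟩ ⟨⟨h1, h2⟩, -⟩
      apply ContinuousAt.continuousWithinAt
      have e : (fun p : Z × Γ => (u j p.1)⁻¹ * u i p.1 * p.2) =ᶠ[𝓝 (z, v)]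
          fun _ => (u j z)⁻¹ * u i z * v := by
        have h3 : ∀ᶠ v' in 𝓝 v, v' = v := by simp
        rw [nhds_prod_eq]
        filter_upwards [(hloc i j z h1 h2).prod_mk h3] with p hp
        rw [hp.1, hp.2]
      exact ContinuousAt.congr continuousAt_const e.symm
    coordChange_comp := by intros; group }
  have cov : IsCoveringMap (Bundle.TotalSpace.proj : core.TotalSpace → Z) :=
    FiberBundle.isCoveringMap
  obtain ⟨w0⟩ : Nonempty W := inferInstance
  obtain ⟨F, ⟨-, hF⟩, -⟩ := cov.existsUnique_continuousMap_lifts γ w0 ⟨γ w0, (1 : Γ)⟩ rfl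
  refine ⟨fun w => u (idx (γ w)) (γ w) * (show Γ from (F w).2), ?_⟩
  have hF' : ∀ w, (F w).1 = γ w := fun w => congrFun hF w
  intro i w hw
  have key : ∀ w', (u i (γ w'))⁻¹ * (u (idx (γ w')) (γ w') * (show Γ from (F w').2)) =
      (core.localTriv i (F w')).2 := by
    intro w'
    rw [core.localTriv_apply]
    change _ = (u i (F w').1)⁻¹ * u (idx (F w').1) (F w').1 * _
    rw [hF']
    exact (mul_assoc _ _ _).symm
  simp only [key]
  have hc : ContinuousAt (fun w' => (core.localTriv i (F w')).2) w := by
    have h1 : F w ∈ (core.localTriv i).source := by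
      rw [core.mem_localTriv_source]
      change (F w).1 ∈ O i
      rw [hF']; exact hw
    have h2 := (core.localTriv i).continuousAt h1
    exact continuous_snd.continuousAt.comp (ContinuousAt.comp (f := F) (x := w) h2 F.continuous.continuousAt)
  have := hc (IsOpen.mem_nhds (isOpen_discrete {(core.localTriv i (F w)).2}) rfl)
  exact this

/-- construct a local system from local frames -/
theorem exists_LS (hO : ∀ i, IsOpen (O i)) (hcov : ∀ z, ∃ i, z ∈ O i)
    (hloc : ∀ i j, ∀ z, z ∈ O i → z ∈ O j → ∀ᶠ z' in 𝓝 z,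
      (u j z')⁻¹ * u i z' = (u j z)⁻¹ * u i z) :
    ∃ L : LS Z Γ, ∀ i (γ : C(I, Z)), (∀ t, γ t ∈ O i) → L.f γ = u i (γ 0) * (u i (γ 1))⁻¹ := by
  have ex1 : ∀ γ : C(I, Z), ∃ s : I → Γ, Flat O u γ s := by
    intro γ
    obtain ⟨s, hs⟩ := exists_flat (W := ℝ) hO hcov hloc
      ⟨γ ∘ projIcc (0:ℝ) 1 zero_le_one, by fun_prop⟩
    refine ⟨s ∘ Subtype.val, ?_⟩
    convert hs.comp continuous_subtype_val using 1
    ext t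
    simp
  have ex2 : ∀ γ : C(I × I, Z), ∃ s : I × I → Γ, Flat O u γ s := by
    intro γ
    obtain ⟨s, hs⟩ := exists_flat (W := ℝ × ℝ) hO hcov hloc
      ⟨γ ∘ Prod.map (projIcc (0:ℝ) 1 zero_le_one) (projIcc (0:ℝ) 1 zero_le_one), by fun_prop⟩
    refine ⟨s ∘ Prod.map Subtype.val Subtype.val, ?_⟩
    convert hs.comp (φ := Prod.map (Subtype.val : I → ℝ) (Subtype.val : I → ℝ)) (by fun_prop) using 1
    ext t
    change γ t = γ (projIcc 0 1 _ (t.1 : ℝ), projIcc 0 1 _ (t.2 : ℝ))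
    rw [projIcc_val, projIcc_val]
  choose S hS using ex1
  have val : ∀ (γ : C(I, Z)) (s : I → Γ), Flat O u γ s → S γ 0 * (S γ 1)⁻¹ = s 0 * (s 1)⁻¹ :=
    fun γ s hs => (hS γ).unique hcov hs 0 1
  refine ⟨⟨fun γ => S γ 0 * (S γ 1)⁻¹, ?_, ?_⟩, ?_⟩
  · intro x y z α β
    let h1 : I → I := fun t => ⟨t / 2, by have := t.2; constructor <;> linarith [this.1, this.2]⟩
    let h2 : I → I := fun t => ⟨(t + 1) / 2, by have := t.2; constructor <;> linarith [this.1, this.2]⟩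
    have c1 : Continuous h1 := by unfold h1; fun_prop
    have c2 : Continuous h2 := by unfold h2; fun_prop
    have f1 := (hS (α.trans β).toContinuousMap).comp c1
    have f2 := (hS (α.trans β).toContinuousMap).comp c2
    have e1 : ((α.trans β).toContinuousMap ∘ h1) = α.toContinuousMap := by
      ext t
      simp only [Function.comp_apply, Path.coe_toContinuousMap, Path.trans_apply]
      have : ((h1 t : I) : ℝ) ≤ 1 / 2 := by simp only [h1]; linarith [t.2.2]
      rw [dif_pos this]
      congr 1
      ext
      simp [h1]
      ring
    have e2 : ((α.trans β).toContinuousMap ∘ h2) = β.toContinuousMap := by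
      ext t
      simp only [Function.comp_apply, Path.coe_toContinuousMap, Path.trans_apply]
      split_ifs with h
      · have h0 : t = 0 := by
          ext
          simp only [h2] at h
          have := t.2.1
          simp only [Icc.coe_zero]
          linarith
        subst h0
        have : (⟨2 * ((h2 0 : I) : ℝ), (unitInterval.mul_pos_mem_iff zero_lt_two).2 ⟨(h2 0).2.1, h⟩⟩ : I) = 1 := by
          ext; simp [h2]
        rw [this]; simp
      · congr 1
        ext
        simp [h2]
        ring
    rw [e1] at f1
    rw [e2] at f2
    rw [val _ _ f1, val _ _ f2]
    have a1 : h1 0 = 0 := by ext; simp [h1]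
    have a2 : h1 1 = h2 0 := by ext; simp [h1, h2]
    have a3 : h2 1 = 1 := by ext; simp [h2]
    simp only [Function.comp_apply, a1, a2, a3]
    group
  · rintro x y α β ⟨H⟩
    obtain ⟨s, hs⟩ := ex2 H.toContinuousMap
    have k0 : Continuous (fun t : I => ((0 : I), t)) := by fun_prop
    have k1 : Continuous (fun t : I => ((1 : I), t)) := by fun_prop
    have k2 : Continuous (fun t : I => (t, (0 : I))) := by fun_prop
    have k3 : Continuous (fun t : I => (t, (1 : I))) := by fun_prop
    have f0 := hs.comp k0
    have f1 := hs.comp k1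
    have f2 := hs.comp k2
    have f3 := hs.comp k3
    have e0 : (H.toContinuousMap ∘ fun t : I => ((0 : I), t)) = α.toContinuousMap := by
      ext t; simp
    have e1 : (H.toContinuousMap ∘ fun t : I => ((1 : I), t)) = β.toContinuousMap := by
      ext t; simp
    rw [e0] at f0
    rw [e1] at f1
    rw [val _ _ f0, val _ _ f1]
    have g2 := f2.const_of_const hcov (by intro w w'; simp) 0 1
    have g3 := f3.const_of_const hcov (by intro w w'; simp) 0 1
    simp only [Function.comp_apply] at g2 g3 ⊢
    rw [g2, g3]
  · intro i γ hγ
    refine val γ (fun t => u i (γ t)) ?_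
    intro j t ht
    exact (γ.continuous.tendsto t).eventually (hloc i j (γ t) (hγ t) ht)

end COV

end Oka

end

open MvPolynomial

noncomputable section

namespace Oka

open unitInterval Set Topology Filter

/-- Descent of a local system along a map with connected fibres and tubes. -/
theorem descent {S B Γ : Type*} [TopologicalSpace S] [TopologicalSpace B] [Group Γ]
    (f : C(S, B)) (ρ : LS S Γ) (hsurj : Function.Surjective f)
    (hfib : ∀ x y, f x = f y → ∃ κ : C(I, S), κ 0 = x ∧ κ 1 = y ∧ ∀ t, f (κ t) = f x)
    (𝒟 : Set (Set B)) (hopen : ∀ D ∈ 𝒟, IsOpen D)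
    (hbasis : ∀ b, ∀ N ∈ 𝓝 b, ∃ D ∈ 𝒟, b ∈ D ∧ D ⊆ N)
    (hpc : ∀ D ∈ 𝒟, ∀ x y, f x ∈ D → f y ∈ D →
      ∃ κ : C(I, S), κ 0 = x ∧ κ 1 = y ∧ ∀ t, f (κ t) ∈ D)
    (htriv : ∀ D ∈ 𝒟, ∀ κ κ' : C(I, S), κ 0 = κ' 0 → κ 1 = κ' 1 → (∀ t, f (κ t) ∈ D) →
      (∀ t, f (κ' t) ∈ D) → ρ.f κ = ρ.f κ') :
    ∃ L : LS B Γ, ∃ h : S → Γ, ∀ γ, ρ.f γ = h (γ 0) * L.f (f.comp γ) * (h (γ 1))⁻¹ := by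
  classical
  obtain ⟨e, he⟩ := hsurj.hasRightInverse
  let T : Set B → S → S → Γ := fun D x y =>
    if h : ∃ κ : C(I, S), κ 0 = x ∧ κ 1 = y ∧ ∀ t, f (κ t) ∈ D then ρ.f h.choose else 1
  have hT : ∀ D ∈ 𝒟, ∀ κ : C(I, S), (∀ t, f (κ t) ∈ D) → ρ.f κ = T D (κ 0) (κ 1) := by
    intro D hD κ hκ
    have h : ∃ κ' : C(I, S), κ' 0 = κ 0 ∧ κ' 1 = κ 1 ∧ ∀ t, f (κ' t) ∈ D := ⟨κ, rfl, rfl, hκ⟩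
    simp only [T, dif_pos h]
    obtain ⟨h1, h2, h3⟩ := h.choose_spec
    exact htriv D hD _ _ h1.symm h2.symm hκ h3
  have hmul : ∀ D ∈ 𝒟, ∀ x y z, f x ∈ D → f y ∈ D → f z ∈ D → T D x z = T D x y * T D y z := by
    intro D hD x y z hx hy hz
    obtain ⟨κ, a1, a2, a3⟩ := hpc D hD x y hx hy
    obtain ⟨κ', b1, b2, b3⟩ := hpc D hD y z hy hz
    have e1 := hT D hD κ a3
    have e2 := hT D hD κ' b3
    rw [a1, a2] at e1
    rw [b1, b2] at e2
    have e3 := hT D hD ((asPath κ a1 a2).trans (asPath κ' b1 b2)).toContinuousMap (by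
      intro t
      have : ((asPath κ a1 a2).trans (asPath κ' b1 b2)) t ∈ range ((asPath κ a1 a2).trans (asPath κ' b1 b2)) := ⟨t, rfl⟩
      rw [Path.trans_range] at this
      rcases this with ⟨s, hs⟩ | ⟨s, hs⟩
      · change f (((asPath κ a1 a2).trans (asPath κ' b1 b2)) t) ∈ D
        rw [← hs]; exact a3 s
      · change f (((asPath κ a1 a2).trans (asPath κ' b1 b2)) t) ∈ D
        rw [← hs]; exact b3 s)
    rw [ρ.mul, asPath_coe, asPath_coe] at e3
    simp only [Path.coe_toContinuousMap, Path.source, Path.target] at e3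
    rw [← e3, e1, e2]
  have hT1 : ∀ D ∈ 𝒟, ∀ x, f x ∈ D → T D x x = 1 := by
    intro D hD x hx
    have := hmul D hD x x x hx hx hx
    exact (mul_eq_left (a := T D x x)).1 this.symm
  have hsub : ∀ D ∈ 𝒟, ∀ D' ∈ 𝒟, D' ⊆ D → ∀ x y, f x ∈ D' → f y ∈ D' → T D x y = T D' x y := by
    intro D hD D' hD' hs x y hx hy
    obtain ⟨κ, a1, a2, a3⟩ := hpc D' hD' x y hx hy
    have e1 := hT D hD κ (fun t => hs (a3 t))
    have e2 := hT D' hD' κ a3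
    rw [a1, a2] at e1 e2
    rw [← e1, e2]
  let ι := {x : Set B × B // x.1 ∈ 𝒟 ∧ x.2 ∈ x.1}
  have hef : ∀ b, f (e b) = b := he
  obtain ⟨L, hL⟩ := exists_LS (Z := B) (Γ := Γ) (ι := ι) (O := fun i => i.1.1)
    (u := fun i b => T i.1.1 (e b) (e i.1.2)) (fun i => hopen _ i.2.1)
    (fun b => by
      obtain ⟨D, h1, h2, -⟩ := hbasis b univ univ_mem
      exact ⟨⟨(D, b), h1, h2⟩, h2⟩)
    (by
      rintro ⟨⟨D, d⟩, h1, h2⟩ ⟨⟨D', d'⟩, h1', h2'⟩ b hb hb'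
      obtain ⟨D'', k1, k2, k3⟩ := hbasis b (D ∩ D')
        (inter_mem ((hopen _ h1).mem_nhds hb) ((hopen _ h1').mem_nhds hb'))
      filter_upwards [(hopen _ k1).mem_nhds k2] with b' hb''
      simp only at *
      have m1 := hmul D h1 (e b') (e b) (e d) (by rw [hef]; exact (k3 hb'').1)
        (by rwa [hef]) (by rwa [hef])
      have m2 := hmul D' h1' (e b') (e b) (e d') (by rw [hef]; exact (k3 hb'').2)
        (by rwa [hef]) (by rwa [hef])
      rw [m1, m2, hsub D h1 D'' k1 (fun _ h => (k3 h).1) _ _ (by rwa [hef]) (by rwa [hef]),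
        hsub D' h1' D'' k1 (fun _ h => (k3 h).2) _ _ (by rwa [hef]) (by rwa [hef])]
      group)
  choose κ k0 k1 k2 using fun x => hfib x (e (f x)) (by rw [hef])
  refine ⟨L, fun x => ρ.f (κ x), fun γ => ?_⟩
  have key := ρ.locGlob2 (L.comap f) (fun x => (ρ.f (κ x))⁻¹) ?_ γ
  · rw [LS.comap_f] at key
    rw [← key]
    group
  · intro z
    obtain ⟨D, h1, h2, -⟩ := hbasis (f z) univ univ_mem
    refine ⟨f ⁻¹' D, f.continuous.continuousAt.preimage_mem_nhds ((hopen _ h1).mem_nhds h2), ?_⟩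
    intro γ hγ
    have a0 := hT D h1 (κ (γ 0)) (fun t => by rw [k2]; exact hγ 0)
    have a1 := hT D h1 (κ (γ 1)) (fun t => by rw [k2]; exact hγ 1)
    have a2 := hT D h1 γ hγ
    have a3 := hL ⟨(D, f z), h1, h2⟩ (f.comp γ) hγ
    rw [k0, k1] at a0 a1
    simp only at a3
    have m1 := hmul D h1 (γ 0) (γ 1) (e (f (γ 1))) (hγ 0) (hγ 1) (by rw [hef]; exact hγ 1)
    have m2 := hmul D h1 (γ 0) (e (f (γ 0))) (e (f (γ 1))) (hγ 0) (by rw [hef]; exact hγ 0)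
      (by rw [hef]; exact hγ 1)
    have m3 := hmul D h1 (e (f (γ 0))) (e (f (γ 1))) (e (f z)) (by rw [hef]; exact hγ 0)
      (by rw [hef]; exact hγ 1) (by rwa [hef])
    rw [LS.comap_f, a3, a0, a1, a2]
    change _ = T D (e (f (γ 0))) (e (f z)) * (T D (e (f (γ 1))) (e (f z)))⁻¹
    rw [m3, mul_inv_cancel_right, inv_inv, mul_assoc, ← m1, m2]
    group

end Oka

end

open MvPolynomial
noncomputable section
namespace Oka
open unitInterval Set Topology Filter

/-- trivialise a local system on a simply connected subset -/
lemma LS.triv_sub {X Γ : Type*} [TopologicalSpace X] [Group Γ] {S : Set X} (L : LS S Γ) {A : Set X}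
    (hAS : A ⊆ S) (hA : SimplyConnectedSpace A) :
    ∃ B : X → Γ, ∀ γ : C(I, S), (∀ t, (γ t : X) ∈ A) → L.f γ = (B (γ 0))⁻¹ * B (γ 1) := by
  classical
  obtain ⟨b, hb⟩ := (L.comap ⟨Set.inclusion hAS, continuous_inclusion hAS⟩).triv
  refine ⟨fun x => if h : x ∈ A then b ⟨x, h⟩ else 1, fun γ hγ => ?_⟩
  have := hb ⟨fun t => ⟨γ t, hγ t⟩, by fun_prop⟩
  simp only [hγ, dif_pos]
  exact this

/-- two trivialisations on a path connected set differ by a constant -/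
lemma triv_diff {X Γ : Type*} [AddCommGroup X] [Module ℝ X] [TopologicalSpace X] [ContinuousAdd X]
    [ContinuousSMul ℝ X] [Group Γ] {S : Set X} (L : LS S Γ) {A : Set X} (hAS : A ⊆ S)
    (hA : Convex ℝ A) (B B' : X → Γ)
    (hB : ∀ γ : C(I, S), (∀ t, (γ t : X) ∈ A) → L.f γ = (B (γ 0))⁻¹ * B (γ 1))
    (hB' : ∀ γ : C(I, S), (∀ t, (γ t : X) ∈ A) → L.f γ = (B' (γ 0))⁻¹ * B' (γ 1)) :
    ∃ k : Γ, ∀ x ∈ A, B' x = k * B x := by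
  rcases A.eq_empty_or_nonempty with rfl | ⟨x0, hx0⟩
  · exact ⟨1, by simp⟩
  refine ⟨B' x0 * (B x0)⁻¹, fun x hx => ?_⟩
  have hseg : ∀ t : I, x0 + (t : ℝ) • (x - x0) ∈ A := fun t =>
    hA.add_smul_sub_mem hx0 hx t.2
  let γ : C(I, S) := ⟨fun t => ⟨x0 + (t : ℝ) • (x - x0), hAS (hseg t)⟩, by
    apply Continuous.subtype_mk
    exact continuous_const.add (by
      exact (continuous_subtype_val : Continuous (fun t : I => (t : ℝ))).smul continuous_const)⟩
  have h1 := hB γ hseg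
  have h2 := hB' γ hseg
  have e0 : ((γ 0 : S) : X) = x0 := by simp [γ]
  have e1 : ((γ 1 : S) : X) = x := by simp [γ]
  rw [e0, e1] at h1 h2
  have h3 := h1.symm.trans h2
  have : B' x = B' x0 * ((B' x0)⁻¹ * B' x) := by group
  rw [this, ← h3]
  group

/-- normalised coordinate -/
def zt (o p w : ℂ) : ℂ := (w - o) / (p - o)

@[fun_prop] lemma continuous_zt (o p : ℂ) : Continuous (zt o p) := by unfold zt; fun_prop

def ray (o p : ℂ) : Set ℂ := {w | (zt o p w).im = 0 ∧ 1 ≤ (zt o p w).re}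
def V0 (P : Finset ℂ) (o : ℂ) : Set ℂ := {w | ∀ p ∈ P, w ∉ ray o p}
def Vs (o : ℂ) (ε : ℝ) (p : ℂ) : Set ℂ :=
  {w | 1 < (zt o p w).re ∧ |(zt o p w).im| < ε * (zt o p w).re}

structure Good (P : Finset ℂ) (o : ℂ) (ε : ℝ) : Prop where
  epos : 0 < ε
  ne : ∀ p ∈ P, p ≠ o
  sep : ∀ p ∈ P, ∀ p' ∈ P, p ≠ p' → ε * (zt o p p').re < |(zt o p p').im|

lemma Good.mono {P P' : Finset ℂ} {o : ℂ} {ε : ℝ} (h : Good P o ε) (hP : P' ⊆ P) : Good P' o ε :=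
  ⟨h.epos, fun p hp => h.ne p (hP hp), fun p hp p' hp' => h.sep p (hP hp) p' (hP hp')⟩

lemma isClosed_ray (o p : ℂ) : IsClosed (ray o p) :=
  (isClosed_eq (f := fun w => (zt o p w).im) (by fun_prop) continuous_const).inter
    (isClosed_le (g := fun w => (zt o p w).re) continuous_const (by fun_prop))

lemma isOpen_V0 (P : Finset ℂ) (o : ℂ) : IsOpen (V0 P o) := by
  have : V0 P o = (⋃ p ∈ P, ray o p)ᶜ := by ext w; simp [V0]
  rw [this, isOpen_compl_iff]
  exact P.finite_toSet.isClosed_biUnion fun p _ => isClosed_ray o p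

lemma isOpen_Vs (o : ℂ) (ε : ℝ) (p : ℂ) : IsOpen (Vs o ε p) :=
  (isOpen_lt (g := fun w => (zt o p w).re) continuous_const (by fun_prop)).inter
    (isOpen_lt (f := fun w => |(zt o p w).im|) (g := fun w => ε * (zt o p w).re)
      (by fun_prop) (by fun_prop))

lemma zt_comb (o p x y : ℂ) (a b : ℝ) (hab : a + b = 1) :
    zt o p (a • x + b • y) = a * zt o p x + b * zt o p y := by
  unfold zt
  have : (a:ℂ) + b = 1 := by exact_mod_cast hab
  rw [Complex.real_smul, Complex.real_smul]
  have : (a:ℂ) * x + b * y - o = a * (x - o) + b * (y - o) := by linear_combination o * this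
  rw [this]; ring

lemma convex_re (o p : ℂ) (K : Set (ℝ × ℝ)) (hK : Convex ℝ K) :
    Convex ℝ {w | ((zt o p w).re, (zt o p w).im) ∈ K} := by
  intro x hx y hy a b ha hb hab
  have := hK hx hy ha hb hab
  simp only [mem_ofPred_eq] at *
  rw [zt_comb o p x y a b hab]
  convert this using 1
  simp

lemma convex_Vs (o : ℂ) (ε : ℝ) (p : ℂ) : Convex ℝ (Vs o ε p) := by
  refine convex_re o p {x | 1 < x.1 ∧ |x.2| < ε * x.1} ?_
  rintro ⟨x1, x2⟩ ⟨hx1, hx2⟩ ⟨y1, y2⟩ ⟨hy1, hy2⟩ a b ha hb hab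
  simp only [mem_ofPred_eq, Prod.smul_mk, Prod.mk_add_mk, smul_eq_mul, abs_lt] at *
  rcases ha.eq_or_lt with rfl | ha
  · have : b = 1 := by linarith
    subst this
    simpa using ⟨hy1, hy2⟩
  refine ⟨by nlinarith, ?_, ?_⟩ <;> nlinarith

lemma convex_Vs_pos (o : ℂ) (ε : ℝ) (p : ℂ) : Convex ℝ (Vs o ε p ∩ {w | 0 < (zt o p w).im}) := by
  refine (convex_Vs o ε p).inter (convex_re o p {x | 0 < x.2} ?_)
  exact (convex_Ioi (0:ℝ)).is_linear_preimage ⟨fun _ _ => rfl, fun _ _ => rfl⟩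

lemma convex_Vs_neg (o : ℂ) (ε : ℝ) (p : ℂ) : Convex ℝ (Vs o ε p ∩ {w | (zt o p w).im < 0}) := by
  refine (convex_Vs o ε p).inter (convex_re o p {x | x.2 < 0} ?_)
  exact (convex_Iio (0:ℝ)).is_linear_preimage ⟨fun _ _ => rfl, fun _ _ => rfl⟩

lemma starConvex_V0 (P : Finset ℂ) (o : ℂ) : StarConvex ℝ o (V0 P o) := by
  intro y hy a b ha hb hab p hp ⟨h1, h2⟩
  apply hy p hp
  rw [zt_comb o p o y a b hab] at h1 h2
  have : zt o p o = 0 := by simp [zt]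
  rw [this] at h1 h2
  simp at h1 h2
  have hb' : 0 < b := by
    rcases hb.eq_or_lt with rfl | h
    · simp at h2; linarith
    · exact h
  refine ⟨h1.resolve_left hb'.ne', ?_⟩
  have hb1 : b ≤ 1 := by linarith
  nlinarith


lemma o_mem_V0 {P : Finset ℂ} {o : ℂ} {ε : ℝ} (_hG : Good P o ε) : o ∈ V0 P o := by
  intro p hp ⟨_, h⟩
  simp [zt] at h
  linarith

lemma sc_V0 {P : Finset ℂ} {o : ℂ} {ε : ℝ} (hG : Good P o ε) : SimplyConnectedSpace (V0 P o) :=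
  starConvex_sc (starConvex_V0 P o) ⟨o, o_mem_V0 hG⟩

lemma self_mem_ray {P : Finset ℂ} {o : ℂ} {ε : ℝ} (hG : Good P o ε) {p : ℂ} (hp : p ∈ P) : p ∈ ray o p := by
  have : zt o p p = 1 := div_self (sub_ne_zero.2 (hG.ne p hp))
  simp [ray, this]

lemma V0_sub {P : Finset ℂ} {o : ℂ} {ε : ℝ} (hG : Good P o ε) : V0 P o ⊆ (↑P : Set ℂ)ᶜ := fun w hw hP => hw w hP (self_mem_ray hG hP)

lemma Vs_ray {P : Finset ℂ} {o : ℂ} {ε : ℝ} (hG : Good P o ε) {p p' w : ℂ} (hp : p ∈ P) (hp' : p' ∈ P) (hw : w ∈ Vs o ε p) (hw' : w ∈ ray o p') :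
    p = p' := by
  by_contra hne
  have h1 := hG.sep p hp p' hp' hne
  have n1 := sub_ne_zero.2 (hG.ne p hp)
  have n2 := sub_ne_zero.2 (hG.ne p' hp')
  have e : zt o p w = ((zt o p' w).re : ℂ) * zt o p p' := by
    have : ((zt o p' w).re : ℂ) = zt o p' w := by
      apply Complex.ext <;> simp [hw'.1]
    rw [this]; unfold zt; field_simp
  have h2 := hw.2
  rw [e, Complex.re_ofReal_mul, Complex.im_ofReal_mul, abs_mul, abs_of_nonneg (by linarith [hw'.2])] at h2
  have h3 := hw'.2
  nlinarith

lemma Vs_sub {P : Finset ℂ} {o : ℂ} {ε : ℝ} (hG : Good P o ε) {p : ℂ} (hp : p ∈ P) : Vs o ε p ⊆ (↑P : Set ℂ)ᶜ := by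
  intro w hw hP
  have := Vs_ray hG hp hP hw (self_mem_ray hG hP)
  subst this
  have h : zt o p p = 1 := div_self (sub_ne_zero.2 (hG.ne p hp))
  have := hw.1
  rw [h] at this
  simp at this

lemma ray_mem_Vs {P : Finset ℂ} {o : ℂ} {ε : ℝ} (hG : Good P o ε) {p w : ℂ} (hp : p ∈ P) (hw : w ∈ ray o p) (hne : w ≠ p) : w ∈ Vs o ε p := by
  have n1 := sub_ne_zero.2 (hG.ne p hp)
  obtain ⟨h1, h2⟩ := hw
  have h3 : 1 < (zt o p w).re := by
    rcases h2.eq_or_lt with h | h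
    · exfalso
      have e : zt o p w = 1 := Complex.ext (by simp [← h]) (by simp [h1])
      apply hne
      unfold zt at e
      rw [div_eq_one_iff_eq n1] at e
      simpa using e
    · exact h
  refine ⟨h3, ?_⟩
  rw [h1, abs_zero]
  exact mul_pos hG.epos (by linarith)

lemma mem_V0_or {P : Finset ℂ} {o : ℂ} {ε : ℝ} (hG : Good P o ε) {w : ℂ} (hw : w ∉ P) : w ∈ V0 P o ∨ ∃ p ∈ P, w ∈ ray o p ∧ w ∈ Vs o ε p := by
  by_cases h : w ∈ V0 P o
  · exact Or.inl h
  · right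
    simp only [V0, mem_ofPred_eq, not_forall, not_not] at h
    obtain ⟨p, hp, h⟩ := h
    exact ⟨p, hp, h, ray_mem_Vs hG hp h (by rintro rfl; exact hw hp)⟩

lemma Vs_V0 {P : Finset ℂ} {o : ℂ} {ε : ℝ} (hG : Good P o ε) {p w : ℂ} (hp : p ∈ P) (hw : w ∈ Vs o ε p) (h : (zt o p w).im ≠ 0) : w ∈ V0 P o := by
  intro p' hp' hr
  have := Vs_ray hG hp hp' hw hr
  subst this
  exact h hr.1

open Classical in
def uu {Γ : Type*} [Group Γ] (o : ℂ) (z : ℂ → Γ) (p w : ℂ) : Γ := if 0 < (zt o p w).im then z p else 1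

lemma uu_loc {Γ : Type*} [Group Γ] (o : ℂ) (z : ℂ → Γ) (p w : ℂ) (h : (zt o p w).im ≠ 0) :
    ∀ᶠ w' in 𝓝 w, uu o z p w' = uu o z p w := by
  have hc : Continuous fun w => (zt o p w).im := by fun_prop
  rcases lt_or_gt_of_ne h with h | h
  · filter_upwards [hc.continuousAt.eventually_lt_const h] with w' h'
    simp [uu, not_lt.2 h.le, not_lt.2 h'.le]
  · filter_upwards [hc.continuousAt.eventually_const_lt h] with w' h'
    simp [uu, h, h']

/-- standard local system -/
theorem exists_St {P : Finset ℂ} {o : ℂ} {ε : ℝ} (hG : Good P o ε) {Γ : Type*} [Group Γ]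
    (z : ℂ → Γ) : ∃ L : LS ↥((↑P : Set ℂ)ᶜ) Γ,
      (∀ γ, (∀ t, (γ t : ℂ) ∈ V0 P o) → L.f γ = 1) ∧
      ∀ p ∈ P, ∀ γ, (∀ t, (γ t : ℂ) ∈ Vs o ε p) →
        L.f γ = uu o z p (γ 0) * (uu o z p (γ 1))⁻¹ := by
  have hoff : ∀ p ∈ P, ∀ w, w ∈ Vs o ε p → w ∉ ray o p → (zt o p w).im ≠ 0 := by
    intro p hp w hw hr h
    exact hr ⟨h, hw.1.le⟩
  have hev : ∀ p (w : ↥((↑P : Set ℂ)ᶜ)), (zt o p w).im ≠ 0 → ∀ᶠ w' : ↥((↑P : Set ℂ)ᶜ) in 𝓝 w,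
      uu o z p (w' : ℂ) = uu o z p w := fun p w h =>
    (continuous_subtype_val.tendsto w).eventually (uu_loc o z p w h)
  obtain ⟨L, hL⟩ := exists_LS (Z := ↥((↑P : Set ℂ)ᶜ)) (ι := Option P)
    (O := fun i => i.elim {w | (w : ℂ) ∈ V0 P o} (fun p => {w | (w : ℂ) ∈ Vs o ε p}))
    (u := fun i w => i.elim 1 (fun p => uu o z p w))
    (by
      rintro (_ | p)
      · exact (isOpen_V0 P o).preimage continuous_subtype_val
      · exact (isOpen_Vs o ε p).preimage continuous_subtype_val)
    (by
      intro w
      rcases mem_V0_or hG w.2 with h | ⟨p, hp, _, h⟩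
      · exact ⟨none, h⟩
      · exact ⟨some ⟨p, hp⟩, h⟩)
    (by
      rintro (_ | ⟨p, hp⟩) (_ | ⟨p', hp'⟩) w hw hw'
      · simp
      · simp only [Option.elim] at hw hw' ⊢
        filter_upwards [hev p' w (hoff p' hp' w hw' (hw p' hp'))] with w' h
        rw [h]
      · simp only [Option.elim] at hw hw' ⊢
        filter_upwards [hev p w (hoff p hp w hw (hw' p hp))] with w' h
        rw [h]
      · by_cases e : p = p'
        · subst e; simp
        · simp only [Option.elim] at hw hw' ⊢
          filter_upwards [hev p w (hoff p hp w hw fun hr => e (Vs_ray hG hp' hp hw' hr).symm),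
            hev p' w (hoff p' hp' w hw' fun hr => e (Vs_ray hG hp hp' hw hr))] with w' h h'
          rw [h, h'])
  refine ⟨L, fun γ h => ?_, fun p hp γ h => hL (some ⟨p, hp⟩) γ h⟩
  simpa using hL none γ h

def St {P : Finset ℂ} {o : ℂ} {ε : ℝ} (hG : Good P o ε) {Γ : Type*} [Group Γ]
    (z : ℂ → Γ) : LS ↥((↑P : Set ℂ)ᶜ) Γ := (exists_St hG z).choose

lemma St_V0 {P : Finset ℂ} {o : ℂ} {ε : ℝ} (hG : Good P o ε) {Γ : Type*} [Group Γ]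
    (z : ℂ → Γ) (γ) (h : ∀ t, (γ t : ℂ) ∈ V0 P o) : (St hG z).f γ = 1 :=
  (exists_St hG z).choose_spec.1 γ h

lemma St_Vs {P : Finset ℂ} {o : ℂ} {ε : ℝ} (hG : Good P o ε) {Γ : Type*} [Group Γ]
    (z : ℂ → Γ) {p} (hp : p ∈ P) (γ) (h : ∀ t, (γ t : ℂ) ∈ Vs o ε p) :
    (St hG z).f γ = uu o z p (γ 0) * (uu o z p (γ 1))⁻¹ :=
  (exists_St hG z).choose_spec.2 p hp γ h

/-- local checks on the complement of a finite set -/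
lemma planar_loc {P : Finset ℂ} {o : ℂ} {ε : ℝ} (hG : Good P o ε)
    (Q : C(I, ↥((↑P : Set ℂ)ᶜ)) → Prop) (h0 : ∀ γ, (∀ t, (γ t : ℂ) ∈ V0 P o) → Q γ)
    (h1 : ∀ p ∈ P, ∀ γ, (∀ t, (γ t : ℂ) ∈ Vs o ε p) → Q γ) (z : ↥((↑P : Set ℂ)ᶜ)) :
    ∃ O ∈ 𝓝 z, ∀ γ : C(I, ↥((↑P : Set ℂ)ᶜ)), (∀ t, γ t ∈ O) → Q γ := by
  rcases mem_V0_or hG z.2 with h | ⟨p, hp, _, h⟩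
  · exact ⟨_, continuous_subtype_val.continuousAt.preimage_mem_nhds ((isOpen_V0 P o).mem_nhds h), h0⟩
  · exact ⟨_, continuous_subtype_val.continuousAt.preimage_mem_nhds ((isOpen_Vs o ε p).mem_nhds h),
      h1 p hp⟩

theorem PL1 {P : Finset ℂ} {o : ℂ} {ε : ℝ} (hG : Good P o ε) {Γ : Type*} [Group Γ]
    (L : LS ↥((↑P : Set ℂ)ᶜ) Γ) : ∃ (z : ℂ → Γ) (b : ↥((↑P : Set ℂ)ᶜ) → Γ), ∀ γ,
      b (γ 0) * L.f γ * (b (γ 1))⁻¹ = (St hG z).f γ := by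
  classical
  obtain ⟨B0, hB0⟩ := L.triv_sub (V0_sub hG) (sc_V0 hG)
  have key : ∀ p ∈ P, ∃ (B : ℂ → Γ) (w : Γ),
      (∀ γ : C(I, ↥((↑P : Set ℂ)ᶜ)), (∀ t, (γ t : ℂ) ∈ Vs o ε p) → L.f γ = (B (γ 0))⁻¹ * B (γ 1)) ∧
      (∀ x ∈ Vs o ε p, (zt o p x).im < 0 → B0 x = B x) ∧
      (∀ x ∈ Vs o ε p, 0 < (zt o p x).im → B0 x = w * B x) := by
    intro p hp
    have hne : (Vs o ε p).Nonempty := by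
      have n1 := sub_ne_zero.2 (hG.ne p hp)
      refine ⟨o + 2 * (p - o), ?_⟩
      have : zt o p (o + 2 * (p - o)) = 2 := by unfold zt; field_simp; ring
      simp [Vs, this, hG.epos]
    obtain ⟨B, hB⟩ := L.triv_sub (Vs_sub hG hp) (convex_sc (convex_Vs o ε p) hne)
    obtain ⟨k, hk⟩ := triv_diff L (fun x hx => Vs_sub hG hp hx.1) (convex_Vs_neg o ε p) B B0
      (fun γ h => hB γ fun t => (h t).1) (fun γ h => hB0 γ fun t => Vs_V0 hG hp (h t).1 (h t).2.ne)
    obtain ⟨k', hk'⟩ := triv_diff L (fun x hx => Vs_sub hG hp hx.1) (convex_Vs_pos o ε p) B B0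
      (fun γ h => hB γ fun t => (h t).1)
      (fun γ h => hB0 γ fun t => Vs_V0 hG hp (h t).1 (ne_of_gt (h t).2))
    refine ⟨fun x => k * B x, k' * k⁻¹, fun γ h => ?_, fun x hx h => hk x ⟨hx, h⟩, fun x hx h => ?_⟩
    · rw [hB γ h]; group
    · rw [hk' x ⟨hx, h⟩]; group
  choose! B w hB hneg hpos using key
  refine ⟨w, fun x => if h : ∃ p ∈ P, (x : ℂ) ∈ ray o p then B h.choose x else B0 x, fun γ => ?_⟩
  refine L.locGlob2 (St hG w)
    (fun x => if h : ∃ p ∈ P, (x : ℂ) ∈ ray o p then B h.choose x else B0 x)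
    (planar_loc hG _ ?_ ?_) γ
  · intro γ h
    rw [St_V0 hG w γ h, hB0 γ h]
    have hh : ∀ t, ¬ ∃ p ∈ P, (γ t : ℂ) ∈ ray o p := fun t ⟨p, hp, hr⟩ => h t p hp hr
    simp only [hh, dif_neg, not_false_eq_true]
    group
  · intro p hp γ h
    rw [St_Vs hG w hp γ h, hB p hp γ h]
    have hh : ∀ t, (if h : ∃ p ∈ P, (γ t : ℂ) ∈ ray o p then B h.choose (γ t) else B0 (γ t)) =
        uu o w p (γ t) * B p (γ t) := by
      intro t
      split_ifs with hx
      · have := Vs_ray hG hp hx.choose_spec.1 (h t) hx.choose_spec.2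
        have h2 := hx.choose_spec.2
        rw [← this] at h2 ⊢
        simp [uu, h2.1]
      · have : (zt o p (γ t)).im ≠ 0 := fun e => hx ⟨p, hp, e, (h t).1.le⟩
        rcases lt_or_gt_of_ne this with e | e
        · simp [uu, not_lt.2 e.le, hneg p hp _ (h t) e]
        · simp [uu, e, hpos p hp _ (h t) e]
    rw [hh, hh]
    group

lemma St_mem {P : Finset ℂ} {o : ℂ} {ε : ℝ} (hG : Good P o ε) {Γ : Type*} [Group Γ]
    (z : ℂ → Γ) (H : Subgroup Γ) (hz : ∀ p ∈ P, z p ∈ H) (γ) : (St hG z).f γ ∈ H := by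
  have := (St hG z).locGlob (fun _ => 1) H (planar_loc hG _ ?_ ?_) γ
  · simpa using this
  · intro γ h; simp [St_V0 hG z γ h]
  · intro p hp γ h
    have hu : ∀ w, uu o z p w ∈ H := by
      intro w; unfold uu; split_ifs
      exacts [hz p hp, H.one_mem]
    rw [St_Vs hG z hp γ h]
    simpa using H.mul_mem (hu _) (H.inv_mem (hu _))

/-- existence of good base points -/
theorem exists_good (P : Finset ℂ) : ∃ o ε, Good P o ε := by
  have h1 : ∃ t : ℝ, ∀ x ∈ P ×ˢ P, (⟨t, t^2⟩ : ℂ) ≠ x.1 ∧ (x.1 ≠ x.2 →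
      (x.2.re - x.1.re) * t^2 + (x.1.im - x.2.im) * t + (x.1.re * x.2.im - x.2.re * x.1.im) ≠ 0) := by
    have hfin : (⋃ x ∈ P ×ˢ P, ({t : ℝ | (⟨t, t^2⟩ : ℂ) = x.1} ∪ {t : ℝ | x.1 ≠ x.2 ∧
      (x.2.re - x.1.re) * t^2 + (x.1.im - x.2.im) * t + (x.1.re * x.2.im - x.2.re * x.1.im) = 0})).Finite := by
      refine Set.Finite.biUnion (P ×ˢ P).finite_toSet fun x _ => Set.Finite.union ?_ ?_
      · refine (Set.finite_singleton x.1.re).subset ?_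
        intro t ht
        simp only [mem_ofPred_eq] at ht
        simp [← ht]
      · by_cases hx : x.1 = x.2
        · simp [hx]
        let f : Polynomial ℝ := Polynomial.C (x.2.re - x.1.re) * Polynomial.X ^ 2 +
          Polynomial.C (x.1.im - x.2.im) * Polynomial.X +
          Polynomial.C (x.1.re * x.2.im - x.2.re * x.1.im)
        have hf : f ≠ 0 := by
          intro h0
          apply hx
          have c1 : f.coeff 1 = x.1.im - x.2.im := by
            simp only [f, Polynomial.coeff_add, Polynomial.coeff_C_mul, Polynomial.coeff_X_pow,
              Polynomial.coeff_X, Polynomial.coeff_C]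
            simp
          have c2 : f.coeff 2 = x.2.re - x.1.re := by
            simp only [f, Polynomial.coeff_add, Polynomial.coeff_C_mul, Polynomial.coeff_X_pow,
              Polynomial.coeff_X, Polynomial.coeff_C]
            simp
          rw [h0] at c1 c2
          simp at c1 c2
          exact Complex.ext (by linarith) (by linarith)
        refine (f.roots.toFinset.finite_toSet).subset ?_
        intro t ht
        simp only [mem_ofPred_eq] at ht
        rw [Finset.mem_coe, Multiset.mem_toFinset, Polynomial.mem_roots hf]
        simp [f, ht.2]
    obtain ⟨t, ht⟩ := hfin.infinite_compl.nonempty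
    refine ⟨t, fun x hx => ⟨fun h => ht ?_, fun hne h => ht ?_⟩⟩
    · simp only [mem_iUnion]
      exact ⟨x, hx, Or.inl h⟩
    · simp only [mem_iUnion]
      exact ⟨x, hx, Or.inr ⟨hne, h⟩⟩
  obtain ⟨t, ht⟩ := h1
  let o : ℂ := ⟨t, t^2⟩
  have hne : ∀ p ∈ P, p ≠ o := fun p hp => ((ht (p, p) (by simp [hp])).1).symm
  have him : ∀ x ∈ P ×ˢ P, x.1 ≠ x.2 → (zt o x.1 x.2).im ≠ 0 := by
    intro x hx hx'
    have h1 := (ht x hx).2 hx'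
    have hp := hne x.1 (Finset.mem_product.1 hx).1
    have n1 : Complex.normSq (x.1 - o) ≠ 0 := by simpa [sub_eq_zero] using hp
    intro h
    apply h1
    unfold zt at h
    rw [Complex.div_im, div_sub_div_same, div_eq_zero_iff] at h
    have h := h.resolve_right n1
    simp [o] at h
    linarith
  have hev : ∀ᶠ ε in 𝓝[>] (0:ℝ), ∀ x ∈ P ×ˢ P, x.1 ≠ x.2 →
      ε * (zt o x.1 x.2).re < |(zt o x.1 x.2).im| := by
    rw [Filter.eventually_all_finset]
    intro x hx
    by_cases hx' : x.1 = x.2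
    · simp [hx']
    have hc : Continuous fun ε : ℝ => ε * (zt o x.1 x.2).re := by fun_prop
    have := (hc.tendsto 0).eventually_lt_const (u := |(zt o x.1 x.2).im|)
      (by simpa using him x hx hx')
    filter_upwards [nhdsWithin_le_nhds this] with ε h _ using h
  obtain ⟨ε, h1, h2⟩ := (hev.and self_mem_nhdsWithin).exists
  exact ⟨o, ε, h2, hne, fun p hp p' hp' h => h1 (p, p') (by simp [hp, hp']) h⟩

end Oka
end

open MvPolynomial
noncomputable section
namespace Oka
open unitInterval Set Topology Filter

/-- restriction of a local system to a punctured disc -/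
theorem disc_struct {Γ : Type*} [Group Γ] {S : Set ℂ} (L : LS S Γ) (p : ℂ) (R : ℝ)
    (hS : ∀ s : ℂ, s.re < R → p + Complex.exp s ∈ S) :
    ∃ (b : ℂ → Γ) (c : Γ), (∀ (γ : C(I, S)) (ς : C(I, ℂ)), (∀ t, (ς t).re < R) →
      (∀ t, (γ t : ℂ) = p + Complex.exp (ς t)) → L.f γ = (b (ς 0))⁻¹ * b (ς 1)) ∧
      ∀ s : ℂ, s.re < R → ∀ k : ℕ, b (s + k * (2 * Real.pi * Complex.I)) = c ^ k * b s := by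
  classical
  let H : Set ℂ := {s | s.re < R}
  have hH : Convex ℝ H := (convex_halfSpace_lt (f := fun s : ℂ => s.re)
    ⟨fun _ _ => rfl, fun c x => by simp⟩ R)
  have hne : H.Nonempty := ⟨((R - 1 : ℝ) : ℂ), by simp [H]⟩
  have := convex_sc hH hne
  let e : C(H, S) := ⟨fun s => ⟨p + Complex.exp s, hS s s.2⟩, by fun_prop⟩
  obtain ⟨b0, hb0⟩ := (L.comap e).triv
  let b : ℂ → Γ := fun s => if h : s ∈ H then b0 ⟨s, h⟩ else 1
  have hb : ∀ (γ : C(I, S)) (ς : C(I, ℂ)), (∀ t, (ς t).re < R) →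
      (∀ t, (γ t : ℂ) = p + Complex.exp (ς t)) → L.f γ = (b (ς 0))⁻¹ * b (ς 1) := by
    intro γ ς h1 h2
    have := hb0 ⟨fun t => ⟨ς t, h1 t⟩, by fun_prop⟩
    have h3 : ∀ t, ς t ∈ H := h1
    simp only [b, h3, dif_pos]
    rw [LS.comap_f] at this
    have e0 : γ = e.comp ⟨fun t => ⟨ς t, h1 t⟩, by fun_prop⟩ := by
      ext t
      simp [e, h2]
    rw [e0, this]
    rfl
  have hper : ∃ c : Γ, ∀ s : ℂ, s.re < R → b (s + 2 * Real.pi * Complex.I) = c * b s := by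
    obtain ⟨s0, hs0⟩ := hne
    refine ⟨b (s0 + 2 * Real.pi * Complex.I) * (b s0)⁻¹, fun s hs => ?_⟩
    have hseg : ∀ t : I, (s0 + (t:ℝ) • (s - s0)) ∈ H := fun t => hH.add_smul_sub_mem hs0 hs t.2
    let γ : C(I, S) := ⟨fun t => ⟨p + Complex.exp (s0 + (t:ℝ) • (s - s0)), hS _ (hseg t)⟩, by fun_prop⟩
    have e1 := hb γ ⟨fun t => s0 + (t:ℝ) • (s - s0), by fun_prop⟩ hseg (fun t => rfl)
    have e2 := hb γ ⟨fun t => (s0 + 2 * Real.pi * Complex.I) + (t:ℝ) • (s - s0), by fun_prop⟩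
      (fun t => by
        have := hseg t
        simp [H] at this ⊢
        exact this) (fun t => by
        simp only [γ, ContinuousMap.coe_mk]
        congr 1
        rw [add_right_comm, Complex.exp_periodic])
    rw [e1] at e2
    simp at e2
    have : s0 + 2 * Real.pi * Complex.I + (s - s0) = s + 2 * Real.pi * Complex.I := by ring
    rw [this] at e2
    rw [mul_assoc (b _) _ (b s), e2]
    group
  obtain ⟨c, hc⟩ := hper
  refine ⟨b, c, hb, fun s hs k => ?_⟩
  induction k with
  | zero => simp
  | succ k ih =>
    have : s + ((k + 1 : ℕ) : ℂ) * (2 * Real.pi * Complex.I) =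
      (s + k * (2 * Real.pi * Complex.I)) + 2 * Real.pi * Complex.I := by push_cast; ring
    rw [this, hc _ (by simpa using hs), ih, pow_succ', mul_assoc]

/-- if the monodromy is trivial, then loops in the punctured disc are trivial -/
theorem disc_triv {Γ : Type*} [Group Γ] {S : Set ℂ} (L : LS S Γ) (p : ℂ) (R : ℝ)
    (b : ℂ → Γ) (hb : (∀ (γ : C(I, S)) (ς : C(I, ℂ)), (∀ t, (ς t).re < R) →
      (∀ t, (γ t : ℂ) = p + Complex.exp (ς t)) → L.f γ = (b (ς 0))⁻¹ * b (ς 1)))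
    (hper : ∀ s : ℂ, s.re < R → ∀ k : ℕ, b (s + k * (2 * Real.pi * Complex.I)) = b s)
    (γ : C(I, S)) (hγ : ∀ t, (γ t : ℂ) ≠ p ∧ ‖(γ t : ℂ) - p‖ < Real.exp R)
    (h01 : γ 0 = γ 1) : L.f γ = 1 := by
  have hperZ : ∀ s s' : ℂ, s.re < R → Complex.exp s = Complex.exp s' → b s = b s' := by
    intro s s' hs h
    obtain ⟨n, hn⟩ := Complex.exp_eq_exp_iff_exists_int.1 h
    have hs' : s'.re < R := by rw [hn] at hs; simpa using hs
    rcases Int.eq_nat_or_neg n with ⟨k, rfl | rfl⟩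
    · rw [hn]
      exact_mod_cast hper s' hs' k
    · have : s' = s + k * (2 * Real.pi * Complex.I) := by rw [hn]; push_cast; ring
      rw [this, hper s hs k]
  let T : Set S := {x | (x : ℂ) ≠ p ∧ ‖(x : ℂ) - p‖ < Real.exp R}
  let L' : LS T Γ := L.comap ⟨Subtype.val, continuous_subtype_val⟩
  let β : T → Γ := fun x => b (Complex.log ((x : S) - p))
  have hre : ∀ x : T, (Complex.log (((x : S) : ℂ) - p)).re < R := by
    intro x
    rw [Complex.log_re, Real.log_lt_iff_lt_exp (by simpa [sub_eq_zero] using x.2.1)]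
    exact x.2.2
  have key := L'.locGlob2 ((L').push (1 : Γ →* Γ)) β ?_ ⟨fun t => ⟨γ t, hγ t⟩, by fun_prop⟩
  · simp only [LS.push_f, MonoidHom.one_apply, ContinuousMap.coe_mk, β, L', LS.comap_f, h01] at key
    rw [mul_inv_eq_one, mul_eq_left] at key
    exact key
  · intro x
    have hx0 : ((x : S) : ℂ) - p ≠ 0 := sub_ne_zero.2 x.2.1
    refine ⟨{y : T | (((y : S) : ℂ) - p) / (((x : S) : ℂ) - p) ∈ Complex.slitPlane}, ?_, ?_⟩
    · refine (Complex.isOpen_slitPlane.preimage (by fun_prop)).mem_nhds ?_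
      simp [div_self hx0]
    · intro γ hγ
      simp only [LS.push_f, MonoidHom.one_apply]
      let ς : C(I, ℂ) := ⟨fun t => Complex.log (((x : S) : ℂ) - p) +
        Complex.log ((((γ t : S) : ℂ) - p) / (((x : S) : ℂ) - p)), by
          refine continuous_const.add ?_
          refine Continuous.clog (by fun_prop) hγ⟩
      have hex : ∀ t, Complex.exp (ς t) = ((γ t : S) : ℂ) - p := by
        intro t
        simp only [ς, ContinuousMap.coe_mk]
        rw [Complex.exp_add, Complex.exp_log hx0, Complex.exp_log (Complex.slitPlane_ne_zero (hγ t))]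
        field_simp
      have hsr : ∀ t, (ς t).re < R := by
        intro t
        have := (γ t).2.2
        rw [← hex, Complex.norm_exp] at this
        exact Real.exp_lt_exp.1 this
      have := hb ((ContinuousMap.mk Subtype.val continuous_subtype_val).comp γ) ς hsr
        (fun t => by rw [hex]; simp)
      simp only [L', LS.comap_f]
      rw [this]
      have hββ : ∀ t, β (γ t) = b (ς t) := fun t => hperZ _ _ (hre _) (by
        rw [hex, Complex.exp_log (sub_ne_zero.2 (γ t).2.1)])
      rw [hββ, hββ]
      group

/-- monodromy of a standard local system -/
theorem St_circle {P : Finset ℂ} {o : ℂ} {ε : ℝ} (hG : Good P o ε) {Γ : Type*} [Group Γ]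
    (L : LS ↥((↑P : Set ℂ)ᶜ) Γ) (z : ℂ → Γ) (β : ↥((↑P : Set ℂ)ᶜ) → Γ)
    (hL : ∀ γ, β (γ 0) * L.f γ * (β (γ 1))⁻¹ = (St hG z).f γ) (p : ℂ) (hp : p ∈ P) (R : ℝ)
    (hS : ∀ s : ℂ, s.re < R → p + Complex.exp s ∉ P)
    (b : ℂ → Γ) (hb : (∀ (γ : C(I, ↥((↑P : Set ℂ)ᶜ))) (ς : C(I, ℂ)), (∀ t, (ς t).re < R) →
      (∀ t, (γ t : ℂ) = p + Complex.exp (ς t)) → L.f γ = (b (ς 0))⁻¹ * b (ς 1)))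
    (c : Γ) (hper : ∀ s : ℂ, s.re < R → b (s + 2 * Real.pi * Complex.I) = c * b s) :
    ∃ g : Γ, c = g * (z p)⁻¹ * g⁻¹ := by
  have n1 := sub_ne_zero.2 (hG.ne p hp)
  have hball : ∃ δ > 0, δ < ε ∧ Real.log (δ * ‖p - o‖) < R ∧
      ∀ w, ‖w - p‖ ≤ δ * ‖p - o‖ → ∀ p' ∈ P, p' ≠ p → w ∉ ray o p' := by
    have hn : ∀ᶠ w in 𝓝 p, ∀ p' ∈ P, p' ≠ p → w ∉ ray o p' := by
      rw [Filter.eventually_all_finset]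
      intro p' hp'
      by_cases e : p' = p
      · simp [e]
      · have : p ∉ ray o p' := by
          intro h
          have := Vs_ray hG hp' hp' (ray_mem_Vs hG hp' h (Ne.symm e)) h
          have h2 := Vs_sub hG hp' (ray_mem_Vs hG hp' h (Ne.symm e))
          exact h2 hp
        filter_upwards [(isClosed_ray o p').isOpen_compl.mem_nhds this] with w hw _ using hw
    obtain ⟨η, hη, hηb⟩ := Metric.eventually_nhds_iff.1 hn
    have hn0 : 0 < ‖p - o‖ := norm_pos_iff.2 n1
    have ht : Tendsto (fun δ : ℝ => δ * ‖p - o‖) (𝓝[>] 0) (𝓝[>] 0) := by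
      refine tendsto_nhdsWithin_iff.2 ⟨?_, ?_⟩
      · have : Continuous fun δ : ℝ => δ * ‖p - o‖ := by fun_prop
        simpa using (this.tendsto 0).mono_left nhdsWithin_le_nhds
      · filter_upwards [self_mem_nhdsWithin] with δ hδ using mul_pos hδ hn0
    have e1 : ∀ᶠ δ : ℝ in 𝓝[>] 0, δ < ε := nhdsWithin_le_nhds (Iio_mem_nhds hG.epos)
    have e2 : ∀ᶠ δ : ℝ in 𝓝[>] 0, Real.log (δ * ‖p - o‖) < R :=
      (Real.tendsto_log_nhdsGT_zero.comp ht).eventually (eventually_lt_atBot R)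
    have e3 : ∀ᶠ δ : ℝ in 𝓝[>] 0, δ * ‖p - o‖ < η :=
      ht.eventually (nhdsWithin_le_nhds (Iio_mem_nhds hη))
    obtain ⟨δ, ⟨⟨h1, h2⟩, h3⟩, h4⟩ := (((e1.and e2).and e3).and self_mem_nhdsWithin).exists
    refine ⟨δ, h4, h1, h2, fun w hw => hηb ?_⟩
    rw [dist_eq_norm]
    exact hw.trans_lt h3
  obtain ⟨δ, hδ, hδε, hδR, hray⟩ := hball
  have hδ0 : (δ : ℂ) * (p - o) ≠ 0 := mul_ne_zero (by exact_mod_cast hδ.ne') n1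
  let l : ℂ := Complex.log (δ * (p - o))
  have hl : Complex.exp l = δ * (p - o) := Complex.exp_log hδ0
  have hlre : l.re < R := by
    simp only [l, Complex.log_re, norm_mul, Complex.norm_real, Real.norm_of_nonneg hδ.le]
    exact hδR
  have hexp : ∀ θ : ℝ, Complex.exp (l + θ * Complex.I) = δ * (p - o) * Complex.exp (θ * Complex.I) := by
    intro θ; rw [Complex.exp_add, hl]
  have hzt : ∀ θ : ℝ, zt o p (p + Complex.exp (l + θ * Complex.I)) = 1 + δ * Complex.exp (θ * Complex.I) := by
    intro θ
    rw [hexp]; unfold zt; field_simp; ring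
  have hre : ∀ θ : ℝ, (zt o p (p + Complex.exp (l + θ * Complex.I))).re = 1 + δ * Real.cos θ := by
    intro θ; rw [hzt]; simp [Complex.exp_ofReal_mul_I_re]
  have him : ∀ θ : ℝ, (zt o p (p + Complex.exp (l + θ * Complex.I))).im = δ * Real.sin θ := by
    intro θ; rw [hzt]; simp [Complex.exp_ofReal_mul_I_im]
  have hlr : ∀ θ : ℝ, (l + θ * Complex.I).re < R := by intro θ; simpa using hlre
  -- arcs
  let arc : ℝ → ℝ → C(I, ↥((↑P : Set ℂ)ᶜ)) := fun θ0 θ1 =>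
    ⟨fun t => ⟨p + Complex.exp (l + ((θ0 + t * (θ1 - θ0) : ℝ) : ℂ) * Complex.I), hS _ (hlr _)⟩, by
      fun_prop⟩
  have harc : ∀ θ0 θ1, L.f (arc θ0 θ1) = (b (l + θ0 * Complex.I))⁻¹ * b (l + θ1 * Complex.I) := by
    intro θ0 θ1
    have := hb (arc θ0 θ1) ⟨fun t => l + ((θ0 + t * (θ1 - θ0) : ℝ) : ℂ) * Complex.I, by fun_prop⟩
      (fun t => hlr _) (fun t => rfl)
    rw [this]
    simp
  have a1 := hL (arc (-(Real.pi/4)) (Real.pi/4))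
  have a2 := hL (arc (Real.pi/4) (-(Real.pi/4) + 2 * Real.pi))
  have hpi := Real.pi_pos
  rw [St_Vs hG z hp] at a1
  swap
  · intro t
    set θ : ℝ := -(Real.pi/4) + t * (Real.pi/4 - -(Real.pi/4)) with hθ
    have h0 := t.2.1
    have h1 := t.2.2
    have hc : 0 < Real.cos θ := by
      apply Real.cos_pos_of_mem_Ioo
      constructor <;> nlinarith
    have e1 := hre θ
    have e2 := him θ
    change p + Complex.exp (l + θ * Complex.I) ∈ Vs o ε p
    refine ⟨?_, ?_⟩
    · rw [e1]; nlinarith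
    · rw [e1, e2, abs_mul, abs_of_pos hδ]
      have := Real.abs_sin_le_one θ
      have h3 : δ * |Real.sin θ| ≤ δ := by nlinarith
      have h4 : 0 < ε * (δ * Real.cos θ) := mul_pos hG.epos (mul_pos hδ hc)
      nlinarith
  rw [St_V0 hG z] at a2
  swap
  · intro t p' hp'
    set θ : ℝ := Real.pi/4 + t * (-(Real.pi/4) + 2 * Real.pi - (Real.pi/4)) with hθ
    have h0 := t.2.1
    have h1 := t.2.2
    change p + Complex.exp (l + θ * Complex.I) ∉ ray o p'
    by_cases e : p' = p
    · subst e
      rintro ⟨h2, h3⟩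
      rw [him] at h2
      rw [hre] at h3
      have hs : Real.sin θ = 0 := by simpa [hδ.ne'] using h2
      have hcos : 0 ≤ Real.cos θ := by nlinarith
      have hθ1 : 0 < θ := by nlinarith
      have hθ2 : θ < 2 * Real.pi := by nlinarith
      have hc1 : Real.cos θ = 1 := by
        have := Real.sin_sq_add_cos_sq θ
        rw [hs] at this
        nlinarith
      obtain ⟨n, hn⟩ := (Real.cos_eq_one_iff θ).1 hc1
      have hn1 : (0:ℝ) < n := by
        by_contra h
        push Not at h
        nlinarith
      have hn2 : (n:ℝ) < 1 := by
        by_contra h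
        push Not at h
        nlinarith
      have : (0:ℤ) < n := by exact_mod_cast hn1
      have : n < (1:ℤ) := by exact_mod_cast hn2
      omega
    · refine hray _ ?_ p' hp' e
      rw [hexp]
      simp [abs_of_pos hδ]
  rw [harc] at a1 a2
  -- endpoints
  have u0 : uu o z p ((arc (-(Real.pi/4)) (Real.pi/4)) 0 : ℂ) = 1 := by
    have : ((arc (-(Real.pi/4)) (Real.pi/4)) 0 : ℂ) = p + Complex.exp (l + ((-(Real.pi/4) : ℝ):ℂ) * Complex.I) := by
      simp [arc]
    rw [this, uu, if_neg]
    rw [him, Real.sin_neg, Real.sin_pi_div_four]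
    have : 0 < √2 := by positivity
    nlinarith
  have u1 : uu o z p ((arc (-(Real.pi/4)) (Real.pi/4)) 1 : ℂ) = z p := by
    have : ((arc (-(Real.pi/4)) (Real.pi/4)) 1 : ℂ) = p + Complex.exp (l + ((Real.pi/4 : ℝ):ℂ) * Complex.I) := by
      simp [arc]
    rw [this, uu, if_pos]
    rw [him, Real.sin_pi_div_four]
    positivity
  have v1 : (arc (Real.pi/4) (-(Real.pi/4) + 2 * Real.pi)) 0 = (arc (-(Real.pi/4)) (Real.pi/4)) 1 := by
    simp [arc]
  have v2 : (arc (Real.pi/4) (-(Real.pi/4) + 2 * Real.pi)) 1 = (arc (-(Real.pi/4)) (Real.pi/4)) 0 := by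
    apply Subtype.ext
    simp only [arc, ContinuousMap.coe_mk]
    congr 1
    refine (congrArg Complex.exp ?_).trans (Complex.exp_periodic _)
    simp
    ring
  rw [u0, u1] at a1
  rw [v1, v2] at a2
  have e3 : l + ((-(Real.pi/4) + 2 * Real.pi : ℝ) : ℂ) * Complex.I =
    (l + ((-(Real.pi/4) : ℝ):ℂ) * Complex.I) + 2 * Real.pi * Complex.I := by push_cast; ring
  rw [e3, hper _ (hlr _)] at a2
  set x := b (l + ((-(Real.pi/4) : ℝ):ℂ) * Complex.I)
  set y := b (l + ((Real.pi/4 : ℝ):ℂ) * Complex.I)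
  set β0 := β ((arc (-(Real.pi/4)) (Real.pi/4)) 0)
  set β1 := β ((arc (-(Real.pi/4)) (Real.pi/4)) 1)
  refine ⟨x * β0⁻¹, ?_⟩
  have h1 : (z p)⁻¹ = β0 * (x⁻¹ * y) * β1⁻¹ := by rw [a1]; group
  have h2 : c = y * (β1⁻¹ * (β1 * (y⁻¹ * (c * x)) * β0⁻¹) * β0) * x⁻¹ := by group
  rw [h1, h2, a2]
  group

lemma mfold (u : ℂ → ℂ) (m : ℕ) (δ : ℝ) (hδ : 0 < δ) (c0 : ℂ) (hc0 : c0 ≠ 0)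
    (hcont : Continuous fun t : I => u (δ * Complex.exp (2 * Real.pi * Complex.I * t)))
    (hslit : ∀ t : I, u (δ * Complex.exp (2 * Real.pi * Complex.I * t)) / c0 ∈ Complex.slitPlane) :
    ∃ ς : C(I, ℂ), (∀ t : I, Complex.exp (ς t) = (δ * Complex.exp (2 * Real.pi * Complex.I * t)) ^ m *
      u (δ * Complex.exp (2 * Real.pi * Complex.I * t))) ∧
      ς 1 = ς 0 + m * (2 * Real.pi * Complex.I) := by
  refine ⟨⟨fun t => m * Complex.log δ + Complex.log c0 + m * (2 * Real.pi * Complex.I * t) +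
    Complex.log (u (δ * Complex.exp (2 * Real.pi * Complex.I * t)) / c0), ?_⟩, ?_, ?_⟩
  · refine Continuous.add (by fun_prop) (Continuous.clog (hcont.div_const c0) hslit)
  · intro t
    have hδ' : (δ : ℂ) ≠ 0 := by exact_mod_cast hδ.ne'
    simp only [ContinuousMap.coe_mk]
    rw [Complex.exp_add, Complex.exp_add, Complex.exp_add, Complex.exp_nat_mul, Complex.exp_log hδ',
      Complex.exp_log hc0, Complex.exp_nat_mul, Complex.exp_log (Complex.slitPlane_ne_zero (hslit t))]
    field_simp
    ring
  · simp only [ContinuousMap.coe_mk]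
    have : Complex.exp (2 * Real.pi * Complex.I * ((1 : I) : ℝ)) =
      Complex.exp (2 * Real.pi * Complex.I * ((0 : I) : ℝ)) := by simp
    rw [this]
    simp
    ring

lemma exp_lt_of_re {s : ℂ} {r : ℝ} (hr : 0 < r) (h : s.re < Real.log r) : ‖Complex.exp s‖ < r := by
  rw [Complex.norm_exp]
  exact (Real.lt_log_iff_exp_lt hr).1 h

lemma re_lt_of_exp {s : ℂ} {r : ℝ} (hr : 0 < r) (h : ‖Complex.exp s‖ < r) : s.re < Real.log r := by
  rw [Complex.norm_exp] at h
  exact (Real.lt_log_iff_exp_lt hr).2 h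

theorem circ_rel {P : Finset ℂ} {o : ℂ} {ε : ℝ} (hG : Good P o ε) {Γ : Type*} [Group Γ]
    (L : LS ↥((↑P : Set ℂ)ᶜ) Γ) (z : ℂ → Γ) (β : ↥((↑P : Set ℂ)ᶜ) → Γ)
    (hL : ∀ γ, β (γ 0) * L.f γ * (β (γ 1))⁻¹ = (St hG z).f γ) (p : ℂ) (hp : p ∈ P) (r : ℝ)
    (hr : 0 < r) (hS : ∀ x : ℂ, x ∈ P → ‖x - p‖ < r → x = p)
    (γ : C(I, ↥((↑P : Set ℂ)ᶜ))) (ς : C(I, ℂ)) (hγ : ∀ t, (γ t : ℂ) = p + Complex.exp (ς t))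
    (hγr : ∀ t, ‖(γ t : ℂ) - p‖ < r) (m : ℕ) (h01 : ς 1 = ς 0 + m * (2 * Real.pi * Complex.I)) :
    ∃ g, L.f γ = g * ((z p) ^ m)⁻¹ * g⁻¹ := by
  have hS' : ∀ s : ℂ, s.re < Real.log r → p + Complex.exp s ∉ P := by
    intro s hs h
    have := hS _ h (by simpa using exp_lt_of_re hr hs)
    simp [Complex.exp_ne_zero] at this
  obtain ⟨b, c, hb, hper⟩ := disc_struct L p (Real.log r) hS'
  obtain ⟨g, hg⟩ := St_circle hG L z β hL p hp (Real.log r) hS' b hb c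
    (fun s hs => by simpa using hper s hs 1)
  have hre : ∀ t, (ς t).re < Real.log r := fun t => re_lt_of_exp hr (by
    have := hγr t
    rw [hγ] at this
    simpa using this)
  refine ⟨(b (ς 0))⁻¹ * g, ?_⟩
  rw [hb γ ς hre hγ, h01, hper _ (hre 0), hg, conj_pow]
  group

/-- if all small circles are trivial then the local system is trivial -/
theorem planar_triv (P : Finset ℂ) {Γ : Type*} [Group Γ] (L : LS ↥((↑P : Set ℂ)ᶜ) Γ)
    (h : ∀ p ∈ P, ∃ δ0 > 0, ∀ δ : ℝ, 0 < δ → δ < δ0 → ∀ γ : C(I, ↥((↑P : Set ℂ)ᶜ)),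
      (∀ t : I, (γ t : ℂ) = p + δ * Complex.exp (2 * Real.pi * Complex.I * t)) → L.f γ = 1) :
    ∃ b : ↥((↑P : Set ℂ)ᶜ) → Γ, ∀ γ, L.f γ = (b (γ 0))⁻¹ * b (γ 1) := by
  obtain ⟨o, ε, hG⟩ := exists_good P
  obtain ⟨z, β, hL⟩ := PL1 hG L
  refine ⟨β, fun γ => ?_⟩
  have hz : ∀ p ∈ P, z p ∈ (⊥ : Subgroup Γ) := by
    intro p hp
    obtain ⟨δ0, hδ0, h1⟩ := h p hp
    have hn : ∀ᶠ x in 𝓝 p, x ∈ P → x = p := by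
      have : ((P.erase p : Finset ℂ) : Set ℂ)ᶜ ∈ 𝓝 p :=
        (P.erase p).finite_toSet.isClosed.isOpen_compl.mem_nhds (by simp)
      filter_upwards [this] with x hx hxP
      by_contra hne
      exact hx (by simp [hne, hxP])
    obtain ⟨r, hr, hrb⟩ := Metric.eventually_nhds_iff.1 hn
    have hrb : ∀ x ∈ P, ‖x - p‖ < r → x = p := fun x hx h => hrb (by rwa [dist_eq_norm]) hx
    set δ := min δ0 r / 2 with hδ
    have hmin : 0 < min δ0 r := lt_min hδ0 hr
    have d0 : 0 < δ := by positivity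
    have d1 : δ < δ0 := by have := min_le_left δ0 r; linarith
    have d2 : δ < r := by have := min_le_right δ0 r; linarith
    have hnorm : ∀ t : I, ‖(δ : ℂ) * Complex.exp (2 * Real.pi * Complex.I * t)‖ = δ := by
      intro t
      have e : 2 * Real.pi * Complex.I * t = ((2 * Real.pi * t : ℝ) : ℂ) * Complex.I := by
        push_cast; ring
      rw [e, norm_mul, Complex.norm_exp_ofReal_mul_I]
      simp [d0.le]
    obtain ⟨ς, e1, e2⟩ := mfold (fun _ => 1) 1 δ d0 1 one_ne_zero continuous_const (by simp)
    let γ : C(I, ↥((↑P : Set ℂ)ᶜ)) := ⟨fun t => ⟨p + δ * Complex.exp (2 * Real.pi * Complex.I * t), by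
      intro hx
      have := hrb _ hx (by simpa using (hnorm t).trans_lt d2)
      have h2 := hnorm t
      simp only [add_eq_left] at this
      rw [this, norm_zero] at h2
      exact d0.ne h2⟩, by fun_prop⟩
    obtain ⟨g, hg⟩ := circ_rel hG L z β hL p hp r hr hrb γ ς (fun t => by
      rw [e1]; simp [γ]) (fun t => by simpa [γ] using (hnorm t).trans_lt d2) 1 e2
    rw [h1 δ d0 d1 γ (fun t => rfl)] at hg
    have : (z p) = (g⁻¹ * (g * ((z p) ^ 1)⁻¹ * g⁻¹) * g)⁻¹ := by group
    rw [Subgroup.mem_bot, this, ← hg]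
    group
  have h1 := St_mem hG z ⊥ hz γ
  rw [← hL, Subgroup.mem_bot, mul_inv_eq_one] at h1
  rw [← h1]; group

/-- if one circle in a punctured disc is trivial then all loops are -/
theorem disc_triv_circle {Γ : Type*} [Group Γ] {S : Set ℂ} (L : LS S Γ) (p : ℂ) (r : ℝ) (hr : 0 < r)
    (hS : ∀ x : ℂ, x ≠ p → ‖x - p‖ < r → x ∈ S) (δ : ℝ) (hδ : 0 < δ) (hδr : δ < r)
    (γ0 : C(I, S)) (h0 : ∀ t : I, (γ0 t : ℂ) = p + δ * Complex.exp (2 * Real.pi * Complex.I * t))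
    (h1 : L.f γ0 = 1) (γ : C(I, S)) (hγ : ∀ t, (γ t : ℂ) ≠ p ∧ ‖(γ t : ℂ) - p‖ < r)
    (h01 : γ 0 = γ 1) : L.f γ = 1 := by
  have hS' : ∀ s : ℂ, s.re < Real.log r → p + Complex.exp s ∈ S := by
    intro s hs
    exact hS _ (by simp [Complex.exp_ne_zero]) (by simpa using exp_lt_of_re hr hs)
  obtain ⟨b, c, hb, hper⟩ := disc_struct L p (Real.log r) hS'
  obtain ⟨ς, e1, e2⟩ := mfold (fun _ => 1) 1 δ hδ 1 one_ne_zero continuous_const (by simp)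
  have hnorm : ∀ t : I, ‖(δ : ℂ) * Complex.exp (2 * Real.pi * Complex.I * t)‖ = δ := by
    intro t
    have e : 2 * Real.pi * Complex.I * t = ((2 * Real.pi * t : ℝ) : ℂ) * Complex.I := by
      push_cast; ring
    rw [e, norm_mul, Complex.norm_exp_ofReal_mul_I]
    simp [hδ.le]
  have hre : ∀ t, (ς t).re < Real.log r := fun t => re_lt_of_exp hr (by
    rw [e1]; simpa using (hnorm t).trans_lt hδr)
  rw [hb γ0 ς hre (fun t => by rw [e1, h0]; simp), e2, hper _ (hre 0)] at h1
  have hc : c = 1 := by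
    have : c = b (ς 0) * ((b (ς 0))⁻¹ * (c ^ 1 * b (ς 0))) * (b (ς 0))⁻¹ := by group
    rw [this, h1]; group
  refine disc_triv L p (Real.log r) b hb (fun s hs k => by rw [hper s hs k, hc]; simp) γ ?_ h01
  intro t
  rw [Real.exp_log hr]
  exact hγ t

end Oka
end

open MvPolynomial
noncomputable section
namespace Oka
open unitInterval Set Topology Filter

abbrev GG (r p q : ℕ) : Type :=
  Monoid.Coprod (Monoid.Coprod (FreeGroup (Fin r)) (Multiplicative (ZMod p))) (Multiplicative (ZMod q))

/-- homs out of a cyclic group -/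
def zmodHom {p : ℕ} {Q : Type*} [Group Q] (x : Q) (hx : x ^ p = 1) : Multiplicative (ZMod p) →* Q :=
  AddMonoidHom.toMultiplicativeLeft (ZMod.lift p ⟨(zmultiplesHom (Additive Q)) (Additive.ofMul x), by
    simp only [zmultiplesHom_apply]
    rw [natCast_zsmul, ← ofMul_pow, hx]; rfl⟩)

lemma zmodHom_gen {p : ℕ} {Q : Type*} [Group Q] (x : Q) (hx : x ^ p = 1) :
    zmodHom x hx (Multiplicative.ofAdd 1) = x := by
  simp only [zmodHom]
  have : (1 : ZMod p) = ((1 : ℤ) : ZMod p) := by simp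
  simp only [AddMonoidHom.toMultiplicativeLeft_apply_apply, toAdd_ofAdd]
  rw [this, ZMod.lift_coe]
  simp

lemma zmod_ext {p : ℕ} {Q : Type*} [Group Q] (f g : Multiplicative (ZMod p) →* Q)
    (h : f (Multiplicative.ofAdd 1) = g (Multiplicative.ofAdd 1)) : f = g := by
  refine MonoidHom.ext fun x => ?_
  have hx : x = (Multiplicative.ofAdd (1 : ZMod p)) ^ (Multiplicative.toAdd x).cast (R := ℤ) := by
    rw [← ofAdd_zsmul]
    simp
  rw [hx, map_zpow, map_zpow, h]

/-- universal property of `𝔽_r * ℤ_p * ℤ_q` -/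
structure IsCop (r p q : ℕ) (G : Type) [Group G] where
  x : Fin r → G
  y : G
  w : G
  hy : y ^ p = 1
  hw : w ^ q = 1
  ext : ∀ f g : G →* G, (∀ i, f (x i) = g (x i)) → f y = g y → f w = g w → f = g
  lift : ∀ (Q : Type) [Group Q] (a : Fin r → Q) (b c : Q), b ^ p = 1 → c ^ q = 1 →
    ∃ s : G →* Q, (∀ i, s (x i) = a i) ∧ s y = b ∧ s w = c
  span : ∀ H : Subgroup G, (∀ i, x i ∈ H) → y ∈ H → w ∈ H → H = ⊤

theorem isCop_GG (r p q : ℕ) : Nonempty (IsCop r p q (GG r p q)) := by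
  have hgen : ∀ e : ℕ, (Multiplicative.ofAdd (1 : ZMod e)) ^ e = 1 := by
    intro e
    rw [← ofAdd_nsmul]; simp
  have hext : ∀ {Q : Type} [Group Q] (f g : GG r p q →* Q),
      (∀ i, f (Monoid.Coprod.inl (Monoid.Coprod.inl (FreeGroup.of i))) =
        g (Monoid.Coprod.inl (Monoid.Coprod.inl (FreeGroup.of i)))) →
      (f (Monoid.Coprod.inl (Monoid.Coprod.inr (Multiplicative.ofAdd 1))) =
        g (Monoid.Coprod.inl (Monoid.Coprod.inr (Multiplicative.ofAdd 1)))) →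
      (f (Monoid.Coprod.inr (Multiplicative.ofAdd 1)) =
        g (Monoid.Coprod.inr (Multiplicative.ofAdd 1))) → f = g := by
    intro Q _ f g h1 h2 h3
    apply Monoid.Coprod.hom_ext
    · apply Monoid.Coprod.hom_ext
      · apply FreeGroup.ext_hom
        exact h1
      · refine zmod_ext _ _ ?_
        exact h2
    · refine zmod_ext _ _ ?_
      exact h3
  refine ⟨⟨fun i => Monoid.Coprod.inl (Monoid.Coprod.inl (FreeGroup.of i)),
    Monoid.Coprod.inl (Monoid.Coprod.inr (Multiplicative.ofAdd 1)),
    Monoid.Coprod.inr (Multiplicative.ofAdd 1), ?_, ?_, ?_, ?_, ?_⟩⟩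
  · rw [← map_pow, ← map_pow, hgen]; simp
  · rw [← map_pow, hgen]; simp
  · exact fun f g => hext f g
  · intro Q _ a b c hb hc
    refine ⟨Monoid.Coprod.lift (Monoid.Coprod.lift (FreeGroup.lift a) (zmodHom b hb)) (zmodHom c hc),
      ?_, ?_, ?_⟩
    · intro i; simp
    · simp [zmodHom_gen]
    · simp [zmodHom_gen]
  · intro H h1 h2 h3
    let s : GG r p q →* H := Monoid.Coprod.lift (Monoid.Coprod.lift (FreeGroup.lift fun i => ⟨_, h1 i⟩)
      (zmodHom ⟨_, h2⟩ (Subtype.ext (by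
        change (Monoid.Coprod.inl (Monoid.Coprod.inr (Multiplicative.ofAdd 1)) : GG r p q) ^ p = 1
        rw [← map_pow, ← map_pow, hgen]; simp))))
      (zmodHom ⟨_, h3⟩ (Subtype.ext (by
        change (Monoid.Coprod.inr (Multiplicative.ofAdd 1) : GG r p q) ^ q = 1
        rw [← map_pow, hgen]; simp)))
    have : H.subtype.comp s = MonoidHom.id _ := by
      apply hext
      · intro i; simp [s]
      · simp [s, zmodHom_gen]
      · simp [s, zmodHom_gen]
    rw [eq_top_iff]
    intro g _
    have := DFunLike.congr_fun this g
    rw [MonoidHom.id_apply] at this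
    rw [← this]
    exact (s g).2

lemma comm_center {N Q : Type} [Group N] [Group Q] (R : N →* Subgroup.center Q) {k : N}
    (hk : k ∈ commutator N) : R k = 1 := by
  have h1 : commutator N ≤ R.ker := by
    rw [commutator_def, Subgroup.commutator_le]
    intro a _ b _
    rw [MonoidHom.mem_ker, map_commutatorElement, commutatorElement_eq_one_iff_mul_comm]
    exact Subtype.ext (Subgroup.mem_center_iff.1 (R b).2 _)
  exact h1 hk

theorem R7 {r p q : ℕ} (hp : p ≠ 0) (hq : q ≠ 0) {G : Type} [Group G]
    (hG : IsCop r p q G) {N : Type} [Group N] (φ : N →* G)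
    (hs : Function.Surjective φ) (hc : φ.ker ≤ Subgroup.center N) (hd : φ.ker ≤ commutator N) :
    Function.Injective φ := by
  rw [injective_iff_map_eq_one]
  intro k hk
  by_contra hk1
  let K := φ.ker
  let _ : CommGroup K := { (inferInstance : Group K) with
    mul_comm := fun a b => Subtype.ext ((Subgroup.mem_center_iff.1 (hc b.2)) a) }
  have hk0 : (Additive.ofMul (⟨k, hk⟩ : K)) ≠ 0 := by
    intro h
    apply hk1
    have : (⟨k, hk⟩ : K) = 1 := h
    simpa using congrArg Subtype.val this
  obtain ⟨χ, hχ⟩ := CharacterModule.exists_character_apply_ne_zero_of_ne_zero hk0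
  let M := Multiplicative (AddCircle (1 : ℚ))
  let χ' : K →* M := AddMonoidHom.toMultiplicativeRight χ
  have hχ' : χ' ⟨k, hk⟩ ≠ 1 := by
    intro h; exact hχ h
  let j : K →* N × M := (K.subtype).prod χ'⁻¹
  let D : Subgroup (N × M) := j.range
  have hDc : D ≤ Subgroup.center (N × M) := by
    rintro _ ⟨a, rfl⟩
    rw [Subgroup.mem_center_iff]
    rintro ⟨n, m⟩
    exact Prod.ext ((Subgroup.mem_center_iff.1 (hc a.2)) n) (mul_comm _ _)
  have hDn : D.Normal := ⟨fun a ha g => by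
    have := Subgroup.mem_center_iff.1 (hDc ha) g
    rw [this, mul_inv_cancel_right]; exact ha⟩
  obtain ⟨Q, hQ, mk, π, hmk, hπ, hmks⟩ : ∃ (Q : Type) (_ : Group Q) (mk : N × M →* Q) (π : Q →* G),
      (∀ x, mk x = 1 ↔ x ∈ D) ∧ (∀ x, π (mk x) = φ x.1) ∧ Function.Surjective mk := by
    have hDk : D ≤ (φ.comp (MonoidHom.fst N M)).ker := by
      rintro _ ⟨a, rfl⟩
      exact a.2
    exact ⟨(N × M) ⧸ D, inferInstance, QuotientGroup.mk' D,
      QuotientGroup.lift D (φ.comp (MonoidHom.fst N M)) hDk,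
      fun x => QuotientGroup.eq_one_iff x, fun x => rfl, QuotientGroup.mk'_surjective D⟩
  have hdiv : ∀ (e : ℕ), e ≠ 0 → ∀ m : M, ∃ m' : M, m' ^ e = m := by
    intro e he m
    have hr : Function.Surjective (fun y : AddCircle (1:ℚ) => (e : ℤ) • y) :=
      DivisibleBy.surjective_smul (AddCircle (1:ℚ)) ℤ (by exact_mod_cast he)
    obtain ⟨y, hy⟩ := hr (Multiplicative.toAdd m)
    refine ⟨Multiplicative.ofAdd y, ?_⟩
    rw [← ofAdd_nsmul]
    have : (e : ℤ) • y = Multiplicative.toAdd m := hy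
    rw [natCast_zsmul] at this
    rw [this]; rfl
  have hlift : ∀ (e : ℕ), e ≠ 0 → ∀ x : G, x ^ e = 1 → ∃ y : Q, y ^ e = 1 ∧ π y = x := by
    intro e he x hx
    obtain ⟨n, hn⟩ := hs x
    have hnK : n ^ e ∈ K := by
      rw [MonoidHom.mem_ker, map_pow, hn, hx]
    obtain ⟨m, hm⟩ := hdiv e he (χ' ⟨n ^ e, hnK⟩)⁻¹
    refine ⟨mk (n, m), ?_, (hπ _).trans hn⟩
    rw [← map_pow, hmk]
    exact ⟨⟨n ^ e, hnK⟩, Prod.ext rfl hm.symm⟩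
  have hmksurj : ∀ x : G, ∃ y : Q, π y = x := fun x => by
    obtain ⟨n, hn⟩ := hs x
    exact ⟨mk (n, 1), (hπ _).trans hn⟩
  choose y0 hy0 using fun i : Fin r => hmksurj (hG.x i)
  obtain ⟨y1, hy1, hy1'⟩ := hlift p hp hG.y hG.hy
  obtain ⟨y2, hy2, hy2'⟩ := hlift q hq hG.w hG.hw
  obtain ⟨s, hs0, hs1, hs2⟩ := hG.lift Q y0 y1 y2 hy1 hy2
  have hsec : π.comp s = MonoidHom.id _ := by
    apply hG.ext
    · intro i; simp [hs0, hy0]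
    · simp [hs1, hy1']
    · simp [hs2, hy2']
  have hsec' : ∀ x, π (s x) = x := fun x => DFunLike.congr_fun hsec x
  have hker : ∀ y : Q, π y = 1 → y ∈ Subgroup.center Q := by
    intro y hy
    obtain ⟨⟨n, m⟩, rfl⟩ := hmks y
    rw [Subgroup.mem_center_iff]
    intro g
    obtain ⟨⟨n', m'⟩, rfl⟩ := hmks g
    rw [← map_mul, ← map_mul]
    congr 1
    have hn : n ∈ K := (hπ _).symm.trans hy
    exact Prod.ext ((Subgroup.mem_center_iff.1 (hc hn)) n') (mul_comm _ _)
  let ρ : N → Subgroup.center Q := fun n => ⟨mk (n, 1) * (s (φ n))⁻¹, hker _ (by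
    rw [map_mul, map_inv, hπ, hsec']; simp)⟩
  let R : N →* Subgroup.center Q := MonoidHom.mk' ρ (by
    intro a b
    apply Subtype.ext
    have hb := Subgroup.mem_center_iff.1 (ρ b).2 (s (φ a))⁻¹
    simp only [ρ, Subgroup.coe_mul] at hb ⊢
    have : ((a * b, 1) : N × M) = (a, 1) * (b, 1) := by simp
    rw [this, map_mul, map_mul, map_mul, mul_inv_rev]
    calc mk (a, 1) * mk (b, 1) * ((s (φ b))⁻¹ * (s (φ a))⁻¹)
        = mk (a, 1) * ((mk (b, 1) * (s (φ b))⁻¹) * (s (φ a))⁻¹) := by group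
      _ = _ := by rw [← hb]; group)
  have hRk : R k = 1 := comm_center R (hd hk)
  have h2 : mk (k, 1) * (s (φ k))⁻¹ = 1 := congrArg Subtype.val hRk
  rw [hk, map_one, inv_one, mul_one, hmk] at h2
  obtain ⟨a, ha⟩ := h2
  have ha1 : (a : N) = k := congrArg Prod.fst ha
  have ha0 : (j a).2 = 1 := by rw [ha]
  have ha2 : (χ' a)⁻¹ = 1 := ha0
  apply hχ'
  have : a = ⟨k, hk⟩ := Subtype.ext ha1
  rw [← this]
  exact inv_eq_one.1 ha2

end Oka
end

open MvPolynomial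
noncomputable section
namespace Oka
open unitInterval Set Topology Filter

lemma fin_compl_nhdsNE {X : Type*} [TopologicalSpace X] [T1Space X] {F : Set X} (hF : F.Finite)
    (x : X) : Fᶜ ∈ 𝓝[≠] x := by
  have h : (F \ {x})ᶜ ∈ 𝓝 x := (hF.subset sdiff_subset).isClosed.isOpen_compl.mem_nhds (by simp)
  filter_upwards [nhdsWithin_le_nhds h, self_mem_nhdsWithin] with y hy hy' hyF
  exact hy ⟨hyF, hy'⟩

/-- the ambient affine space -/
abbrev E3 : Type := Fin 3 → ℂ

/-- restriction of a polynomial to the line `x + s v` -/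
def lineP (x v : E3) (h : MvPolynomial (Fin 3) ℂ) : Polynomial ℂ :=
  MvPolynomial.aeval (fun i => Polynomial.C (x i) + Polynomial.X * Polynomial.C (v i)) h

lemma lineP_eval (x v : E3) (h : MvPolynomial (Fin 3) ℂ) (s : ℂ) :
    (lineP x v h).eval s = eval (x + s • v) h := by
  have h1 : (Polynomial.evalRingHom s).comp
      (MvPolynomial.aeval (R := ℂ) (fun i : Fin 3 => Polynomial.C (x i) + Polynomial.X * Polynomial.C (v i))).toRingHom
      = (eval (x + s • v)) := by
    apply MvPolynomial.ringHom_ext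
    · intro r; simp
    · intro i; simp; ring
  exact DFunLike.congr_fun h1 h

lemma cont_eval (h : MvPolynomial (Fin 3) ℂ) : Continuous (fun x : E3 => eval x h) :=
  MvPolynomial.continuous_eval h

lemma exists_eval_ne {h : MvPolynomial (Fin 3) ℂ} (hh : h ≠ 0) : ∃ x : E3, eval x h ≠ 0 := by
  by_contra hc
  push Not at hc
  exact hh (MvPolynomial.funext (fun x => by simp [hc x]))

lemma exists_near {h : MvPolynomial (Fin 3) ℂ} (hh : h ≠ 0) (x : E3) {O : Set E3} (hO : O ∈ 𝓝 x) :
    ∃ x' ∈ O, eval x' h ≠ 0 := by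
  obtain ⟨y, hy⟩ := exists_eval_ne hh
  have hP : lineP x (y - x) h ≠ 0 := by
    intro h0
    have := lineP_eval x (y - x) h 1
    rw [h0] at this
    simp at this
    exact hy this.symm
  have hf : {s : ℂ | (lineP x (y - x) h).IsRoot s}.Finite := Polynomial.finite_setOfPred_isRoot hP
  have hc : Continuous (fun s : ℂ => x + s • (y - x)) := by fun_prop
  have h1 : ∀ᶠ s in 𝓝[≠] (0 : ℂ), x + s • (y - x) ∈ O := by
    apply Filter.Eventually.filter_mono nhdsWithin_le_nhds
    apply hc.continuousAt.eventually
    simpa using hO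
  have h2 : ∀ᶠ s in 𝓝[≠] (0 : ℂ), ¬ (lineP x (y - x) h).IsRoot s := by
    have : {s : ℂ | (lineP x (y - x) h).IsRoot s}ᶜ ∈ 𝓝[≠] (0 : ℂ) := fin_compl_nhdsNE hf 0
    exact this
  obtain ⟨s, hs1, hs2⟩ := (h1.and h2).exists
  exact ⟨_, hs1, by rwa [Polynomial.IsRoot, lineP_eval] at hs2⟩

/-- path in a convex open set off a hypersurface -/
lemma ball_path {h : MvPolynomial (Fin 3) ℂ} {B : Set E3} (hB : IsOpen B) (hBc : Convex ℝ B)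
    {x y : E3} (hx : x ∈ B) (hy : y ∈ B) (hhx : eval x h ≠ 0) (hhy : eval y h ≠ 0) :
    ∃ γ : C(I, E3), γ 0 = x ∧ γ 1 = y ∧ ∀ t, γ t ∈ B ∧ eval (γ t) h ≠ 0 := by
  set P := lineP x (y - x) h with hPd
  have hP0 : P.eval 0 ≠ 0 := by rw [hPd, lineP_eval]; simpa using hhx
  have hP1 : P.eval 1 ≠ 0 := by rw [hPd, lineP_eval]; simpa using hhy
  have hP : P ≠ 0 := by rintro h0; simp [h0] at hP0
  have hf : {s : ℂ | P.IsRoot s}.Finite := Polynomial.finite_setOfPred_isRoot hP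
  let s : ℝ → I → ℂ := fun τ t => (t : ℂ) + Complex.I * (τ * t * (1 - t) : ℝ)
  have hs : Continuous (fun a : ℝ × I => s a.1 a.2) := by fun_prop
  have hs2 : Continuous (fun a : ℝ × I => x + s a.1 a.2 • (y - x)) := by fun_prop
  have h1 : ∀ᶠ τ in 𝓝 (0 : ℝ), ∀ t ∈ (univ : Set I), x + s τ t • (y - x) ∈ B := by
    apply isCompact_univ.eventually_forall_of_forall_eventually
    intro t _
    apply hs2.continuousAt.eventually
    apply hB.mem_nhds
    have : x + s 0 t • (y - x) = x + (t : ℝ) • (y - x) := by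
      simp [s]
    change x + s 0 t • (y - x) ∈ B
    rw [this]
    exact hBc.add_smul_sub_mem hx hy t.2
  have h1' : ∀ᶠ τ in 𝓝[≠] (0 : ℝ), ∀ t ∈ (univ : Set I), x + s τ t • (y - x) ∈ B :=
    h1.filter_mono nhdsWithin_le_nhds
  have hbad : ((fun f : ℂ => f.im / (f.re * (1 - f.re))) '' {s : ℂ | P.IsRoot s}).Finite := hf.image _
  have h2 : ∀ᶠ τ in 𝓝[≠] (0 : ℝ),
      τ ∉ (fun f : ℂ => f.im / (f.re * (1 - f.re))) '' {s : ℂ | P.IsRoot s} :=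
    fin_compl_nhdsNE hbad 0
  obtain ⟨τ, hτ1, hτ2⟩ := (h1'.and h2).exists
  refine ⟨⟨fun t => x + s τ t • (y - x), by fun_prop⟩, ?_, ?_, fun t => ⟨hτ1 t (mem_univ _), ?_⟩⟩
  · simp [s]
  · simp [s]
  · change eval (x + s τ t • (y - x)) h ≠ 0
    rw [← lineP_eval]
    intro h0
    by_cases ht0 : (t : ℝ) = 0
    · apply hP0
      have : s τ t = 0 := by simp [s, ht0]
      rw [this] at h0; exact h0
    by_cases ht1 : (t : ℝ) = 1
    · apply hP1
      have : s τ t = 1 := by simp [s, ht1]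
      rw [this] at h0; exact h0
    apply hτ2
    refine ⟨s τ t, h0, ?_⟩
    have e1 : (s τ t).re = t := by simp [s]
    have e2 : (s τ t).im = τ * t * (1 - t) := by simp [s]
    simp only [e1, e2]
    have : (1 - (t : ℝ)) ≠ 0 := fun h => ht1 (by linarith)
    field_simp

/-- perturbation of paths off a hypersurface -/
theorem perturb {Γ : Type*} [Group Γ] {Z : Set E3} (hZ : IsOpen Z) (ρ : LS ↥Z Γ)
    {h : MvPolynomial (Fin 3) ℂ} (hh : h ≠ 0) (γ : C(I, Z)) :
    ∃ ε > 0, ∀ x' y' : Z, (x' : E3) ∈ Metric.ball (γ 0 : E3) ε → (y' : E3) ∈ Metric.ball (γ 1 : E3) ε →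
      eval (x' : E3) h ≠ 0 → eval (y' : E3) h ≠ 0 → ∃ γ' : C(I, Z), γ' 0 = x' ∧ γ' 1 = y' ∧
      (∀ t, eval (γ' t : E3) h ≠ 0) ∧ ∀ δ δ' : C(I, Z), δ 0 = γ 0 → δ 1 = x' → δ' 0 = y' → δ' 1 = γ 1 →
        (∀ t, (δ t : E3) ∈ Metric.ball (γ 0 : E3) ε) → (∀ t, (δ' t : E3) ∈ Metric.ball (γ 1 : E3) ε) →
        ρ.f γ = ρ.f δ * ρ.f γ' * ρ.f δ' := by
  revert γ
  have hball : ∀ z : Z, ∃ ε > 0, Metric.ball (z : E3) ε ⊆ Z := fun z =>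
    Metric.isOpen_iff.1 hZ _ z.2
  apply path_induction
  · intro z
    obtain ⟨ε, hε, hb⟩ := hball z
    refine ⟨Subtype.val ⁻¹' Metric.ball (z : E3) (ε/2), ?_, ?_⟩
    · exact continuous_subtype_val.continuousAt (Metric.ball_mem_nhds _ (by positivity))
    intro γ hγ
    refine ⟨ε/2, by positivity, ?_⟩
    intro x' y' hx' hy' hhx hhy
    have hx : (x' : E3) ∈ Metric.ball (z : E3) ε := by
      have h1 := hγ 0
      simp only [mem_preimage, Metric.mem_ball] at h1 hx' ⊢
      linarith [dist_triangle (x' : E3) (γ 0) z]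
    have hy : (y' : E3) ∈ Metric.ball (z : E3) ε := by
      have h1 := hγ 1
      simp only [mem_preimage, Metric.mem_ball] at h1 hy' ⊢
      linarith [dist_triangle (y' : E3) (γ 1) z]
    obtain ⟨κ, hκ0, hκ1, hκ⟩ := ball_path Metric.isOpen_ball (convex_ball _ _) hx hy hhx hhy
    let κ' : C(I, Z) := ⟨fun t => ⟨κ t, hb (hκ t).1⟩, by fun_prop⟩
    refine ⟨κ', Subtype.ext hκ0, Subtype.ext hκ1, fun t => (hκ t).2, ?_⟩
    intro δ δ' h0 h1 h2 h3 hδ hδ'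
    obtain ⟨b, hbb⟩ := ρ.triv_sub hb (convex_sc (convex_ball _ _) ⟨z, Metric.mem_ball_self hε⟩)
    have e1 := hbb γ (fun t => Metric.ball_subset_ball (by linarith) (hγ t))
    have e2 := hbb κ' (fun t => (hκ t).1)
    have e3 := hbb δ (fun t => by
      have h1 := hγ 0
      have h2 := hδ t
      simp only [mem_preimage, Metric.mem_ball] at h1 h2 ⊢
      linarith [dist_triangle (δ t : E3) (γ 0) z])
    have e4 := hbb δ' (fun t => by
      have h1 := hγ 1
      have h2 := hδ' t
      simp only [mem_preimage, Metric.mem_ball] at h1 h2 ⊢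
      linarith [dist_triangle (δ' t : E3) (γ 1) z])
    have k0 : κ' 0 = x' := Subtype.ext hκ0
    have k1 : κ' 1 = y' := Subtype.ext hκ1
    rw [e1, e2, e3, e4, h0, h1, h2, h3, k0, k1]
    group
  · intro x y z α β ⟨ε1, hε1, H1⟩ ⟨ε2, hε2, H2⟩
    have a0 : (α.toContinuousMap) 0 = x := α.source
    have a1 : (α.toContinuousMap) 1 = y := α.target
    have b0 : (β.toContinuousMap) 0 = y := β.source
    have b1 : (β.toContinuousMap) 1 = z := β.target
    have c0 : ((α.trans β).toContinuousMap) 0 = x := (α.trans β).source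
    have c1 : ((α.trans β).toContinuousMap) 1 = z := (α.trans β).target
    rw [a0, a1] at H1
    rw [b0, b1] at H2
    rw [c0, c1]
    obtain ⟨ε3, hε3, hb3⟩ := hball y
    refine ⟨min ε1 ε2, lt_min hε1 hε2, ?_⟩
    intro x' z' hx' hz' hhx hhz
    set η := min (min ε1 ε2) ε3
    have hη : 0 < η := lt_min (lt_min hε1 hε2) hε3
    obtain ⟨y', hy', hhy⟩ := exists_near hh y (Metric.ball_mem_nhds _ hη)
    have hyZ : y' ∈ Z := hb3 (Metric.ball_subset_ball (min_le_right _ _) hy')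
    obtain ⟨α', p0, p1, p2, p3⟩ := H1 x' ⟨y', hyZ⟩
      (Metric.ball_subset_ball (min_le_left _ _) hx')
      (Metric.ball_subset_ball ((min_le_left _ _).trans (min_le_left _ _)) hy') hhx hhy
    obtain ⟨β', q0, q1, q2, q3⟩ := H2 ⟨y', hyZ⟩ z'
      (Metric.ball_subset_ball ((min_le_left _ _).trans (min_le_right _ _)) hy')
      (Metric.ball_subset_ball (min_le_right _ _) hz') hhy hhz
    have hseg : ∀ t : I, (y : E3) + (t : ℝ) • (y' - y) ∈ Metric.ball (y : E3) η := fun t =>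
      (convex_ball _ _).add_smul_sub_mem (Metric.mem_ball_self hη) hy' t.2
    let ξ : Path y (⟨y', hyZ⟩ : Z) :=
      ⟨⟨fun t => ⟨(y : E3) + (t : ℝ) • (y' - y), hb3 (Metric.ball_subset_ball (min_le_right _ _) (hseg t))⟩,
        by fun_prop⟩, by simp, by simp⟩
    have hξ : ∀ t, (ξ t : E3) ∈ Metric.ball (y : E3) η := hseg
    let αp := asPath α' p0 p1
    let βp := asPath β' q0 q1
    refine ⟨(αp.trans βp).toContinuousMap, (αp.trans βp).source, (αp.trans βp).target, ?_, ?_⟩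
    · intro t
      change eval ((αp.trans βp) t : E3) h ≠ 0
      rw [Path.trans_apply]
      split_ifs
      · exact p2 _
      · exact q2 _
    · intro δ δ' h0 h1 h2 h3 hδ hδ'
      rw [ρ.mul, ρ.mul]
      rw [p3 δ ξ.symm.toContinuousMap h0 h1 ξ.symm.source ξ.symm.target
        (fun t => Metric.ball_subset_ball (min_le_left _ _) (hδ t))
        (fun t => Metric.ball_subset_ball ((min_le_left _ _).trans (min_le_left _ _)) (hξ _)),
        q3 ξ.toContinuousMap δ' ξ.source ξ.target h2 h3
        (fun t => Metric.ball_subset_ball ((min_le_left _ _).trans (min_le_right _ _)) (hξ _))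
        (fun t => Metric.ball_subset_ball (min_le_right _ _) (hδ' t)), ρ.f_symm]
      have ea : αp.toContinuousMap = α' := rfl
      have eb : βp.toContinuousMap = β' := rfl
      rw [ea, eb]
      group
  · intro x y α β hab ⟨ε, hε, H⟩
    have a0 : (α.toContinuousMap) 0 = x := α.source
    have a1 : (α.toContinuousMap) 1 = y := α.target
    have b0 : (β.toContinuousMap) 0 = x := β.source
    have b1 : (β.toContinuousMap) 1 = y := β.target
    rw [a0, a1] at H
    rw [b0, b1]
    rw [ρ.hom α β hab] at H
    exact ⟨ε, hε, H⟩

/-- perturbation rel endpoints -/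
theorem perturb' {Γ : Type*} [Group Γ] {Z : Set E3} (hZ : IsOpen Z) (ρ : LS ↥Z Γ)
    {h : MvPolynomial (Fin 3) ℂ} (γ : C(I, Z)) (h0 : eval (γ 0 : E3) h ≠ 0)
    (h1 : eval (γ 1 : E3) h ≠ 0) :
    ∃ γ' : C(I, Z), γ' 0 = γ 0 ∧ γ' 1 = γ 1 ∧ (∀ t, eval (γ' t : E3) h ≠ 0) ∧ ρ.f γ' = ρ.f γ := by
  have hh : h ≠ 0 := by rintro rfl; simp at h0
  obtain ⟨ε, hε, H⟩ := perturb hZ ρ hh γ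
  obtain ⟨γ', g0, g1, g2, g3⟩ := H (γ 0) (γ 1) (Metric.mem_ball_self hε) (Metric.mem_ball_self hε) h0 h1
  refine ⟨γ', g0, g1, g2, ?_⟩
  have := g3 (ContinuousMap.const I (γ 0)) (ContinuousMap.const I (γ 1)) rfl rfl rfl rfl
    (fun t => Metric.mem_ball_self hε) (fun t => Metric.mem_ball_self hε)
  rw [ρ.f_const, ρ.f_const] at this
  simpa using this.symm

end Oka
end

open MvPolynomial
noncomputable section
namespace Oka
open unitInterval Set Topology Filter

lemma eval_smul_hom {F : MvPolynomial (Fin 3) ℂ} {d : ℕ} (hF : F.IsHomogeneous d) (μ : ℂ) (v : E3) :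
    eval (μ • v) F = μ ^ d * eval v F := by
  rw [MvPolynomial.eval_eq', MvPolynomial.eval_eq', Finset.mul_sum]
  refine Finset.sum_congr rfl fun m hm => ?_
  have h1 : ∏ i, (μ • v) i ^ m i = μ ^ (∑ i, m i) * ∏ i, v i ^ m i := by
    rw [← Finset.prod_pow_eq_pow_sum, ← Finset.prod_mul_distrib]
    exact Finset.prod_congr rfl fun i _ => by simp [mul_pow]
  have h2 : ∑ i, m i = d := by
    have h := hF (mem_support_iff.1 hm)
    rw [Finsupp.weight_apply, Finsupp.sum_fintype _ _ (by simp)] at h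
    simpa using h
  rw [h1, h2]; ring

lemma mk_continuous : Continuous (fun v : {v : E3 // v ≠ 0} => (Projectivization.mk ℂ v.1 v.2 : P2)) :=
  continuous_quot_mk

lemma mk_isOpenMap : IsOpenMap (fun v : {v : E3 // v ≠ 0} => (Projectivization.mk ℂ v.1 v.2 : P2)) := by
  intro O hO
  have hq : IsQuotientMap (fun v : {v : E3 // v ≠ 0} => (Projectivization.mk ℂ v.1 v.2 : P2)) :=
    isQuotientMap_quot_mk
  rw [← hq.isOpen_preimage]
  have : (fun v : {v : E3 // v ≠ 0} => (Projectivization.mk ℂ v.1 v.2 : P2)) ⁻¹'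
      ((fun v : {v : E3 // v ≠ 0} => (Projectivization.mk ℂ v.1 v.2 : P2)) '' O) =
      ⋃ a : ℂˣ, (fun v : {v : E3 // v ≠ 0} =>
        (⟨a • v.1, (smul_ne_zero_iff_ne a).2 v.2⟩ : {v : E3 // v ≠ 0})) ⁻¹' O := by
    ext v
    simp only [mem_preimage, mem_image, mem_iUnion, Projectivization.mk_eq_mk_iff]
    constructor
    · rintro ⟨w, hw, a, ha⟩
      exact ⟨a, by convert hw⟩
    · rintro ⟨a, ha⟩
      exact ⟨_, ha, a, rfl⟩
  rw [this]
  refine isOpen_iUnion fun a => hO.preimage ?_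
  refine Continuous.subtype_mk ?_ _
  exact (continuous_const_smul (a : ℂ)).comp continuous_subtype_val

lemma rep_mk (v : E3) (hv : v ≠ 0) : ∃ a : ℂ, a ≠ 0 ∧ (Projectivization.mk ℂ v hv : P2).rep = a • v := by
  obtain ⟨a, ha⟩ := Projectivization.exists_smul_eq_mk_rep ℂ v hv
  exact ⟨a, a.ne_zero, ha.symm⟩

/-- degree zero functions descend to continuous functions -/
lemma cont_desc {Y : Type*} [TopologicalSpace Y] (f : E3 → Y)
    (hhom : ∀ (a : ℂ) (v : E3), a ≠ 0 → v ≠ 0 → f (a • v) = f v) (x : P2)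
    (hf : ContinuousAt f x.rep) : ContinuousAt (fun x : P2 => f x.rep) x := by
  let v0 : {v : E3 // v ≠ 0} := ⟨x.rep, x.rep_nonzero⟩
  have hx : (Projectivization.mk ℂ v0.1 v0.2 : P2) = x := Projectivization.mk_rep x
  have h1 : 𝓝 x ≤ Filter.map (fun v : {v : E3 // v ≠ 0} => (Projectivization.mk ℂ v.1 v.2 : P2)) (𝓝 v0) := by
    have := mk_isOpenMap.nhds_le v0
    rwa [hx] at this
  refine Filter.Tendsto.mono_left ?_ h1
  rw [Filter.tendsto_map'_iff]
  have h2 : ((fun x : P2 => f x.rep) ∘ fun v : {v : E3 // v ≠ 0} => (Projectivization.mk ℂ v.1 v.2 : P2))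
      = fun v => f v.1 := by
    funext v
    obtain ⟨a, ha, hav⟩ := rep_mk v.1 v.2
    simp only [Function.comp]
    rw [hav, hhom a v.1 ha v.2]
  rw [h2]
  exact hf.tendsto.comp continuous_subtype_val.continuousAt

/-- complement upstairs and downstairs -/
def XX (g : MvPolynomial (Fin 3) ℂ) : Set E3 := {v | eval v g ≠ 0}
def UU (g : MvPolynomial (Fin 3) ℂ) : Set P2 := {x | eval x.rep g ≠ 0}

lemma isOpen_XX (g : MvPolynomial (Fin 3) ℂ) : IsOpen (XX g) :=
  isOpen_ne_fun (cont_eval g) continuous_const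

lemma XX_ne {g : MvPolynomial (Fin 3) ℂ} {d : ℕ} (hg : g.IsHomogeneous d) (hd : d ≠ 0) {v : E3}
    (hv : v ∈ XX g) : v ≠ 0 := by
  rintro rfl
  apply hv
  have := eval_smul_hom hg 0 0
  rw [smul_zero, zero_pow hd, zero_mul] at this
  exact this

lemma XX_smul {g : MvPolynomial (Fin 3) ℂ} {d : ℕ} (hg : g.IsHomogeneous d) {v : E3}
    (hv : v ∈ XX g) {a : ℂ} (ha : a ≠ 0) : a • v ∈ XX g := by
  change eval _ _ ≠ 0
  rw [eval_smul_hom hg]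
  exact mul_ne_zero (pow_ne_zero _ ha) hv

lemma mk_mem_UU {g : MvPolynomial (Fin 3) ℂ} {d : ℕ} (hg : g.IsHomogeneous d) {v : E3} (hv : v ≠ 0) :
    (Projectivization.mk ℂ v hv : P2) ∈ UU g ↔ v ∈ XX g := by
  obtain ⟨a, ha, h⟩ := rep_mk v hv
  change eval _ _ ≠ 0 ↔ eval _ _ ≠ 0
  rw [h, eval_smul_hom hg]
  simp [ha]

variable {g : MvPolynomial (Fin 3) ℂ} {d : ℕ}

/-- projection -/
def pr (hg : g.IsHomogeneous d) (hd : d ≠ 0) : C(XX g, UU g) :=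
  ⟨fun v => ⟨Projectivization.mk ℂ v.1 (XX_ne hg hd v.2), (mk_mem_UU hg _).2 v.2⟩, by
    refine Continuous.subtype_mk ?_ _
    exact mk_continuous.comp (f := fun v : XX g => (⟨v.1, XX_ne hg hd v.2⟩ : {v : E3 // v ≠ 0}))
      (by fun_prop)⟩

lemma pr_rep (hg : g.IsHomogeneous d) (hd : d ≠ 0) (v : XX g) :
    ∃ a : ℂ, a ≠ 0 ∧ ((pr hg hd v : UU g) : P2).rep = a • (v : E3) :=
  rep_mk v.1 (XX_ne hg hd v.2)

lemma pr_eq_iff (hg : g.IsHomogeneous d) (hd : d ≠ 0) (v w : XX g) :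
    pr hg hd v = pr hg hd w ↔ ∃ a : ℂ, a ≠ 0 ∧ (v : E3) = a • (w : E3) := by
  rw [Subtype.ext_iff]
  change Projectivization.mk ℂ v.1 _ = Projectivization.mk ℂ w.1 _ ↔ _
  rw [Projectivization.mk_eq_mk_iff]
  constructor
  · rintro ⟨a, ha⟩; exact ⟨a, a.ne_zero, ha.symm⟩
  · rintro ⟨a, ha, h⟩; exact ⟨Units.mk0 a ha, h.symm⟩

lemma pr_surj (hg : g.IsHomogeneous d) (hd : d ≠ 0) : Function.Surjective (pr hg hd) := by
  rintro ⟨x, hx⟩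
  exact ⟨⟨x.rep, hx⟩, Subtype.ext (Projectivization.mk_rep x)⟩

lemma pr_scale (hg : g.IsHomogeneous d) (hd : d ≠ 0) (v w : XX g) (h : pr hg hd v = pr hg hd w) :
    ∃ α : C(I, XX g), α 0 = v ∧ α 1 = w ∧ ∀ t, pr hg hd (α t) = pr hg hd v := by
  obtain ⟨a, ha, h⟩ := (pr_eq_iff hg hd w v).1 h.symm
  refine ⟨⟨fun t => ⟨Complex.exp ((t : ℝ) * Complex.log a) • (v : E3), XX_smul hg v.2 (Complex.exp_ne_zero _)⟩,
    by fun_prop⟩, ?_, ?_, ?_⟩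
  · apply Subtype.ext; simp
  · apply Subtype.ext; simp [Complex.exp_log ha, h]
  · intro t
    rw [pr_eq_iff]
    exact ⟨_, Complex.exp_ne_zero _, rfl⟩

/-- lifting of paths up to local systems -/
theorem lift_path (hg : g.IsHomogeneous d) (hd : d ≠ 0) {Γ : Type*} [Group Γ] (τ : LS (UU g) Γ)
    (β : C(I, UU g)) : ∀ x y : XX g, pr hg hd x = β 0 → pr hg hd y = β 1 →
      ∃ α : C(I, XX g), α 0 = x ∧ α 1 = y ∧ τ.f ((pr hg hd).comp α) = τ.f β := by
  revert β
  apply path_induction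
  · intro z
    obtain ⟨k, hk⟩ : ∃ k, (z : P2).rep k ≠ 0 := by
      by_contra hc
      push Not at hc
      exact (z : P2).rep_nonzero (funext hc)
    let f : E3 → E3 := fun v => (v k)⁻¹ • v
    have hf : ∀ v : E3, v k ≠ 0 → ContinuousAt f v := by
      intro v hv
      have : ContinuousAt (fun v : E3 => v k) v := (continuous_apply k).continuousAt
      exact (this.inv₀ hv).smul continuousAt_id
    have hhom : ∀ (a : ℂ) (v : E3), a ≠ 0 → v ≠ 0 → f (a • v) = f v := by
      intro a v ha _
      simp only [f, Pi.smul_apply, smul_eq_mul, smul_smul]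
      congr 1
      by_cases hv : v k = 0
      · simp [hv]
      · field_simp
    refine ⟨{u : UU g | (u : P2).rep k ≠ 0}, ?_, ?_⟩
    · have h1 : ContinuousAt (fun x : P2 => f x.rep) z := cont_desc f hhom z (hf _ hk)
      have h2 : ContinuousAt (fun x : UU g => f (x : P2).rep k) z :=
        ((continuous_apply k).continuousAt.comp h1).comp (f := fun x : UU g => (x : P2))
          continuous_subtype_val.continuousAt
      have h3 : f (z : P2).rep k ≠ 0 := by simp [f, hk]
      filter_upwards [h2.eventually_ne h3] with u hu hc
      apply hu
      simp [f, hc]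
    intro γ hγ x y hx hy
    let α0 : C(I, XX g) := ⟨fun t => ⟨f ((γ t : UU g) : P2).rep, XX_smul hg (γ t).2 (inv_ne_zero (hγ t))⟩, by
      refine Continuous.subtype_mk ?_ _
      rw [continuous_iff_continuousAt]
      intro t
      exact (cont_desc f hhom _ (hf _ (hγ t))).comp (f := fun t => ((γ t : UU g) : P2))
        (continuous_subtype_val.comp γ.continuous).continuousAt⟩
    have hpr : ∀ t, pr hg hd (α0 t) = γ t := by
      intro t
      have h1 : pr hg hd ⟨((γ t : UU g) : P2).rep, (γ t).2⟩ = γ t :=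
        Subtype.ext (Projectivization.mk_rep _)
      refine Eq.trans ?_ h1
      rw [pr_eq_iff]
      exact ⟨_, inv_ne_zero (hγ t), rfl⟩
    obtain ⟨κ0, a0, a1, a2⟩ := pr_scale hg hd x (α0 0) (by rw [hx, hpr])
    obtain ⟨κ1, b0, b1, b2⟩ := pr_scale hg hd (α0 1) y (by rw [hy, hpr])
    let p0 := asPath κ0 a0 a1
    let p1 := asPath κ1 b0 b1
    let p2 := toPath α0
    refine ⟨(p0.trans (p2.trans p1)).toContinuousMap, Path.source _, Path.target _, ?_⟩
    have := (τ.comap (pr hg hd)).mul p0 (p2.trans p1)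
    rw [(τ.comap (pr hg hd)).mul p2 p1] at this
    simp only [LS.comap_f] at this
    rw [this]
    have e0 : τ.f ((pr hg hd).comp p0.toContinuousMap) = 1 := τ.f_eq_one_of_const _ (fun t => by
      change pr hg hd (κ0 t) = pr hg hd (κ0 0)
      rw [a2, a2])
    have e1 : τ.f ((pr hg hd).comp p1.toContinuousMap) = 1 := τ.f_eq_one_of_const _ (fun t => by
      change pr hg hd (κ1 t) = pr hg hd (κ1 0)
      rw [b2, b2])
    have e2 : (pr hg hd).comp p2.toContinuousMap = γ := ContinuousMap.ext hpr
    rw [e0, e1, e2]; simp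
  · intro x y z α β hα hβ x' z' hx hz
    have a0 : (α.toContinuousMap) 0 = x := α.source
    have a1 : (α.toContinuousMap) 1 = y := α.target
    have b0 : (β.toContinuousMap) 0 = y := β.source
    have b1 : (β.toContinuousMap) 1 = z := β.target
    have c0 : ((α.trans β).toContinuousMap) 0 = x := (α.trans β).source
    have c1 : ((α.trans β).toContinuousMap) 1 = z := (α.trans β).target
    obtain ⟨y', hy'⟩ := pr_surj hg hd y
    obtain ⟨α', p0, p1, p2⟩ := hα x' y' (by rw [hx, a0, c0]) (by rw [hy', a1])
    obtain ⟨β', q0, q1, q2⟩ := hβ y' z' (by rw [hy', b0]) (by rw [hz, b1, c1])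
    refine ⟨((asPath α' p0 p1).trans (asPath β' q0 q1)).toContinuousMap, Path.source _, Path.target _, ?_⟩
    have := (τ.comap (pr hg hd)).mul (asPath α' p0 p1) (asPath β' q0 q1)
    simp only [LS.comap_f] at this
    rw [this, τ.mul]
    exact congrArg₂ (· * ·) p2 q2
  · intro x y α β hab hα x' y' hx hy
    have a0 : (α.toContinuousMap) 0 = x := α.source
    have a1 : (α.toContinuousMap) 1 = y := α.target
    have b0 : (β.toContinuousMap) 0 = x := β.source
    have b1 : (β.toContinuousMap) 1 = y := β.target
    rw [← τ.hom α β hab]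
    exact hα x' y' (by rw [hx, b0, a0]) (by rw [hy, b1, a1])

lemma UU_pathConnected (hg : g.IsHomogeneous d) (hd : d ≠ 0) (hg0 : g ≠ 0) : PathConnectedSpace (UU g) := by
  obtain ⟨v, hv⟩ := exists_eval_ne hg0
  refine ⟨⟨pr hg hd ⟨v, hv⟩⟩, ?_⟩
  intro a b
  obtain ⟨x, rfl⟩ := pr_surj hg hd a
  obtain ⟨y, rfl⟩ := pr_surj hg hd b
  obtain ⟨γ, h0, h1, h2⟩ := ball_path (h := g) isOpen_univ convex_univ (mem_univ (x : E3)) (mem_univ (y : E3))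
    x.2 y.2
  let γ' : C(I, XX g) := ⟨fun t => ⟨γ t, (h2 t).2⟩, by fun_prop⟩
  exact ⟨asPath ((pr hg hd).comp γ') (congrArg (pr hg hd) (Subtype.ext h0 : γ' 0 = x))
    (congrArg (pr hg hd) (Subtype.ext h1 : γ' 1 = y))⟩

/-- every path in `U` is realised upstairs off `h = 0` -/
theorem lift_off (hg : g.IsHomogeneous d) (hd : d ≠ 0) {Γ : Type*} [Group Γ] (τ : LS (UU g) Γ)
    {h : MvPolynomial (Fin 3) ℂ} (β : C(I, UU g)) (x y : XX g) (hx : pr hg hd x = β 0)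
    (hy : pr hg hd y = β 1) (hhx : eval (x : E3) h ≠ 0) (hhy : eval (y : E3) h ≠ 0) :
    ∃ α : C(I, XX g), α 0 = x ∧ α 1 = y ∧ (∀ t, eval (α t : E3) h ≠ 0) ∧
      τ.f ((pr hg hd).comp α) = τ.f β := by
  obtain ⟨α, h0, h1, h2⟩ := lift_path hg hd τ β x y hx hy
  obtain ⟨α', k0, k1, k2, k3⟩ := perturb' (isOpen_XX g) (τ.comap (pr hg hd)) (h := h) α
    (by rwa [h0]) (by rwa [h1])
  simp only [LS.comap_f] at k3
  exact ⟨α', k0.trans h0, k1.trans h1, k2, k3.trans h2⟩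

end Oka
end

open MvPolynomial
noncomputable section
namespace Oka
open unitInterval Set Topology Filter

abbrev Pol : Type := MvPolynomial (Fin 3) ℂ

lemma totalDegree_pderiv_lt {k : Pol} {i : Fin 3} (h : pderiv i k ≠ 0) :
    (pderiv i k).totalDegree < k.totalDegree := by
  have hk : ∀ m ∈ (pderiv i k).support, (m.sum fun _ e => e) < k.totalDegree := by
    intro m hm
    rw [mem_support_iff, coeff_pderiv] at hm
    have h1 : m + Finsupp.single i 1 ∈ k.support := mem_support_iff.2 (fun h => hm (by simp [h]))
    have h2 := le_totalDegree h1
    rw [Finsupp.sum_add_index' (by simp) (by simp)] at h2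
    simp at h2
    omega
  obtain ⟨m, hm⟩ := support_nonempty.2 h
  rw [totalDegree, Finset.sup_lt_iff]
  · exact hk
  · exact lt_of_le_of_lt bot_le (hk m hm)

lemma exists_pderiv_ne {k : Pol} (h : k.totalDegree ≠ 0) : ∃ i, pderiv i k ≠ 0 := by
  by_contra hc
  push Not at hc
  apply h
  rw [totalDegree_eq_zero_iff_eq_C]
  ext m
  rw [coeff_C]
  split_ifs with h0
  · rw [h0]
  · obtain ⟨i, hi⟩ : ∃ i, m i ≠ 0 := by
      by_contra hh
      push Not at hh
      exact h0 (Finsupp.ext fun i => (hh i).symm ▸ rfl)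
    have h1 : coeff (m - Finsupp.single i 1) (pderiv i k) = 0 := by rw [hc i]; simp
    rw [coeff_pderiv] at h1
    have h2 : m - Finsupp.single i 1 + Finsupp.single i 1 = m := by
      apply tsub_add_cancel_of_le
      rw [Finsupp.single_le_iff]; omega
    rw [h2] at h1
    rcases mul_eq_zero.1 h1 with h3 | h3
    · exact h3
    · exfalso
      exact Nat.cast_add_one_ne_zero _ h3

lemma irr_totalDegree {k : Pol} (hk : Irreducible k) : k.totalDegree ≠ 0 := by
  intro h
  apply hk.not_isUnit
  rw [totalDegree_eq_zero_iff_eq_C] at h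
  rw [h]
  apply IsUnit.map
  rw [isUnit_iff_ne_zero]
  intro h0
  rw [h0, map_zero] at h
  exact hk.ne_zero h

lemma irr_not_dvd_pderiv {k : Pol} {i : Fin 3} (hi : pderiv i k ≠ 0) : ¬ k ∣ pderiv i k := by
  rintro ⟨a, ha⟩
  have hk0 : k ≠ 0 := by rintro rfl; simp at hi
  have ha0 : a ≠ 0 := by rintro rfl; simp [ha] at hi
  have h1 := totalDegree_pderiv_lt hi
  rw [ha, totalDegree_mul_of_isDomain hk0 ha0] at h1
  omega

/-- consequence of the Nullstellensatz -/
lemma exists_zero_of_not_dvd {k Q : Pol} (hk : Irreducible k) (hQ : ¬ k ∣ Q) :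
    ∃ y : E3, eval y k = 0 ∧ eval y Q ≠ 0 := by
  by_contra hc
  push Not at hc
  apply hQ
  have hpr : Prime k := hk.prime
  have h1 : Q ∈ vanishingIdeal ℂ (zeroLocus ℂ (Ideal.span {k})) := by
    rw [mem_vanishingIdeal_iff]
    intro x hx
    rw [mem_zeroLocus_iff] at hx
    have := hx k (Ideal.subset_span rfl)
    have e : ∀ p : Pol, aeval x p = eval x p := fun p => rfl
    rw [e] at this ⊢
    exact hc x this
  rw [vanishingIdeal_zeroLocus_eq_radical,
    (Ideal.IsPrime.radical ((Ideal.span_singleton_prime hk.ne_zero).2 hpr))] at h1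
  exact Ideal.mem_span_singleton.1 h1

lemma exists_smooth_zero {k Q : Pol} (hk : Irreducible k) (hQ : ¬ k ∣ Q) :
    ∃ y : E3, ∃ i, eval y k = 0 ∧ eval y (pderiv i k) ≠ 0 ∧ eval y Q ≠ 0 := by
  obtain ⟨i, hi⟩ := exists_pderiv_ne (irr_totalDegree hk)
  obtain ⟨y, h1, h2⟩ := exists_zero_of_not_dvd (Q := pderiv i k * Q) hk (fun h => by
    rcases hk.prime.dvd_or_dvd h with h | h
    · exact irr_not_dvd_pderiv hi h
    · exact hQ h)
  rw [map_mul] at h2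
  exact ⟨y, i, h1, left_ne_zero_of_mul h2, right_ne_zero_of_mul h2⟩

lemma irr_coprime_pow {k k' : Pol} (hk : Irreducible k) (hk' : Irreducible k') (hn : ¬ Associated k k')
    (μ ν : ℕ) (a : Pol) (h : k' ^ ν ∣ k ^ μ * a) : k' ^ ν ∣ a := by
  have h1 : IsRelPrime (k' ^ ν) (k ^ μ) := by
    apply IsRelPrime.pow
    rw [hk'.isRelPrime_iff_not_dvd]
    intro hd
    exact hn (hk'.associated_of_dvd hk hd).symm
  exact h1.dvd_of_dvd_mul_left h

/-- a polynomial all of whose multiplicities are divisible by `o` is an `o`-th power -/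
lemma is_pow_of_mult (o : ℕ) (ho : o ≠ 0) : ∀ (n : ℕ) (f : Pol), f ≠ 0 → f.totalDegree ≤ n →
    (∀ k : Pol, Irreducible k → ∀ (μ : ℕ) (a : Pol), f = k ^ μ * a → ¬ k ∣ a → o ∣ μ) →
    ∃ h, f = h ^ o := by
  intro n
  induction n with
  | zero =>
    intro f hf hd _
    have h0 : f.totalDegree = 0 := by omega
    rw [totalDegree_eq_zero_iff_eq_C] at h0
    obtain ⟨c, hc⟩ := IsAlgClosed.exists_pow_nat_eq (coeff 0 f) (Nat.pos_of_ne_zero ho)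
    exact ⟨C c, by rw [← map_pow, hc]; exact h0⟩
  | succ n ih =>
    intro f hf hd hmul
    by_cases hu : IsUnit f
    · apply ih f hf _ hmul
      rw [isUnit_iff_totalDegree_of_isReduced] at hu
      omega
    obtain ⟨k, hk, hkf⟩ := WfDvdMonoid.exists_irreducible_factor hu hf
    obtain ⟨μ, a, hka, hfa⟩ := WfDvdMonoid.max_power_factor hf hk
    have ha0 : a ≠ 0 := by rintro rfl; simp at hka
    have hμ0 : μ ≠ 0 := by
      rintro rfl
      rw [pow_zero, one_mul] at hfa
      exact hka (hfa ▸ hkf)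
    obtain ⟨j, hj⟩ := hmul k hk μ a hfa hka
    have hdeg : a.totalDegree ≤ n := by
      have h1 : f.totalDegree = (k ^ μ).totalDegree + a.totalDegree := by
        rw [hfa, totalDegree_mul_of_isDomain (pow_ne_zero _ hk.ne_zero) ha0]
      have h2 : (k ^ μ).totalDegree ≠ 0 := by
        intro h
        apply hk.not_isUnit
        rw [← isUnit_pow_iff hμ0 (a := k), isUnit_iff_totalDegree_of_isReduced]
        refine ⟨?_, h⟩
        rw [isUnit_iff_ne_zero]
        intro h0
        rw [totalDegree_eq_zero_iff_eq_C, h0, map_zero] at h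
        exact pow_ne_zero _ hk.ne_zero h
      omega
    obtain ⟨h, hh⟩ := ih a ha0 hdeg (by
      intro k' hk' ν b hab hkb
      by_cases hass : Associated k k'
      · have : ν = 0 := by
          by_contra hν
          apply hka
          rw [hab]
          exact (hass.dvd.trans (dvd_pow_self _ hν)).mul_right _
        simp [this]
      · refine hmul k' hk' ν (k ^ μ * b) (by rw [hfa, hab]; ring) ?_
        intro hd
        have := irr_coprime_pow hk hk' hass μ 1 b (by simpa using hd)
        rw [pow_one] at this
        exact hkb this)
    exact ⟨k ^ j * h, by rw [hfa, hh, hj, mul_pow, ← pow_mul]; ring⟩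

/-- gcd of multiplicities -/
lemma pow_eq_one_of_mult {Γ : Type*} [Group Γ] {f : Pol} (hf : f ≠ 0)
    (hpow : ∀ k, 2 ≤ k → ∀ h : Pol, f ≠ h ^ k) (w : Γ)
    (hw : ∀ k : Pol, Irreducible k → ∀ (μ : ℕ) (a : Pol), μ ≠ 0 → f = k ^ μ * a → ¬ k ∣ a → w ^ μ = 1) :
    w = 1 := by
  by_contra hw1
  have ho1 : orderOf w ≠ 1 := fun h => hw1 (orderOf_eq_one_iff.1 h)
  have key : ∀ o, orderOf w ∣ o → 2 ≤ o → (∀ k : Pol, Irreducible k → ∀ (μ : ℕ) (a : Pol),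
      f = k ^ μ * a → ¬ k ∣ a → o ∣ μ) → False := by
    intro o _ ho h
    obtain ⟨b, hb⟩ := is_pow_of_mult o (by omega) _ f hf le_rfl h
    exact hpow o ho b hb
  have hd : ∀ k : Pol, Irreducible k → ∀ (μ : ℕ) (a : Pol), f = k ^ μ * a → ¬ k ∣ a → orderOf w ∣ μ := by
    intro k hk μ a hfa hka
    by_cases hμ : μ = 0
    · simp [hμ]
    · exact orderOf_dvd_of_pow_eq_one (hw k hk μ a hμ hfa hka)
  by_cases h0 : orderOf w = 0
  · refine key 0 (by simp) ?_ ?_ |>.elim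
    · exfalso
      refine key (orderOf w * 2) ⟨2, rfl⟩ ?_ ?_
      · exfalso
        obtain ⟨b, hb⟩ := is_pow_of_mult 2 (by omega) _ f hf le_rfl (by
          intro k hk μ a hfa hka
          have := hd k hk μ a hfa hka
          rw [h0] at this
          simp [Nat.eq_zero_of_zero_dvd this])
        exact hpow 2 le_rfl b hb
      · intro k hk μ a hfa hka
        have := hd k hk μ a hfa hka
        rw [h0] at this ⊢
        simpa using this
    · intro k hk μ a hfa hka
      have := hd k hk μ a hfa hka
      rwa [h0] at this
  · exact key _ dvd_rfl (by omega) hd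

/-- derivative of polynomial functions -/
def grad (x : E3) (F : Pol) : E3 →L[ℂ] ℂ :=
  ∑ i, eval x (pderiv i F) • ContinuousLinearMap.proj (R := ℂ) (φ := fun _ : Fin 3 => ℂ) i

lemma grad_apply (x v : E3) (F : Pol) : grad x F v = ∑ i, eval x (pderiv i F) * v i := by
  simp [grad]

lemma hasStrictFDerivAt_eval (F : Pol) (x : E3) :
    HasStrictFDerivAt (fun x : E3 => eval x F) (grad x F) x := by
  induction F using MvPolynomial.induction_on with
  | C a =>
    simp only [eval_C]
    have : grad x (C a) = 0 := by ext v; simp [grad]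
    rw [this]
    exact hasStrictFDerivAt_const _ _
  | add p q hp hq =>
    simp only [map_add]
    have : grad x (p + q) = grad x p + grad x q := by
      apply ContinuousLinearMap.ext
      intro v
      rw [add_apply, grad_apply, grad_apply, grad_apply]
      simp [add_mul, Finset.sum_add_distrib]
    rw [this]
    exact hp.add hq
  | mul_X p j hp =>
    simp only [map_mul, eval_X]
    have h2 : HasStrictFDerivAt (fun x : E3 => x j)
      (ContinuousLinearMap.proj (R := ℂ) (φ := fun _ : Fin 3 => ℂ) j) x :=
      (ContinuousLinearMap.proj (R := ℂ) (φ := fun _ : Fin 3 => ℂ) j).hasStrictFDerivAt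
    have h3 := hp.mul h2
    have e : grad x (p * X j) = eval x p •
        ContinuousLinearMap.proj (R := ℂ) (φ := fun _ : Fin 3 => ℂ) j + x j • grad x p := by
      apply ContinuousLinearMap.ext
      intro v
      have : (eval x p • ContinuousLinearMap.proj (R := ℂ) (φ := fun _ : Fin 3 => ℂ) j +
        x j • grad x p) v = eval x p * v j + x j * grad x p v := rfl
      rw [this, grad_apply, grad_apply]
      simp only [pderiv_mul, pderiv_X, map_add, map_mul, eval_X,
        add_mul, Finset.sum_add_distrib, Finset.mul_sum]
      rw [add_comm]
      congr 1
      · rw [Finset.sum_eq_single j]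
        · simp
        · intro b _ hb; simp [Pi.single_apply, hb.symm]
        · simp
      · exact Finset.sum_congr rfl fun i _ => by ring
    rw [e]
    exact h3

lemma lineP_deriv (x v : E3) (F : Pol) : (lineP x v F).derivative.eval 0 = grad x F v := by
  have h1 : HasDerivAt (fun s : ℂ => (lineP x v F).eval s) ((lineP x v F).derivative.eval 0) 0 :=
    (lineP x v F).hasDerivAt 0
  have h2 : HasDerivAt (fun s : ℂ => eval (x + s • v) F) (grad x F v) 0 := by
    have h3 : HasDerivAt (fun s : ℂ => x + s • v) v 0 := by
      simpa using ((hasDerivAt_id (0:ℂ)).smul_const v).const_add x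
    have h5 : HasFDerivAt (fun x : E3 => eval x F) (grad x F) (x + (0:ℂ) • v) := by
      rw [zero_smul, add_zero]; exact (hasStrictFDerivAt_eval F x).hasFDerivAt
    exact HasFDerivAt.comp_hasDerivAt (f := fun s : ℂ => x + s • v) (0 : ℂ) h5 h3
  have : (fun s : ℂ => (lineP x v F).eval s) = fun s : ℂ => eval (x + s • v) F := by
    funext s; exact lineP_eval _ _ _ _
  rw [this] at h1
  exact h1.unique h2

end Oka
end

open MvPolynomial
noncomputable section
namespace Oka
open unitInterval Set Topology Filter

section Bez
variable {R : Type*} [CommRing R] [IsDomain R]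

lemma clr (p : Polynomial (FractionRing R)) : ∃ c : R, c ≠ 0 ∧ ∃ P : Polynomial R,
    P.map (algebraMap R (FractionRing R)) = Polynomial.C (algebraMap R (FractionRing R) c) * p := by
  obtain ⟨b, hb', hb⟩ := IsLocalization.integerNormalization_spec (nonZeroDivisors R) p
  refine ⟨b, nonZeroDivisors.ne_zero hb', _, hb.trans ?_⟩
  rw [Polynomial.C_mul', algebraMap_smul]

lemma clr_coprime {F G : Polynomial R}
    (h : IsCoprime (F.map (algebraMap R (FractionRing R))) (G.map (algebraMap R (FractionRing R)))) :
    ∃ A B : Polynomial R, ∃ c : R, c ≠ 0 ∧ A * F + B * G = Polynomial.C c := by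
  obtain ⟨a, b, hab⟩ := h
  obtain ⟨ca, hca, A, hA⟩ := clr a
  obtain ⟨cb, hcb, B, hB⟩ := clr b
  refine ⟨Polynomial.C cb * A, Polynomial.C ca * B, ca * cb, mul_ne_zero hca hcb, ?_⟩
  apply Polynomial.map_injective _ (IsFractionRing.injective R (FractionRing R))
  simp only [Polynomial.map_add, Polynomial.map_mul, hA, hB, Polynomial.map_C, map_mul]
  linear_combination (Polynomial.C (algebraMap R (FractionRing R) ca) *
    Polynomial.C (algebraMap R (FractionRing R) cb)) * hab

/-- Gauss: relatively prime over a UFD gives a Bezout identity up to a constant. -/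
lemma bez [UniqueFactorizationMonoid R] {F G : Polynomial R} (hF : F ≠ 0)
    (h : IsRelPrime F G) :
    ∃ A B : Polynomial R, ∃ c : R, c ≠ 0 ∧ A * F + B * G = Polynomial.C c := by
  classical
  apply clr_coprime
  let _ : NormalizedGCDMonoid R := Classical.choice inferInstance
  set K := FractionRing R
  rw [← isRelPrime_iff_isCoprime]
  intro d hd1 hd2
  obtain ⟨c, hc, P, hP⟩ := clr d
  have hF' : F.map (algebraMap R K) ≠ 0 := by
    rwa [Ne, Polynomial.map_eq_zero_iff (IsFractionRing.injective R K)]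
  have hd0 : d ≠ 0 := by rintro rfl; exact hF' (zero_dvd_iff.1 hd1)
  have hcK : algebraMap R K c ≠ 0 := by simpa using hc
  have hu : IsUnit (Polynomial.C (algebraMap R K c)) := Polynomial.isUnit_C.2 (isUnit_iff_ne_zero.2 hcK)
  have hP0 : P ≠ 0 := by
    rintro rfl
    rw [Polynomial.map_zero] at hP
    exact mul_ne_zero hu.ne_zero hd0 hP.symm
  have hcont : algebraMap R K P.content ≠ 0 := by
    simpa [Polynomial.content_eq_zero_iff] using hP0
  have hu' : IsUnit (Polynomial.C (algebraMap R K P.content)) :=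
    Polynomial.isUnit_C.2 (isUnit_iff_ne_zero.2 hcont)
  have hass : Associated (P.primPart.map (algebraMap R K)) d := by
    have h1 : P.map (algebraMap R K) = Polynomial.C (algebraMap R K P.content) * P.primPart.map (algebraMap R K) := by
      conv_lhs => rw [P.eq_C_content_mul_primPart]
      rw [Polynomial.map_mul, Polynomial.map_C]
    have h2 := h1.symm.trans hP
    have h3 : Associated (Polynomial.C (algebraMap R K P.content) * P.primPart.map (algebraMap R K))
      (P.primPart.map (algebraMap R K)) := by
      simpa using (associated_one_iff_isUnit.2 hu').mul_right (P.primPart.map (algebraMap R K))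
    have h4 : Associated (Polynomial.C (algebraMap R K c) * d) d := by
      simpa using (associated_one_iff_isUnit.2 hu).mul_right d
    exact h3.symm.trans (h2 ▸ h4)
  have g1 : P.primPart ∣ F := P.isPrimitive_primPart.dvd_of_fraction_map_dvd_fraction_map (K := K) (hass.dvd.trans hd1)
  have g2 : P.primPart ∣ G := P.isPrimitive_primPart.dvd_of_fraction_map_dvd_fraction_map (K := K) (hass.dvd.trans hd2)
  have g3 := h g1 g2
  exact hass.isUnit (g3.map (Polynomial.mapRingHom (algebraMap R K)))

end Bez

/-- shift automorphism of `ℂ[x,y,z][s]` -/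
def shiftHom (e : E3) : Polynomial Pol →+* Polynomial Pol :=
  Polynomial.eval₂RingHom (eval₂Hom (Polynomial.C.comp (C : ℂ →+* Pol))
    (fun i => Polynomial.C (X i) + Polynomial.C (C (e i)) * Polynomial.X)) Polynomial.X

lemma shiftHom_comp (e : E3) (P : Polynomial Pol) : shiftHom (-e) (shiftHom e P) = P := by
  have : (shiftHom (-e)).comp (shiftHom e) = RingHom.id _ := by
    apply Polynomial.ringHom_ext'
    · apply MvPolynomial.ringHom_ext
      · intro r; simp [shiftHom]
      · intro i; simp [shiftHom]; ring
    · simp [shiftHom]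
  exact congrArg (fun f : Polynomial Pol →+* Polynomial Pol => f P) this

lemma shift_eval (e y : E3) (s : ℂ) (h : Pol) :
    eval y ((shiftHom e (Polynomial.C h)).eval (C s)) = eval (y + s • e) h := by
  have : (((eval y).comp (Polynomial.evalRingHom (C s))).comp (shiftHom e)).comp Polynomial.C
      = eval (y + s • e) := by
    apply MvPolynomial.ringHom_ext
    · intro r; simp [shiftHom]
    · intro i; simp [shiftHom]; ring
  exact congrArg (fun f : Pol →+* ℂ => f h) this

/-- coprime `g,h`: generic lines in direction `e` miss `g = h = 0`. -/
lemma line_bez {g h : Pol} (hg : g ≠ 0) (hgh : IsRelPrime g h) (e : E3) :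
    ∃ c0 : Pol, c0 ≠ 0 ∧ ∀ (y : E3) (s : ℂ), eval (y + s • e) g = 0 → eval (y + s • e) h = 0 →
      eval y c0 = 0 := by
  have h1 : IsRelPrime (Polynomial.C g) (Polynomial.C h) := by
    intro d hd1 hd2
    have hdeg : d.natDegree = 0 := by
      have := Polynomial.natDegree_le_of_dvd hd1 (by simpa using hg)
      simpa using this
    rw [Polynomial.eq_C_of_natDegree_eq_zero hdeg] at hd1 hd2 ⊢
    rw [Polynomial.isUnit_C]
    apply hgh
    · have := (Polynomial.C_dvd_iff_dvd_coeff _ _).1 hd1 0; simpa using this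
    · have := (Polynomial.C_dvd_iff_dvd_coeff _ _).1 hd2 0; simpa using this
  have h2 : IsRelPrime (shiftHom e (Polynomial.C g)) (shiftHom e (Polynomial.C h)) := by
    intro d hd1 hd2
    have key : ∀ k : Pol, d ∣ shiftHom e (Polynomial.C k) → shiftHom (-e) d ∣ Polynomial.C k := by
      intro k hk
      have := map_dvd (shiftHom (-e)) hk
      rwa [shiftHom_comp] at this
    have := h1 (key g hd1) (key h hd2)
    have h3 := this.map (shiftHom e)
    have h4 := shiftHom_comp (-e) d
    rw [neg_neg] at h4
    rwa [h4] at h3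
  have h0 : shiftHom e (Polynomial.C g) ≠ 0 := by
    intro h0
    have := shiftHom_comp e (Polynomial.C g)
    rw [h0, map_zero] at this
    exact hg (by simpa using this.symm)
  obtain ⟨A, B, c, hc, hAB⟩ := bez h0 h2
  refine ⟨c, hc, fun y s hs1 hs2 => ?_⟩
  have := congrArg (fun P : Polynomial Pol => eval y (P.eval (C s))) hAB
  simp only [Polynomial.eval_add, Polynomial.eval_mul, map_add, map_mul, shift_eval, hs1, hs2,
    Polynomial.eval_C, mul_zero, add_zero] at this
  exact this.symm

end Oka
end

open MvPolynomial
noncomputable section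
namespace Oka
open unitInterval Set Topology Filter

section conc
variable {Z : Type*} [TopologicalSpace Z] {Γ : Type*} [Group Γ]

/-- concatenation on the level of continuous maps -/
def ctrans (a b : C(I, Z)) (h : a 1 = b 0) : C(I, Z) :=
  ((toPath a).trans (asPath b h.symm rfl)).toContinuousMap

lemma ctrans_zero (a b : C(I, Z)) (h : a 1 = b 0) : ctrans a b h 0 = a 0 :=
  ((toPath a).trans (asPath b h.symm rfl)).source

lemma ctrans_one (a b : C(I, Z)) (h : a 1 = b 0) : ctrans a b h 1 = b 1 :=
  ((toPath a).trans (asPath b h.symm rfl)).target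

lemma ctrans_mem (a b : C(I, Z)) (h : a 1 = b 0) {S : Set Z} (ha : ∀ t, a t ∈ S) (hb : ∀ t, b t ∈ S)
    (t : I) : ctrans a b h t ∈ S := by
  have : ctrans a b h t ∈ Set.range ((toPath a).trans (asPath b h.symm rfl)) := ⟨t, rfl⟩
  rw [Path.trans_range] at this
  rcases this with ⟨s, hs⟩ | ⟨s, hs⟩
  · rw [← hs]; exact ha s
  · rw [← hs]; exact hb s

lemma LS.f_ctrans (L : LS Z Γ) (a b : C(I, Z)) (h : a 1 = b 0) :
    L.f (ctrans a b h) = L.f a * L.f b := L.mul _ _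

def csymm (a : C(I, Z)) : C(I, Z) := (toPath a).symm.toContinuousMap

lemma csymm_zero (a : C(I, Z)) : csymm a 0 = a 1 := (toPath a).symm.source
lemma csymm_one (a : C(I, Z)) : csymm a 1 = a 0 := (toPath a).symm.target
lemma csymm_mem (a : C(I, Z)) {S : Set Z} (ha : ∀ t, a t ∈ S) (t : I) : csymm a t ∈ S := ha _
lemma LS.f_csymm (L : LS Z Γ) (a : C(I, Z)) : L.f (csymm a) = (L.f a)⁻¹ := L.f_symm _

lemma ctrans_map {W : Type*} [TopologicalSpace W] (g : C(Z, W)) (a b : C(I, Z)) (h : a 1 = b 0) :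
    g.comp (ctrans a b h) = ctrans (g.comp a) (g.comp b) (congrArg g h) := by
  ext t
  simp only [ctrans, ContinuousMap.comp_apply, Path.coe_toContinuousMap, Path.trans_apply]
  split_ifs <;> rfl

lemma csymm_map {W : Type*} [TopologicalSpace W] (g : C(Z, W)) (a : C(I, Z)) :
    g.comp (csymm a) = csymm (g.comp a) := rfl

end conc

lemma root_bound {g : Pol} {d : ℕ} (hg : g.IsHomogeneous d) {e : E3} (he : eval e g ≠ 0) :
    ∃ K : ℝ, 0 < K ∧ ∀ (y : E3) (s : ℂ), K * (1 + ‖y‖) ≤ ‖s‖ → eval (y + s • e) g ≠ 0 := by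
  have h1 : ∀ᶠ u in 𝓝 (0 : E3), eval (e + u) g ≠ 0 := by
    have : ContinuousAt (fun u : E3 => eval (e + u) g) 0 :=
      ((cont_eval g).comp (continuous_const.add continuous_id)).continuousAt
    exact this.eventually_ne (by simpa using he)
  obtain ⟨ε, hε, hb⟩ := Metric.eventually_nhds_iff.1 h1
  refine ⟨1 / ε, by positivity, fun y s hs => ?_⟩
  have hpos : 0 < ‖s‖ := lt_of_lt_of_le (by positivity) hs
  have hs0 : s ≠ 0 := norm_pos_iff.1 hpos
  have h2 : y + s • e = s • (e + s⁻¹ • y) := by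
    rw [smul_add, smul_inv_smul₀ hs0, add_comm]
  rw [h2, eval_smul_hom hg]
  refine mul_ne_zero (pow_ne_zero _ hs0) (hb ?_)
  rw [dist_zero_right, norm_smul, norm_inv, inv_mul_lt_iff₀ hpos]
  have h3 : 1 + ‖y‖ ≤ ε * ‖s‖ := by
    have := mul_le_mul_of_nonneg_left hs hε.le
    rwa [← mul_assoc, mul_one_div_cancel hε.ne', one_mul] at this
  linarith [mul_comm ε ‖s‖]

lemma line_path {g : Pol} {e x : E3} {s1 : ℂ} (h0 : eval x g ≠ 0) (h1 : eval (x + s1 • e) g ≠ 0) :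
    ∃ k : C(I, ℂ), k 0 = 0 ∧ k 1 = s1 ∧ ∀ t, eval (x + k t • e) g ≠ 0 := by
  have hP : lineP x e g ≠ 0 := by
    intro hh
    have := lineP_eval x e g 0
    rw [hh] at this
    simp at this
    exact h0 this.symm
  have hf : {s : ℂ | (lineP x e g).IsRoot s}.Finite := Polynomial.finite_setOfPred_isRoot hP
  have hpc : IsPathConnected ({s : ℂ | (lineP x e g).IsRoot s}ᶜ) :=
    hf.countable.isPathConnected_compl_of_one_lt_rank (by rw [Complex.rank_real_complex]; exact Cardinal.one_lt_two)
  have m : ∀ s : ℂ, s ∈ ({s : ℂ | (lineP x e g).IsRoot s}ᶜ) ↔ eval (x + s • e) g ≠ 0 := by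
    intro s
    rw [mem_compl_iff, mem_ofPred_eq, Polynomial.IsRoot, lineP_eval]
  obtain ⟨k, hk⟩ := hpc.joinedIn 0 ((m 0).2 (by simpa using h0)) s1 ((m s1).2 h1)
  exact ⟨k.toContinuousMap, k.source, k.target, fun t => (m _).1 (hk t)⟩

/-- extension theorem -/
theorem ext_triv {Γ : Type*} [Group Γ] {g h : Pol} {d : ℕ} (hg : g.IsHomogeneous d)
    (hgh : IsRelPrime g h) {e : E3} (he : eval e g ≠ 0) (ρ : LS (XX g) Γ)
    (H : ∀ y : E3, eval y g = 0 → eval y h ≠ 0 → ∃ ε0 > 0, ∀ ε : ℝ, 0 < ε → ε < ε0 →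
      ∀ γ : C(I, XX g), (∀ t : I, (γ t : E3) =
        y + ((ε : ℂ) * Complex.exp (2 * Real.pi * Complex.I * t)) • e) → ρ.f γ = 1)
    (γ : C(I, XX g)) (hγ : γ 0 = γ 1) : ρ.f γ = 1 := by
  classical
  have hg0 : g ≠ 0 := by rintro rfl; simp at he
  obtain ⟨c0, hc0, hc⟩ := line_bez hg0 hgh e
  obtain ⟨K, hK, hKb⟩ := root_bound hg he
  let R : E3 → ℂ := fun y => ((K * (1 + ‖y‖) : ℝ) : ℂ)
  have hRc : Continuous R := by fun_prop
  have hR : ∀ y, y + R y • e ∈ XX g := fun y => hKb y _ (by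
    rw [Complex.norm_real, Real.norm_of_nonneg (by positivity)])
  let S : C(E3, XX g) := ⟨fun y => ⟨y + R y • e, hR y⟩, by fun_prop⟩
  -- triviality on good lines
  have hline : ∀ x : E3, eval x g ≠ 0 → eval x c0 ≠ 0 → ∀ (k k' : C(I, ℂ)) (a a' : C(I, XX g)),
      (∀ t, (a t : E3) = x + k t • e) → (∀ t, (a' t : E3) = x + k' t • e) → k 0 = k' 0 → k 1 = k' 1 →
      ρ.f a = ρ.f a' := by
    intro x hx hxc k k' a a' ha ha' h0 h1
    have hP : lineP x e g ≠ 0 := by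
      intro hh
      have := lineP_eval x e g 0
      rw [hh] at this
      simp at this
      exact hx this.symm
    set P : Finset ℂ := (lineP x e g).roots.toFinset with hPd
    have hm : ∀ s : ℂ, s ∈ ((↑P : Set ℂ)ᶜ) ↔ eval (x + s • e) g ≠ 0 := by
      intro s
      rw [hPd, mem_compl_iff, Finset.mem_coe, Multiset.mem_toFinset, Polynomial.mem_roots hP,
        Polynomial.IsRoot, lineP_eval]
    let ℓ : C(↥((↑P : Set ℂ)ᶜ), XX g) := ⟨fun s => ⟨x + (s : ℂ) • e, (hm s).1 s.2⟩, by fun_prop⟩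
    obtain ⟨b, hb⟩ := planar_triv P (ρ.comap ℓ) (by
      intro s0 hs0
      have hs0' : eval (x + s0 • e) g = 0 := by
        by_contra hh
        exact ((hm s0).2 hh) hs0
      obtain ⟨ε0, hε0, hε⟩ := H (x + s0 • e) hs0' (fun hh => hxc (hc x s0 hs0' hh))
      refine ⟨ε0, hε0, fun δ hδ hδ0 γ hγ => ?_⟩
      rw [LS.comap_f]
      refine hε δ hδ hδ0 _ fun t => ?_
      change x + (γ t : ℂ) • e = _
      rw [hγ t, add_smul, add_assoc])
    have key : ∀ (k : C(I, ℂ)) (a : C(I, XX g)) (ha : ∀ t, (a t : E3) = x + k t • e),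
        ρ.f a = (b ⟨k 0, (hm _).2 (by rw [← ha]; exact (a 0).2)⟩)⁻¹ *
          b ⟨k 1, (hm _).2 (by rw [← ha]; exact (a 1).2)⟩ := by
      intro k a ha
      have := hb ⟨fun t => ⟨k t, (hm _).2 (by rw [← ha]; exact (a t).2)⟩, by fun_prop⟩
      rw [LS.comap_f] at this
      refine Eq.trans ?_ this
      congr 1
      ext1 t
      exact Subtype.ext (ha t)
    rw [key k a ha, key k' a' ha']
    simp only [h0, h1]
  -- the regular part
  let X' : Set E3 := {x | eval x g ≠ 0 ∧ eval x c0 ≠ 0}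
  have hpath : ∀ x : X', ∃ k : C(I, ℂ), k 0 = 0 ∧ k 1 = R x ∧ ∀ t, eval ((x : E3) + k t • e) g ≠ 0 :=
    fun x => line_path x.2.1 (hR x)
  choose k hk0 hk1 hkg using hpath
  let κ : X' → C(I, XX g) := fun x => ⟨fun t => ⟨(x : E3) + k x t • e, hkg x t⟩, by fun_prop⟩
  let ι : C(X', XX g) := ⟨fun x => ⟨x, x.2.1⟩, by fun_prop⟩
  let v : C(X', E3) := ⟨Subtype.val, continuous_subtype_val⟩
  have main : ∀ α : C(I, X'), α 0 = α 1 → ρ.f (ι.comp α) = 1 := by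
    intro α hα
    have h1 := LS.locGlob2 (ρ.comap ι) (ρ.comap (S.comp v)) (fun x => (ρ.f (κ x))⁻¹) (by
      intro z
      have hopen : ∀ᶠ x : X' in 𝓝 z, ∀ t ∈ (univ : Set I),
          eval ((x : E3) + (k z t + (t : ℂ) * (R x - R z)) • e) g ≠ 0 := by
        apply isCompact_univ.eventually_forall_of_forall_eventually
        intro t _
        have hc : ContinuousAt (fun w : X' × I => eval ((w.1 : E3) + (k z w.2 + (w.2 : ℂ) * (R w.1 - R z)) • e) g)
            (z, t) := by
          apply Continuous.continuousAt
          refine (cont_eval g).comp ?_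
          fun_prop
        exact hc.eventually_ne (by simpa using hkg z t)
      refine ⟨_, hopen, fun α hα => ?_⟩
      have hα' : ∀ u t : I, eval ((α u : E3) + (k z t + (t : ℂ) * (R (α u) - R z)) • e) g ≠ 0 :=
        fun u t => hα u t (mem_univ _)
      let Hm : C(I × I, XX g) := ⟨fun w => ⟨(α w.2 : E3) + (k z w.1 + (w.1 : ℂ) * (R (α w.2) - R z)) • e,
        hα' w.2 w.1⟩, by fun_prop⟩
      have sq := ρ.square Hm (Hm.comp ⟨fun t => (t, 0), by fun_prop⟩) ((S.comp v).comp α) (ι.comp α)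
        (Hm.comp ⟨fun t => (t, 1), by fun_prop⟩) (fun t => rfl) (fun t => Subtype.ext (by
          change (α t : E3) + R (α t) • e = (α t : E3) + (k z 1 + ((1 : I) : ℂ) * (R (α t) - R z)) • e
          rw [hk1]; simp)) (fun t => Subtype.ext (by
          change (α t : E3) = (α t : E3) + (k z 0 + ((0 : I) : ℂ) * (R (α t) - R z)) • e
          rw [hk0]; simp)) (fun t => rfl)
      have e0 : ∀ u : I, ρ.f (Hm.comp ⟨fun t => (t, u), by fun_prop⟩) = ρ.f (κ (α u)) := by
        intro u
        refine hline (α u) (α u).2.1 (α u).2.2 ⟨fun t => k z t + (t : ℂ) * (R (α u) - R z), by fun_prop⟩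
          (k (α u)) _ _ (fun t => rfl) (fun t => rfl) ?_ ?_
        · change k z 0 + ((0 : I) : ℂ) * (R (α u) - R z) = _
          rw [hk0, hk0]; simp
        · change k z 1 + ((1 : I) : ℂ) * (R (α u) - R z) = _
          rw [hk1, hk1]; simp
      rw [e0 0, e0 1] at sq
      rw [LS.comap_f, LS.comap_f, inv_inv, mul_assoc, ← sq, inv_mul_cancel_left]) α
    have h2 : (ρ.comap (S.comp v)).f α = 1 := by
      rw [LS.comap_f, ContinuousMap.comp_assoc]
      have : SimplyConnectedSpace E3 := inferInstance
      rw [ρ.f_eq_of_sc S (v.comp α) (ContinuousMap.const I (v (α 0))) rfl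
        (congrArg v hα.symm)]
      exact ρ.f_const (S (v (α 0)))
    rw [h2, hα, LS.comap_f, mul_inv_eq_one] at h1
    simpa using h1
  -- general loops
  have hnear : ∃ x' : XX g, eval (x' : E3) c0 ≠ 0 ∧ ∃ a : C(I, XX g), a 0 = γ 0 ∧ a 1 = x' := by
    obtain ⟨r, hr, hb⟩ := Metric.isOpen_iff.1 (isOpen_XX g) (γ 0 : E3) (γ 0).2
    obtain ⟨x', hx', hx'c⟩ := exists_near hc0 (γ 0 : E3) (Metric.ball_mem_nhds _ hr)
    have hj := ((convex_ball (γ 0 : E3) r).isPathConnected ⟨_, hx'⟩).joinedIn _ (Metric.mem_ball_self hr) x' hx'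
    obtain ⟨a, ha⟩ := hj
    refine ⟨⟨x', hb hx'⟩, hx'c, ⟨fun t => ⟨a t, hb (ha t)⟩, by fun_prop⟩, ?_, ?_⟩
    · exact Subtype.ext a.source
    · exact Subtype.ext a.target
  obtain ⟨x', hx', a, ha0, ha1⟩ := hnear
  have q1 : (csymm a) 1 = γ 0 := by rw [csymm_one, ha0]
  have q2 : (ctrans (csymm a) γ q1) 1 = a 0 := by rw [ctrans_one, ha0, hγ]
  have e0 : (ctrans (ctrans (csymm a) γ q1) a q2) 0 = x' := by
    rw [ctrans_zero, ctrans_zero, csymm_zero, ha1]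
  have e1 : (ctrans (ctrans (csymm a) γ q1) a q2) 1 = x' := by
    rw [ctrans_one, ha1]
  obtain ⟨β, b0, b1, b2, b3⟩ := perturb' (isOpen_XX g) ρ (h := c0) (ctrans (ctrans (csymm a) γ q1) a q2)
    (by rw [e0]; exact hx') (by rw [e1]; exact hx')
  have h5 := main ⟨fun t => ⟨β t, (β t).2, b2 t⟩, by fun_prop⟩
    (Subtype.ext (congrArg (Subtype.val : XX g → E3) (b0.trans (e0.trans (e1.symm.trans b1.symm)))))
  have h6 : ρ.f β = 1 := by
    refine Eq.trans ?_ h5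
    rfl
  rw [b3, LS.f_ctrans, LS.f_ctrans, LS.f_csymm] at h6
  have h7 : (ρ.f a)⁻¹ * ρ.f γ = (ρ.f a)⁻¹ := eq_inv_of_mul_eq_one_left h6
  simpa using h7

end Oka
end

open MvPolynomial
noncomputable section
namespace Oka
open unitInterval Set Topology Filter

def Jac (fp fq : Pol) (i : Fin 3) : Pol :=
  pderiv (i+1) fp * pderiv (i+2) fq - pderiv (i+2) fp * pderiv (i+1) fq

def Psi (fp fq : Pol) (i : Fin 3) : Fin 3 → Pol := ![fp, fq, X i]

def PsiF (fp fq : Pol) (i : Fin 3) (x : E3) : E3 := fun j => eval x (Psi fp fq i j)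

lemma cont_PsiF (fp fq : Pol) (i : Fin 3) : Continuous (PsiF fp fq i) :=
  continuous_pi fun j => cont_eval _

lemma eval_Psi (fp fq : Pol) (i : Fin 3) (x : E3) (P : Pol) :
    eval x (aeval (Psi fp fq i) P) = eval (PsiF fp fq i x) P := by
  have : (eval x).comp (aeval (R := ℂ) (Psi fp fq i)).toRingHom = eval (PsiF fp fq i x) := by
    apply MvPolynomial.ringHom_ext
    · intro r; simp
    · intro j; simp [PsiF]
  exact congrArg (fun f : Pol →+* ℂ => f P) this

lemma relprime_of_cf {fp fq : Pol} (hfp0 : fp ≠ 0)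
    (hcf : ∀ h : Pol, h ∣ fp → h ∣ fq → h.totalDegree = 0) : IsRelPrime fp fq := by
  intro d h1 h2
  have := hcf d h1 h2
  rw [totalDegree_eq_zero_iff_eq_C] at this
  rw [this]
  apply IsUnit.map
  rw [isUnit_iff_ne_zero]
  intro h0
  rw [h0, map_zero] at this
  rw [this] at h1
  exact hfp0 (zero_dvd_iff.1 h1)

lemma exists_Jac {p q : ℕ} (hp : 1 ≤ p) (hq : 1 ≤ q) {fp fq : Pol} (hfp0 : fp ≠ 0)
    (hfp : fp.IsHomogeneous p) (hfq : fq.IsHomogeneous q) (hrel : IsRelPrime fp fq) :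
    ∃ i, Jac fp fq i ≠ 0 := by
  by_contra hc
  push Not at hc
  have hm : ∀ a b : Fin 3, pderiv a fp * pderiv b fq = pderiv b fp * pderiv a fq := by
    have h0 := sub_eq_zero.1 (hc 0)
    have h1 := sub_eq_zero.1 (hc 1)
    have h2 := sub_eq_zero.1 (hc 2)
    have e1 : (1 + 1 : Fin 3) = 2 := rfl
    have e2 : (1 + 2 : Fin 3) = 0 := rfl
    have e3 : (2 + 1 : Fin 3) = 0 := rfl
    have e4 : (2 + 2 : Fin 3) = 1 := rfl
    rw [zero_add, zero_add] at h0
    rw [e1, e2] at h1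
    rw [e3, e4] at h2
    intro a b
    by_cases hab : a = b
    · rw [hab]
    have hthree : ∀ a : Fin 3, a = 0 ∨ a = 1 ∨ a = 2 := by decide
    rcases hthree a with rfl | rfl | rfl <;> rcases hthree b with rfl | rfl | rfl
    · exact absurd rfl hab
    · exact h2
    · exact h1.symm
    · exact h2.symm
    · exact absurd rfl hab
    · exact h0
    · exact h1
    · exact h0.symm
    · exact absurd rfl hab
  have key : ∀ b, fp ∣ pderiv b fp := by
    intro b
    have e1 := hfp.sum_X_mul_pderiv
    have e2 := hfq.sum_X_mul_pderiv
    have h1 : (p • fp) * pderiv b fq = (q • fq) * pderiv b fp := by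
      rw [← e1, ← e2, Finset.sum_mul, Finset.sum_mul]
      refine Finset.sum_congr rfl fun a _ => ?_
      rw [mul_assoc, hm a b]; ring
    have h2 : fp ∣ fq * ((q : Pol) * pderiv b fp) := by
      refine ⟨(p : Pol) * pderiv b fq, ?_⟩
      simp only [nsmul_eq_mul] at h1
      linear_combination -h1
    have h3 := hrel.dvd_of_dvd_mul_left h2
    have hu : IsUnit (q : Pol) := by
      have : ((q : ℕ) : Pol) = C (q : ℂ) := by simp
      rw [this]
      exact IsUnit.map _ (isUnit_iff_ne_zero.2 (by exact_mod_cast (by omega : q ≠ 0)))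
    exact (hu.dvd_mul_left).1 h3
  have hd : fp.totalDegree ≠ 0 := by rw [hfp.totalDegree hfp0]; omega
  obtain ⟨i, hi⟩ := exists_pderiv_ne hd
  exact irr_not_dvd_pderiv hi (key i)

lemma Jac_hom {p q : ℕ} {fp fq : Pol} 
    (hfp : fp.IsHomogeneous p) (hfq : fq.IsHomogeneous q) (i : Fin 3) :
    (Jac fp fq i).IsHomogeneous ((p - 1) + (q - 1)) :=
  (hfp.pderiv.mul hfq.pderiv).sub (hfp.pderiv.mul hfq.pderiv)

lemma psi_local {fp fq : Pol} {i : Fin 3} {x : E3} (hJ : eval x (Jac fp fq i) ≠ 0) :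
    ∃ e : OpenPartialHomeomorph E3 E3, x ∈ e.source ∧ (e : E3 → E3) = PsiF fp fq i := by
  let D : E3 →L[ℂ] E3 := ContinuousLinearMap.pi fun j => grad x (Psi fp fq i j)
  have hD : HasStrictFDerivAt (PsiF fp fq i) D x :=
    hasStrictFDerivAt_pi.2 fun j => hasStrictFDerivAt_eval _ x
  have hinj : Function.Injective D := by
    rw [injective_iff_map_eq_zero]
    intro v hv
    have h0 : grad x fp v = 0 := congrFun hv 0
    have h1 : grad x fq v = 0 := congrFun hv 1
    have h2 : grad x (X i) v = 0 := congrFun hv 2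
    rw [grad_apply, Fin.sum_univ_three] at h0 h1
    have hvi : v i = 0 := by
      rw [grad_apply, Finset.sum_eq_single i] at h2
      · simpa using h2
      · intro b _ hb; simp [pderiv_X, Pi.single_apply, hb.symm]
      · simp
    simp only [Jac, map_sub, map_mul] at hJ
    have e1 : (1 + 1 : Fin 3) = 2 := rfl
    have e2 : (1 + 2 : Fin 3) = 0 := rfl
    have e3 : (2 + 1 : Fin 3) = 0 := rfl
    have e4 : (2 + 2 : Fin 3) = 1 := rfl
    have key : ∀ a b c d s t : ℂ, a * d - b * c ≠ 0 → a * s + b * t = 0 → c * s + d * t = 0 → s = 0 ∧ t = 0 := by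
      intro a b c d s t h1 h2 h3
      constructor
      · refine (mul_eq_zero.1 (?_ : (a * d - b * c) * s = 0)).resolve_left h1
        linear_combination d * h2 - b * h3
      · refine (mul_eq_zero.1 (?_ : (a * d - b * c) * t = 0)).resolve_left h1
        linear_combination a * h3 - c * h2
    fin_cases i <;> simp only [Fin.zero_eta, Fin.mk_one, Fin.reduceFinMk, zero_add, e1, e2, e3, e4] at hvi hJ <;>
      rw [hvi] at h0 h1
    · obtain ⟨q1, q2⟩ := key _ _ _ _ (v 1) (v 2) hJ (by linear_combination h0) (by linear_combination h1)
      ext j; fin_cases j <;> assumption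
    · obtain ⟨q1, q2⟩ := key _ _ _ _ (v 2) (v 0) hJ (by linear_combination h0) (by linear_combination h1)
      ext j; fin_cases j <;> assumption
    · obtain ⟨q1, q2⟩ := key _ _ _ _ (v 0) (v 1) hJ (by linear_combination h0) (by linear_combination h1)
      ext j; fin_cases j <;> assumption
  let D' : E3 ≃L[ℂ] E3 := (LinearEquiv.ofInjectiveEndo (D : E3 →ₗ[ℂ] E3) hinj).toContinuousLinearEquiv
  have hD' : HasStrictFDerivAt (PsiF fp fq i) (D' : E3 →L[ℂ] E3) x := by
    have : (D' : E3 →L[ℂ] E3) = D := by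
      apply ContinuousLinearMap.ext; intro v; rfl
    rw [this]; exact hD
  exact ⟨hD'.toOpenPartialHomeomorph _, hD'.mem_toOpenPartialHomeomorph_source,
    hD'.toOpenPartialHomeomorph_coe⟩

lemma psi_ind {fp fq : Pol} {i : Fin 3} (hJ : Jac fp fq i ≠ 0) :
    AlgebraicIndependent ℂ (Psi fp fq i) := by
  rw [algebraicIndependent_iff]
  intro P hP
  by_contra hP0
  obtain ⟨x, hx⟩ := exists_eval_ne hJ
  obtain ⟨e, he, hE⟩ := psi_local hx
  obtain ⟨u, hu, hu'⟩ := exists_near hP0 (e x) (e.open_target.mem_nhds (e.map_source he))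
  apply hu'
  have := eval_Psi fp fq i (e.symm u) P
  rw [hP, map_zero, ← hE, e.right_inv hu] at this
  exact this.symm

lemma psi_alg {fp fq : Pol} {i : Fin 3} (hJ : Jac fp fq i ≠ 0) :
    Algebra.IsAlgebraic (Algebra.adjoin ℂ (Set.range (Psi fp fq i))) Pol := by
  have := (psi_ind hJ).isTranscendenceBasis_of_trdeg_le (by
    rw [MvPolynomial.trdeg_of_isDomain]; simp) (by
    rw [MvPolynomial.trdeg_of_isDomain]; simp)
  exact this.isAlgebraic

lemma root_bd (P : Polynomial ℂ) (hP : P ≠ 0) (z : ℂ) (hz : P.eval z = 0) :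
    ‖z‖ ≤ (∑ j ∈ Finset.range P.natDegree, ‖P.coeff j‖) / ‖P.leadingCoeff‖ + 1 := by
  have h1 : ‖z‖₊ < P.cauchyBound := Polynomial.IsRoot.norm_lt_cauchyBound hP hz
  have h2 : P.cauchyBound ≤ (∑ j ∈ Finset.range P.natDegree, ‖P.coeff j‖₊) / ‖P.leadingCoeff‖₊ + 1 := by
    rw [Polynomial.cauchyBound]
    gcongr
    exact Finset.sup_le fun j hj => Finset.single_le_sum (f := fun j => ‖P.coeff j‖₊) (fun _ _ => zero_le) hj
  have h3 := h1.le.trans h2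
  have h4 : ((‖z‖₊ : NNReal) : ℝ) ≤ ((∑ j ∈ Finset.range P.natDegree, ‖P.coeff j‖₊) / ‖P.leadingCoeff‖₊ + 1 : NNReal) := by
    exact_mod_cast h3
  simpa using h4

lemma psi_rel {fp fq : Pol} {i : Fin 3} (hJ : Jac fp fq i ≠ 0) (k : Fin 3) :
    ∃ Q : Polynomial Pol, Q ≠ 0 ∧ ∀ x : E3, (Q.map (eval (PsiF fp fq i x))).eval (x k) = 0 := by
  have hi := psi_ind hJ
  have := psi_alg hJ
  obtain ⟨P, hP, hP0⟩ := Algebra.IsAlgebraic.isAlgebraic (R := Algebra.adjoin ℂ (Set.range (Psi fp fq i)))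
    (X k : Pol)
  let φ := hi.aevalEquiv
  refine ⟨P.map (φ.symm : _ →+* Pol), ?_, fun x => ?_⟩
  · rwa [Ne, Polynomial.map_eq_zero_iff]
    exact φ.symm.injective
  · have h1 : (eval (PsiF fp fq i x)).comp (φ.symm : _ →+* Pol) =
      (eval x).comp (algebraMap (Algebra.adjoin ℂ (Set.range (Psi fp fq i))) Pol) := by
      ext a
      obtain ⟨b, rfl⟩ := φ.surjective a
      simp only [RingHom.comp_apply]
      have e1 : (φ.symm : _ →+* Pol) (φ b) = b := φ.symm_apply_apply b
      rw [e1, ← eval_Psi]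
      exact congrArg (eval x) (hi.algebraMap_aevalEquiv b).symm
    rw [Polynomial.map_map, h1, ← Polynomial.map_map]
    have h2 := congrArg (eval x) hP0
    rw [map_zero, Polynomial.aeval_def, Polynomial.eval₂_eq_eval_map] at h2
    have h3 := Polynomial.eval_map_apply (p := P.map (algebraMap (Algebra.adjoin ℂ (Set.range (Psi fp fq i))) Pol)) (eval x) (X k)
    rw [eval_X] at h3
    rw [h3]
    exact h2

lemma rel_bd (Q : Polynomial Pol) (u0 : E3) (hu0 : eval u0 Q.leadingCoeff ≠ 0) :
    ∃ O ∈ 𝓝 u0, ∃ M : ℝ, ∀ u ∈ O, ∀ z : ℂ, (Q.map (eval u)).eval z = 0 → ‖z‖ ≤ M := by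
  let B : E3 → ℝ := fun u => (∑ j ∈ Finset.range Q.natDegree, ‖eval u (Q.coeff j)‖) / ‖eval u Q.leadingCoeff‖ + 1
  have hB : ContinuousAt B u0 := by
    refine ContinuousAt.add (ContinuousAt.div ?_ ?_ (by simpa using hu0)) continuousAt_const
    · exact (continuous_finsetSum _ fun j _ => (cont_eval _).norm).continuousAt
    · exact (cont_eval _).norm.continuousAt
  have h1 : ∀ᶠ u in 𝓝 u0, eval u Q.leadingCoeff ≠ 0 := (cont_eval _).continuousAt.eventually_ne hu0
  have h2 : ∀ᶠ u in 𝓝 u0, B u < B u0 + 1 := hB.eventually_lt_const (by linarith)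
  refine ⟨_, h1.and h2, B u0 + 1, ?_⟩
  rintro u ⟨hu1, hu2⟩ z hz
  have hd := Polynomial.natDegree_map_of_leadingCoeff_ne_zero (eval u) hu1
  have hl := Polynomial.leadingCoeff_map_of_leadingCoeff_ne_zero (eval u) hu1
  have h3 := root_bd (Q.map (eval u)) (by
    intro h0
    rw [h0] at hl
    exact hu1 (by rw [← hl]; simp)) z hz
  rw [hd, hl] at h3
  simp only [Polynomial.coeff_map] at h3
  exact h3.trans hu2.le

end Oka
end

open MvPolynomial
noncomputable section
namespace Oka
open unitInterval Set Topology Filter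

lemma psi_mult {fp fq : Pol} {i : Fin 3} (hJ : Jac fp fq i ≠ 0) {J : Pol} (hJ0 : J ≠ 0) :
    ∃ D : Pol, D ≠ 0 ∧ J ∣ aeval (Psi fp fq i) D := by
  have hi := psi_ind hJ
  have := psi_alg hJ
  have ha := Algebra.IsAlgebraic.isAlgebraic (R := Algebra.adjoin ℂ (Set.range (Psi fp fq i))) J
  obtain ⟨r, hr, hd⟩ := ha.exists_nonzero_dvd (mem_nonZeroDivisors_of_ne_zero hJ0)
  obtain ⟨D, rfl⟩ := hi.aevalEquiv.surjective r
  refine ⟨D, ?_, ?_⟩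
  · rintro rfl; exact hr (map_zero _)
  · rwa [hi.algebraMap_aevalEquiv] at hd

lemma Psi_ne {fp fq : Pol} {i : Fin 3} (hJ : Jac fp fq i ≠ 0) {D : Pol} (hD : D ≠ 0) :
    aeval (Psi fp fq i) D ≠ 0 := by
  intro h
  exact hD ((algebraicIndependent_iff.1 (psi_ind hJ)) D h)

lemma alg_delta0 {fp fq : Pol} {i : Fin 3} (hJ : Jac fp fq i ≠ 0) :
    ∃ D : Pol, D ≠ 0 ∧ (∀ x, eval (PsiF fp fq i x) D ≠ 0 → eval x (Jac fp fq i) ≠ 0) ∧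
      ∀ u0, eval u0 D ≠ 0 → ∃ O ∈ 𝓝 u0, ∃ M : ℝ, ∀ x, PsiF fp fq i x ∈ O → ‖x‖ ≤ M := by
  obtain ⟨D, hD0, hD⟩ := psi_mult hJ hJ
  choose Q hQ0 hQ using psi_rel hJ
  refine ⟨D * ∏ k, (Q k).leadingCoeff, ?_, ?_, ?_⟩
  · refine mul_ne_zero hD0 (Finset.prod_ne_zero_iff.2 fun k _ => ?_)
    exact Polynomial.leadingCoeff_ne_zero.2 (hQ0 k)
  · intro x hx h0
    rw [map_mul] at hx
    have h1 := left_ne_zero_of_mul hx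
    rw [← eval_Psi] at h1
    obtain ⟨a, ha⟩ := hD
    rw [ha, map_mul, h0, zero_mul] at h1
    exact h1 rfl
  · intro u0 hu0
    rw [map_mul, map_prod] at hu0
    have h1 := Finset.prod_ne_zero_iff.1 (right_ne_zero_of_mul hu0)
    choose O hO M hM using fun k => rel_bd (Q k) u0 (h1 k (Finset.mem_univ k))
    refine ⟨⋂ k, O k, Filter.iInter_mem.2 hO, ∑ k, |M k|, fun x hx => ?_⟩
    rw [pi_norm_le_iff_of_nonneg (Finset.sum_nonneg fun _ _ => abs_nonneg _)]
    intro k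
    have := hM k _ (Set.mem_iInter.1 hx k) (x k) (hQ k x)
    exact (this.trans (le_abs_self _)).trans
      (Finset.single_le_sum (f := fun k => |M k|) (fun _ _ => abs_nonneg _) (Finset.mem_univ k))

/-- basic data of the pencil -/
structure Dat (p q m n : ℕ) (fp fq : Pol) : Prop where
  hp : 1 ≤ p
  hq : 1 ≤ q
  hmn : p * m = q * n + 1
  hfp0 : fp ≠ 0
  hfq0 : fq ≠ 0
  hfp : fp.IsHomogeneous p
  hfq : fq.IsHomogeneous q
  hrel : IsRelPrime fp fq

def lam (m n : ℕ) (fp fq : Pol) (x : E3) : ℂ := eval x fp ^ m / eval x fq ^ n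
def cc (p q : ℕ) (fp fq : Pol) (x : E3) : ℂ := eval x fq ^ p / eval x fp ^ q
def ret (m n : ℕ) (fp fq : Pol) (x : E3) : E3 := (lam m n fp fq x)⁻¹ • x

variable {p q m n : ℕ} {fp fq : Pol}

/-- the slice -/
def Sig (m n : ℕ) (fp fq : Pol) : Set E3 :=
  {x | eval x fp ≠ 0 ∧ eval x fq ≠ 0 ∧ lam m n fp fq x = 1}

lemma lam_ne {x : E3} (h1 : eval x fp ≠ 0) (h2 : eval x fq ≠ 0) : lam m n fp fq x ≠ 0 :=
  div_ne_zero (pow_ne_zero _ h1) (pow_ne_zero _ h2)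

lemma cc_ne {x : E3} (h1 : eval x fp ≠ 0) (h2 : eval x fq ≠ 0) : cc p q fp fq x ≠ 0 :=
  div_ne_zero (pow_ne_zero _ h2) (pow_ne_zero _ h1)

lemma Dat.lam_smul (hd : Dat p q m n fp fq) {x : E3} (h2 : eval x fq ≠ 0) {a : ℂ}
    (ha : a ≠ 0) : lam m n fp fq (a • x) = a * lam m n fp fq x := by
  unfold lam
  rw [eval_smul_hom hd.hfp, eval_smul_hom hd.hfq, mul_pow, mul_pow, ← pow_mul, ← pow_mul, hd.hmn]
  field_simp
  ring

lemma Dat.cc_smul (hd : Dat p q m n fp fq) {x : E3} {a : ℂ}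
    (ha : a ≠ 0) : cc p q fp fq (a • x) = cc p q fp fq x := by
  unfold cc
  rw [eval_smul_hom hd.hfp, eval_smul_hom hd.hfq, mul_pow, mul_pow, ← pow_mul, ← pow_mul,
    mul_comm q p, mul_div_mul_left _ _ (pow_ne_zero _ ha)]

lemma Dat.ret_mem (hd : Dat p q m n fp fq) {x : E3} (h1 : eval x fp ≠ 0) (h2 : eval x fq ≠ 0) :
    ret m n fp fq x ∈ Sig m n fp fq := by
  have hl := lam_ne (m := m) (n := n) h1 h2
  have hi := inv_ne_zero hl
  refine ⟨?_, ?_, ?_⟩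
  · rw [ret, eval_smul_hom hd.hfp]; exact mul_ne_zero (pow_ne_zero _ hi) h1
  · rw [ret, eval_smul_hom hd.hfq]; exact mul_ne_zero (pow_ne_zero _ hi) h2
  · rw [ret, hd.lam_smul h2 hi, inv_mul_cancel₀ hl]

lemma ret_sig {x : E3} (hx : x ∈ Sig m n fp fq) : ret m n fp fq x = x := by
  rw [ret, hx.2.2, inv_one, one_smul]

lemma Dat.cc_ret (hd : Dat p q m n fp fq) {x : E3} (h1 : eval x fp ≠ 0) (h2 : eval x fq ≠ 0) :
    cc p q fp fq (ret m n fp fq x) = cc p q fp fq x :=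
  hd.cc_smul (inv_ne_zero (lam_ne h1 h2))

lemma Dat.sig_fp (hd : Dat p q m n fp fq) {x : E3} (hx : x ∈ Sig m n fp fq) :
    eval x fp = cc p q fp fq x ^ n := by
  obtain ⟨h1, h2, h3⟩ := hx
  have h4 : eval x fp ^ m = eval x fq ^ n := by
    rwa [lam, div_eq_one_iff_eq (pow_ne_zero _ h2)] at h3
  rw [cc, div_pow, eq_div_iff (pow_ne_zero _ (pow_ne_zero _ h1)), ← pow_mul, ← pow_mul, mul_comm p n,
    pow_mul (eval x fq), ← h4, ← pow_mul, mul_comm m p, hd.hmn, pow_succ']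

lemma Dat.sig_fq (hd : Dat p q m n fp fq) {x : E3} (hx : x ∈ Sig m n fp fq) :
    eval x fq = cc p q fp fq x ^ m := by
  obtain ⟨h1, h2, h3⟩ := hx
  have h4 : eval x fp ^ m = eval x fq ^ n := by
    rwa [lam, div_eq_one_iff_eq (pow_ne_zero _ h2)] at h3
  rw [cc, div_pow, eq_div_iff (pow_ne_zero _ (pow_ne_zero _ h1)), ← pow_mul, ← pow_mul, mul_comm q m,
    pow_mul, h4, ← pow_mul, hd.hmn, mul_comm n q, pow_succ']

lemma Dat.sig_of (hd : Dat p q m n fp fq) {x : E3} {c : ℂ} (hc : c ≠ 0)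
    (h1 : eval x fp = c ^ n) (h2 : eval x fq = c ^ m) :
    x ∈ Sig m n fp fq ∧ cc p q fp fq x = c := by
  refine ⟨⟨?_, ?_, ?_⟩, ?_⟩
  · rw [h1]; exact pow_ne_zero _ hc
  · rw [h2]; exact pow_ne_zero _ hc
  · rw [lam, h1, h2, ← pow_mul, ← pow_mul, mul_comm n m, div_self (pow_ne_zero _ hc)]
  · rw [cc, h1, h2, ← pow_mul, ← pow_mul, mul_comm m p, hd.hmn, mul_comm n q, pow_succ',
      mul_div_assoc, div_self (pow_ne_zero _ hc), mul_one]

lemma Dat.alg (hd : Dat p q m n fp fq) : ∃ i, ∃ D : Pol,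
    (∀ x, eval (PsiF fp fq i x) D ≠ 0 → eval x (Jac fp fq i) ≠ 0) ∧
    (∀ u0, eval u0 D ≠ 0 → ∃ O ∈ 𝓝 u0, ∃ M : ℝ, ∀ x, PsiF fp fq i x ∈ O → ‖x‖ ≤ M) ∧
    ∃ x ∈ Sig m n fp fq, eval (PsiF fp fq i x) D ≠ 0 := by
  obtain ⟨i, hJ⟩ := exists_Jac hd.hp hd.hq hd.hfp0 hd.hfp hd.hfq hd.hrel
  obtain ⟨D0, hD0, h1, h2⟩ := alg_delta0 hJ
  obtain ⟨x, hx⟩ := exists_eval_ne (mul_ne_zero (Psi_ne hJ hD0) (mul_ne_zero hd.hfp0 hd.hfq0))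
  rw [map_mul, map_mul, eval_Psi] at hx
  have hx1 := left_ne_zero_of_mul hx
  have hx2 := left_ne_zero_of_mul (right_ne_zero_of_mul hx)
  have hx3 := right_ne_zero_of_mul (right_ne_zero_of_mul hx)
  set κ := lam m n fp fq x with hκ
  have hκ0 : κ ≠ 0 := lam_ne hx2 hx3
  let s : E3 → E3 := fun u => ![κ ^ p * u 0, κ ^ q * u 1, κ * u 2]
  have hs : Continuous s := by
    refine continuous_pi fun j => ?_
    fin_cases j
    · exact continuous_const.mul (continuous_apply 0)
    · exact continuous_const.mul (continuous_apply 1)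
    · exact continuous_const.mul (continuous_apply 2)
  have hsP : ∀ x, s (PsiF fp fq i x) = PsiF fp fq i (κ • x) := by
    intro x
    funext j
    fin_cases j
    · exact (eval_smul_hom hd.hfp κ x).symm
    · exact (eval_smul_hom hd.hfq κ x).symm
    · simp [s, PsiF, Psi]
  let D : Pol := aeval ![C (κ ^ p) * X 0, C (κ ^ q) * X 1, C κ * X 2] D0
  have hD : ∀ u, eval u D = eval (s u) D0 := by
    intro u
    have : (eval u).comp (aeval (R := ℂ) (![C (κ ^ p) * X 0, C (κ ^ q) * X 1, C κ * X 2] : Fin 3 → Pol)).toRingHom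
        = eval (s u) := by
      apply MvPolynomial.ringHom_ext
      · intro r; simp
      · intro j; fin_cases j <;> simp [s]
    exact congrArg (fun f : Pol →+* ℂ => f D0) this
  refine ⟨i, D, ?_, ?_, ret m n fp fq x, hd.ret_mem hx2 hx3, ?_⟩
  · intro y hy h0
    rw [hD, hsP] at hy
    apply h1 _ hy
    rw [eval_smul_hom (Jac_hom hd.hfp hd.hfq i), h0, mul_zero]
  · intro u0 hu0
    rw [hD] at hu0
    obtain ⟨O, hO, M, hM⟩ := h2 _ hu0
    refine ⟨s ⁻¹' O, hs.continuousAt hO, ‖κ‖⁻¹ * M, fun x hx => ?_⟩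
    have := hM (κ • x) (by rw [← hsP]; exact hx)
    rw [norm_smul] at this
    have hk : 0 < ‖κ‖ := norm_pos_iff.2 hκ0
    rw [le_inv_mul_iff₀ hk]; exact this
  · rw [hD, hsP, ret, smul_smul, mul_inv_cancel₀ hκ0, one_smul]
    exact hx1

/-- homogenisation along the retraction -/
lemma exists_h1 (H A B : Pol) : ∃ h1 : Pol, ∃ M : ℕ, ∀ x, eval x B ≠ 0 →
    eval x h1 = eval x B ^ M * eval ((eval x A / eval x B) • x) H := by
  refine ⟨∑ d ∈ Finset.range (H.totalDegree + 1), homogeneousComponent d H * A ^ d * B ^ (H.totalDegree - d),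
    H.totalDegree, fun x hx => ?_⟩
  have e0 : ∀ y, eval y H = ∑ d ∈ Finset.range (H.totalDegree + 1), eval y (homogeneousComponent d H) := by
    intro y
    rw [← map_sum, sum_homogeneousComponent]
  rw [map_sum, e0, Finset.mul_sum]
  refine Finset.sum_congr rfl fun d hd' => ?_
  rw [eval_smul_hom (homogeneousComponent_isHomogeneous d H), map_mul, map_mul, map_pow, map_pow, div_pow]
  have : eval x B ^ H.totalDegree = eval x B ^ (H.totalDegree - d) * eval x B ^ d := by
    rw [← pow_add]; congr 1; simp at hd'; omega
  rw [this]
  field_simp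

end Oka
end

open MvPolynomial
noncomputable section
namespace Oka
open unitInterval Set Topology Filter

abbrev PP := Polynomial (Polynomial ℂ)
/-- value of a two-variable polynomial -/
def ev2 (Q : PP) (c w : ℂ) : ℂ := (Q.map (Polynomial.evalRingHom c)).eval w

lemma ev2_mul (F G : PP) (c w : ℂ) : ev2 (F * G) c w = ev2 F c w * ev2 G c w := by simp [ev2]
lemma ev2_add (F G : PP) (c w : ℂ) : ev2 (F + G) c w = ev2 F c w + ev2 G c w := by simp [ev2]
lemma ev2_pow (F : PP) (k : ℕ) (c w : ℂ) : ev2 (F ^ k) c w = ev2 F c w ^ k := by simp [ev2]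
lemma ev2_C (e : Polynomial ℂ) (c w : ℂ) : ev2 (Polynomial.C e) c w = e.eval c := by simp [ev2]

lemma ev2_cont (Q : PP) : Continuous fun x : ℂ × ℂ => ev2 Q x.1 x.2 := by
  have : (fun x : ℂ × ℂ => ev2 Q x.1 x.2) = fun x => ∑ j ∈ Finset.range (Q.natDegree + 1), (Q.coeff j).eval x.1 * x.2 ^ j := by
    funext x
    rw [ev2, Polynomial.eval_eq_sum_range' (n := Q.natDegree + 1)]
    · simp
    · exact Nat.lt_succ_of_le Polynomial.natDegree_map_le
  rw [this]
  exact continuous_finsetSum _ fun j _ => ((Polynomial.continuous _).comp continuous_fst).mul (continuous_snd.pow j)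

/-- separable replacement -/
lemma sep_part (Q : PP) (hQ : Q ≠ 0) : ∃ F : PP, ∃ E : Polynomial ℂ, E ≠ 0 ∧ ∀ c, E.eval c ≠ 0 →
    (∀ w, ev2 Q c w = 0 ↔ ev2 F c w = 0) ∧ F.leadingCoeff.eval c ≠ 0 ∧
    ∀ w, ev2 F c w = 0 → ev2 (Polynomial.derivative F) c w ≠ 0 := by
  classical
  let _ : NormalizedGCDMonoid (Polynomial ℂ) := Classical.choice inferInstance
  let _ : NormalizedGCDMonoid PP := Classical.choice inferInstance
  set P := Q.primPart with hP
  have hPp : P.IsPrimitive := Polynomial.isPrimitive_primPart Q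
  have hP0 : P ≠ 0 := hPp.ne_zero
  set F : PP := UniqueFactorizationMonoid.radical P with hF
  have hFP : F ∣ P := UniqueFactorizationMonoid.radical_dvd_self
  obtain ⟨N, hN⟩ := UniqueFactorizationMonoid.exists_dvd_radical_self_pow hP0
  have hsq : Squarefree F := UniqueFactorizationMonoid.squarefree_radical
  have hFp : F.IsPrimitive := Polynomial.isPrimitive_of_dvd hPp hFP
  have hF0 : F ≠ 0 := hFp.ne_zero
  have hrel : IsRelPrime F (Polynomial.derivative F) := by
    intro d h1 h2
    by_contra hd
    have hd0 : d ≠ 0 := by rintro rfl; exact hF0 (zero_dvd_iff.1 h1)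
    obtain ⟨k, hk, hkd⟩ := WfDvdMonoid.exists_irreducible_factor hd hd0
    obtain ⟨a, ha⟩ := hkd.trans h1
    have h3 : k ∣ Polynomial.derivative F := hkd.trans h2
    rw [ha, Polynomial.derivative_mul] at h3
    have h4 : k ∣ Polynomial.derivative k * a := (dvd_add_left (dvd_mul_right k _)).1 h3
    have hkp : Prime k := hk.prime
    rcases hkp.dvd_or_dvd h4 with h5 | h5
    · have h6 : Polynomial.derivative k = 0 := by
        by_contra h7
        exact h7 (Polynomial.eq_zero_of_dvd_of_degree_lt h5 (Polynomial.degree_derivative_lt hk.ne_zero))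
      have h8 := Polynomial.derivative_eq_zero.1 h6
      rw [Polynomial.natDegree_eq_zero] at h8
      obtain ⟨e, he⟩ := h8
      have h9 := hFp e (by rw [he]; exact hkd.trans h1)
      exact hk.not_isUnit (by rw [← he]; exact h9.map Polynomial.C)
    · obtain ⟨b, hb⟩ := h5
      have := hsq k ⟨b, by rw [ha, hb]; ring⟩
      exact hk.not_isUnit this
  obtain ⟨A, B, e, he, hAB⟩ := bez hF0 hrel
  have hc0 : Q.content ≠ 0 := by rwa [Ne, Polynomial.content_eq_zero_iff]
  have hQe := Polynomial.eq_C_content_mul_primPart Q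
  refine ⟨F, Q.content * F.leadingCoeff * e, ?_, ?_⟩
  · exact mul_ne_zero (mul_ne_zero hc0 (Polynomial.leadingCoeff_ne_zero.2 hF0)) he
  · intro c hc
    rw [Polynomial.eval_mul, Polynomial.eval_mul] at hc
    have h1 := left_ne_zero_of_mul (left_ne_zero_of_mul hc)
    have h2 := right_ne_zero_of_mul (left_ne_zero_of_mul hc)
    have h3 := right_ne_zero_of_mul hc
    refine ⟨fun w => ?_, h2, fun w hw hw' => ?_⟩
    · rw [hQe, ev2_mul, ev2_C, mul_eq_zero, or_iff_right h1]
      constructor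
      · intro h
        obtain ⟨a, ha⟩ := hN
        have : ev2 F c w ^ N = 0 := by rw [← ev2_pow, ha, ev2_mul]; rw [hP, h, zero_mul]
        exact eq_zero_of_pow_eq_zero this
      · intro h
        obtain ⟨a, ha⟩ := hFP
        rw [← hP, ha, ev2_mul, h, zero_mul]
    · apply h3
      rw [← ev2_C e c w, ← hAB, ev2_add, ev2_mul, ev2_mul, hw, hw']; ring

lemma root_near (F : PP) (c1 w1 : ℂ) (hl : F.leadingCoeff.eval c1 ≠ 0) (hw : ev2 F c1 w1 = 0)
    (ε : ℝ) (hε : 0 < ε) : ∀ᶠ c in 𝓝 c1, ∃ w, ‖w - w1‖ < ε ∧ ev2 F c w = 0 := by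
  have e1 : ∀ᶠ c in 𝓝 c1, F.leadingCoeff.eval c ≠ 0 := (Polynomial.continuous _).continuousAt.eventually_ne hl
  have e2 : ∀ᶠ c in 𝓝 c1, ‖ev2 F c w1‖ < ‖F.leadingCoeff.eval c‖ * ε ^ F.natDegree := by
    have k1 : ContinuousAt (fun c => ‖ev2 F c w1‖) c1 :=
      (((ev2_cont F).comp (continuous_id.prodMk continuous_const)).norm).continuousAt
    have k2 : ContinuousAt (fun c => ‖F.leadingCoeff.eval c‖ * ε ^ F.natDegree) c1 :=
      ((Polynomial.continuous _).norm.mul continuous_const).continuousAt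
    refine k1.eventually_lt k2 ?_
    simp only [hw, norm_zero]
    exact mul_pos (norm_pos_iff.2 hl) (pow_pos hε _)
  filter_upwards [e1, e2] with c h1 h2
  by_contra hcon
  push Not at hcon
  set P := F.map (Polynomial.evalRingHom c) with hP
  have hd : P.natDegree = F.natDegree := Polynomial.natDegree_map_of_leadingCoeff_ne_zero _ h1
  have hlc : P.leadingCoeff = F.leadingCoeff.eval c := Polynomial.leadingCoeff_map_of_leadingCoeff_ne_zero _ h1
  have hP0 : P ≠ 0 := by
    intro h0; rw [h0] at hlc; exact h1 (by rw [← hlc]; simp)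
  have hsp : P.Splits := IsAlgClosed.splits P
  have h3 := hsp.eval_eq_prod_roots w1
  have h4 : ‖ev2 F c w1‖ = ‖F.leadingCoeff.eval c‖ * (P.roots.map fun a => ‖w1 - a‖).prod := by
    rw [ev2, ← hP, h3, norm_mul, hlc]
    congr 1
    have := Multiset.prod_hom (P.roots.map fun a => w1 - a) (normHom : ℂ →*₀ ℝ)
    rw [Multiset.map_map] at this
    exact this.symm
  have h5 : ε ^ F.natDegree ≤ (P.roots.map fun a => ‖w1 - a‖).prod := by
    have : ∀ s : Multiset ℂ, (∀ a ∈ s, ε ≤ ‖w1 - a‖) → ε ^ s.card ≤ (s.map fun a => ‖w1 - a‖).prod := by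
      intro s
      induction s using Multiset.induction with
      | empty => simp
      | cons a s ih =>
        intro h
        rw [Multiset.card_cons, Multiset.map_cons, Multiset.prod_cons, pow_succ']
        exact mul_le_mul (h a (Multiset.mem_cons_self a s)) (ih fun b hb => h b (Multiset.mem_cons_of_mem hb))
          (by positivity) (norm_nonneg _)
    rw [← hd, ← IsAlgClosed.card_roots_eq_natDegree]
    apply this
    intro a ha
    by_contra hlt
    refine hcon a ?_ ?_
    · rw [norm_sub_rev]; exact not_le.1 hlt
    · exact (Polynomial.mem_roots hP0).1 ha
  rw [h4] at h2
  exact absurd h2 (not_lt.2 (mul_le_mul_of_nonneg_left h5 (norm_nonneg _)))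

lemma roots_cont (F : PP) (c0 : ℂ) (hl : F.leadingCoeff.eval c0 ≠ 0)
    (hs : ∀ w, ev2 F c0 w = 0 → ev2 (Polynomial.derivative F) c0 w ≠ 0) :
    ∃ r0 > 0, ∃ R : Finset ℂ, ∃ rr : ℂ → ℂ → ℂ, (∀ w ∈ R, ContinuousOn (rr w) (Metric.ball c0 r0)) ∧
      (∀ w ∈ R, rr w c0 = w) ∧
      ∀ c ∈ Metric.ball c0 r0, ∀ z, ev2 F c z = 0 ↔ ∃ w ∈ R, rr w c = z := by
  classical
  have hne : ∀ c, F.leadingCoeff.eval c ≠ 0 → F.map (Polynomial.evalRingHom c) ≠ 0 := by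
    intro c h1 h0
    have hlc : (F.map (Polynomial.evalRingHom c)).leadingCoeff = F.leadingCoeff.eval c :=
      Polynomial.leadingCoeff_map_of_leadingCoeff_ne_zero _ h1
    rw [h0] at hlc; exact h1 (by rw [← hlc]; simp)
  have hdeg : ∀ c, F.leadingCoeff.eval c ≠ 0 → (F.map (Polynomial.evalRingHom c)).natDegree = F.natDegree :=
    fun c h1 => Polynomial.natDegree_map_of_leadingCoeff_ne_zero _ h1
  set R : Finset ℂ := (F.map (Polynomial.evalRingHom c0)).roots.toFinset with hR
  have memR : ∀ w, w ∈ R ↔ ev2 F c0 w = 0 := by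
    intro w
    rw [hR, Multiset.mem_toFinset, Polynomial.mem_roots (hne c0 hl)]; rfl
  have hcard : R.card = F.natDegree := by
    rw [hR, Multiset.toFinset_card_of_nodup, IsAlgClosed.card_roots_eq_natDegree, hdeg c0 hl]
    rw [Multiset.nodup_iff_count_le_one]
    intro a
    rw [Polynomial.count_roots]
    by_contra hlt
    have h2 : 1 < (F.map (Polynomial.evalRingHom c0)).rootMultiplicity a := not_le.1 hlt
    rw [Polynomial.one_lt_rootMultiplicity_iff_isRoot (hne c0 hl)] at h2
    apply hs a h2.1
    have := h2.2
    rw [ev2, ← Polynomial.derivative_map]; exact this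
  obtain ⟨η, hη, hsep⟩ : ∃ η > 0, ∀ w ∈ R, ∀ w' ∈ R, ‖w - w'‖ < η → w = w' := by
    have : ∀ x ∈ R.offDiag, 0 < ‖x.1 - x.2‖ := by
      intro x hx
      rw [Finset.mem_offDiag] at hx
      exact norm_pos_iff.2 (sub_ne_zero.2 hx.2.2)
    rcases R.offDiag.eq_empty_or_nonempty with h0 | h0
    · refine ⟨1, one_pos, fun w hw w' hw' _ => ?_⟩
      by_contra hc
      have : (w, w') ∈ R.offDiag := Finset.mem_offDiag.2 ⟨hw, hw', hc⟩
      rw [h0] at this; simp at this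
    · obtain ⟨x, hx, hmin⟩ := Finset.exists_min_image R.offDiag (fun x => ‖x.1 - x.2‖) h0
      refine ⟨_, this x hx, fun w hw w' hw' hlt => ?_⟩
      by_contra hc
      exact absurd hlt (not_lt.2 (hmin (w, w') (Finset.mem_offDiag.2 ⟨hw, hw', hc⟩)))
  have ev : ∀ᶠ c in 𝓝 c0, F.leadingCoeff.eval c ≠ 0 ∧ ∀ w ∈ R, ∃ z, ‖z - w‖ < η / 3 ∧ ev2 F c z = 0 := by
    refine ((Polynomial.continuous _).continuousAt.eventually_ne hl).and ?_
    rw [Filter.eventually_all_finset]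
    intro w hw
    exact root_near F c0 w hl ((memR w).1 hw) _ (by positivity)
  obtain ⟨r0, hr0, hball⟩ := Metric.eventually_nhds_iff_ball.1 ev
  let rr : ℂ → ℂ → ℂ := fun w c => if h : ∃ z, ‖z - w‖ < η / 3 ∧ ev2 F c z = 0 then h.choose else 0
  have hrr : ∀ w ∈ R, ∀ c ∈ Metric.ball c0 r0, ‖rr w c - w‖ < η / 3 ∧ ev2 F c (rr w c) = 0 := by
    intro w hw c hc
    have h := (hball c hc).2 w hw
    simp only [rr, dif_pos h]
    exact h.choose_spec
  have hinj : ∀ c ∈ Metric.ball c0 r0, ∀ w ∈ R, ∀ w' ∈ R, rr w c = rr w' c → w = w' := by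
    intro c hc w hw w' hw' he
    apply hsep w hw w' hw'
    have h1 := (hrr w hw c hc).1
    have h2 := (hrr w' hw' c hc).1
    rw [← he] at h2
    have : w - w' = (rr w c - w') - (rr w c - w) := by ring
    rw [this]
    have := norm_sub_le (rr w c - w') (rr w c - w)
    linarith
  have hall : ∀ c ∈ Metric.ball c0 r0, ∀ z, ev2 F c z = 0 ↔ ∃ w ∈ R, rr w c = z := by
    intro c hc z
    constructor
    · intro hz
      have hl' := (hball c hc).1
      have hsub : R.image (fun w => rr w c) ⊆ (F.map (Polynomial.evalRingHom c)).roots.toFinset := by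
        intro y hy
        obtain ⟨w, hw, rfl⟩ := Finset.mem_image.1 hy
        rw [Multiset.mem_toFinset, Polynomial.mem_roots (hne c hl')]
        exact (hrr w hw c hc).2
      have heq := Finset.eq_of_subset_of_card_le hsub (by
        rw [Finset.card_image_of_injOn (fun w hw w' hw' he => hinj c hc w hw w' hw' he), hcard]
        refine (Multiset.toFinset_card_le _).trans ?_
        rw [IsAlgClosed.card_roots_eq_natDegree, hdeg c hl'])
      have : z ∈ R.image (fun w => rr w c) := by
        rw [heq, Multiset.mem_toFinset, Polynomial.mem_roots (hne c hl')]
        exact hz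
      obtain ⟨w, hw, he⟩ := Finset.mem_image.1 this
      exact ⟨w, hw, he⟩
    · rintro ⟨w, hw, rfl⟩
      exact (hrr w hw c hc).2
  have hc0 : c0 ∈ Metric.ball c0 r0 := Metric.mem_ball_self hr0
  refine ⟨r0, hr0, R, rr, ?_, ?_, hall⟩
  · intro w hw c1 hc1
    rw [Metric.continuousWithinAt_iff']
    intro ε hε
    have h1 := root_near F c1 (rr w c1) (hball c1 hc1).1 (hrr w hw c1 hc1).2 (min ε (η / 3)) (by positivity)
    filter_upwards [nhdsWithin_le_nhds h1, self_mem_nhdsWithin] with c hc hcb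
    obtain ⟨z, hz1, hz2⟩ := hc
    obtain ⟨w', hw', rfl⟩ := (hall c hcb z).1 hz2
    have : w' = w := by
      apply hsep w' hw' w hw
      have k1 := (hrr w' hw' c hcb).1
      have k2 := (hrr w hw c1 hc1).1
      have k3 := hz1.trans_le (min_le_right _ _)
      have e : w' - w = (rr w c1 - w) + (rr w' c - rr w c1) - (rr w' c - w') := by ring
      rw [e]
      have q1 := norm_sub_le ((rr w c1 - w) + (rr w' c - rr w c1)) (rr w' c - w')
      have q2 := norm_add_le (rr w c1 - w) (rr w' c - rr w c1)
      linarith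
    rw [this] at hz1
    rw [dist_eq_norm]
    exact hz1.trans_le (min_le_left _ _)
  · intro w hw
    have h1 := hrr w hw c0 hc0
    apply hsep _ ((memR _).2 h1.2) w hw
    linarith [h1.1]

end Oka
end

open MvPolynomial
noncomputable section
namespace Oka
open unitInterval Set Topology Filter

lemma motion (Q : PP) (hQ : Q ≠ 0) : ∃ E : Polynomial ℂ, E ≠ 0 ∧ ∀ c0, E.eval c0 ≠ 0 →
    ∃ r0 > 0, ∃ H H' : ℂ → ℂ → ℂ,
      ContinuousOn (fun x : ℂ × ℂ => H x.1 x.2) (Metric.ball c0 r0 ×ˢ univ) ∧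
      ContinuousOn (fun x : ℂ × ℂ => H' x.1 x.2) (Metric.ball c0 r0 ×ˢ univ) ∧
      (∀ c ∈ Metric.ball c0 r0, ∀ w, H c (H' c w) = w) ∧
      (∀ c ∈ Metric.ball c0 r0, ∀ w, H' c (H c w) = w) ∧
      (∀ w, H c0 w = w) ∧
      ∀ c ∈ Metric.ball c0 r0, ∀ w, ev2 Q c (H c w) = 0 ↔ ev2 Q c0 w = 0 := by
  classical
  obtain ⟨F, E, hE, hF⟩ := sep_part Q hQ
  refine ⟨E, hE, fun c0 hc0 => ?_⟩
  obtain ⟨hF1, hF2, hF3⟩ := hF c0 hc0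
  obtain ⟨r1, hr1, R, rr, hcont, hrr0, hall⟩ := roots_cont F c0 hF2 hF3
  obtain ⟨η, hη, hsep⟩ : ∃ η > 0, ∀ w ∈ R, ∀ w' ∈ R, ‖w - w'‖ < η → w = w' := by
    have : ∀ x ∈ R.offDiag, 0 < ‖x.1 - x.2‖ := by
      intro x hx
      rw [Finset.mem_offDiag] at hx
      exact norm_pos_iff.2 (sub_ne_zero.2 hx.2.2)
    rcases R.offDiag.eq_empty_or_nonempty with h0 | h0
    · refine ⟨1, one_pos, fun w hw w' hw' _ => ?_⟩
      by_contra hc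
      have : (w, w') ∈ R.offDiag := Finset.mem_offDiag.2 ⟨hw, hw', hc⟩
      rw [h0] at this; simp at this
    · obtain ⟨x, hx, hmin⟩ := Finset.exists_min_image R.offDiag (fun x => ‖x.1 - x.2‖) h0
      refine ⟨_, this x hx, fun w hw w' hw' hlt => ?_⟩
      by_contra hc
      exact absurd hlt (not_lt.2 (hmin (w, w') (Finset.mem_offDiag.2 ⟨hw, hw', hc⟩)))
  let χ : ℂ → ℂ → ℝ := fun v w => max 0 (1 - ‖w - v‖ / η)
  have hχ1 : ∀ v, χ v v = 1 := by intro v; simp [χ]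
  have hχ0 : ∀ v ∈ R, ∀ w ∈ R, v ≠ w → χ v w = 0 := by
    intro v hv w hw hne
    have : η ≤ ‖w - v‖ := by
      by_contra hlt
      exact hne (hsep w hw v hv (not_le.1 hlt)).symm
    simp only [χ]
    apply max_eq_left
    rw [sub_nonpos, le_div_iff₀ hη]; linarith
  have hχL : ∀ v w w', |χ v w - χ v w'| ≤ ‖w - w'‖ / η := by
    intro v w w'
    simp only [χ]
    rw [max_comm 0, max_comm 0]
    refine (abs_max_sub_max_le_abs (1 - ‖w - v‖ / η) (1 - ‖w' - v‖ / η) 0).trans ?_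
    have e : (1 - ‖w - v‖ / η) - (1 - ‖w' - v‖ / η) = (‖w' - v‖ - ‖w - v‖) / η := by ring
    rw [e, abs_div, abs_of_pos hη]
    gcongr
    refine (abs_norm_sub_norm_le _ _).trans ?_
    rw [norm_sub_rev w w']
    apply le_of_eq; congr 1; ring
  have hχc : ∀ v, Continuous (χ v) := by
    intro v
    exact continuous_const.max (continuous_const.sub ((continuous_id.sub continuous_const).norm.div_const _))
  let ps : ℂ → ℂ → ℂ := fun c w => ∑ v ∈ R, (χ v w : ℂ) * (rr v c - v)
  have hsm : ∃ r0 > 0, r0 ≤ r1 ∧ (∀ c ∈ Metric.ball c0 r0, E.eval c ≠ 0) ∧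
      ∀ c ∈ Metric.ball c0 r0, ∑ v ∈ R, ‖rr v c - v‖ < η / 2 := by
    have h1 : ContinuousAt (fun c => ∑ v ∈ R, ‖rr v c - v‖) c0 := by
      refine tendsto_finsetSum _ fun v hv => ?_
      exact (((hcont v hv).continuousAt (Metric.ball_mem_nhds c0 hr1)).sub continuousAt_const).norm
    have h2 : ∀ᶠ c in 𝓝 c0, ∑ v ∈ R, ‖rr v c - v‖ < η / 2 := by
      refine h1.eventually_lt_const ?_
      beta_reduce
      rw [Finset.sum_eq_zero]
      · linarith
      · intro v hv; rw [hrr0 v hv]; simp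
    have h3 : ∀ᶠ c in 𝓝 c0, E.eval c ≠ 0 := (Polynomial.continuous _).continuousAt.eventually_ne hc0
    obtain ⟨r2, hr2, hb⟩ := Metric.eventually_nhds_iff_ball.1 (h2.and h3)
    refine ⟨min r1 r2, by positivity, min_le_left _ _, ?_, ?_⟩
    · exact fun c hc => (hb c (Metric.ball_subset_ball (min_le_right _ _) hc)).2
    · exact fun c hc => (hb c (Metric.ball_subset_ball (min_le_right _ _) hc)).1
  obtain ⟨r0, hr0, hr01, hEb, hsum⟩ := hsm
  have hpL : ∀ c ∈ Metric.ball c0 r0, ∀ w w', ‖ps c w - ps c w'‖ ≤ (1 / 2) * ‖w - w'‖ := by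
    intro c hc w w'
    have e : ps c w - ps c w' = ∑ v ∈ R, (((χ v w - χ v w' : ℝ)) : ℂ) * (rr v c - v) := by
      simp only [ps]
      rw [← Finset.sum_sub_distrib]
      refine Finset.sum_congr rfl fun v _ => ?_
      push_cast; ring
    rw [e]
    refine (norm_sum_le _ _).trans ?_
    calc ∑ v ∈ R, ‖(((χ v w - χ v w' : ℝ)) : ℂ) * (rr v c - v)‖
        ≤ ∑ v ∈ R, ‖w - w'‖ / η * ‖rr v c - v‖ := by
          refine Finset.sum_le_sum fun v _ => ?_
          rw [norm_mul, Complex.norm_real, Real.norm_eq_abs]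
          exact mul_le_mul_of_nonneg_right (hχL v w w') (norm_nonneg _)
      _ = ‖w - w'‖ / η * ∑ v ∈ R, ‖rr v c - v‖ := by rw [Finset.mul_sum]
      _ ≤ ‖w - w'‖ / η * (η / 2) := by
          apply mul_le_mul_of_nonneg_left (hsum c hc).le; positivity
      _ = (1 / 2) * ‖w - w'‖ := by field_simp
  let H : ℂ → ℂ → ℂ := fun c w => w + ps c w
  have hbi : ∀ c ∈ Metric.ball c0 r0, ∀ w w', ‖w - w'‖ ≤ 2 * ‖H c w - H c w'‖ := by
    intro c hc w w'
    have h1 := hpL c hc w w'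
    have e : w - w' = (H c w - H c w') - (ps c w - ps c w') := by simp only [H]; ring
    have h2 := norm_sub_le (H c w - H c w') (ps c w - ps c w')
    rw [← e] at h2
    linarith
  have hsurj : ∀ c ∈ Metric.ball c0 r0, ∀ u, ∃ w, H c w = u := by
    intro c hc u
    have hL : LipschitzWith (1 / 2) fun w => u - ps c w := by
      refine LipschitzWith.of_dist_le_mul fun w w' => ?_
      rw [dist_eq_norm, dist_eq_norm]
      have : u - ps c w - (u - ps c w') = -(ps c w - ps c w') := by ring
      rw [this, norm_neg]
      simpa using hpL c hc w w'
    have hC : ContractingWith (1 / 2) fun w => u - ps c w := ⟨by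
      rw [div_lt_one] <;> norm_num, hL⟩
    refine ⟨hC.fixedPoint _, ?_⟩
    have := hC.fixedPoint_isFixedPt
    have h2 : u - ps c (hC.fixedPoint _) = hC.fixedPoint _ := this
    simp only [H]
    linear_combination -h2
  let H' : ℂ → ℂ → ℂ := fun c u => if h : ∃ w, H c w = u then h.choose else 0
  have hHH' : ∀ c ∈ Metric.ball c0 r0, ∀ u, H c (H' c u) = u := by
    intro c hc u
    simp only [H', dif_pos (hsurj c hc u)]
    exact (hsurj c hc u).choose_spec
  have hinj : ∀ c ∈ Metric.ball c0 r0, ∀ w w', H c w = H c w' → w = w' := by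
    intro c hc w w' h
    have := hbi c hc w w'
    rw [h, sub_self, norm_zero, mul_zero] at this
    exact sub_eq_zero.1 (norm_le_zero_iff.1 this)
  have hH'H : ∀ c ∈ Metric.ball c0 r0, ∀ u, H' c (H c u) = u :=
    fun c hc u => hinj c hc _ _ (hHH' c hc _)
  have hHc : ContinuousOn (fun x : ℂ × ℂ => H x.1 x.2) (Metric.ball c0 r0 ×ˢ univ) := by
    refine continuousOn_snd.add ?_
    refine continuousOn_finsetSum _ fun v hv => ?_
    refine ContinuousOn.mul ?_ ?_
    · exact (Complex.continuous_ofReal.comp ((hχc v).comp continuous_snd)).continuousOn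
    · refine ContinuousOn.sub ?_ continuousOn_const
      exact (hcont v hv).comp continuousOn_fst fun x hx => Metric.ball_subset_ball hr01 hx.1
  refine ⟨r0, hr0, H, H', hHc, ?_, hHH', hH'H, ?_, ?_⟩
  · rintro ⟨c1, u1⟩ ⟨hc1, -⟩
    have hc1' : c1 ∈ Metric.ball c0 r0 := hc1
    rw [Metric.continuousWithinAt_iff']
    intro ε hε
    set w1 := H' c1 u1 with hw1
    have h1 : ContinuousWithinAt (fun x : ℂ × ℂ => ‖x.2 - H x.1 w1‖) (Metric.ball c0 r0 ×ˢ univ) (c1, u1) := by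
      refine (ContinuousWithinAt.sub continuous_snd.continuousWithinAt ?_).norm
      have h2 : ContinuousWithinAt (fun x : ℂ × ℂ => H x.1 x.2) (Metric.ball c0 r0 ×ˢ univ) (c1, w1) :=
        hHc (c1, w1) ⟨hc1', mem_univ _⟩
      have h3 : ContinuousWithinAt (fun x : ℂ × ℂ => (x.1, w1)) (Metric.ball c0 r0 ×ˢ univ) (c1, u1) :=
        (continuous_fst.prodMk continuous_const).continuousWithinAt
      have h4 : MapsTo (fun x : ℂ × ℂ => (x.1, w1)) (Metric.ball c0 r0 ×ˢ univ) (Metric.ball c0 r0 ×ˢ univ) :=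
        fun x hx => ⟨hx.1, mem_univ _⟩
      exact ContinuousWithinAt.comp (g := fun x : ℂ × ℂ => H x.1 x.2) (f := fun x : ℂ × ℂ => (x.1, w1)) h2 h3 h4
    have h4 : ∀ᶠ x in 𝓝[Metric.ball c0 r0 ×ˢ univ] (c1, u1), ‖x.2 - H x.1 w1‖ < ε / 2 := by
      refine h1.eventually_lt_const ?_
      simp only [hw1]
      rw [hHH' c1 hc1', sub_self, norm_zero]; linarith
    filter_upwards [h4, self_mem_nhdsWithin] with x hx hxm
    have h5 := hbi x.1 hxm.1 (H' x.1 x.2) w1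
    rw [hHH' x.1 hxm.1] at h5
    rw [dist_eq_norm]
    linarith
  · intro w
    simp only [H, ps]
    rw [Finset.sum_eq_zero, add_zero]
    intro v hv; rw [hrr0 v hv]; simp
  · intro c hc w
    have hv : ∀ v ∈ R, H c v = rr v c := by
      intro v hv
      simp only [H, ps]
      rw [Finset.sum_eq_single v]
      · rw [hχ1]; simp
      · intro b hb hne; rw [hχ0 b hb v hv hne]; simp
      · exact fun h => absurd hv h
    rw [(hF c (hEb c hc)).1, hF1, hall c (Metric.ball_subset_ball hr01 hc), hall c0 (Metric.mem_ball_self hr1)]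
    constructor
    · rintro ⟨v, hvR, h⟩
      rw [← hv v hvR] at h
      exact ⟨v, hvR, by rw [hrr0 v hvR]; exact hinj c hc _ _ h⟩
    · rintro ⟨v, hvR, h⟩
      rw [hrr0 v hvR] at h
      exact ⟨v, hvR, by rw [← h, hv v hvR]⟩

end Oka
end

open MvPolynomial
noncomputable section
namespace Oka
open unitInterval Set Topology Filter

variable {fp fq : Pol} {i : Fin 3} {D : Pol}

def Edel (fp fq : Pol) (i : Fin 3) (D : Pol) : Set E3 := {x | eval (PsiF fp fq i x) D ≠ 0}

lemma isOpen_Edel : IsOpen (Edel fp fq i D) :=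
  isOpen_ne_fun ((cont_eval D).comp (cont_PsiF fp fq i)) continuous_const

def psiR (fp fq : Pol) (i : Fin 3) (D : Pol) : Edel fp fq i D → XX D :=
  fun x => ⟨PsiF fp fq i x, x.2⟩

lemma cont_psiR : Continuous (psiR fp fq i D) :=
  ((cont_PsiF fp fq i).comp continuous_subtype_val).subtype_mk _

lemma psiR_cov (h1 : ∀ x, eval (PsiF fp fq i x) D ≠ 0 → eval x (Jac fp fq i) ≠ 0)
    (h2 : ∀ u0, eval u0 D ≠ 0 → ∃ O ∈ 𝓝 u0, ∃ M : ℝ, ∀ x, PsiF fp fq i x ∈ O → ‖x‖ ≤ M) :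
    IsCoveringMap (psiR fp fq i D) := by
  have hlh : IsLocalHomeomorph (psiR fp fq i D) := by
    refine IsLocalHomeomorph.of_comp (g := (Subtype.val : XX D → E3)) ?_ ?_ cont_psiR
    rotate_left
    · exact (isOpen_XX D).isOpenEmbedding_subtypeVal.isLocalHomeomorph
    · have : IsLocalHomeomorphOn (PsiF fp fq i) (Edel fp fq i D) := by
        refine IsLocalHomeomorphOn.mk _ _ fun x hx => ?_
        obtain ⟨e, he, hE⟩ := psi_local (h1 x hx)
        exact ⟨e, he, fun y _ => by rw [hE]⟩
      have h3 := this.comp (isOpen_Edel (fp := fp) (fq := fq) (i := i) (D := D)).isOpenEmbedding_subtypeVal.isLocalHomeomorph.isLocalHomeomorphOn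
        (s := univ) (fun x _ => x.2)
      exact isLocalHomeomorph_iff_isLocalHomeomorphOn_univ.2 h3
  have hprop : IsProperMap (psiR fp fq i D) := by
    rw [isProperMap_iff_ultrafilter]
    refine ⟨cont_psiR, fun 𝒰 u hu => ?_⟩
    obtain ⟨O, hO, M, hM⟩ := h2 u u.2
    have hu' : Tendsto (fun x : Edel fp fq i D => PsiF fp fq i x) 𝒰 (𝓝 (u : E3)) :=
      (continuous_subtype_val.tendsto u).comp hu
    have hmem : Metric.closedBall (0 : E3) M ∈ (𝒰.map (Subtype.val : Edel fp fq i D → E3)) := by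
      have : ∀ᶠ x : Edel fp fq i D in 𝒰, PsiF fp fq i x ∈ O := hu' hO
      refine Ultrafilter.mem_map.2 (Filter.mem_of_superset this fun x hx => ?_)
      rw [Set.mem_preimage, mem_closedBall_zero_iff]
      exact hM _ hx
    obtain ⟨x, -, hx⟩ := (isCompact_closedBall (0 : E3) M).ultrafilter_le_nhds' _ hmem
    have hx' : Tendsto (Subtype.val : Edel fp fq i D → E3) 𝒰 (𝓝 x) := hx
    have hPx : PsiF fp fq i x = u := tendsto_nhds_unique (((cont_PsiF fp fq i).tendsto x).comp hx') hu'
    have hxE : x ∈ Edel fp fq i D := by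
      change eval (PsiF fp fq i x) D ≠ 0
      rw [hPx]; exact u.2
    refine ⟨⟨x, hxE⟩, Subtype.ext hPx, ?_⟩
    rw [nhds_subtype_eq_comap]
    exact tendsto_iff_comap.1 hx'
  have hfin : ∀ u, (psiR fp fq i D ⁻¹' {u}).Finite := by
    intro u
    refine (hprop.isCompact_preimage isCompact_singleton).finite ?_
    refine (hlh.isLocalHomeomorphOn (s := psiR fp fq i D ⁻¹' {u})).isDiscrete_of_image ?_
    apply Set.Subsingleton.isDiscrete
    rintro _ ⟨x, hx, rfl⟩ _ ⟨y, hy, rfl⟩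
    exact (hx : _ = u).trans (hy : _ = u).symm
  rw [isCoveringMap_iff_isCoveringMapOn_univ]
  exact hprop.isClosedMap.isCoveringMapOn_of_isLocalHomeomorphOn (fun u _ => hfin u) hlh.isLocalHomeomorphOn

end Oka
end

open MvPolynomial
noncomputable section
namespace Oka
open unitInterval Set Topology Filter

variable {p q m n : ℕ} {fp fq : Pol} {i : Fin 3} {D : Pol}

/-- the good part of the slice -/
def Sg (m n : ℕ) (fp fq : Pol) (i : Fin 3) (D : Pol) : Set E3 :=
  {x | x ∈ Sig m n fp fq ∧ eval (PsiF fp fq i x) D ≠ 0}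

def dhat (m n : ℕ) (D : Pol) : PP :=
  aeval ![Polynomial.C (Polynomial.X ^ n), Polynomial.C (Polynomial.X ^ m), Polynomial.X] D

def tri (m n : ℕ) (c w : ℂ) : E3 := ![c ^ n, c ^ m, w]

lemma ev2_dhat (c w : ℂ) : ev2 (dhat m n D) c w = eval (tri m n c w) D := by
  have : ((Polynomial.evalRingHom w).comp ((Polynomial.mapRingHom (Polynomial.evalRingHom c)))).comp
      (aeval (R := ℂ) (![Polynomial.C (Polynomial.X ^ n), Polynomial.C (Polynomial.X ^ m), Polynomial.X] :
        Fin 3 → PP)).toRingHom = eval (tri m n c w) := by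
    apply MvPolynomial.ringHom_ext
    · intro r
      simp [Polynomial.algebraMap_apply]
    · intro j; fin_cases j <;> simp [tri]
  exact congrArg (fun f : Pol →+* ℂ => f D) this

lemma Dat.psi_sig (hd : Dat p q m n fp fq) {x : E3} (hx : x ∈ Sig m n fp fq) :
    PsiF fp fq i x = tri m n (cc p q fp fq x) (x i) := by
  funext j
  fin_cases j
  · exact hd.sig_fp hx
  · exact hd.sig_fq hx
  · simp [PsiF, Psi, tri]

lemma Dat.sg_of (hd : Dat p q m n fp fq) {x : E3} (hx : x ∈ Edel fp fq i D) {c w : ℂ} (hc : c ≠ 0)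
    (h : PsiF fp fq i x = tri m n c w) : x ∈ Sg m n fp fq i D ∧ cc p q fp fq x = c ∧ x i = w := by
  have h0 : eval x fp = c ^ n := congrFun h 0
  have h1 : eval x fq = c ^ m := congrFun h 1
  have h2 : x i = w := by
    have := congrFun h 2
    simpa [PsiF, Psi, tri] using this
  obtain ⟨h3, h4⟩ := hd.sig_of hc h0 h1
  exact ⟨⟨h3, hx⟩, h4, h2⟩

lemma cont_tri : Continuous fun x : ℂ × ℂ => tri m n x.1 x.2 := by
  refine continuous_pi fun j => ?_
  fin_cases j
  · exact continuous_fst.pow n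
  · exact continuous_fst.pow m
  · exact continuous_snd

def TrDom (p q m n : ℕ) (fp fq : Pol) (i : Fin 3) (D : Pol) (B : Set ℂ) : Set (ℂ × ℂ × E3) :=
  {a | a.1 ∈ B ∧ a.2.1 ∈ B ∧ a.2.2 ∈ Sg m n fp fq i D ∧ cc p q fp fq a.2.2 = a.1}

def seg (c1 c2 : ℂ) (t : I) : ℂ := (1 - (t : ℝ) : ℂ) * c1 + ((t : ℝ) : ℂ) * c2

lemma seg_mem {B : Set ℂ} (hB : Convex ℝ B) {c1 c2 : ℂ} (h1 : c1 ∈ B) (h2 : c2 ∈ B) (t : I) :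
    seg c1 c2 t ∈ B := by
  have := hB h1 h2 (sub_nonneg.2 t.2.2) t.2.1 (by ring)
  simpa [seg, Complex.real_smul] using this

lemma cont_seg : Continuous fun x : I × ℂ × ℂ => seg x.2.1 x.2.2 x.1 := by
  unfold seg; fun_prop

lemma Dat.transport (hd : Dat p q m n fp fq)
    (h1 : ∀ x, eval (PsiF fp fq i x) D ≠ 0 → eval x (Jac fp fq i) ≠ 0)
    (h2 : ∀ u0, eval u0 D ≠ 0 → ∃ O ∈ 𝓝 u0, ∃ M : ℝ, ∀ x, PsiF fp fq i x ∈ O → ‖x‖ ≤ M)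
    (h3 : ∃ x ∈ Sig m n fp fq, eval (PsiF fp fq i x) D ≠ 0) :
    ∃ E : Polynomial ℂ, E ≠ 0 ∧ ∀ c0, c0 ≠ 0 → E.eval c0 ≠ 0 → ∃ r0 > 0,
      (∀ c ∈ Metric.ball c0 r0, c ≠ 0) ∧ ∃ Tr : ℂ → ℂ → E3 → E3,
      ContinuousOn (fun a : ℂ × ℂ × E3 => Tr a.1 a.2.1 a.2.2)
        (TrDom p q m n fp fq i D (Metric.ball c0 r0)) ∧
      ∀ c1 c2 x, (c1, c2, x) ∈ TrDom p q m n fp fq i D (Metric.ball c0 r0) →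
        Tr c1 c2 x ∈ Sg m n fp fq i D ∧ cc p q fp fq (Tr c1 c2 x) = c2 ∧
        Tr c2 c1 (Tr c1 c2 x) = x ∧ Tr c1 c1 x = x := by
  have hcov := psiR_cov h1 h2
  have hQ : dhat m n D ≠ 0 := by
    obtain ⟨x, hx, hx'⟩ := h3
    intro h
    rw [hd.psi_sig hx, ← ev2_dhat, h] at hx'
    simp [ev2] at hx'
  obtain ⟨E, hE, hmot⟩ := motion _ hQ
  refine ⟨E, hE, fun c0 hc0 hEc => ?_⟩
  obtain ⟨r1, hr1, H, H', hHc, hHc', hHH', hHH2, -, hz⟩ := hmot c0 hEc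
  refine ⟨min r1 ‖c0‖, lt_min hr1 (norm_pos_iff.2 hc0), ?_, ?_⟩
  · rintro c hc rfl
    simp at hc
  set B := Metric.ball c0 (min r1 ‖c0‖) with hBdef
  have hB : Convex ℝ B := convex_ball _ _
  have hB1 : B ⊆ Metric.ball c0 r1 := Metric.ball_subset_ball (min_le_left _ _)
  have hB0 : ∀ c ∈ B, c ≠ 0 := by
    rintro c hc rfl
    simp [hBdef] at hc
  set A := TrDom p q m n fp fq i D B with hA
  have hzz : ∀ c1 ∈ B, ∀ c2 ∈ B, ∀ w, eval (tri m n c1 w) D ≠ 0 →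
      eval (tri m n c2 (H c2 (H' c1 w))) D ≠ 0 := by
    intro c1 hc1 c2 hc2 w hw
    rw [← ev2_dhat] at hw ⊢
    rw [Ne, hz c2 (hB1 hc2), ← hz c1 (hB1 hc1), hHH' c1 (hB1 hc1)]
    exact hw
  let base : I × A → E3 := fun ta =>
    tri m n (seg ta.2.1.1 ta.2.1.2.1 ta.1) (H (seg ta.2.1.1 ta.2.1.2.1 ta.1) (H' ta.2.1.1 (ta.2.1.2.2 i)))
  have hsegm : ∀ ta : I × A, seg ta.2.1.1 ta.2.1.2.1 ta.1 ∈ B := fun ta =>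
    seg_mem hB ta.2.2.1 ta.2.2.2.1 _
  have hbase : Continuous base := by
    have hs : Continuous fun ta : I × A => seg ta.2.1.1 ta.2.1.2.1 ta.1 :=
      cont_seg.comp (f := fun ta : I × A => (ta.1, ta.2.1.1, ta.2.1.2.1)) (by fun_prop)
    have hh' : Continuous fun ta : I × A => H' ta.2.1.1 (ta.2.1.2.2 i) :=
      hHc'.comp_continuous (f := fun ta : I × A => (ta.2.1.1, ta.2.1.2.2 i)) (by fun_prop)
        (fun ta => ⟨hB1 ta.2.2.1, mem_univ _⟩)
    have hh : Continuous fun ta : I × A => H (seg ta.2.1.1 ta.2.1.2.1 ta.1) (H' ta.2.1.1 (ta.2.1.2.2 i)) :=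
      hHc.comp_continuous (hs.prodMk hh') (fun ta => ⟨hB1 (hsegm ta), mem_univ _⟩)
    exact cont_tri.comp (hs.prodMk hh)
  have hbm : ∀ ta, base ta ∈ XX D := by
    intro ta
    refine hzz _ ta.2.2.1 _ (hsegm ta) _ ?_
    have := ta.2.2.2.2.1.2
    rwa [hd.psi_sig ta.2.2.2.2.1.1, ta.2.2.2.2.2] at this
  let HH : C(I × A, XX D) := ⟨fun ta => ⟨base ta, hbm ta⟩, hbase.subtype_mk _⟩
  let f0 : C(A, Edel fp fq i D) := ⟨fun a => ⟨a.1.2.2, a.2.2.2.1.2⟩, by fun_prop⟩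
  have hH0 : ∀ a, HH (0, a) = psiR fp fq i D (f0 a) := by
    intro a
    apply Subtype.ext
    change tri m n (seg a.1.1 a.1.2.1 0) (H (seg a.1.1 a.1.2.1 0) (H' a.1.1 (a.1.2.2 i))) = PsiF fp fq i a.1.2.2
    have : seg a.1.1 a.1.2.1 0 = a.1.1 := by simp [seg]
    rw [this, hHH' _ (hB1 a.2.1), hd.psi_sig a.2.2.2.1.1, a.2.2.2.2]
  let Γ := hcov.liftHomotopy HH f0 hH0
  have hΓ : ∀ ta, PsiF fp fq i (Γ ta) = base ta := fun ta =>
    congrArg Subtype.val (congrFun (hcov.liftHomotopy_lifts HH f0 hH0) ta)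
  have hΓ0 : ∀ a, (Γ (0, a) : E3) = a.1.2.2 := fun a =>
    congrArg Subtype.val (hcov.liftHomotopy_zero HH f0 hH0 a)
  have hΓS : ∀ ta : I × A, (Γ ta : E3) ∈ Sg m n fp fq i D ∧
      cc p q fp fq (Γ ta) = seg ta.2.1.1 ta.2.1.2.1 ta.1 ∧
      (Γ ta : E3) i = H (seg ta.2.1.1 ta.2.1.2.1 ta.1) (H' ta.2.1.1 (ta.2.1.2.2 i)) := fun ta =>
    hd.sg_of (Γ ta).2 (hB0 _ (hsegm ta)) (hΓ ta)
  have hseg1 : ∀ c1 c2, seg c1 c2 1 = c2 := fun c1 c2 => by simp [seg]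
  classical
  let Tr : ℂ → ℂ → E3 → E3 := fun c1 c2 x =>
    if h : (c1, c2, x) ∈ A then (Γ (1, ⟨_, h⟩) : E3) else 0
  have hTr : ∀ a : A, Tr a.1.1 a.1.2.1 a.1.2.2 = Γ (1, a) := fun a => dif_pos a.2
  have key : ∀ a : A, Tr a.1.1 a.1.2.1 a.1.2.2 ∈ Sg m n fp fq i D ∧
      cc p q fp fq (Tr a.1.1 a.1.2.1 a.1.2.2) = a.1.2.1 ∧
      (Tr a.1.1 a.1.2.1 a.1.2.2) i = H a.1.2.1 (H' a.1.1 (a.1.2.2 i)) := by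
    intro a
    rw [hTr]
    have := hΓS (1, a)
    dsimp only at this
    rwa [hseg1] at this
  refine ⟨Tr, ?_, ?_⟩
  · rw [continuousOn_iff_continuous_domRestrict]
    have : Continuous fun a : A => (Γ (1, a) : E3) := by fun_prop
    refine this.congr fun a => (hTr a).symm
  · intro c1 c2 x hx
    let a : A := ⟨_, hx⟩
    obtain ⟨k1, k2, k3⟩ := key a
    refine ⟨k1, k2, ?_, ?_⟩
    · have hx2 : (c2, c1, Tr c1 c2 x) ∈ A := ⟨hx.2.1, hx.1, k1, k2⟩
      let a2 : A := ⟨_, hx2⟩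
      have e : (fun t : I => Γ (t, a2)) = fun t : I => Γ (unitInterval.symm t, a) := by
        refine hcov.eq_of_comp_eq (by fun_prop) (by fun_prop) ?_ 0 ?_
        · funext t
          apply Subtype.ext
          refine (hΓ (t, a2)).trans (Eq.trans ?_ (hΓ (unitInterval.symm t, a)).symm)
          change tri m n (seg c2 c1 t) (H (seg c2 c1 t) (H' c2 ((Tr c1 c2 x) i))) =
            tri m n (seg c1 c2 (unitInterval.symm t)) (H (seg c1 c2 (unitInterval.symm t)) (H' c1 (x i)))
          have es : seg c2 c1 t = seg c1 c2 (unitInterval.symm t) := by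
            simp [seg]; ring
          rw [es]
          congr 2
          have h6 : (Tr c1 c2 x) i = H c2 (H' c1 (x i)) := k3
          rw [h6]
          exact hHH2 c2 (hB1 hx.2.1) _
        · apply Subtype.ext
          refine (hΓ0 a2).trans ?_
          rw [unitInterval.symm_zero]
          exact hTr a
      have e1 := congrArg Subtype.val (congrFun e 1)
      rw [unitInterval.symm_one] at e1
      exact (hTr a2).trans (e1.trans (hΓ0 a))
    · have hx2 : (c1, c1, x) ∈ A := ⟨hx.1, hx.1, hx.2.2.1, hx.2.2.2⟩
      let a2 : A := ⟨_, hx2⟩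
      have e : Γ (1, a2) = Γ (0, a2) := by
        refine hcov.const_of_comp (g := fun t : I => Γ (t, a2)) (by fun_prop) ?_ 1 0
        intro t t'
        apply Subtype.ext
        refine (hΓ (t, a2)).trans (Eq.trans ?_ (hΓ (t', a2)).symm)
        change tri m n (seg c1 c1 t) (H (seg c1 c1 t) (H' c1 (x i))) =
            tri m n (seg c1 c1 t') (H (seg c1 c1 t') (H' c1 (x i)))
        have es : ∀ t, seg c1 c1 t = c1 := fun t => by simp [seg]; ring
        rw [es, es]
      exact (hTr a2).trans ((congrArg Subtype.val e).trans (hΓ0 a2))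

end Oka
end

open MvPolynomial
noncomputable section
namespace Oka
open unitInterval Set Topology Filter

variable {p q m n : ℕ} {fp fq : Pol} {i : Fin 3} {D : Pol}

lemma Dat.lam_smul' (hd : Dat p q m n fp fq) (x : E3) {a : ℂ}
    (ha : a ≠ 0) : lam m n fp fq (a • x) = a * lam m n fp fq x := by
  unfold lam
  rw [eval_smul_hom hd.hfp, eval_smul_hom hd.hfq, mul_pow, mul_pow, ← pow_mul, ← pow_mul, hd.hmn,
    mul_div_mul_comm, pow_succ, mul_div_assoc, mul_comm (a ^ (q * n)), div_mul_cancel₀ _ (pow_ne_zero _ ha)]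

lemma Dat.ret_smul (hd : Dat p q m n fp fq) (x : E3) {a : ℂ}
    (ha : a ≠ 0) : ret m n fp fq (a • x) = ret m n fp fq x := by
  rw [ret, hd.lam_smul' x ha, smul_smul, mul_inv, mul_comm a⁻¹, mul_assoc, inv_mul_cancel₀ ha, mul_one, ret]

lemma ret_contAt {x : E3} (h1 : eval x fp ≠ 0) (h2 : eval x fq ≠ 0) : ContinuousAt (ret m n fp fq) x := by
  unfold ret
  refine ContinuousAt.smul (ContinuousAt.inv₀ ?_ (lam_ne h1 h2)) continuousAt_id
  unfold lam
  exact ((cont_eval fp).pow m).continuousAt.div ((cont_eval fq).pow n).continuousAt (pow_ne_zero _ h2)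

lemma cc_contAt {x : E3} (h1 : eval x fp ≠ 0) : ContinuousAt (cc p q fp fq) x := by
  unfold cc
  exact ((cont_eval fq).pow p).continuousAt.div ((cont_eval fp).pow q).continuousAt (pow_ne_zero _ h1)

lemma exists_h0 (hd : Dat p q m n fp fq) (i : Fin 3) {D : Pol}
    (h3 : ∃ x ∈ Sig m n fp fq, eval (PsiF fp fq i x) D ≠ 0) :
    ∃ h0 : Pol, h0 ≠ 0 ∧ ∀ x, eval x h0 ≠ 0 ↔ eval x fp ≠ 0 ∧ eval x fq ≠ 0 ∧
      ret m n fp fq x ∈ Sg m n fp fq i D := by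
  obtain ⟨h1, M, hh⟩ := exists_h1 (aeval (Psi fp fq i) D) (fq ^ n) (fp ^ m)
  have key : ∀ x, eval x (fp * fq * h1) ≠ 0 ↔ eval x fp ≠ 0 ∧ eval x fq ≠ 0 ∧
      ret m n fp fq x ∈ Sg m n fp fq i D := by
    intro x
    rw [map_mul, map_mul, mul_ne_zero_iff, mul_ne_zero_iff, and_assoc]
    refine and_congr_right fun k1 => and_congr_right fun k2 => ?_
    have kB : eval x (fp ^ m) ≠ 0 := by rw [map_pow]; exact pow_ne_zero _ k1
    rw [hh x kB, mul_ne_zero_iff, eval_Psi]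
    have : (eval x (fq ^ n) / eval x (fp ^ m)) • x = ret m n fp fq x := by
      rw [ret, lam, inv_div, map_pow, map_pow]
    rw [this]
    constructor
    · rintro ⟨-, h⟩; exact ⟨hd.ret_mem k1 k2, h⟩
    · rintro ⟨-, h⟩; exact ⟨pow_ne_zero _ kB, h⟩
  refine ⟨fp * fq * h1, ?_, key⟩
  obtain ⟨x, hx, hx'⟩ := h3
  intro h0
  refine (key x).2 ⟨hx.1, hx.2.1, ?_⟩ ?_
  · rw [ret_sig hx]; exact ⟨hx, hx'⟩
  · rw [h0, map_zero]

/-- local product structure over a disc in the base -/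
def TubeAt (p q m n : ℕ) (fp fq : Pol) (i : Fin 3) (D : Pol) (c0 : ℂ) (r0 : ℝ) (Tr : ℂ → ℂ → E3 → E3) : Prop :=
  0 < r0 ∧ (∀ c ∈ Metric.ball c0 r0, c ≠ 0) ∧
      ContinuousOn (fun a : ℂ × ℂ × E3 => Tr a.1 a.2.1 a.2.2)
        (TrDom p q m n fp fq i D (Metric.ball c0 r0)) ∧
      ∀ c1 c2 x, (c1, c2, x) ∈ TrDom p q m n fp fq i D (Metric.ball c0 r0) →
        Tr c1 c2 x ∈ Sg m n fp fq i D ∧ cc p q fp fq (Tr c1 c2 x) = c2 ∧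
        Tr c2 c1 (Tr c1 c2 x) = x ∧ Tr c1 c1 x = x

lemma TubeAt.mono {c0 : ℂ} {r0 r1 : ℝ} {Tr} (h : TubeAt p q m n fp fq i D c0 r0 Tr) (h1 : 0 < r1) (hr : r1 ≤ r0) :
    TubeAt p q m n fp fq i D c0 r1 Tr := by
  have hs := Metric.ball_subset_ball (x := c0) hr
  have ht : TrDom p q m n fp fq i D (Metric.ball c0 r1) ⊆ TrDom p q m n fp fq i D (Metric.ball c0 r0) :=
    fun a ha => ⟨hs ha.1, hs ha.2.1, ha.2.2⟩
  exact ⟨h1, fun c hc => h.2.1 c (hs hc), h.2.2.1.mono ht, fun c1 c2 x hx => h.2.2.2 c1 c2 x (ht hx)⟩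

/-- the fibre of the good slice -/
def Fb (p q m n : ℕ) (fp fq : Pol) (i : Fin 3) (D : Pol) (c : ℂ) : Set E3 :=
  {x | x ∈ Sg m n fp fq i D ∧ cc p q fp fq x = c}

def SigC (p q m n : ℕ) (fp fq : Pol) (c : ℂ) : Set E3 :=
  {x | x ∈ Sig m n fp fq ∧ cc p q fp fq x = c}

lemma Dat.sigC_conn (hd : Dat p q m n fp fq) {c : ℂ} (hc : c ≠ 0)
    (h : IsConnected {x : P2 | x ∉ V fp ∩ V fq ∧
        c * eval x.rep (fp ^ q) = 1 * eval x.rep (fq ^ p)}) :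
    IsConnected (SigC p q m n fp fq c) := by
  have hne : ∀ x : P2, x ∉ V fp ∩ V fq ∧ c * eval x.rep (fp ^ q) = 1 * eval x.rep (fq ^ p) →
      eval x.rep fp ≠ 0 ∧ eval x.rep fq ≠ 0 ∧ cc p q fp fq x.rep = c := by
    rintro x ⟨h1, h2⟩
    rw [map_pow, map_pow, one_mul] at h2
    have hq0 : q ≠ 0 := by have := hd.hq; omega
    have hp0 : p ≠ 0 := by have := hd.hp; omega
    have k1 : eval x.rep fp ≠ 0 := by
      intro h0
      rw [h0, zero_pow hq0, mul_zero] at h2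
      exact h1 ⟨h0, (pow_eq_zero_iff hp0).1 h2.symm⟩
    refine ⟨k1, ?_, ?_⟩
    · intro h0
      rw [h0, zero_pow hp0] at h2
      exact mul_ne_zero hc (pow_ne_zero _ k1) h2
    · rw [cc, ← h2, mul_div_assoc, div_self (pow_ne_zero _ k1), mul_one]
  have him : (fun x : P2 => ret m n fp fq x.rep) '' {x : P2 | x ∉ V fp ∩ V fq ∧
        c * eval x.rep (fp ^ q) = 1 * eval x.rep (fq ^ p)} = SigC p q m n fp fq c := by
    ext y
    constructor
    · rintro ⟨x, hx, rfl⟩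
      obtain ⟨h1, h2, h3⟩ := hne x hx
      exact ⟨hd.ret_mem h1 h2, (hd.cc_ret h1 h2).trans h3⟩
    · rintro ⟨hy, hyc⟩
      have hy0 : y ≠ 0 := by
        rintro rfl
        refine hy.1 ?_
        have := eval_smul_hom hd.hfp 0 (0 : E3)
        rw [smul_zero, zero_pow (by have := hd.hp; omega), zero_mul] at this
        exact this
      obtain ⟨a, ha, hr⟩ := rep_mk y hy0
      refine ⟨Projectivization.mk ℂ y hy0, ?_, ?_⟩
      · constructor
        · rintro ⟨h1, -⟩
          change eval _ _ = _ at h1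
          rw [hr, eval_smul_hom hd.hfp] at h1
          exact mul_ne_zero (pow_ne_zero _ ha) hy.1 h1
        · have := hd.cc_smul (x := y) ha
          rw [hyc, ← hr, cc, div_eq_iff] at this
          · rw [map_pow, map_pow, one_mul, this]
          · rw [hr, eval_smul_hom hd.hfp]
            exact pow_ne_zero _ (mul_ne_zero (pow_ne_zero _ ha) hy.1)
      · change ret m n fp fq (Projectivization.mk ℂ y hy0 : P2).rep = y
        rw [hr, hd.ret_smul _ ha, ret_sig hy]
  rw [← him]
  refine h.image _ fun x hx => ContinuousAt.continuousWithinAt ?_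
  obtain ⟨h1, h2, -⟩ := hne x hx
  exact cont_desc (ret m n fp fq) (fun a v ha _ => hd.ret_smul v ha) x (ret_contAt h1 h2)

lemma Dat.fb_conn (hd : Dat p q m n fp fq) {c0 : ℂ} {r0 : ℝ} {Tr} (hT : TubeAt p q m n fp fq i D c0 r0 Tr)
    {h0 : Pol} (hh0 : h0 ≠ 0) (hh : ∀ x, eval x h0 ≠ 0 ↔ eval x fp ≠ 0 ∧ eval x fq ≠ 0 ∧
      ret m n fp fq x ∈ Sg m n fp fq i D)
    (hS : IsConnected (SigC p q m n fp fq c0)) : IsPathConnected (Fb p q m n fp fq i D c0) := by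
  obtain ⟨hr, hB0, hcont, hTr⟩ := hT
  set Y := Fb p q m n fp fq i D c0 with hY
  let e : E3 → E3 := fun x => Tr (cc p q fp fq x) c0 (ret m n fp fq x)
  have hc0 : c0 ∈ Metric.ball c0 r0 := Metric.mem_ball_self hr
  have hmem : ∀ x, eval x h0 ≠ 0 → cc p q fp fq x ∈ Metric.ball c0 r0 →
      (cc p q fp fq x, c0, ret m n fp fq x) ∈ TrDom p q m n fp fq i D (Metric.ball c0 r0) := by
    intro x hx hc
    obtain ⟨k1, k2, k3⟩ := (hh x).1 hx
    exact ⟨hc, hc0, k3, hd.cc_ret k1 k2⟩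
  have heY : ∀ x, eval x h0 ≠ 0 → cc p q fp fq x ∈ Metric.ball c0 r0 → e x ∈ Y := by
    intro x hx hc
    obtain ⟨j1, j2, -, -⟩ := hTr _ _ _ (hmem x hx hc)
    exact ⟨j1, j2⟩
  have heid : ∀ y ∈ Y, eval y h0 ≠ 0 ∧ e y = y := by
    rintro y ⟨hy, hyc⟩
    refine ⟨(hh y).2 ⟨hy.1.1, hy.1.2.1, ?_⟩, ?_⟩
    · rw [ret_sig hy.1]; exact hy
    · change Tr _ _ _ = _
      rw [ret_sig hy.1, hyc]
      exact (hTr c0 c0 y ⟨hc0, hc0, hy, hyc⟩).2.2.2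
  have hloc : ∀ z ∈ SigC p q m n fp fq c0, ∃ O, IsOpen O ∧ z ∈ O ∧ ∀ x ∈ O, ∀ x' ∈ O, eval x h0 ≠ 0 →
      eval x' h0 ≠ 0 → e x ∈ Y ∧ JoinedIn Y (e x) (e x') := by
    rintro z ⟨hz, hzc⟩
    have hn : cc p q fp fq ⁻¹' (Metric.ball c0 r0) ∈ 𝓝 z :=
      (cc_contAt hz.1).preimage_mem_nhds (by rw [hzc]; exact Metric.ball_mem_nhds _ hr)
    obtain ⟨ε, hε, hb⟩ := Metric.mem_nhds_iff.1 hn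
    refine ⟨Metric.ball z ε, Metric.isOpen_ball, Metric.mem_ball_self hε, fun x hx x' hx' hhx hhx' => ?_⟩
    refine ⟨heY x hhx (hb hx), ?_⟩
    obtain ⟨γ, g0, g1, hγ⟩ := ball_path Metric.isOpen_ball (convex_ball z ε) hx hx' hhx hhx'
    have hcγ : Continuous fun t : I => e (γ t) := by
      refine hcont.comp_continuous (f := fun t : I => (cc p q fp fq (γ t), c0, ret m n fp fq (γ t))) ?_
        (fun t => hmem _ (hγ t).2 (hb (hγ t).1))
      refine Continuous.prodMk ?_ (continuous_const.prodMk ?_)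
      · rw [continuous_iff_continuousAt]
        intro t
        exact (cc_contAt ((hh _).1 (hγ t).2).1).comp γ.continuous.continuousAt
      · rw [continuous_iff_continuousAt]
        intro t
        exact (ret_contAt ((hh _).1 (hγ t).2).1 ((hh _).1 (hγ t).2).2.1).comp γ.continuous.continuousAt
    refine ⟨⟨⟨fun t => e (γ t), hcγ⟩, ?_, ?_⟩, fun t => heY _ (hγ t).2 (hb (hγ t).1)⟩
    · change e (γ 0) = _; rw [g0]
    · change e (γ 1) = _; rw [g1]
  obtain ⟨z0, hz0⟩ := hS.nonempty
  obtain ⟨O0, hO0, hzO, hO0'⟩ := hloc z0 hz0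
  obtain ⟨x0, hx0, hhx0⟩ := exists_near hh0 z0 (hO0.mem_nhds hzO)
  set y0 := e x0 with hy0
  have hy0Y : y0 ∈ Y := (hO0' x0 hx0 x0 hx0 hhx0 hhx0).1
  let U1 : Set E3 := {z | ∃ O, IsOpen O ∧ z ∈ O ∧ ∀ x ∈ O, eval x h0 ≠ 0 → JoinedIn Y y0 (e x)}
  let U2 : Set E3 := {z | ∃ O, IsOpen O ∧ z ∈ O ∧ ∀ x ∈ O, eval x h0 ≠ 0 → ¬ JoinedIn Y y0 (e x)}
  have o1 : IsOpen U1 := by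
    rw [isOpen_iff_mem_nhds]
    rintro z ⟨O, hO, hz, h⟩
    exact Filter.mem_of_superset (hO.mem_nhds hz) fun z' hz' => ⟨O, hO, hz', h⟩
  have o2 : IsOpen U2 := by
    rw [isOpen_iff_mem_nhds]
    rintro z ⟨O, hO, hz, h⟩
    exact Filter.mem_of_superset (hO.mem_nhds hz) fun z' hz' => ⟨O, hO, hz', h⟩
  have hdis : Disjoint U1 U2 := by
    rw [Set.disjoint_left]
    rintro z ⟨O, hO, hz, h⟩ ⟨O', hO', hz', h'⟩
    obtain ⟨x, hx, hhx⟩ := exists_near hh0 z ((hO.inter hO').mem_nhds ⟨hz, hz'⟩)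
    exact h' x hx.2 hhx (h x hx.1 hhx)
  have hcov : SigC p q m n fp fq c0 ⊆ U1 ∪ U2 := by
    intro z hz
    obtain ⟨O, hO, hzO, h⟩ := hloc z hz
    obtain ⟨x, hx, hhx⟩ := exists_near hh0 z (hO.mem_nhds hzO)
    by_cases hj : JoinedIn Y y0 (e x)
    · exact Or.inl ⟨O, hO, hzO, fun x' hx' hhx' => hj.trans (h x hx x' hx' hhx hhx').2⟩
    · refine Or.inr ⟨O, hO, hzO, fun x' hx' hhx' hj' => hj (hj'.trans (h x' hx' x hx hhx' hhx).2)⟩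
  have hYS : ∀ y ∈ Y, y ∈ SigC p q m n fp fq c0 := fun y hy => ⟨hy.1.1, hy.2⟩
  have hy0U : y0 ∈ U1 := by
    rcases hcov (hYS y0 hy0Y) with h | ⟨O, hO, hyO, h⟩
    · exact h
    · exfalso
      refine h y0 hyO (heid y0 hy0Y).1 ?_
      rw [(heid y0 hy0Y).2]
      exact JoinedIn.refl hy0Y
  have hsub := hS.isPreconnected.subset_left_of_subset_union o1 o2 hdis hcov ⟨y0, hYS y0 hy0Y, hy0U⟩
  refine ⟨y0, hy0Y, fun {y} hy => ?_⟩
  obtain ⟨O, hO, hyO, h⟩ := hsub (hYS y hy)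
  have := h y hyO (heid y hy).1
  rwa [(heid y hy).2] at this

end Oka
end

open MvPolynomial
noncomputable section
namespace Oka
open unitInterval Set Topology Filter

/-- all the data -/
structure Cfg where
  p : ℕ
  q : ℕ
  m : ℕ
  n : ℕ
  r : ℕ
  fp : Pol
  fq : Pol
  i : Fin 3
  D : Pol
  h0 : Pol
  A1 : Finset ℂ
  t : Fin (r + 1) → ℂ
  hd : Dat p q m n fp fq
  hh0 : h0 ≠ 0
  hh : ∀ x, eval x h0 ≠ 0 ↔ eval x fp ≠ 0 ∧ eval x fq ≠ 0 ∧ ret m n fp fq x ∈ Sg m n fp fq i D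
  tube : ∀ c, c ∉ A1 → ∃ r0 Tr, TubeAt p q m n fp fq i D c r0 Tr
  fb : ∀ c, c ∉ A1 → IsPathConnected (Fb p q m n fp fq i D c)
  hA0 : 0 ∈ A1
  ht : ∀ j, t j ∉ A1
  hti : Function.Injective t
  hcop : ∀ j, IsRelPrime (C (t j) * fp ^ q - fq ^ p) h0
  hpowp : ∀ k, 2 ≤ k → ∀ h : Pol, fp ≠ h ^ k
  hpowq : ∀ k, 2 ≤ k → ∀ h : Pol, fq ≠ h ^ k
  hpowc : ∀ c : ℂ, c ≠ 0 → ∀ k, 2 ≤ k → ∀ h : Pol, C c * fp ^ q - fq ^ p ≠ h ^ k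

namespace Cfg
variable (K : Cfg)

def gt (c : ℂ) : Pol := C c * K.fp ^ K.q - K.fq ^ K.p
def g : Pol := ∏ j, K.gt (K.t j)
def cx (x : E3) : ℂ := cc K.p K.q K.fp K.fq x
def rt (x : E3) : E3 := ret K.m K.n K.fp K.fq x
def SG : Set E3 := Sg K.m K.n K.fp K.fq K.i K.D
def S : Set E3 := {x | x ∈ K.SG ∧ K.cx x ∉ K.A1 ∧ ∀ j, K.cx x ≠ K.t j}
def hS : Pol := K.h0 * ∏ c ∈ K.A1.erase 0, K.gt c

lemma t_ne (j) : K.t j ≠ 0 := fun h => K.ht j (h ▸ K.hA0)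
lemma p_ne : K.p ≠ 0 := by have := K.hd.hp; omega
lemma q_ne : K.q ≠ 0 := by have := K.hd.hq; omega

lemma gt_eval (c : ℂ) (x : E3) : eval x (K.gt c) = c * eval x K.fp ^ K.q - eval x K.fq ^ K.p := by
  simp [gt]

lemma gt_eval' (c : ℂ) {x : E3} (h1 : eval x K.fp ≠ 0) :
    eval x (K.gt c) = eval x K.fp ^ K.q * (c - K.cx x) := by
  rw [gt_eval, cx, cc]
  field_simp

lemma gt_hom (c : ℂ) : (K.gt c).IsHomogeneous (K.p * K.q) := by
  unfold gt
  refine IsHomogeneous.sub ?_ ?_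
  · have := (isHomogeneous_C (Fin 3) c).mul (K.hd.hfp.pow K.q)
    rwa [zero_add] at this
  · have := K.hd.hfq.pow K.p
    rwa [mul_comm K.q] at this

lemma exists_gd : ∃ x, x ∈ K.SG ∧ eval x K.h0 ≠ 0 := by
  obtain ⟨x, hx⟩ := exists_eval_ne K.hh0
  obtain ⟨h1, h2, h3⟩ := (K.hh x).1 hx
  refine ⟨_, h3, (K.hh _).2 ⟨h3.1.1, h3.1.2.1, ?_⟩⟩
  rw [ret_sig h3.1]; exact h3

lemma gt_ne (c : ℂ) : K.gt c ≠ 0 := by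
  intro h
  by_cases hc : c = 0
  · subst hc
    have : K.fq ^ K.p = 0 := by simpa [gt] using h
    exact pow_ne_zero _ K.hd.hfq0 this
  · refine K.hpowc c hc 2 le_rfl 0 ?_
    rw [zero_pow two_ne_zero]; exact h

def dg : ℕ := K.p * K.q * (K.r + 1)

lemma g_hom : K.g.IsHomogeneous K.dg := by
  have := IsHomogeneous.prod Finset.univ (fun j => K.gt (K.t j)) (fun _ => K.p * K.q)
    (fun j _ => K.gt_hom (K.t j))
  rw [Finset.sum_const, Finset.card_univ, Fintype.card_fin, smul_eq_mul, mul_comm] at this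
  exact this

lemma dg_ne : K.dg ≠ 0 := mul_ne_zero (mul_ne_zero K.p_ne K.q_ne) (Nat.succ_ne_zero _)

lemma g_ne : K.g ≠ 0 := Finset.prod_ne_zero_iff.2 fun _ _ => K.gt_ne _

lemma hS_ne : K.hS ≠ 0 := mul_ne_zero K.hh0 (Finset.prod_ne_zero_iff.2 fun _ _ => K.gt_ne _)

lemma g_eval_ne (x : E3) : eval x K.g ≠ 0 ↔ ∀ j, eval x (K.gt (K.t j)) ≠ 0 := by
  rw [g, map_prod, Finset.prod_ne_zero_iff]; simp

lemma g_eval_ne' {x : E3} (h1 : eval x K.fp ≠ 0) : eval x K.g ≠ 0 ↔ ∀ j, K.cx x ≠ K.t j := by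
  rw [g_eval_ne]
  refine forall_congr' fun j => ?_
  rw [K.gt_eval' _ h1, mul_ne_zero_iff, sub_ne_zero]
  exact ⟨fun h => h.2.symm, fun h => ⟨pow_ne_zero _ h1, h.symm⟩⟩

lemma S_sub {x : E3} (hx : x ∈ K.S) : x ∈ XX K.g :=
  (K.g_eval_ne' hx.1.1.1).2 hx.2.2

lemma S_of {x : E3} (hx : x ∈ XX K.g) (hx' : eval x K.hS ≠ 0) : K.rt x ∈ K.S := by
  rw [hS, map_mul, map_prod, mul_ne_zero_iff, Finset.prod_ne_zero_iff] at hx'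
  obtain ⟨h1, h2, h3⟩ := (K.hh x).1 hx'.1
  have e : K.cx (K.rt x) = K.cx x := K.hd.cc_ret h1 h2
  refine ⟨h3, ?_, ?_⟩
  · rw [e]
    intro hA
    have hc : K.cx x ≠ 0 := cc_ne h1 h2
    refine hx'.2 _ (Finset.mem_erase.2 ⟨hc, hA⟩) ?_
    rw [K.gt_eval' _ h1, sub_self, mul_zero]
  · rw [e]; exact (K.g_eval_ne' h1).1 hx

lemma hS_of {x : E3} (hx : x ∈ K.S) : eval x K.hS ≠ 0 := by
  rw [hS, map_mul, map_prod, mul_ne_zero_iff, Finset.prod_ne_zero_iff]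
  refine ⟨(K.hh x).2 ⟨hx.1.1.1, hx.1.1.2.1, ?_⟩, fun c hc => ?_⟩
  · rw [ret_sig hx.1.1]; exact hx.1
  · rw [K.gt_eval' _ hx.1.1.1, mul_ne_zero_iff, sub_ne_zero]
    refine ⟨pow_ne_zero _ hx.1.1.1, ?_⟩
    rintro rfl
    exact hx.2.1 (Finset.mem_erase.1 hc).2

lemma rt_S {x : E3} (hx : x ∈ K.S) : K.rt x = x := ret_sig hx.1.1

def ι : C(K.S, XX K.g) := ⟨fun x => ⟨x.1, K.S_sub x.2⟩, by fun_prop⟩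
def pi : C(XX K.g, UU K.g) := pr K.g_hom K.dg_ne
def ps : C(K.S, UU K.g) := K.pi.comp K.ι

lemma pi_rt {x : E3} (hx : x ∈ XX K.g) (hx' : eval x K.hS ≠ 0) : K.ps ⟨K.rt x, K.S_of hx hx'⟩ = K.pi ⟨x, hx⟩ := by
  have h0 : eval x K.h0 ≠ 0 := by
    rw [hS, map_mul] at hx'; exact left_ne_zero_of_mul hx'
  obtain ⟨h1, h2, -⟩ := (K.hh x).1 h0
  exact (pr_eq_iff K.g_hom K.dg_ne _ _).2 ⟨_, inv_ne_zero (lam_ne h1 h2), rfl⟩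

lemma rt_contAt {x : E3} (hx' : eval x K.hS ≠ 0) : ContinuousAt K.rt x := by
  have h0 : eval x K.h0 ≠ 0 := by
    rw [hS, map_mul] at hx'; exact left_ne_zero_of_mul hx'
  obtain ⟨h1, h2, -⟩ := (K.hh x).1 h0
  exact ret_contAt h1 h2

/-- push a path off the bad locus into the slice -/
def rpath (α : C(I, XX K.g)) (h : ∀ t, eval (α t : E3) K.hS ≠ 0) : C(I, K.S) :=
  ⟨fun t => ⟨K.rt (α t), K.S_of (α t).2 (h t)⟩, by
    refine Continuous.subtype_mk ?_ _
    rw [continuous_iff_continuousAt]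
    intro t
    exact (K.rt_contAt (h t)).comp (f := fun t : I => (α t : E3)) (by fun_prop : Continuous fun t => (α t : E3)).continuousAt⟩

lemma rpath_ps (α : C(I, XX K.g)) (h : ∀ t, eval (α t : E3) K.hS ≠ 0) :
    K.ps.comp (K.rpath α h) = K.pi.comp α := by
  ext1 t
  exact K.pi_rt (α t).2 (h t)

theorem LIFT {N : Type*} [Group N] (τ : LS (UU K.g) N) (x y : K.S) (β : C(I, UU K.g)) (h0 : β 0 = K.ps x)
    (h1 : β 1 = K.ps y) : ∃ α : C(I, K.S), α 0 = x ∧ α 1 = y ∧ τ.f (K.ps.comp α) = τ.f β := by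
  obtain ⟨α, a0, a1, a2, a3⟩ := lift_off K.g_hom K.dg_ne τ (h := K.hS) β (K.ι x) (K.ι y) h0.symm h1.symm
    (K.hS_of x.2) (K.hS_of y.2)
  refine ⟨K.rpath α a2, ?_, ?_, ?_⟩
  · apply Subtype.ext
    change K.rt (α 0) = x
    rw [a0]; exact K.rt_S x.2
  · apply Subtype.ext
    change K.rt (α 1) = y
    rw [a1]; exact K.rt_S y.2
  · rw [rpath_ps]; exact a3

instance : PathConnectedSpace (UU K.g) := UU_pathConnected K.g_hom K.dg_ne K.g_ne

lemma gt_cop {c c' : ℂ} (h : c ≠ c') : IsRelPrime (K.gt c) (K.gt c') := by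
  intro d h1 h2
  have e1 : K.gt c - K.gt c' = C (c - c') * K.fp ^ K.q := by
    rw [gt, gt, map_sub]; ring
  have hu : IsUnit (C (c - c') : Pol) := (isUnit_iff_ne_zero.2 (sub_ne_zero.2 h)).map C
  have h3 : d ∣ K.fp ^ K.q := by
    have := dvd_sub h1 h2
    rw [e1] at this
    exact hu.dvd_mul_left.1 this
  have h4 : d ∣ K.fq ^ K.p := by
    have := (h3.mul_left (C c)).sub h1
    rw [gt] at this
    simpa using this
  exact (K.hd.hrel.pow (m := K.q) (n := K.p)) h3 h4

end Cfg
end Oka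
end

open MvPolynomial
noncomputable section
namespace Oka
open unitInterval Set Topology Filter

namespace Cfg
variable (K : Cfg)

def sc (c : ℂ) : ℂ := c / (K.t 0 - c)
def cs (w : ℂ) : ℂ := K.t 0 * w / (1 + w)

lemma one_add_sc {c : ℂ} (h : c ≠ K.t 0) : 1 + K.sc c = K.t 0 / (K.t 0 - c) := by
  have : K.t 0 - c ≠ 0 := sub_ne_zero.2 h.symm
  rw [sc]; field_simp; ring

lemma sc_ne {c : ℂ} (h : c ≠ K.t 0) : K.sc c ≠ -1 := by
  intro h1
  have := K.one_add_sc h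
  rw [h1, add_neg_cancel] at this
  exact div_ne_zero (K.t_ne 0) (sub_ne_zero.2 h.symm) this.symm

lemma cs_sc {c : ℂ} (h : c ≠ K.t 0) : K.cs (K.sc c) = c := by
  have h1 : K.t 0 - c ≠ 0 := sub_ne_zero.2 h.symm
  have h2 := K.t_ne 0
  rw [cs, K.one_add_sc h, sc]; field_simp

lemma t0_sub_cs {w : ℂ} (h : w ≠ -1) : K.t 0 - K.cs w = K.t 0 / (1 + w) := by
  have : 1 + w ≠ 0 := fun h1 => h (by linear_combination h1)
  rw [cs]; field_simp; ring

lemma cs_ne {w : ℂ} (h : w ≠ -1) : K.cs w ≠ K.t 0 := by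
  have h1 : 1 + w ≠ 0 := fun h1 => h (by linear_combination h1)
  intro h2
  have := K.t0_sub_cs h
  rw [h2, sub_self] at this
  exact div_ne_zero (K.t_ne 0) h1 this.symm

lemma sc_cs {w : ℂ} (h : w ≠ -1) : K.sc (K.cs w) = w := by
  have h1 : 1 + w ≠ 0 := fun h1 => h (by linear_combination h1)
  have h2 := K.t_ne 0
  rw [sc, K.t0_sub_cs h, cs]; field_simp

def P : Finset ℂ := {0, -1} ∪ (K.A1.image K.sc ∪ Finset.univ.image fun j : Fin K.r => K.sc (K.t j.succ))

lemma mem_P {w : ℂ} : w ∈ K.P ↔ w = 0 ∨ w = -1 ∨ (∃ c ∈ K.A1, K.sc c = w) ∨ ∃ j : Fin K.r, K.sc (K.t j.succ) = w := by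
  simp [P]

lemma A1_ne {c : ℂ} (h : c ∈ K.A1) (j) : c ≠ K.t j := by rintro rfl; exact K.ht j h
lemma ts_ne (j : Fin K.r) : K.t j.succ ≠ K.t 0 := fun h => Fin.succ_ne_zero j (K.hti h)

lemma sc_P {c : ℂ} (h1 : c ∉ K.A1) (h2 : ∀ j, c ≠ K.t j) : K.sc c ∈ (↑K.P : Set ℂ)ᶜ := by
  intro h
  rcases K.mem_P.1 h with h | h | ⟨d, hd, h⟩ | ⟨j, h⟩
  · have : c = 0 := by rw [← K.cs_sc (h2 0), h]; simp [cs]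
    exact h1 (this ▸ K.hA0)
  · exact K.sc_ne (h2 0) h
  · apply h1
    rw [← K.cs_sc (h2 0), ← h, K.cs_sc (K.A1_ne hd 0)]; exact hd
  · apply h2 j.succ
    rw [← K.cs_sc (h2 0), ← h, K.cs_sc (K.ts_ne j)]

lemma cs_P {w : ℂ} (h : w ∈ (↑K.P : Set ℂ)ᶜ) : w ≠ -1 ∧ K.cs w ∉ K.A1 ∧ ∀ j, K.cs w ≠ K.t j := by
  have h' : w ∉ K.P := h
  rw [K.mem_P] at h'
  push Not at h'
  obtain ⟨h0, h1, h2, h3⟩ := h'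
  refine ⟨h1, fun hA => h2 _ hA (K.sc_cs h1), fun j hj => ?_⟩
  rcases Fin.eq_zero_or_eq_succ j with rfl | ⟨k, rfl⟩
  · exact K.cs_ne h1 hj
  · apply h3 k; rw [← hj]; exact K.sc_cs h1

lemma cx_cont : Continuous fun x : K.S => K.cx x := by
  rw [continuous_iff_continuousAt]
  intro x
  exact (cc_contAt x.2.1.1.1).comp (f := fun x : K.S => (x : E3)) continuous_subtype_val.continuousAt

lemma sc_contAt {c : ℂ} (h : c ≠ K.t 0) : ContinuousAt K.sc c :=
  continuousAt_id.div (continuousAt_const.sub continuousAt_id) (sub_ne_zero.2 h.symm)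

lemma cs_contAt {w : ℂ} (h : w ≠ -1) : ContinuousAt K.cs w :=
  (continuousAt_const.mul continuousAt_id).div (continuousAt_const.add continuousAt_id)
    (fun h1 => h (by linear_combination (h1 : 1 + w = 0)))

def f : C(K.S, ↥((↑K.P : Set ℂ)ᶜ)) := ⟨fun x => ⟨K.sc (K.cx x), K.sc_P x.2.2.1 x.2.2.2⟩, by
  refine Continuous.subtype_mk ?_ _
  rw [continuous_iff_continuousAt]
  intro x
  exact (K.sc_contAt (x.2.2.2 0)).comp (f := fun x : K.S => K.cx x) K.cx_cont.continuousAt⟩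

lemma f_eq_iff (x y : K.S) : K.f x = K.f y ↔ K.cx x = K.cx y := by
  constructor
  · intro h
    have h1 : K.sc (K.cx x) = K.sc (K.cx y) := congrArg Subtype.val h
    rw [← K.cs_sc (x.2.2.2 0), h1, K.cs_sc (y.2.2.2 0)]
  · intro h
    apply Subtype.ext
    change K.sc (K.cx x) = K.sc (K.cx y)
    rw [h]

lemma cs_f (x : K.S) : K.cs (K.f x) = K.cx x := K.cs_sc (x.2.2.2 0)

def STube (c0 : ℂ) (r0 : ℝ) (Tr : ℂ → ℂ → E3 → E3) : Prop :=
  TubeAt K.p K.q K.m K.n K.fp K.fq K.i K.D c0 r0 Tr ∧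
    ∀ c ∈ Metric.ball c0 r0, c ∉ K.A1 ∧ ∀ j, c ≠ K.t j

lemma stube_ex {c0 : ℂ} (h1 : c0 ∉ K.A1) (h2 : ∀ j, c0 ≠ K.t j) {O : Set ℂ} (hO : O ∈ 𝓝 c0) :
    ∃ r0 Tr, K.STube c0 r0 Tr ∧ Metric.ball c0 r0 ⊆ O := by
  obtain ⟨r0, Tr, hT⟩ := K.tube c0 h1
  have hn : {c : ℂ | c ∉ K.A1 ∧ ∀ j, c ≠ K.t j} ∈ 𝓝 c0 := by
    have h3 : IsClosed ((↑K.A1 : Set ℂ) ∪ Set.range K.t) :=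
      (K.A1.finite_toSet.union (Set.finite_range K.t)).isClosed
    refine Filter.mem_of_superset (h3.isOpen_compl.mem_nhds (x := c0) ?_) ?_
    · rintro (h | ⟨j, h⟩)
      · exact h1 h
      · exact h2 j h.symm
    · intro c hc
      exact ⟨fun h => hc (Or.inl h), fun j h => hc (Or.inr ⟨j, h.symm⟩)⟩
  obtain ⟨ε, hε, hb⟩ := Metric.mem_nhds_iff.1 (Filter.inter_mem hn hO)
  refine ⟨min r0 ε, Tr, ⟨hT.mono (lt_min hT.1 hε) (min_le_left _ _), fun c hc => ?_⟩, fun c hc => ?_⟩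
  · exact (hb (Metric.ball_subset_ball (min_le_right _ _) hc)).1
  · exact (hb (Metric.ball_subset_ball (min_le_right _ _) hc)).2

variable {K}

lemma STube.dom {c0 : ℂ} {r0 : ℝ} {Tr} (_h : K.STube c0 r0 Tr) (x : K.S) {c : ℂ}
    (hx : K.cx x ∈ Metric.ball c0 r0) (hc : c ∈ Metric.ball c0 r0) :
    (K.cx x, c, (x : E3)) ∈ TrDom K.p K.q K.m K.n K.fp K.fq K.i K.D (Metric.ball c0 r0) :=
  ⟨hx, hc, x.2.1, rfl⟩

lemma STube.mem {c0 : ℂ} {r0 : ℝ} {Tr} (h : K.STube c0 r0 Tr) (x : K.S) {c : ℂ}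
    (hx : K.cx x ∈ Metric.ball c0 r0) (hc : c ∈ Metric.ball c0 r0) :
    Tr (K.cx x) c x ∈ K.S ∧ K.cx (Tr (K.cx x) c x) = c := by
  obtain ⟨h1, h2, -, -⟩ := h.1.2.2.2 _ _ _ (h.dom x hx hc)
  have h2' : K.cx (Tr (K.cx x) c x) = c := h2
  exact ⟨⟨h1, by rw [h2']; exact (h.2 c hc).1, by rw [h2']; exact (h.2 c hc).2⟩, h2'⟩

/-- continuous transport -/
def STube.tr {c0 : ℂ} {r0 : ℝ} {Tr} (h : K.STube c0 r0 Tr) {Z : Type*} [TopologicalSpace Z] (x : C(Z, K.S))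
    (c : C(Z, ℂ)) (hx : ∀ z, K.cx (x z) ∈ Metric.ball c0 r0) (hc : ∀ z, c z ∈ Metric.ball c0 r0) : C(Z, K.S) :=
  ⟨fun z => ⟨Tr (K.cx (x z)) (c z) (x z), (h.mem (x z) (hx z) (hc z)).1⟩, by
    refine Continuous.subtype_mk ?_ _
    refine h.1.2.2.1.comp_continuous (f := fun z : Z => (K.cx (x z), c z, (x z : E3))) ?_
      (fun z => h.dom (x z) (hx z) (hc z))
    exact (K.cx_cont.comp x.continuous).prodMk (c.continuous.prodMk (continuous_subtype_val.comp x.continuous))⟩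

lemma STube.tr_cx {c0 : ℂ} {r0 : ℝ} {Tr} (h : K.STube c0 r0 Tr) {Z : Type*} [TopologicalSpace Z] (x : C(Z, K.S))
    (c : C(Z, ℂ)) (hx : ∀ z, K.cx (x z) ∈ Metric.ball c0 r0) (hc : ∀ z, c z ∈ Metric.ball c0 r0) (z : Z) :
    K.cx (h.tr x c hx hc z) = c z := (h.mem (x z) (hx z) (hc z)).2

lemma STube.tr_self {c0 : ℂ} {r0 : ℝ} {Tr} (h : K.STube c0 r0 Tr) {Z : Type*} [TopologicalSpace Z] (x : C(Z, K.S))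
    (c : C(Z, ℂ)) (hx : ∀ z, K.cx (x z) ∈ Metric.ball c0 r0) (hc : ∀ z, c z ∈ Metric.ball c0 r0) (z : Z)
    (hz : c z = K.cx (x z)) : h.tr x c hx hc z = x z := by
  apply Subtype.ext
  change Tr (K.cx (x z)) (c z) (x z) = x z
  rw [hz]
  exact (h.1.2.2.2 _ _ _ (h.dom (x z) (hx z) (hx z))).2.2.2

lemma fibre_path (x y : K.S) (h : K.cx x = K.cx y) :
    ∃ κ : C(I, K.S), κ 0 = x ∧ κ 1 = y ∧ ∀ t, K.cx (κ t) = K.cx x := by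
  obtain ⟨γ, hγ⟩ := (K.fb _ x.2.2.1).joinedIn x ⟨x.2.1, rfl⟩ y ⟨y.2.1, h.symm⟩
  have hc : ∀ t, K.cx (γ t) = K.cx x := fun t => (hγ t).2
  refine ⟨⟨fun t => ⟨γ t, (hγ t).1, ?_, ?_⟩, ?_⟩, ?_, ?_, ?_⟩
  · rw [hc]; exact x.2.2.1
  · rw [hc]; exact x.2.2.2
  · fun_prop
  · apply Subtype.ext; exact γ.source
  · apply Subtype.ext; exact γ.target
  · exact hc

/-- contract a path of the tube into a fibre -/
lemma STube.contract {c0 : ℂ} {r0 : ℝ} {Tr} (h : K.STube c0 r0 Tr) {c : ℂ} (hc : c ∈ Metric.ball c0 r0)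
    {Γ : Type*} [Group Γ] (ρ : LS K.S Γ) : ∃ E : K.S → C(I, K.S),
    (∀ x : K.S, K.cx x ∈ Metric.ball c0 r0 → E x 0 = x ∧ K.cx (E x 1) = c ∧
      (∀ t, K.cx (E x t) ∈ Metric.ball c0 r0) ∧ (K.cx x = c → ∀ t, E x t = x)) ∧
    ∀ κ : C(I, K.S), (∀ t, K.cx (κ t) ∈ Metric.ball c0 r0) → ∃ κ' : C(I, K.S),
      κ' 0 = E (κ 0) 1 ∧ κ' 1 = E (κ 1) 1 ∧ (∀ t, K.cx (κ' t) = c) ∧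
      ρ.f κ * ρ.f (E (κ 1)) = ρ.f (E (κ 0)) * ρ.f κ' := by
  classical
  have hcv := convex_ball c0 r0
  let E : K.S → C(I, K.S) := fun x => if hx : K.cx x ∈ Metric.ball c0 r0 then
    h.tr (ContinuousMap.const I x) ⟨fun t => seg (K.cx x) c t, cont_seg.comp (by fun_prop : Continuous fun t : I => (t, K.cx x, c))⟩
      (fun _ => hx) (fun t => seg_mem hcv hx hc t) else ContinuousMap.const I x
  have hE : ∀ (x : K.S) (hx : K.cx x ∈ Metric.ball c0 r0) t, (E x t : E3) = Tr (K.cx x) (seg (K.cx x) c t) x := by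
    intro x hx t
    change (((if hx : K.cx x ∈ Metric.ball c0 r0 then _ else _) : C(I, K.S)) t : E3) = _
    rw [dif_pos hx]; rfl
  have s0 : ∀ c1 c2, seg c1 c2 0 = c1 := fun c1 c2 => by simp [seg]
  have s1 : ∀ c1 c2, seg c1 c2 1 = c2 := fun c1 c2 => by simp [seg]
  have ss : ∀ c1 t, seg c1 c1 t = c1 := fun c1 t => by simp [seg]; ring
  refine ⟨E, fun x hx => ⟨?_, ?_, ?_, ?_⟩, fun κ hκ => ?_⟩
  · apply Subtype.ext
    rw [hE x hx, s0]; exact (h.1.2.2.2 _ _ _ (h.dom x hx hx)).2.2.2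
  · rw [hE x hx, s1]; exact (h.mem x hx hc).2
  · intro t
    rw [hE x hx, (h.mem x hx (seg_mem hcv hx hc t)).2]; exact seg_mem hcv hx hc t
  · intro e t
    apply Subtype.ext
    rw [hE x hx, ← e, ss]; exact (h.1.2.2.2 _ _ _ (h.dom x hx hx)).2.2.2
  · let H : C(I × I, K.S) := h.tr (κ.comp ⟨Prod.fst, continuous_fst⟩)
      ⟨fun z => seg (K.cx (κ z.1)) c z.2,
        cont_seg.comp (g := fun x : I × ℂ × ℂ => seg x.2.1 x.2.2 x.1)
          (f := fun z : I × I => (z.2, K.cx (κ z.1), c)) (continuous_snd.prodMk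
          (((K.cx_cont.comp κ.continuous).comp continuous_fst).prodMk continuous_const))⟩
      (fun z => hκ z.1) (fun z => seg_mem hcv (hκ z.1) hc z.2)
    have hH : ∀ z, (H z : E3) = Tr (K.cx (κ z.1)) (seg (K.cx (κ z.1)) c z.2) (κ z.1) := fun z => rfl
    let κ' : C(I, K.S) := H.comp ⟨fun t => (t, 1), by fun_prop⟩
    have hE' : ∀ t u, H (t, u) = E (κ t) u := fun t u => Subtype.ext ((hH (t, u)).trans (hE _ (hκ t) u).symm)
    refine ⟨κ', hE' 0 1, hE' 1 1, fun t => ?_, ?_⟩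
    · have := hE' t 1
      change K.cx (H (t, 1)) = c
      rw [hH, s1]; exact (h.mem _ (hκ t) hc).2
    · refine ρ.square H κ (E (κ 1)) (E (κ 0)) κ' ?_ ?_ ?_ ?_
      · intro t
        apply Subtype.ext
        rw [hH, s0]; exact ((h.1.2.2.2 _ _ _ (h.dom (κ t) (hκ t) (hκ t))).2.2.2).symm
      · intro t; exact (hE' 1 t).symm
      · intro t; exact (hE' 0 t).symm
      · intro t; rfl

end Cfg
end Oka
end

open MvPolynomial
noncomputable section
namespace Oka
open unitInterval Set Topology Filter

namespace Cfg
variable {K : Cfg} {Γ : Type*} [Group Γ]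

def IsFL (κ : C(I, K.S)) : Prop := κ 0 = κ 1 ∧ ∀ t, K.cx (κ t) = K.cx (κ 0)

lemma STube.path {c0 : ℂ} {r0 : ℝ} {Tr} (h : K.STube c0 r0 Tr) (x y : K.S)
    (hx : K.cx x ∈ Metric.ball c0 r0) (hy : K.cx y ∈ Metric.ball c0 r0) :
    ∃ κ : C(I, K.S), κ 0 = x ∧ κ 1 = y ∧ ∀ t, K.cx (κ t) ∈ Metric.ball c0 r0 := by
  let L : LS K.S (Multiplicative ℤ) := ⟨fun _ => 1, by simp, by simp⟩
  obtain ⟨E, hE, -⟩ := h.contract hy L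
  obtain ⟨e0, e1, e2, -⟩ := hE x hx
  obtain ⟨κ, k0, k1, k2⟩ := fibre_path (E x 1) y e1
  refine ⟨ctrans (E x) κ k0.symm, (ctrans_zero _ _ _).trans e0, (ctrans_one _ _ _).trans k1, fun t => ?_⟩
  refine ctrans_mem (E x) κ k0.symm (S := {z : K.S | K.cx z ∈ Metric.ball c0 r0}) e2 (fun t => ?_) t
  change K.cx (κ t) ∈ Metric.ball c0 r0
  rw [k2, e1]; exact hy

lemma f_surj : Function.Surjective K.f := by
  rintro ⟨w, hw⟩
  obtain ⟨h1, h2, h3⟩ := K.cs_P hw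
  obtain ⟨x, hx, -⟩ := K.fb _ h2
  have hc : K.cx x = K.cs w := hx.2
  refine ⟨⟨x, hx.1, by rw [hc]; exact h2, by rw [hc]; exact h3⟩, Subtype.ext ?_⟩
  change K.sc (K.cx x) = w
  rw [hc, K.sc_cs h1]

variable (K) in
def DD : Set (Set ↥((↑K.P : Set ℂ)ᶜ)) :=
  {D | ∃ c0 r0 Tr, K.STube c0 r0 Tr ∧ D = {w : ↥((↑K.P : Set ℂ)ᶜ) | K.cs w ∈ Metric.ball c0 r0}}

lemma DD_open (D) (hD : D ∈ K.DD) : IsOpen D := by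
  obtain ⟨c0, r0, Tr, -, rfl⟩ := hD
  rw [isOpen_iff_mem_nhds]
  intro w hw
  have : ContinuousAt (fun w : ↥((↑K.P : Set ℂ)ᶜ) => K.cs w) w :=
    (K.cs_contAt (K.cs_P w.2).1).comp continuous_subtype_val.continuousAt
  exact this (Metric.isOpen_ball.mem_nhds hw)

lemma DD_basis (b) (N) (hN : N ∈ 𝓝 b) : ∃ D ∈ K.DD, b ∈ D ∧ D ⊆ N := by
  obtain ⟨h1, h2, h3⟩ := K.cs_P b.2
  obtain ⟨O, hO, hON⟩ := mem_nhds_subtype _ b N |>.1 hN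
  have h4 : K.sc ⁻¹' O ∈ 𝓝 (K.cs b) := (K.sc_contAt (h3 0)).preimage_mem_nhds (by rw [K.sc_cs h1]; exact hO)
  obtain ⟨r0, Tr, hT, hb⟩ := K.stube_ex h2 h3 h4
  refine ⟨_, ⟨_, r0, Tr, hT, rfl⟩, Metric.mem_ball_self hT.1.1, fun w hw => hON ?_⟩
  have := hb hw
  change K.sc (K.cs w) ∈ O at this
  rwa [K.sc_cs (K.cs_P w.2).1] at this

theorem descS (ρ : LS K.S Γ) (hρ : ∀ κ : C(I, K.S), IsFL κ → ρ.f κ = 1) :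
    ∃ L : LS ↥((↑K.P : Set ℂ)ᶜ) Γ, ∃ h : K.S → Γ, ∀ γ, ρ.f γ = h (γ 0) * L.f (K.f.comp γ) * (h (γ 1))⁻¹ := by
  refine descent K.f ρ f_surj ?_ K.DD DD_open DD_basis ?_ ?_
  · intro x y h
    obtain ⟨κ, k0, k1, k2⟩ := fibre_path x y ((K.f_eq_iff x y).1 h)
    exact ⟨κ, k0, k1, fun t => (K.f_eq_iff _ _).2 (k2 t)⟩
  · rintro D ⟨c0, r0, Tr, hT, rfl⟩ x y hx hy
    simp only [mem_ofPred_eq, cs_f] at hx hy ⊢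
    exact hT.path x y hx hy
  · rintro D ⟨c0, r0, Tr, hT, rfl⟩ κ κ' h0 h1 hκ hκ'
    simp only [mem_ofPred_eq, cs_f] at hκ hκ'
    obtain ⟨E, -, hE⟩ := hT.contract (Metric.mem_ball_self hT.1.1) ρ
    obtain ⟨d, d0, d1, d2, d3⟩ := hE κ hκ
    obtain ⟨d', d0', d1', d2', d3'⟩ := hE κ' hκ'
    rw [← h0] at d0' d3'
    rw [← h1] at d1' d3'
    have e : ρ.f d = ρ.f d' := by
      have hj : d 1 = csymm d' 0 := by rw [csymm_zero, d1, d1']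
      have := hρ (ctrans d (csymm d') hj) ⟨?_, fun t => ?_⟩
      · rw [LS.f_ctrans, LS.f_csymm, mul_inv_eq_one] at this; exact this
      · rw [ctrans_zero, ctrans_one, csymm_one, d0, d0']
      · rw [ctrans_zero, d2 0]
        exact ctrans_mem d (csymm d') hj (S := {z : K.S | K.cx z = c0}) d2 (csymm_mem d' d2') t
    rw [e, ← d3'] at d3
    exact mul_right_cancel d3

theorem transport (ρ : LS K.S Γ) (δ : C(I, K.S)) : ∀ κ : C(I, K.S), IsFL κ → κ 0 = δ 0 →
    ∃ κ' : C(I, K.S), IsFL κ' ∧ κ' 0 = δ 1 ∧ ρ.f κ' = (ρ.f δ)⁻¹ * ρ.f κ * ρ.f δ := by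
  revert δ
  apply path_induction
  · intro x
    obtain ⟨r0, Tr, hT, -⟩ := K.stube_ex x.2.2.1 x.2.2.2 Filter.univ_mem
    have hO : {z : K.S | K.cx z ∈ Metric.ball (K.cx x) r0} ∈ 𝓝 x :=
      K.cx_cont.continuousAt (Metric.ball_mem_nhds _ hT.1.1)
    refine ⟨_, hO, fun δ hδ κ hκ h0 => ?_⟩
    have hκ' : ∀ t, K.cx (κ t) ∈ Metric.ball (K.cx x) r0 := fun t => by rw [hκ.2 t, h0]; exact hδ 0
    obtain ⟨E, hE, hE'⟩ := hT.contract (hδ 1) ρ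
    obtain ⟨d, d0, d1, d2, d3⟩ := hE' κ hκ'
    obtain ⟨d', d0', d1', d2', d3'⟩ := hE' δ hδ
    have hc : ρ.f (E (δ 1)) = 1 := LS.f_eq_one_of_const _ _ fun t => by
      rw [(hE _ (hδ 1)).2.2.2 rfl t, (hE _ (hδ 1)).2.2.2 rfl 0]
    rw [hc, mul_one] at d3'
    have d1' : d' 1 = δ 1 := d1'.trans ((hE _ (hδ 1)).2.2.2 rfl 1)
    rw [← hκ.1, h0] at d3 d1
    rw [h0] at d0
    have j1 : csymm d' 1 = d 0 := by rw [csymm_one, d0, d0']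
    have j2 : ctrans (csymm d') d j1 1 = d' 0 := by rw [ctrans_one, d1, d0']
    have m0 : ctrans (ctrans (csymm d') d j1) d' j2 0 = δ 1 := by rw [ctrans_zero, ctrans_zero, csymm_zero, d1']
    refine ⟨ctrans (ctrans (csymm d') d j1) d' j2, ⟨?_, fun t => ?_⟩, m0, ?_⟩
    · rw [m0, ctrans_one, d1']
    · rw [m0]
      exact ctrans_mem _ d' j2 (S := {z : K.S | K.cx z = K.cx (δ 1)})
        (ctrans_mem (csymm d') d j1 (csymm_mem d' d2') d2) d2' t
    · rw [LS.f_ctrans, LS.f_ctrans, LS.f_csymm]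
      have e : ρ.f d = (ρ.f (E (δ 0)))⁻¹ * ρ.f κ * ρ.f (E (δ 0)) := by
        rw [mul_assoc, d3, inv_mul_cancel_left]
      rw [e, d3']; group
  · intro x y z α β h1 h2 κ hκ h0
    obtain ⟨κ1, k1, k2, k3⟩ := h1 κ hκ (by simpa using h0)
    obtain ⟨κ2, l1, l2, l3⟩ := h2 κ1 k1 (by simpa using k2)
    refine ⟨κ2, l1, by simpa using l2, ?_⟩
    rw [l3, k3, ρ.mul]; group
  · intro x y α β hab h1 κ hκ h0
    obtain ⟨κ1, k1, k2, k3⟩ := h1 κ hκ (by simpa using h0)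
    refine ⟨κ1, k1, by simpa using k2, ?_⟩
    rw [k3, ρ.hom α β hab]

/-- local lifting of base paths, up to fibre paths -/
lemma lift_loc (x : K.S) : ∃ O ∈ 𝓝 (K.f x), ∀ γ : C(I, ↥((↑K.P : Set ℂ)ᶜ)), (∀ t, γ t ∈ O) →
    ∃ α : C(I, K.S), K.f.comp α = γ := by
  obtain ⟨r0, Tr, hT, -⟩ := K.stube_ex x.2.2.1 x.2.2.2 Filter.univ_mem
  have hc : ∀ w : ↥((↑K.P : Set ℂ)ᶜ), ContinuousAt (fun w : ↥((↑K.P : Set ℂ)ᶜ) => K.cs w) w := fun w =>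
    (K.cs_contAt (K.cs_P w.2).1).comp continuous_subtype_val.continuousAt
  refine ⟨{w : ↥((↑K.P : Set ℂ)ᶜ) | K.cs w ∈ Metric.ball (K.cx x) r0}, hc (K.f x) (by
    change Metric.ball (K.cx x) r0 ∈ 𝓝 (K.cs (K.f x)); rw [cs_f]; exact Metric.ball_mem_nhds _ hT.1.1),
    fun γ hγ => ?_⟩
  have hcc : Continuous fun w : ↥((↑K.P : Set ℂ)ᶜ) => K.cs w := continuous_iff_continuousAt.2 hc
  refine ⟨hT.tr (ContinuousMap.const I x) ⟨fun t => K.cs (γ t), hcc.comp γ.continuous⟩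
    (fun _ => Metric.mem_ball_self hT.1.1) hγ, ?_⟩
  ext1 t
  apply Subtype.ext
  have := hT.tr_cx (ContinuousMap.const I x) ⟨fun t => K.cs (γ t), hcc.comp γ.continuous⟩
    (fun _ => Metric.mem_ball_self hT.1.1) hγ t
  change K.sc (K.cx _) = _
  rw [this]
  exact K.sc_cs (K.cs_P (γ t).2).1

variable {N : Type*} [Group N]

/-- all values are attained between any two points -/
lemma realize (τ : LS (UU K.g) N) (x0 : UU K.g) (hτ : ∀ n, ∃ α : Path x0 x0, τ.f α.toContinuousMap = n)
    (x y : K.S) (n : N) : ∃ α : C(I, K.S), α 0 = x ∧ α 1 = y ∧ τ.f (K.ps.comp α) = n := by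
  let a : Path x0 (K.ps x) := (PathConnectedSpace.joined _ _).somePath
  let b : Path x0 (K.ps y) := (PathConnectedSpace.joined _ _).somePath
  obtain ⟨γ, hγ⟩ := hτ (τ.f a.toContinuousMap * n * (τ.f b.toContinuousMap)⁻¹)
  obtain ⟨α, h0, h1, h2⟩ := K.LIFT τ x y ((a.symm.trans γ).trans b).toContinuousMap
    ((a.symm.trans γ).trans b).source ((a.symm.trans γ).trans b).target
  refine ⟨α, h0, h1, h2.trans ?_⟩
  rw [τ.mul, τ.mul, hγ, τ.f_symm]; group

end Cfg
end Oka
end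

open MvPolynomial
noncomputable section
namespace Oka
open unitInterval Set Topology Filter

lemma circ_norm {δ : ℝ} (hδ : 0 < δ) (t : I) : ‖(δ : ℂ) * Complex.exp (2 * Real.pi * Complex.I * t)‖ = δ := by
  have e : 2 * Real.pi * Complex.I * t = ((2 * Real.pi * t : ℝ) : ℂ) * Complex.I := by
    push_cast; ring
  rw [e, norm_mul, Complex.norm_exp_ofReal_mul_I, Complex.norm_real, Real.norm_of_nonneg hδ.le, mul_one]

lemma iso_pt (P : Finset ℂ) (p : ℂ) : ∃ r > 0, ∀ x : ℂ, x ∈ P → ‖x - p‖ < r → x = p := by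
  have : ((P.erase p : Finset ℂ) : Set ℂ)ᶜ ∈ 𝓝 p :=
    (P.erase p).finite_toSet.isClosed.isOpen_compl.mem_nhds (by simp)
  obtain ⟨r, hr, hb⟩ := Metric.mem_nhds_iff.1 this
  refine ⟨r, hr, fun x hx hn => ?_⟩
  by_contra hne
  exact hb (by rwa [Metric.mem_ball, dist_eq_norm]) (by simp [hne, hx])

namespace Cfg
variable {K : Cfg} {Γ : Type*} [Group Γ]

variable (K) in
lemma hS_parts {x : E3} (h : eval x K.hS ≠ 0) : eval x K.h0 ≠ 0 ∧ eval x K.fp ≠ 0 ∧ eval x K.fq ≠ 0 := by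
  rw [hS, map_mul] at h
  have h0 := left_ne_zero_of_mul h
  obtain ⟨h1, h2, -⟩ := (K.hh x).1 h0
  exact ⟨h0, h1, h2⟩

variable (K) in
lemma cx_rt {x : E3} (h : eval x K.hS ≠ 0) : K.cx (K.rt x) = K.cx x :=
  K.hd.cc_ret (K.hS_parts h).2.1 (K.hS_parts h).2.2

theorem R4core (τ : LS (UU K.g) Γ) {o : ℂ} {ε : ℝ} (hG : Good K.P o ε) (z : ℂ → Γ) (H : K.S → Γ)
    (hz : ∀ γ : C(I, K.S), τ.f (K.ps.comp γ) = (H (γ 0))⁻¹ * (St hG z).f (K.f.comp γ) * H (γ 1))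
    (F : Pol) (e : ℕ) (he : e ≠ 0) (c : ℂ) (hc : c ≠ 0) (w : ℂ) (hw : w ∈ K.P) (hFg : IsRelPrime F K.g)
    (hs : ∀ x, eval x K.hS ≠ 0 → x ∈ XX K.g → K.sc (K.cx x) = w + c * eval x F ^ e / eval x (K.gt (K.t 0)))
    (k : Pol) (hk : Irreducible k) (μ : ℕ) (a : Pol) (hμ : μ ≠ 0) (hF : F = k ^ μ * a) (ha : ¬ k ∣ a) :
    z w ^ (e * μ) = 1 := by
  obtain ⟨b, hb, hbk⟩ := (FiniteMultiplicity.of_prime_left hk.prime K.hS_ne).exists_eq_pow_mul_and_not_dvd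
  set ν := multiplicity k K.hS
  have hgk : ¬ k ∣ K.g := fun h => hk.not_isUnit (hFg (by rw [hF]; exact (dvd_pow_self k hμ).mul_right a) h)
  have hQ : ¬ k ∣ a * b * K.g := by
    intro h
    rcases hk.prime.dvd_or_dvd h with h | h
    · rcases hk.prime.dvd_or_dvd h with h | h
      exacts [ha h, hbk h]
    · exact hgk h
  obtain ⟨y, i, h1, h2, h3⟩ := exists_smooth_zero hk hQ
  simp only [map_mul, mul_ne_zero_iff] at h3
  obtain ⟨⟨ya, yb⟩, yg⟩ := h3
  let d : E3 := Pi.single i 1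
  have hroot : (lineP y d k).eval 0 = 0 := by rw [lineP_eval, zero_smul, add_zero, h1]
  obtain ⟨v, hv⟩ := Polynomial.dvd_iff_isRoot.2 hroot
  rw [Polynomial.C_0, sub_zero] at hv
  have hv0 : v.eval 0 ≠ 0 := by
    have h4 := lineP_deriv y d k
    rw [hv, Polynomial.derivative_mul, grad_apply] at h4
    simp [d, Pi.single_apply] at h4
    rw [h4]; exact h2
  have hcl : ∀ Q : Pol, Continuous fun s : ℂ => eval (y + s • d) Q := fun Q => by
    have := (lineP y d Q).continuous
    simpa only [lineP_eval] using this
  have hy0 : ∀ Q : Pol, eval (y + (0:ℂ) • d) Q = eval y Q := fun Q => by rw [zero_smul, add_zero]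
  have hkv : ∀ s : ℂ, eval (y + s • d) k = s * v.eval s := fun s => by
    rw [← lineP_eval, hv]; simp
  let u : ℂ → ℂ := fun s => c * (v.eval s) ^ (e * μ) * eval (y + s • d) a ^ e / eval (y + s • d) (K.gt (K.t 0))
  have yg0 := (K.g_eval_ne y).1 yg 0
  have hu : ∀ s, eval (y + s • d) K.g ≠ 0 → ContinuousAt u s := fun s hsg => by
    refine ContinuousAt.div ?_ (hcl _).continuousAt ((K.g_eval_ne _).1 hsg 0)
    have := hcl a
    have := v.continuous
    fun_prop
  have hu0 : u 0 ≠ 0 := by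
    refine div_ne_zero (mul_ne_zero (mul_ne_zero hc (pow_ne_zero _ hv0)) (pow_ne_zero _ ?_)) ?_
    · rw [hy0]; exact ya
    · rw [hy0]; exact yg0
  obtain ⟨r1, hr1, hiso⟩ := iso_pt K.P w
  have E1 : ∀ᶠ s in 𝓝 (0:ℂ), eval (y + s • d) K.g ≠ 0 := (hcl _).continuousAt.eventually_ne (by rw [hy0]; exact yg)
  have E2 : ∀ᶠ s in 𝓝 (0:ℂ), eval (y + s • d) b ≠ 0 := (hcl _).continuousAt.eventually_ne (by rw [hy0]; exact yb)
  have E33 : ∀ᶠ s in 𝓝 (0:ℂ), v.eval s ≠ 0 := v.continuous.continuousAt.eventually_ne hv0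
  have hu0c : ContinuousAt u 0 := hu 0 (by rw [hy0]; exact yg)
  have E4 : ∀ᶠ s in 𝓝 (0:ℂ), u s / u 0 ∈ Complex.slitPlane := by
    refine (hu0c.div_const (u 0)).eventually (Complex.isOpen_slitPlane.mem_nhds ?_)
    change u 0 / u 0 ∈ Complex.slitPlane
    rw [div_self hu0]; simp
  have E5 : ∀ᶠ s in 𝓝 (0:ℂ), ‖s ^ (e * μ) * u s‖ < r1 := by
    have h5 : ContinuousAt (fun s => ‖s ^ (e * μ) * u s‖) 0 := by fun_prop
    refine h5.eventually_lt_const ?_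
    change ‖(0:ℂ) ^ (e * μ) * u 0‖ < r1
    rw [zero_pow (mul_ne_zero he hμ)]; simpa using hr1
  obtain ⟨r, hr, hB⟩ := Metric.eventually_nhds_iff_ball.1 (E1.and (E2.and (E33.and (E4.and E5))))
  have hδ : 0 < r / 2 := by linarith
  have hin : ∀ t : I, ((r / 2 : ℝ) : ℂ) * Complex.exp (2 * Real.pi * Complex.I * t) ∈ Metric.ball (0:ℂ) r := fun t => by
    rw [mem_ball_zero_iff, circ_norm hδ]; linarith
  let cir : C(I, Metric.ball (0:ℂ) r) := ⟨fun t => ⟨_, hin t⟩, by fun_prop⟩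
  let disc : C(Metric.ball (0:ℂ) r, XX K.g) := ⟨fun s => ⟨y + (s:ℂ) • d, (hB s s.2).1⟩, by fun_prop⟩
  have : SimplyConnectedSpace (Metric.ball (0:ℂ) r) := convex_sc (convex_ball _ _) ⟨0, Metric.mem_ball_self hr⟩
  have c01 : cir 0 = cir 1 := by
    apply Subtype.ext
    simp [cir, Complex.exp_two_pi_mul_I]
  have tr1 : τ.f (K.pi.comp (disc.comp cir)) = 1 := by
    have := (τ.comap K.pi).f_eq_of_sc disc cir (ContinuousMap.const I (cir 0)) rfl (by rw [← c01]; rfl)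
    rw [LS.comap_f, LS.comap_f] at this
    rw [this]
    exact τ.f_eq_one_of_const _ fun t => rfl
  have hoff : ∀ t, eval ((disc.comp cir) t : E3) K.hS ≠ 0 := by
    intro t
    change eval (y + (cir t : ℂ) • d) K.hS ≠ 0
    rw [hb, map_mul, map_pow, hkv]
    refine mul_ne_zero (pow_ne_zero _ (mul_ne_zero ?_ (hB _ (hin t)).2.2.1)) (hB _ (hin t)).2.1
    rw [← norm_ne_zero_iff]
    change ‖((r / 2 : ℝ) : ℂ) * Complex.exp (2 * Real.pi * Complex.I * t)‖ ≠ 0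
    rw [circ_norm hδ]; exact hδ.ne'
  obtain ⟨ς, e1, e2⟩ := mfold u (e * μ) (r / 2) hδ (u 0) hu0 (by
    rw [continuous_iff_continuousAt]
    intro t
    exact (hu _ (hB _ (hin t)).1).comp (f := fun t : I => ((r / 2 : ℝ) : ℂ) * Complex.exp (2 * Real.pi * Complex.I * t))
      (by fun_prop)) (fun t => (hB _ (hin t)).2.2.2.1)
  have hγ : ∀ t, ((K.f.comp (K.rpath _ hoff)) t : ℂ) = w + Complex.exp (ς t) := by
    intro t
    rw [e1]
    have hx := K.cx_rt (hoff t)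
    change K.sc (K.cx (K.rt _)) = _
    rw [hx, hs _ (hoff t) ((disc.comp cir) t).2]
    change w + c * eval (y + (cir t : ℂ) • d) F ^ e / eval (y + (cir t : ℂ) • d) (K.gt (K.t 0)) =
      w + (cir t : ℂ) ^ (e * μ) * u (cir t)
    have hg0 := (K.g_eval_ne _).1 (hB _ (hin t)).1 0
    rw [hF, map_mul, map_pow, hkv]
    simp only [u]
    rw [mul_pow, ← pow_mul, mul_pow, mul_comm μ e]
    ring
  obtain ⟨g, hg⟩ := circ_rel hG (St hG z) z 1 (fun γ => by simp) w hw r1 hr1 hiso _ ς hγ (fun t => by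
    rw [hγ, add_sub_cancel_left, e1]; exact (hB _ (hin t)).2.2.2.2) (e * μ) e2
  have key := hz (K.rpath _ hoff)
  rw [rpath_ps, tr1, hg] at key
  have h01 : K.rpath _ hoff 1 = K.rpath _ hoff 0 := by
    apply Subtype.ext
    change K.rt (disc (cir 1)) = K.rt (disc (cir 0))
    rw [c01]
  rw [h01] at key
  have h6 : z w ^ (e * μ) = g⁻¹ * (H (K.rpath _ hoff 0) * ((H (K.rpath _ hoff 0))⁻¹ * (g * (z w ^ (e * μ))⁻¹ * g⁻¹) * H (K.rpath _ hoff 0)) * (H (K.rpath _ hoff 0))⁻¹)⁻¹ * g := by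
    group
  rw [h6, ← key]; group

variable (K) in
lemma relprime_g {F : Pol} (h : ∀ j, IsRelPrime F (K.gt (K.t j))) : IsRelPrime F K.g :=
  IsRelPrime.prod_right fun j _ => h j

variable (K) in
lemma fp_cop {c : ℂ} : IsRelPrime K.fp (K.gt c) := by
  intro d h1 h2
  have h3 : d ∣ K.fq ^ K.p := by
    have := ((h1.trans (dvd_pow_self _ K.q_ne)).mul_left (C c)).sub h2
    rw [gt] at this
    simpa using this
  exact (K.hd.hrel.pow_right (n := K.p)) h1 h3

variable (K) in
lemma fq_cop {c : ℂ} (hc : c ≠ 0) : IsRelPrime K.fq (K.gt c) := by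
  intro d h1 h2
  have h3 : d ∣ K.fp ^ K.q := by
    have := h2.add (h1.trans (dvd_pow_self _ K.p_ne))
    rw [gt, sub_add_cancel] at this
    exact ((isUnit_iff_ne_zero.2 hc).map (C : ℂ →+* Pol)).dvd_mul_left.1 this
  exact (K.hd.hrel.pow_left (m := K.q)) h3 h1

variable (K) in
lemma sc_cx_fq {x : E3} (h : eval x K.fp ≠ 0) (hx : x ∈ XX K.g) :
    K.sc (K.cx x) = eval x K.fq ^ K.p / eval x (K.gt (K.t 0)) := by
  have h1 : K.t 0 - K.cx x ≠ 0 := sub_ne_zero.2 ((K.g_eval_ne' h).1 hx 0).symm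
  rw [K.gt_eval' _ h, sc]
  have h2 : eval x K.fq ^ K.p = K.cx x * eval x K.fp ^ K.q := by rw [cx, cc]; field_simp
  rw [h2]; field_simp

variable (K) in
lemma sc_cx_gt {x : E3} (h : eval x K.fp ≠ 0) (hx : x ∈ XX K.g) {c : ℂ} (hc : c ≠ K.t 0) :
    K.sc (K.cx x) = K.sc c + (- K.t 0 / (K.t 0 - c)) * eval x (K.gt c) ^ 1 / eval x (K.gt (K.t 0)) := by
  have h1 : K.t 0 - K.cx x ≠ 0 := sub_ne_zero.2 ((K.g_eval_ne' h).1 hx 0).symm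
  have h2 : K.t 0 - c ≠ 0 := sub_ne_zero.2 hc.symm
  rw [K.gt_eval' _ h, K.gt_eval' _ h, sc, sc]
  field_simp
  ring

lemma mem_P0 : (0:ℂ) ∈ K.P := K.mem_P.2 (Or.inl rfl)
lemma mem_P1 : (-1:ℂ) ∈ K.P := K.mem_P.2 (Or.inr (Or.inl rfl))
lemma mem_PA {c : ℂ} (hc : c ∈ K.A1) : K.sc c ∈ K.P := K.mem_P.2 (Or.inr (Or.inr (Or.inl ⟨c, hc, rfl⟩)))
lemma mem_Pt (j : Fin K.r) : K.sc (K.t j.succ) ∈ K.P := K.mem_P.2 (Or.inr (Or.inr (Or.inr ⟨j, rfl⟩)))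

theorem R4 (τ : LS (UU K.g) Γ) {o : ℂ} {ε : ℝ} (hG : Good K.P o ε) (z : ℂ → Γ) (H : K.S → Γ)
    (hz : ∀ γ : C(I, K.S), τ.f (K.ps.comp γ) = (H (γ 0))⁻¹ * (St hG z).f (K.f.comp γ) * H (γ 1)) :
    z 0 ^ K.p = 1 ∧ z (-1) ^ K.q = 1 ∧ ∀ c ∈ K.A1, c ≠ 0 → z (K.sc c) = 1 := by
  refine ⟨?_, ?_, ?_⟩
  · refine pow_eq_one_of_mult K.hd.hfq0 K.hpowq _ fun k hk μ a hμ hF ha => ?_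
    rw [← pow_mul]
    refine R4core τ hG z H hz K.fq K.p K.p_ne 1 one_ne_zero 0 mem_P0
      (K.relprime_g fun j => K.fq_cop (K.t_ne j)) (fun x hx hx' => ?_) k hk μ a hμ hF ha
    rw [K.sc_cx_fq (K.hS_parts hx).2.1 hx', zero_add, one_mul]
  · refine pow_eq_one_of_mult K.hd.hfp0 K.hpowp _ fun k hk μ a hμ hF ha => ?_
    rw [← pow_mul]
    refine R4core τ hG z H hz K.fp K.q K.q_ne (K.t 0) (K.t_ne 0) (-1) mem_P1
      (K.relprime_g fun j => K.fp_cop) (fun x hx hx' => ?_) k hk μ a hμ hF ha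
    have h1 := (K.g_eval_ne x).1 hx' 0
    rw [K.sc_cx_fq (K.hS_parts hx).2.1 hx']
    have h2 := K.gt_eval (K.t 0) x
    field_simp
    rw [h2]; ring
  · intro c hc hc0
    refine pow_eq_one_of_mult (K.gt_ne c) (K.hpowc c hc0) _ fun k hk μ a hμ hF ha => ?_
    have h0 := K.A1_ne hc 0
    rw [← one_mul μ]
    refine R4core τ hG z H hz (K.gt c) 1 one_ne_zero (- K.t 0 / (K.t 0 - c))
      (div_ne_zero (neg_ne_zero.2 (K.t_ne 0)) (sub_ne_zero.2 h0.symm)) (K.sc c) (mem_PA hc)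
      (K.relprime_g fun j => K.gt_cop (K.A1_ne hc j)) (fun x hx hx' => ?_) k hk μ a hμ hF ha
    exact K.sc_cx_gt (K.hS_parts hx).2.1 hx' h0

end Cfg
end Oka
end

open MvPolynomial
noncomputable section
namespace Oka
open unitInterval Set Topology Filter

lemma loc_triv {P : Finset ℂ} {Γ : Type*} [Group Γ] (L : LS ↥((↑P : Set ℂ)ᶜ) Γ) (w0 : ℂ) (h : w0 ∉ P) :
    ∃ (r : ℝ) (a : ℂ → Γ), 0 < r ∧ Metric.ball w0 r ⊆ (↑P : Set ℂ)ᶜ ∧ ∀ γ : C(I, ↥((↑P : Set ℂ)ᶜ)), (∀ t, (γ t : ℂ) ∈ Metric.ball w0 r) →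
      L.f γ = (a (γ 0))⁻¹ * a (γ 1) := by
  have : (↑P : Set ℂ)ᶜ ∈ 𝓝 w0 := P.finite_toSet.isClosed.isOpen_compl.mem_nhds h
  obtain ⟨r, hr, hb⟩ := Metric.mem_nhds_iff.1 this
  obtain ⟨B, hB⟩ := L.triv_sub hb (convex_sc (convex_ball w0 r) ⟨w0, Metric.mem_ball_self hr⟩)
  exact ⟨r, B, hr, hb, hB⟩

section bet
variable {Γ : Type*} [Group Γ]

def bet (b : ℂ → Γ) (e : ℕ) (w : ℂ) : Γ := b (e * Complex.log w)

/-- good structure of a puncture with an `e`-th root -/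
structure Pun (P : Finset ℂ) (L : LS ↥((↑P : Set ℂ)ᶜ) Γ) (p : ℂ) (e : ℕ) (R : ℝ) (b : ℂ → Γ) (c : Γ) : Prop where
  he : e ≠ 0
  hP : ∀ s : ℂ, s.re < R → p + Complex.exp s ∉ P
  hb : ∀ (γ : C(I, ↥((↑P : Set ℂ)ᶜ))) (ς : C(I, ℂ)), (∀ t, (ς t).re < R) →
      (∀ t, (γ t : ℂ) = p + Complex.exp (ς t)) → L.f γ = (b (ς 0))⁻¹ * b (ς 1)
  hper : ∀ s : ℂ, s.re < R → ∀ k : ℕ, b (s + k * (2 * Real.pi * Complex.I)) = c ^ k * b s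
  hc : c ^ e = 1

variable {P : Finset ℂ} {L : LS ↥((↑P : Set ℂ)ᶜ) Γ} {p : ℂ} {e : ℕ} {R : ℝ} {b : ℂ → Γ} {c : Γ}

lemma Pun.perZ (h : Pun P L p e R b c) {s : ℂ} (hs : s.re < R) (k : ℤ) :
    b (s + k * (2 * Real.pi * Complex.I)) = c ^ k * b s := by
  obtain ⟨n, rfl | rfl⟩ := k.eq_nat_or_neg
  · have := h.hper s hs n
    simpa using this
  · have h1 : (s + ((-(n:ℤ) : ℤ) : ℂ) * (2 * Real.pi * Complex.I)).re < R := by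
      have : (((n:ℂ)) * (2 * Real.pi * Complex.I)).re = 0 := by simp
      push_cast
      rw [neg_mul, Complex.add_re, Complex.neg_re, this]; simpa using hs
    have h2 := h.hper _ h1 n
    have e2 : s + ((-(n:ℤ) : ℤ) : ℂ) * (2 * Real.pi * Complex.I) + n * (2 * Real.pi * Complex.I) = s := by
      push_cast; ring
    rw [e2] at h2
    rw [h2]; simp

lemma Pun.bet_zeta (h : Pun P L p e R b c) {ζ w w' : ℂ} (hζ : ζ ^ e = 1) (hw : w ≠ 0) (hw' : w' ≠ 0)
    (h1 : ((e:ℂ) * Complex.log w).re < R) (h1' : ((e:ℂ) * Complex.log w').re < R) :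
    bet b e (ζ * w) * (bet b e w)⁻¹ = bet b e (ζ * w') * (bet b e w')⁻¹ := by
  have he : (e:ℂ) ≠ 0 := by exact_mod_cast h.he
  have hζ0 : ζ ≠ 0 := by rintro rfl; rw [zero_pow h.he] at hζ; exact zero_ne_one hζ
  have key : ∀ w : ℂ, w ≠ 0 → ((e:ℂ) * Complex.log w).re < R → ∃ k : ℤ,
      bet b e (ζ * w) * (bet b e w)⁻¹ = c ^ k ∧ ζ = Complex.exp (k * (2 * Real.pi * Complex.I) / e) := by
    intro w hw h1
    have e1 : Complex.exp (e * Complex.log (ζ * w)) = Complex.exp (e * Complex.log w) := by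
      rw [Complex.exp_nat_mul, Complex.exp_nat_mul, Complex.exp_log hw, Complex.exp_log (mul_ne_zero hζ0 hw), mul_pow, hζ, one_mul]
    obtain ⟨k, hk⟩ := Complex.exp_eq_exp_iff_exists_int.1 e1
    refine ⟨k, ?_, ?_⟩
    · rw [bet, hk, h.perZ h1, bet]; group
    · have e2 : k * (2 * Real.pi * Complex.I) / e = Complex.log (ζ * w) - Complex.log w := by
        field_simp
        linear_combination -hk
      rw [e2, Complex.exp_sub, Complex.exp_log hw, Complex.exp_log (mul_ne_zero hζ0 hw), mul_div_cancel_right₀ _ hw]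
  obtain ⟨k, k1, k2⟩ := key w hw h1
  obtain ⟨k', k1', k2'⟩ := key w' hw' h1'
  rw [k1, k1']
  obtain ⟨n, hn⟩ := Complex.exp_eq_exp_iff_exists_int.1 (k2.symm.trans k2')
  have hk : (k:ℂ) = k' + n * e := by
    have h3 : (2 * Real.pi * Complex.I) ≠ 0 := Complex.two_pi_I_ne_zero
    field_simp at hn
    have h4 : (2 * Real.pi * Complex.I) * k = (2 * Real.pi * Complex.I) * (k' + n * e) := by linear_combination (2 * Real.pi * Complex.I) * hn
    exact mul_left_cancel₀ h3 h4
  have hk' : k = k' + n * e := by exact_mod_cast hk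
  rw [hk', zpow_add, mul_comm n, zpow_mul, zpow_natCast, h.hc, one_zpow, mul_one]

lemma Pun.bet_loc (h : Pun P L p e R b c) {w0 : ℂ} (hw : w0 ≠ 0) (h1 : ((e:ℂ) * Complex.log w0).re < R)
    {r : ℝ} (hr : 0 < r) {a : ℂ → Γ} (ha : ∀ γ : C(I, ↥((↑P : Set ℂ)ᶜ)),
      (∀ t, (γ t : ℂ) ∈ Metric.ball (p + w0 ^ e) r) → L.f γ = (a (γ 0))⁻¹ * a (γ 1)) :
    ∀ᶠ w' in 𝓝 w0, (a (p + w0 ^ e))⁻¹ * a (p + w' ^ e) = (bet b e w0)⁻¹ * bet b e w' := by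
  have he : (e:ℂ) ≠ 0 := by exact_mod_cast h.he
  have hexp : Complex.exp (e * Complex.log w0) = w0 ^ e := by
    rw [Complex.exp_nat_mul, Complex.exp_log hw]
  have E1 : ∀ᶠ y in 𝓝 (0:ℂ), p + Complex.exp (e * Complex.log w0 + y) ∈ Metric.ball (p + w0 ^ e) r ∧
      (e * Complex.log w0 + y).re < R := by
    have c1 : ContinuousAt (fun y : ℂ => p + Complex.exp (e * Complex.log w0 + y)) 0 := by fun_prop
    have c2 : ContinuousAt (fun y : ℂ => (e * Complex.log w0 + y).re) 0 := by fun_prop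
    refine Filter.Eventually.and (c1.eventually_mem (s := Metric.ball (p + w0 ^ e) r) ?_) (c2.eventually_lt_const ?_)
    · simp only [add_zero, hexp]; exact Metric.ball_mem_nhds _ hr
    · simpa using h1
  obtain ⟨η, hη, hball⟩ := Metric.eventually_nhds_iff_ball.1 E1
  have E2 : ∀ᶠ w' in 𝓝 w0, ‖(e:ℂ) * Complex.log (w' / w0)‖ < η := by
    have c3 : ContinuousAt (fun w' : ℂ => ‖(e:ℂ) * Complex.log (w' / w0)‖) w0 := by
      refine (continuousAt_const.mul (ContinuousAt.clog (continuousAt_id.div_const w0) ?_)).norm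
      simp [div_self hw]
    refine c3.eventually_lt_const ?_
    simp [div_self hw, hη]
  filter_upwards [E2, eventually_ne_nhds hw] with w' hw' hw0
  let y : ℂ := e * Complex.log (w' / w0)
  have hy : ∀ t : I, (t:ℂ) * y ∈ Metric.ball (0:ℂ) η := fun t => by
    rw [mem_ball_zero_iff, norm_mul]
    refine lt_of_le_of_lt ?_ hw'
    have : ‖((t:ℝ):ℂ)‖ ≤ 1 := by
      rw [Complex.norm_real, Real.norm_of_nonneg t.2.1]; exact t.2.2
    exact mul_le_of_le_one_left (norm_nonneg _) this
  let ς : C(I, ℂ) := ⟨fun t => e * Complex.log w0 + t * y, by fun_prop⟩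
  have hς : ∀ t, (ς t).re < R := fun t => (hball _ (hy t)).2
  let γ : C(I, ↥((↑P : Set ℂ)ᶜ)) := ⟨fun t => ⟨p + Complex.exp (ς t), h.hP _ (hς t)⟩, by fun_prop⟩
  have f1 := ha γ fun t => (hball _ (hy t)).1
  have f2 := h.hb γ ς hς fun t => rfl
  have s0 : ς 0 = e * Complex.log w0 := by simp [ς]
  have s1 : ς 1 = e * Complex.log w0 + y := by simp [ς]
  have x1 : Complex.exp (ς 1) = w' ^ e := by
    rw [s1, Complex.exp_add, hexp, Complex.exp_nat_mul, Complex.exp_log (div_ne_zero hw0 hw), div_pow, mul_div_cancel₀ _ (pow_ne_zero e hw)]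
  have g0 : (γ 0 : ℂ) = p + w0 ^ e := by
    change p + Complex.exp (ς 0) = _
    rw [s0, hexp]
  have g1 : (γ 1 : ℂ) = p + w' ^ e := by
    change p + Complex.exp (ς 1) = _
    rw [x1]
  rw [g0, g1] at f1
  rw [← f1, f2, s0]
  congr 1
  have e3 : Complex.exp (Complex.log w0 + Complex.log (w' / w0)) = Complex.exp (Complex.log w') := by
    rw [Complex.exp_add, Complex.exp_log hw, Complex.exp_log hw0, Complex.exp_log (div_ne_zero hw0 hw)]
    field_simp
  obtain ⟨k, hk⟩ := Complex.exp_eq_exp_iff_exists_int.1 e3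
  have e4 : ς 1 = e * Complex.log w' + ((k * e : ℤ) : ℂ) * (2 * Real.pi * Complex.I) := by
    rw [s1]; push_cast
    linear_combination e * hk
  have hre : ((e:ℂ) * Complex.log w').re < R := by
    have h5 := hς 1
    rw [e4] at h5
    have h6 : (((k * e : ℤ) : ℂ) * (2 * Real.pi * Complex.I)).re = 0 := by simp
    rw [Complex.add_re, h6, add_zero] at h5
    exact h5
  rw [e4, h.perZ hre, mul_comm k, zpow_mul, zpow_natCast, h.hc, one_zpow, one_mul, bet]

end bet
end Oka
end

open MvPolynomial
noncomputable section
namespace Oka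
open unitInterval Set Topology Filter

/-- data for orbifold charts -/
structure Orb (U : Type) [TopologicalSpace U] (s : C(U, ℂ)) (J : Set ℂ) (e : ℂ → ℕ) where
  ix : Type
  O : ix → Set U
  h : ix → ℂ → U → ℂ
  θ : ix → ℂ → U → ℂ
  hO : ∀ i, IsOpen (O i)
  cov : ∀ x, ∃ i, x ∈ O i
  hcont : ∀ i, ∀ p ∈ J, ∀ x ∈ O i, ContinuousAt (h i p) x
  hh : ∀ i, ∀ p ∈ J, ∀ x ∈ O i, h i p x ^ e p = s x - p
  hθ : ∀ i, ∀ p ∈ J, ∀ x ∈ O i, θ i p x ≠ 0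
  comp : ∀ i j, ∀ p ∈ J, ∀ x ∈ O i, x ∈ O j → ∃ ζ : ℂ, ζ ^ e p = 1 ∧ ∀ᶠ x' in 𝓝 x,
    h i p x' = ζ * h j p x' ∧ θ i p x' = ζ * θ j p x'

theorem Orb.ext {U : Type} [TopologicalSpace U] {s : C(U, ℂ)} {J : Set ℂ} {e : ℂ → ℕ} (Ω : Orb U s J e)
    {P : Finset ℂ} {Γ : Type*} [Group Γ] (L : LS ↥((↑P : Set ℂ)ᶜ) Γ) (hs : ∀ x, s x ∈ P → s x ∈ J) (hJ : J ⊆ ↑P)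
    (R : ℂ → ℝ) (b : ℂ → ℂ → Γ) (c : ℂ → Γ) (hP : ∀ p ∈ J, Pun P L p (e p) (R p) (b p) (c p)) :
    ∃ Φ : LS U Γ, ∀ (W : Type) [TopologicalSpace W] (k : C(W, U)) (k' : C(W, ↥((↑P : Set ℂ)ᶜ))),
      (∀ w, s (k w) = k' w) → ∀ γ : C(I, W), Φ.f (k.comp γ) = L.f (k'.comp γ) := by
  classical
  choose! r a hr hrb ha using fun w0 h => loc_triv L w0 h
  let lv : ℂ → ℂ → ℂ := fun p θ => (Real.exp ((R p - 1) / e p) : ℂ) * (θ / ‖θ‖)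
  let val : Ω.ix → ℂ → U → ℂ := fun i p x => if Ω.h i p x = 0 then lv p (Ω.θ i p x) else Ω.h i p x
  let O : (↥((↑P : Set ℂ)ᶜ) ⊕ (Ω.ix × J)) → Set U := Sum.elim
    (fun w0 => {x | s x ∈ Metric.ball (w0:ℂ) (r w0)})
    (fun i => {x | x ∈ Ω.O i.1 ∧ s x ∈ Metric.ball (i.2:ℂ) (Real.exp (R i.2))})
  let u : (↥((↑P : Set ℂ)ᶜ) ⊕ (Ω.ix × J)) → U → Γ := Sum.elim
    (fun w0 x => (a w0 (s x))⁻¹) (fun i x => (bet (b i.2) (e i.2) (val i.1 i.2 x))⁻¹)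
  have sc : Continuous s := s.continuous
  -- re bound
  have hre : ∀ i, ∀ p ∈ J, ∀ x ∈ Ω.O i, s x ∈ Metric.ball p (Real.exp (R p)) →
      val i p x ≠ 0 ∧ ((e p : ℂ) * Complex.log (val i p x)).re < R p := by
    intro i p hp x hx hsx
    have he : (e p : ℝ) ≠ 0 := by exact_mod_cast (hP p hp).he
    have hre' : ∀ w : ℂ, ((e p : ℂ) * Complex.log w).re = e p * Real.log ‖w‖ := by
      intro w
      rw [Complex.mul_re, Complex.log_re]; simp
    by_cases h0 : Ω.h i p x = 0
    · have hθ := Ω.hθ i p hp x hx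
      have hn : ‖lv p (Ω.θ i p x)‖ = Real.exp ((R p - 1) / e p) := by
        simp only [lv]
        rw [norm_mul, Complex.norm_real, norm_div, Complex.norm_real, norm_norm, div_self (norm_ne_zero_iff.2 hθ), mul_one,
          Real.norm_of_nonneg (Real.exp_pos _).le]
      have hv : val i p x = lv p (Ω.θ i p x) := if_pos h0
      rw [hv]
      refine ⟨norm_ne_zero_iff.1 (by rw [hn]; exact (Real.exp_pos _).ne'), ?_⟩
      rw [hre', hn, Real.log_exp, mul_div_cancel₀ _ he]; linarith
    · have hv : val i p x = Ω.h i p x := if_neg h0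
      rw [hv]
      refine ⟨h0, ?_⟩
      rw [hre', ← Real.log_pow, ← norm_pow, Ω.hh i p hp x hx, Real.log_lt_iff_lt_exp]
      · rwa [← dist_eq_norm]
      · rw [← Ω.hh i p hp x hx]; exact norm_pos_iff.2 (pow_ne_zero _ h0)
  -- key property at generic points
  have star : ∀ i x, x ∈ O i → s x ∉ P → ∀ᶠ x' in 𝓝 x, a (s x) (s x') * u i x' = a (s x) (s x) * u i x := by
    rintro (w0 | ⟨i, p, hp⟩) x hx hsx
    · have hb : Metric.ball (s x) (r (s x)) ∩ Metric.ball (w0:ℂ) (r w0) ∈ 𝓝 (s x) :=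
        Filter.inter_mem (Metric.ball_mem_nhds _ (hr _ hsx)) (Metric.isOpen_ball.mem_nhds hx)
      obtain ⟨η, hη, hsub⟩ := Metric.mem_nhds_iff.1 (Filter.inter_mem hb
        (P.finite_toSet.isClosed.isOpen_compl.mem_nhds hsx))
      filter_upwards [sc.continuousAt (Metric.ball_mem_nhds _ hη)] with x' hx'
      have hx' : s x' ∈ Metric.ball (s x) η := hx'
      have hm : ∀ t : I, seg (s x) (s x') t ∈ Metric.ball (s x) η := fun t =>
        seg_mem (convex_ball _ _) (Metric.mem_ball_self hη) hx' t
      let γ : C(I, ↥((↑P : Set ℂ)ᶜ)) := ⟨fun t => ⟨seg (s x) (s x') t, (hsub (hm t)).2⟩, by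
        refine Continuous.subtype_mk ?_ _
        exact cont_seg.comp (by fun_prop : Continuous fun t : I => (t, s x, s x'))⟩
      have f1 := ha _ hsx γ fun t => (hsub (hm t)).1.1
      have f2 := ha _ w0.2 γ fun t => (hsub (hm t)).1.2
      have g0 : (γ 0 : ℂ) = s x := by simp [γ, seg]
      have g1 : (γ 1 : ℂ) = s x' := by simp [γ, seg]
      rw [g0, g1] at f1 f2
      change a (s x) (s x') * (a w0 (s x'))⁻¹ = a (s x) (s x) * (a w0 (s x))⁻¹
      have f3 : a (s x) (s x') = a (s x) (s x) * ((a w0 (s x))⁻¹ * a w0 (s x')) := by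
        rw [← f2, f1]; group
      rw [f3]; group
    · have hx1 : x ∈ Ω.O i := hx.1
      have e1 := Ω.hh i p hp x hx1
      have h0 : Ω.h i p x ≠ 0 := by
        intro h0
        rw [h0, zero_pow (hP p hp).he] at e1
        apply hsx
        rw [sub_eq_zero.1 e1.symm]
        exact hJ hp
      have hv : val i p x = Ω.h i p x := if_neg h0
      have hb := hre i p hp x hx1 hx.2
      rw [hv] at hb
      have e2 : s x = p + Ω.h i p x ^ e p := by rw [e1]; ring
      have l := (hP p hp).bet_loc hb.1 hb.2 (hr _ hsx) (a := a (s x)) (by rw [← e2]; exact ha _ hsx)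
      have hc := Ω.hcont i p hp x hx1
      filter_upwards [hc.eventually l, hc.eventually_ne h0, (Ω.hO i).mem_nhds hx1] with x' l' h0' hx'
      have hv' : val i p x' = Ω.h i p x' := if_neg h0'
      have e2' : p + Ω.h i p x' ^ e p = s x' := by rw [Ω.hh i p hp x' hx']; ring
      rw [e2', ← e2] at l'
      change a (s x) (s x') * (bet (b p) (e p) (val i p x'))⁻¹ = a (s x) (s x) * (bet (b p) (e p) (val i p x))⁻¹
      rw [hv, hv']
      have f3 : a (s x) (s x') = a (s x) (s x) * ((bet (b p) (e p) (Ω.h i p x))⁻¹ * bet (b p) (e p) (Ω.h i p x')) := by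
        rw [← l']; group
      rw [f3]; group
  have hOo : ∀ i, IsOpen (O i) := by
    rintro (w0 | ⟨i, p⟩)
    · exact Metric.isOpen_ball.preimage sc
    · exact (Ω.hO i).inter (Metric.isOpen_ball.preimage sc)
  have hcov : ∀ x, ∃ i, x ∈ O i := by
    intro x
    by_cases hx : s x ∈ P
    · obtain ⟨i, hi⟩ := Ω.cov x
      exact ⟨Sum.inr (i, ⟨s x, hs x hx⟩), hi, Metric.mem_ball_self (Real.exp_pos _)⟩
    · exact ⟨Sum.inl ⟨s x, hx⟩, Metric.mem_ball_self (hr _ hx)⟩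
  have hloc : ∀ i j x, x ∈ O i → x ∈ O j → ∀ᶠ x' in 𝓝 x, (u j x')⁻¹ * u i x' = (u j x)⁻¹ * u i x := by
    intro i j x hi hj
    by_cases hx : s x ∈ P
    · have hpt : ∀ i, x ∈ O i → ∃ (i' : Ω.ix) (hp : s x ∈ J), i = Sum.inr (i', ⟨s x, hp⟩) := by
        rintro (w0 | ⟨i, p, hp⟩) hi
        · exact absurd hx (hrb _ w0.2 hi)
        · have : s x = p := by
            by_contra hne
            have h0 : s x - p ≠ 0 := sub_ne_zero.2 hne
            refine (hP p hp).hP (Complex.log (s x - p)) ?_ ?_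
            · rw [Complex.log_re, Real.log_lt_iff_lt_exp (norm_pos_iff.2 h0), ← dist_eq_norm]; exact hi.2
            · rw [Complex.exp_log h0, add_sub_cancel]; exact hx
          subst this
          exact ⟨i, hp, rfl⟩
      obtain ⟨i, hp, rfl⟩ := hpt i hi
      obtain ⟨j, hp2, rfl⟩ := hpt j hj
      obtain ⟨ζ, hζ, hev⟩ := Ω.comp i j _ hp x hi.1 hj.1
      have hζ0 : ζ ≠ 0 := by rintro rfl; rw [zero_pow (hP _ hp).he] at hζ; exact zero_ne_one hζ
      have hζ1 : ‖ζ‖ = 1 := Complex.norm_eq_one_of_pow_eq_one hζ (hP _ hp).he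
      have hval : ∀ᶠ x' in 𝓝 x, val i (s x) x' = ζ * val j (s x) x' := by
        filter_upwards [hev] with x' h
        by_cases h0 : Ω.h j (s x) x' = 0
        · have h0' : Ω.h i (s x) x' = 0 := by rw [h.1, h0, mul_zero]
          simp only [val]
          rw [if_pos h0, if_pos h0', h.2]
          simp only [lv]
          rw [norm_mul, hζ1, one_mul]; ring
        · have h0' : Ω.h i (s x) x' ≠ 0 := by rw [h.1]; exact mul_ne_zero hζ0 h0
          simp only [val]
          rw [if_neg h0, if_neg h0', h.1]
      have hjo : O (Sum.inr (j, ⟨s x, hp⟩)) ∈ 𝓝 x := (hOo _).mem_nhds hj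
      filter_upwards [hval, hjo] with x' v1 hx'
      have v0 := hval.self_of_nhds
      change ((bet (b (s x)) (e (s x)) (val j (s x) x'))⁻¹)⁻¹ * (bet (b (s x)) (e (s x)) (val i (s x) x'))⁻¹ =
        ((bet (b (s x)) (e (s x)) (val j (s x) x))⁻¹)⁻¹ * (bet (b (s x)) (e (s x)) (val i (s x) x))⁻¹
      obtain ⟨n1, r1⟩ := hre j (s x) hp x' hx'.1 hx'.2
      obtain ⟨n2, r2⟩ := hre j (s x) hp x hj.1 hj.2
      have key := congrArg (·⁻¹) ((hP _ hp).bet_zeta hζ n1 n2 r1 r2)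
      simp only [mul_inv_rev] at key
      rw [v1, v0]; exact key
    · filter_upwards [star i x hi hx, star j x hj hx] with x' h1 h2
      have f1 : u i x' = (a (s x) (s x'))⁻¹ * (a (s x) (s x) * u i x) := by rw [← h1]; group
      have f2 : u j x' = (a (s x) (s x'))⁻¹ * (a (s x) (s x) * u j x) := by rw [← h2]; group
      rw [f1, f2]; group
  obtain ⟨Φ, hΦ⟩ := exists_LS (O := O) (u := u) (Γ := Γ) hOo hcov hloc
  refine ⟨Φ, fun W _ k k' hk γ => ?_⟩
  have := (Φ.comap k).locGlob2 (L.comap k') 1 (fun w => ?_) γ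
  · simpa [LS.comap_f] using this
  · refine ⟨{w' : W | s (k w') ∈ Metric.ball (k' w : ℂ) (r (k' w))}, ?_, fun γ hγ => ?_⟩
    · refine (sc.comp k.continuous).continuousAt.preimage_mem_nhds ?_
      change _ ∈ 𝓝 (s (k w))
      rw [hk]; exact Metric.ball_mem_nhds _ (hr _ (k' w).2)
    · rw [LS.comap_f, LS.comap_f, hΦ (Sum.inl (k' w)) (k.comp γ) hγ, ha _ (k' w).2 (k'.comp γ) (fun t => by
        have := hγ t
        change s (k (γ t)) ∈ Metric.ball (k' w : ℂ) (r (k' w)) at this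
        rw [hk] at this; exact this)]
      simp [u, hk]
end Oka
end

open MvPolynomial
noncomputable section
namespace Oka
open unitInterval Set Topology Filter

lemma exists_pun {P : Finset ℂ} {o : ℂ} {ε : ℝ} (hG : Good P o ε) {Γ : Type*} [Group Γ] (z : ℂ → Γ) (p : ℂ) (hp : p ∈ P)
    (e : ℕ) (he : e ≠ 0) (hz : z p ^ e = 1) : ∃ R b c, Pun P (St hG z) p e R b c := by
  obtain ⟨r, hr, hiso⟩ := iso_pt P p
  have hS : ∀ s : ℂ, s.re < Real.log r → p + Complex.exp s ∉ P := fun s hs h => by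
    have := hiso _ h (by simpa using exp_lt_of_re hr hs)
    simp [Complex.exp_ne_zero] at this
  obtain ⟨b, c, hb, hper⟩ := disc_struct (St hG z) p (Real.log r) hS
  obtain ⟨g, hg⟩ := St_circle hG (St hG z) z 1 (fun γ => by simp) p hp _ hS b hb c fun s hs => by
    simpa using hper s hs 1
  refine ⟨_, b, c, he, hS, hb, hper, ?_⟩
  rw [hg, conj_pow, inv_pow, hz]; group

lemma St_sub {P P' : Finset ℂ} {o : ℂ} {ε : ℝ} (hG : Good P o ε) (hP : P' ⊆ P) {Γ : Type*} [Group Γ] (z : ℂ → Γ)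
    (hz : ∀ p ∈ P, p ∉ P' → z p = 1) (j : C(↥((↑P : Set ℂ)ᶜ), ↥((↑P' : Set ℂ)ᶜ))) (hj : ∀ w, (j w : ℂ) = w)
    (γ : C(I, ↥((↑P : Set ℂ)ᶜ))) : (St (hG.mono hP) z).f (j.comp γ) = (St hG z).f γ := by
  have := ((St (hG.mono hP) z).comap j).locGlob2 (St hG z) 1 (planar_loc hG _ ?_ ?_) γ
  · simpa [LS.comap_f] using this
  · intro γ h
    rw [LS.comap_f, St_V0 hG z γ h, St_V0 _ z]
    · simp
    · intro t p hp
      change (j (γ t) : ℂ) ∉ _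
      rw [hj]; exact h t p (hP hp)
  · intro p hp γ h
    rw [LS.comap_f, St_Vs hG z hp γ h]
    by_cases hp' : p ∈ P'
    · rw [St_Vs _ z hp' _ (fun t => by change (j (γ t) : ℂ) ∈ Vs o ε p; rw [hj]; exact h t)]
      simp [hj]
    · rw [St_V0 _ z]
      · simp [uu, hz p hp hp']
      · intro t p' h' hr
        change (j (γ t) : ℂ) ∈ _ at hr
        rw [hj] at hr
        exact hp' (Vs_ray hG hp (hP h') (h t) hr ▸ h')

namespace Cfg
variable {K : Cfg}

lemma gt0_ne (x : UU K.g) (j) : eval (x : P2).rep (K.gt (K.t j)) ≠ 0 := (K.g_eval_ne _).1 x.2 j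

lemma gt_smul (c a : ℂ) (v : E3) : eval (a • v) (K.gt c) = a ^ (K.p * K.q) * eval v (K.gt c) :=
  eval_smul_hom (K.gt_hom c) a v

def sq (v : E3) : ℂ := eval v K.fq ^ K.p / eval v (K.gt (K.t 0))

lemma sq_smul (a : ℂ) (v : E3) (ha : a ≠ 0) : K.sq (a • v) = K.sq v := by
  have : a ^ (K.p * K.q) ≠ 0 := pow_ne_zero _ ha
  rw [sq, gt_smul, eval_smul_hom K.hd.hfq, mul_pow, ← pow_mul, mul_comm K.q, mul_div_mul_left _ _ this, sq]

lemma cont_UU {Y : Type*} [TopologicalSpace Y] (f : E3 → Y)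
    (hhom : ∀ (a : ℂ) (v : E3), a ≠ 0 → v ≠ 0 → f (a • v) = f v) (x : UU K.g)
    (hf : ContinuousAt f (x : P2).rep) : ContinuousAt (fun x : UU K.g => f (x : P2).rep) x :=
  (cont_desc f hhom _ hf).comp (f := fun x : UU K.g => (x : P2)) continuous_subtype_val.continuousAt

variable (K) in
def su : C(UU K.g, ℂ) := ⟨fun x => K.sq (x : P2).rep, by
  rw [continuous_iff_continuousAt]
  refine fun x => cont_UU K.sq (fun a v ha _ => sq_smul a v ha) x ?_
  exact ((cont_eval _).continuousAt.pow _).div (cont_eval _).continuousAt (gt0_ne x 0)⟩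

lemma su_ps (x : K.S) : K.su (K.ps x) = K.f x := by
  obtain ⟨a, ha, h⟩ := pr_rep K.g_hom K.dg_ne (K.ι x)
  change K.sq (((pr K.g_hom K.dg_ne (K.ι x) : UU K.g) : P2).rep) = K.sc (K.cx x)
  rw [h, sq_smul _ _ ha, K.sc_cx_fq x.2.1.1.1 (K.S_sub x.2)]
  rfl

variable (K) in
/-- local sections of the normalisation `gt (t 0) = 1` -/
def Sect : Type := {i : Set (UU K.g) × (UU K.g → ℂ) // IsOpen i.1 ∧ ∀ x ∈ i.1,
  i.2 x ^ (K.p * K.q) * eval (x : P2).rep (K.gt (K.t 0)) = 1 ∧ ContinuousAt (fun x => i.2 x • (x : P2).rep) x}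

lemma sect_ex (x0 : UU K.g) : ∃ i : K.Sect, x0 ∈ i.1.1 := by
  have hN : K.p * K.q ≠ 0 := mul_ne_zero K.p_ne K.q_ne
  have hN' : ((K.p * K.q : ℕ) : ℂ) ≠ 0 := by exact_mod_cast hN
  obtain ⟨k, hk⟩ : ∃ k, (x0 : P2).rep k ≠ 0 := by
    by_contra h; push Not at h; exact (x0 : P2).rep_nonzero (funext h)
  let R : E3 → ℂ := fun v => v k ^ (K.p * K.q) / eval v (K.gt (K.t 0))
  have hR : ∀ (a : ℂ) (v : E3), a ≠ 0 → R (a • v) = R v := fun a v ha => by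
    simp only [R]
    rw [gt_smul, Pi.smul_apply, smul_eq_mul, mul_pow, mul_div_mul_left _ _ (pow_ne_zero _ ha)]
  have hR0 : R (x0 : P2).rep ≠ 0 := div_ne_zero (pow_ne_zero _ hk) (gt0_ne x0 0)
  set R0 := R (x0 : P2).rep with hR0d
  obtain ⟨ω, hω⟩ := IsAlgClosed.exists_pow_nat_eq R0 (Nat.pos_of_ne_zero hN)
  let μ : E3 → ℂ := fun v => (v k)⁻¹ * ω * Complex.exp (Complex.log (R v / R0) / (K.p * K.q : ℕ))
  have hRc : ∀ x : UU K.g, ContinuousAt R (x : P2).rep := fun x =>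
    ((continuous_apply k).continuousAt.pow _).div (cont_eval _).continuousAt (gt0_ne x 0)
  have hRk : ∀ x : UU K.g, R (x : P2).rep / R0 ∈ Complex.slitPlane → (x : P2).rep k ≠ 0 := by
    intro x hx h
    simp [R, h, zero_pow hN] at hx
  refine ⟨⟨({x | R (x : P2).rep / R0 ∈ Complex.slitPlane}, fun x => μ (x : P2).rep), ?_, fun x hx => ⟨?_, ?_⟩⟩, ?_⟩
  · refine Complex.isOpen_slitPlane.preimage (f := fun x : UU K.g => R (x : P2).rep / R0) ?_
    rw [continuous_iff_continuousAt]
    exact fun x => (cont_UU R (fun a v ha _ => hR a v ha) x (hRc x)).div_const _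
  · have hx : R (x : P2).rep / R0 ∈ Complex.slitPlane := hx
    have h1 := hRk x hx
    have h2 := gt0_ne x 0
    change μ _ ^ _ * _ = _
    simp only [μ]
    rw [mul_pow, mul_pow, hω, ← Complex.exp_nat_mul, mul_div_cancel₀ _ hN', Complex.exp_log (Complex.slitPlane_ne_zero hx),
      mul_assoc _ R0, mul_div_cancel₀ _ hR0]
    simp only [R]
    field_simp
    rw [← mul_pow, one_div, inv_mul_cancel₀ h1, one_pow]
  · have hx : R (x : P2).rep / R0 ∈ Complex.slitPlane := hx
    refine cont_UU (fun v => μ v • v) (fun a v ha _ => ?_) x ?_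
    · simp only [μ]
      rw [hR a v ha, Pi.smul_apply, smul_eq_mul, smul_smul]
      congr 1
      field_simp
    · refine ContinuousAt.fun_smul ?_ continuousAt_id
      refine ((((continuous_apply k).continuousAt).inv₀ (hRk x hx)).mul continuousAt_const).mul ?_
      exact ContinuousAt.cexp ((((hRc x).div_const _).clog hx).div_const _)
  · change R (x0 : P2).rep / R0 ∈ Complex.slitPlane
    rw [← hR0d, div_self hR0]; exact Complex.one_mem_slitPlane

lemma sect_comp (i j : K.Sect) (x : UU K.g) (hi : x ∈ i.1.1) (hj : x ∈ j.1.1) : ∃ ζ : ℂ, ζ ^ (K.p * K.q) = 1 ∧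
    ∀ᶠ x' in 𝓝 x, i.1.2 x' = ζ * j.1.2 x' := by
  have hN : K.p * K.q ≠ 0 := mul_ne_zero K.p_ne K.q_ne
  have hne : ∀ (i : K.Sect) (x : UU K.g), x ∈ i.1.1 → i.1.2 x ≠ 0 := fun i x hx h => by
    have := (i.2.2 x hx).1
    rw [h, zero_pow hN, zero_mul] at this; exact zero_ne_one this
  obtain ⟨k, hk⟩ : ∃ k, (x : P2).rep k ≠ 0 := by
    by_contra h; push Not at h; exact (x : P2).rep_nonzero (funext h)
  let A : K.Sect → UU K.g → ℂ := fun i x => i.1.2 x * (x : P2).rep k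
  have hA : ∀ i : K.Sect, x ∈ i.1.1 → ContinuousAt (A i) x := fun i hi =>
    (continuous_apply k).continuousAt.comp (f := fun x : UU K.g => i.1.2 x • (x : P2).rep) (i.2.2 x hi).2
  have hA0 : A j x ≠ 0 := mul_ne_zero (hne j x hj) hk
  have hρ : ContinuousAt (fun x => A i x / A j x) x := (hA i hi).div (hA j hj) hA0
  have hev : ∀ᶠ x' in 𝓝 x, A i x' / A j x' = i.1.2 x' / j.1.2 x' ∧ (A i x' / A j x') ^ (K.p * K.q) = 1 ∧ j.1.2 x' ≠ 0 := by
    filter_upwards [(hA j hj).eventually_ne hA0, i.2.1.mem_nhds hi, j.2.1.mem_nhds hj] with x' h1 h2 h3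
    have e1 : A i x' / A j x' = i.1.2 x' / j.1.2 x' := mul_div_mul_right _ _ (right_ne_zero_of_mul h1)
    refine ⟨e1, ?_, hne j x' h3⟩
    rw [e1, div_pow, div_eq_one_iff_eq (pow_ne_zero _ (hne j x' h3))]
    have a1 := (i.2.2 x' h2).1
    have a2 := (j.2.2 x' h3).1
    exact mul_right_cancel₀ (gt0_ne x' 0) (a1.trans a2.symm)
  have hfin : {w : ℂ | w ^ (K.p * K.q) = 1}.Finite := by
    have h := Polynomial.finite_setOfPred_isRoot (p := (Polynomial.X ^ (K.p * K.q) - Polynomial.C (1:ℂ))) (Polynomial.X_pow_sub_C_ne_zero (Nat.pos_of_ne_zero hN) _)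
    refine h.subset fun w hw => ?_
    have hw : w ^ (K.p * K.q) = 1 := hw
    simp [Polynomial.IsRoot, hw]
  set ζ := A i x / A j x with hζd
  have hev2 : ∀ᶠ x' in 𝓝 x, A i x' / A j x' ∈ ({w : ℂ | w ^ (K.p * K.q) = 1} \ {ζ})ᶜ :=
    hρ.eventually_mem ((hfin.subset Set.sdiff_subset).isClosed.isOpen_compl.mem_nhds (by simp [hζd]))
  refine ⟨ζ, hev.self_of_nhds.2.1, ?_⟩
  filter_upwards [hev, hev2] with x' h1 h2
  have : A i x' / A j x' = ζ := by
    by_contra h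
    exact h2 ⟨h1.2.1, h⟩
  rw [← this, h1.1, div_mul_cancel₀ _ h1.2.2]

lemma orb_ex : Nonempty (Orb (UU K.g) K.su {0, -1} fun p => if p = 0 then K.p else K.q) := by
  have hN : K.p * K.q ≠ 0 := mul_ne_zero K.p_ne K.q_ne
  obtain ⟨κ, hκ⟩ := IsAlgClosed.exists_pow_nat_eq (K.t 0) (Nat.pos_of_ne_zero K.q_ne)
  refine ⟨⟨K.Sect, fun i => i.1.1,
    fun i p x => if p = 0 then eval (i.1.2 x • (x : P2).rep) K.fq else κ * eval (i.1.2 x • (x : P2).rep) K.fp,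
    fun i p x => if p = 0 then i.1.2 x ^ K.q else i.1.2 x ^ K.p, fun i => i.2.1, sect_ex, ?_, ?_, ?_, ?_⟩⟩
  · rintro i p - x hx
    have hc := (i.2.2 x hx).2
    split_ifs
    · exact (cont_eval K.fq).continuousAt.comp hc
    · exact continuousAt_const.mul ((cont_eval K.fp).continuousAt.comp hc)
  · rintro i p hp x hx
    have h1 := (i.2.2 x hx).1
    have h2 := gt0_ne x 0
    rcases hp with rfl | hp
    · rw [if_pos rfl, if_pos rfl, sub_zero]
      change _ = K.sq _
      rw [eval_smul_hom K.hd.hfq, mul_pow, ← pow_mul, mul_comm K.q, sq, eq_div_iff h2]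
      linear_combination (eval (x : P2).rep K.fq ^ K.p) * h1
    · rw [Set.mem_singleton_iff.1 hp, if_neg (by norm_num), if_neg (by norm_num)]
      change _ = K.sq _ - _
      rw [eval_smul_hom K.hd.hfp, mul_pow, mul_pow, ← pow_mul, hκ, sq, sub_neg_eq_add, div_add_one h2, eq_div_iff h2]
      have h3 := K.gt_eval (K.t 0) (x : P2).rep
      linear_combination (K.t 0 * eval (x : P2).rep K.fp ^ K.q) * h1 - h3
  · rintro i p - x hx
    have h : i.1.2 x ≠ 0 := fun h => by
      have := (i.2.2 x hx).1
      rw [h, zero_pow hN, zero_mul] at this; exact zero_ne_one this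
    split_ifs
    · exact pow_ne_zero _ h
    · exact pow_ne_zero _ h
  · rintro i j p - x hi hj
    obtain ⟨ζ, hζ, hev⟩ := sect_comp i j x hi hj
    by_cases hp : p = 0
    · refine ⟨ζ ^ K.q, by rw [if_pos hp, ← pow_mul, mul_comm, hζ], ?_⟩
      filter_upwards [hev] with x' h
      simp only [if_pos hp]
      rw [h, eval_smul_hom K.hd.hfq, eval_smul_hom K.hd.hfq, mul_pow]
      exact ⟨by ring, rfl⟩
    · refine ⟨ζ ^ K.p, by rw [if_neg hp, ← pow_mul, hζ], ?_⟩
      filter_upwards [hev] with x' h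
      simp only [if_neg hp]
      rw [h, eval_smul_hom K.hd.hfp, eval_smul_hom K.hd.hfp, mul_pow]
      exact ⟨by ring, rfl⟩

theorem R3 {Γ : Type} [Group Γ] {o : ℂ} {ε : ℝ} (hG : Good K.P o ε) (z : ℂ → Γ) (hz0 : z 0 ^ K.p = 1) (hz1 : z (-1) ^ K.q = 1)
    (hz : ∀ w ∈ K.P, w ≠ 0 → w ≠ -1 → (∀ j : Fin K.r, K.sc (K.t j.succ) ≠ w) → z w = 1) :
    ∃ Φ : LS (UU K.g) Γ, ∀ γ : C(I, K.S), Φ.f (K.ps.comp γ) = (St hG z).f (K.f.comp γ) := by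
  obtain ⟨Ω⟩ := K.orb_ex
  let P' : Finset ℂ := {0, -1} ∪ Finset.univ.image fun j : Fin K.r => K.sc (K.t j.succ)
  have mem' : ∀ w, w ∈ P' ↔ w = 0 ∨ w = -1 ∨ ∃ j : Fin K.r, K.sc (K.t j.succ) = w := by simp [P']
  have hP : P' ⊆ K.P := by
    intro w hw
    rcases (mem' w).1 hw with h | h | h
    · exact K.mem_P.2 (Or.inl h)
    · exact K.mem_P.2 (Or.inr (Or.inl h))
    · exact K.mem_P.2 (Or.inr (Or.inr (Or.inr h)))
  have hpun : ∀ p : ℂ, p ∈ ({0, -1} : Set ℂ) → ∃ R b c, Pun P' (St (hG.mono hP) z) p (if p = 0 then K.p else K.q) R b c := by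
    rintro p (rfl | hp)
    · rw [if_pos rfl]
      exact exists_pun _ z 0 ((mem' _).2 (Or.inl rfl)) _ K.p_ne hz0
    · rw [Set.mem_singleton_iff.1 hp, if_neg (by norm_num)]
      exact exists_pun _ z _ ((mem' _).2 (Or.inr (Or.inl rfl))) _ K.q_ne hz1
  choose! R b c hpun using hpun
  have hs : ∀ x, K.su x ∈ P' → K.su x ∈ ({0, -1} : Set ℂ) := by
    intro x hx
    rcases (mem' _).1 hx with h | h | ⟨j, h⟩
    · exact Or.inl h
    · exact Or.inr h
    · exfalso
      have h1 := gt0_ne x 0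
      have h2 := gt0_ne x j.succ
      have h3 : K.t 0 - K.t j.succ ≠ 0 := sub_ne_zero.2 (K.ts_ne j).symm
      change K.sc _ = K.sq _ at h
      rw [sc, sq, div_eq_div_iff h3 h1] at h
      have e1 := K.gt_eval (K.t 0) (x : P2).rep
      have e2 := K.gt_eval (K.t j.succ) (x : P2).rep
      have : K.t 0 * eval (x : P2).rep (K.gt (K.t j.succ)) = 0 := by
        rw [e2]; rw [e1] at h; linear_combination h
      exact mul_ne_zero (K.t_ne 0) h2 this
  have hJ : ({0, -1} : Set ℂ) ⊆ ↑P' := by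
    intro w hw
    rcases hw with h | h
    · exact (mem' w).2 (Or.inl h)
    · exact (mem' w).2 (Or.inr (Or.inl h))
  obtain ⟨Φ, hΦ⟩ := Ω.ext (St (hG.mono hP) z) hs hJ R b c hpun
  let j : C(↥((↑K.P : Set ℂ)ᶜ), ↥((↑P' : Set ℂ)ᶜ)) := ⟨fun w => ⟨w, fun h => w.2 (hP h)⟩, by fun_prop⟩
  refine ⟨Φ, fun γ => ?_⟩
  rw [hΦ K.S K.ps (j.comp K.f) su_ps γ]
  refine St_sub hG hP z ?_ j (fun _ => rfl) (K.f.comp γ)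
  intro p hp hp'
  rw [mem'] at hp'; push Not at hp'
  exact hz p hp hp'.1 hp'.2.1 hp'.2.2

end Cfg
end Oka
end

open MvPolynomial
noncomputable section
namespace Oka
open unitInterval Set Topology Filter

lemma path_in {A S : Set ℂ} (hA : PathConnectedSpace A) (hAS : A ⊆ S) {x y : ℂ} (hx : x ∈ A) (hy : y ∈ A) :
    ∃ γ : C(I, S), (∀ t, (γ t : ℂ) ∈ A) ∧ (γ 0 : ℂ) = x ∧ (γ 1 : ℂ) = y := by
  let a : Path (⟨x, hx⟩ : A) ⟨y, hy⟩ := (PathConnectedSpace.joined _ _).somePath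
  exact ⟨⟨fun t => ⟨(a t : ℂ), hAS (a t).2⟩, by fun_prop⟩, fun t => (a t).2, by simp, by simp⟩

lemma St_push {P : Finset ℂ} {o : ℂ} {ε : ℝ} (hG : Good P o ε) {Γ Δ : Type*} [Group Γ] [Group Δ] (z : ℂ → Γ) (z' : ℂ → Δ)
    (s : Γ →* Δ) (hs : ∀ p ∈ P, s (z p) = z' p) (γ) : s ((St hG z).f γ) = (St hG z').f γ := by
  have := ((St hG z).push s).locGlob2 (St hG z') 1 (planar_loc hG _ ?_ ?_) γ
  · simpa using this
  · intro γ h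
    rw [LS.push_f, St_V0 hG z γ h, St_V0 hG z' γ h]; simp
  · intro p hp γ h
    rw [LS.push_f, St_Vs hG z hp γ h, St_Vs hG z' hp γ h]
    have : ∀ w, s (uu o z p w) = uu o z' p w := fun w => by
      unfold uu; split_ifs
      · exact hs p hp
      · exact map_one s
    simp [this]

lemma St_span {P : Finset ℂ} {o : ℂ} {ε : ℝ} (hG : Good P o ε) {Γ : Type*} [Group Γ] (z : ℂ → Γ) (H : Subgroup Γ)
    (b : ↥((↑P : Set ℂ)ᶜ) → Γ) (hb : ∀ γ, b (γ 0) * (St hG z).f γ * (b (γ 1))⁻¹ ∈ H) :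
    ∃ g : Γ, ∀ p ∈ P, g * z p * g⁻¹ ∈ H := by
  have ho : o ∈ V0 P o := o_mem_V0 hG
  have hV : ∀ w (hw : w ∈ V0 P o) w' (hw' : w' ∈ V0 P o), b ⟨w, V0_sub hG hw⟩ * (b ⟨w', V0_sub hG hw'⟩)⁻¹ ∈ H := by
    intro w hw w' hw'
    have := sc_V0 hG
    obtain ⟨γ, h1, h2, h3⟩ := path_in inferInstance (V0_sub hG) hw hw'
    have h := hb γ
    rw [St_V0 hG z γ h1, mul_one] at h
    rwa [show γ 0 = ⟨w, V0_sub hG hw⟩ from Subtype.ext h2, show γ 1 = ⟨w', V0_sub hG hw'⟩ from Subtype.ext h3] at h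
  refine ⟨b ⟨o, V0_sub hG ho⟩, fun p hp => ?_⟩
  have hn : p - o ≠ 0 := sub_ne_zero.2 (hG.ne p hp)
  have hz : ∀ y : ℂ, zt o p (o + (p - o) * y) = y := fun y => by
    rw [zt, add_sub_cancel_left, mul_div_cancel_left₀ _ hn]
  have hε := hG.epos
  have m1 : o + (p - o) * ⟨2, ε⟩ ∈ Vs o ε p := by
    change 1 < _ ∧ _ < _
    rw [hz]; simp only [abs_of_pos hε]; constructor <;> linarith
  have m2 : o + (p - o) * ⟨2, -ε⟩ ∈ Vs o ε p := by
    change 1 < _ ∧ _ < _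
    rw [hz]; simp only [abs_neg, abs_of_pos hε]; constructor <;> linarith
  have v1 := Vs_V0 hG hp m1 (by rw [hz]; exact hε.ne')
  have v2 := Vs_V0 hG hp m2 (by rw [hz]; exact (neg_lt_zero.2 hε).ne)
  have := convex_sc (convex_Vs o ε p) ⟨_, m1⟩
  obtain ⟨γ, h1, h2, h3⟩ := path_in inferInstance (Vs_sub hG hp) m1 m2
  have h := hb γ
  rw [St_Vs hG z hp γ h1, h2, h3, uu, uu, if_pos (by rw [hz]; exact hε), if_neg (by rw [hz]; simp [hε.le]), inv_one, mul_one,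
    show γ 0 = ⟨_, V0_sub hG v1⟩ from Subtype.ext h2, show γ 1 = ⟨_, V0_sub hG v2⟩ from Subtype.ext h3] at h
  have k1 := hV _ ho _ v1
  have k2 := hV _ v2 _ ho
  have := H.mul_mem (H.mul_mem k1 h) k2
  refine (congrArg (· ∈ H) ?_).mp this
  group

namespace Cfg
variable {K : Cfg}

/-- normal subgroup generated by the fibre loops -/
def Kn {N : Type} [Group N] (τ : LS (UU K.g) N) : Subgroup N :=
  Subgroup.normalClosure {n | ∃ κ : C(I, K.S), IsFL κ ∧ τ.f (K.ps.comp κ) = n}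

theorem phi_ex {N : Type} [Group N] (τ : LS (UU K.g) N) (x0 : UU K.g) (hτ : ∀ n, ∃ α : Path x0 x0, τ.f α.toContinuousMap = n)
    (huniv : ∀ (G : Type) [Group G] (L : LS (UU K.g) G), ∃ φ : N →* G, ∃ b : UU K.g → G,
        ∀ γ, L.f γ = (b (γ 0))⁻¹ * φ (τ.f γ) * b (γ 1)) {G : Type} [Group G] (hc : IsCop K.r K.p K.q G) :
    ∃ φ : N →* G, Function.Surjective φ ∧ ∀ k, φ k = 1 → k ∈ K.Kn τ := by
  classical
  obtain ⟨o, ε, hG⟩ := exists_good K.P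
  have hKn : (K.Kn τ).Normal := Subgroup.normalClosure_normal
  -- the quotient side
  let mk := QuotientGroup.mk' (K.Kn τ)
  obtain ⟨L, h, hL⟩ := descS ((τ.push mk).comap K.ps) (fun κ hκ => by
    rw [LS.comap_f, LS.push_f]
    exact (QuotientGroup.eq_one_iff _).2 (Subgroup.subset_normalClosure ⟨κ, hκ, rfl⟩))
  obtain ⟨z, b, hzb⟩ := PL1 hG L
  let H : K.S → N ⧸ K.Kn τ := fun x => b (K.f x) * (h x)⁻¹
  have hz : ∀ γ : C(I, K.S), (τ.push mk).f (K.ps.comp γ) = (H (γ 0))⁻¹ * (St hG z).f (K.f.comp γ) * H (γ 1) := by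
    intro γ
    have h1 := hL γ
    rw [LS.comap_f] at h1
    rw [h1, ← hzb]
    simp only [H, ContinuousMap.comp_apply]; group
  obtain ⟨z0, z1, zA⟩ := R4 (τ.push mk) hG z H hz
  -- the group side
  have inj : ∀ {c d : ℂ}, c ≠ K.t 0 → d ≠ K.t 0 → K.sc c = K.sc d → c = d := fun {c d} h1 h2 h => by
    rw [← K.cs_sc h1, h, K.cs_sc h2]
  have sc0 : K.sc 0 = 0 := by simp [sc]
  have nz : ∀ {c : ℂ}, c ≠ K.t 0 → c ≠ 0 → K.sc c ≠ 0 := fun {c} h1 h2 h => h2 (inj h1 (K.t_ne 0).symm (h.trans sc0.symm))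
  let z' : ℂ → G := fun w => if w = 0 then hc.y else if w = -1 then hc.w else
    if h : ∃ j : Fin K.r, K.sc (K.t j.succ) = w then hc.x h.choose else 1
  have z'0 : z' 0 = hc.y := if_pos rfl
  have z'1 : z' (-1) = hc.w := by simp [z']
  have z't : ∀ j : Fin K.r, z' (K.sc (K.t j.succ)) = hc.x j := by
    intro j
    have hex : ∃ j' : Fin K.r, K.sc (K.t j'.succ) = K.sc (K.t j.succ) := ⟨j, rfl⟩
    simp only [z']
    rw [if_neg (nz (K.ts_ne j) (K.t_ne _)), if_neg (K.sc_ne (K.ts_ne j)), dif_pos hex]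
    exact congrArg _ (Fin.succ_injective _ (K.hti (inj (K.ts_ne _) (K.ts_ne _) hex.choose_spec)))
  have z'e : ∀ w : ℂ, w ≠ 0 → w ≠ -1 → (∀ j : Fin K.r, K.sc (K.t j.succ) ≠ w) → z' w = 1 := by
    intro w h1 h2 h3
    simp only [z']
    rw [if_neg h1, if_neg h2, dif_neg (fun ⟨j, hj⟩ => h3 j hj)]
  obtain ⟨Φ, hΦ⟩ := R3 hG z' (by rw [z'0]; exact hc.hy) (by rw [z'1]; exact hc.hw) (fun w _ => z'e w)
  obtain ⟨φ, b', hφ⟩ := huniv G Φ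
  let B : K.S → G := fun x => b' (K.ps x)
  have hφB : ∀ γ : C(I, K.S), φ (τ.f (K.ps.comp γ)) = B (γ 0) * (St hG z').f (K.f.comp γ) * (B (γ 1))⁻¹ := by
    intro γ
    rw [← hΦ γ, hφ]
    simp only [B, ContinuousMap.comp_apply]; group
  obtain ⟨s, s1, s2, s3⟩ := hc.lift (N ⧸ K.Kn τ) (fun j => z (K.sc (K.t j.succ))) (z 0) (z (-1)) z0 z1
  have hsz : ∀ w ∈ K.P, s (z' w) = z w := by
    intro w hw
    rcases K.mem_P.1 hw with rfl | rfl | ⟨c, hcA, rfl⟩ | ⟨j, rfl⟩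
    · rw [z'0, s2]
    · rw [z'1, s3]
    · by_cases c0 : c = 0
      · rw [c0, sc0, z'0, s2]
      · rw [zA c hcA c0, z'e, map_one]
        · exact nz (K.A1_ne hcA 0) c0
        · exact K.sc_ne (K.A1_ne hcA 0)
        · exact fun j hj => K.A1_ne hcA j.succ (inj (K.ts_ne j) (K.A1_ne hcA 0) hj).symm
    · rw [z't, s1]
  refine ⟨φ, ?_, ?_⟩
  · -- surjectivity
    choose sec hsec using K.f_surj
    have key := (St hG z').locGlob (fun w => B (sec w)) φ.range ?_
    · obtain ⟨g, hg⟩ := St_span hG z' φ.range (fun w => B (sec w)) key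
      have hm : ∀ p ∈ K.P, z' p ∈ φ.range.map (MulAut.conj g⁻¹).toMonoidHom := fun p hp =>
        ⟨_, hg p hp, by simp [MulAut.conj_apply]; group⟩
      have htop := hc.span _ (fun j => by rw [← z't]; exact hm _ (mem_Pt j)) (by rw [← z'0]; exact hm _ mem_P0)
        (by rw [← z'1]; exact hm _ mem_P1)
      intro x
      obtain ⟨y, hy, hyx⟩ : g⁻¹ * x * g ∈ φ.range.map (MulAut.conj g⁻¹).toMonoidHom := by rw [htop]; trivial
      have : y = x := by
        have h1 : g⁻¹ * y * g = g⁻¹ * x * g := by simpa [MulAut.conj_apply] using hyx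
        simpa using h1
      rw [← this]; exact hy
    · intro w
      obtain ⟨O, hO, hlift⟩ := lift_loc (sec w)
      rw [hsec] at hO
      refine ⟨O, hO, fun γ hγ => ?_⟩
      obtain ⟨α, rfl⟩ := hlift γ hγ
      have hfib : ∀ x : K.S, B (sec (K.f x)) * (B x)⁻¹ ∈ φ.range := by
        intro x
        obtain ⟨κ, k0, k1, k2⟩ := fibre_path (sec (K.f x)) x ((K.f_eq_iff _ _).1 (hsec _))
        refine ⟨τ.f (K.ps.comp κ), ?_⟩
        rw [hφB, LS.f_eq_one_of_const, k0, k1, mul_one]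
        exact fun t => (K.f_eq_iff _ _).2 ((k2 t).trans (k2 0).symm)
      have h1 := hfib (α 0)
      have h2 := φ.range.inv_mem (hfib (α 1))
      have h3 : φ (τ.f (K.ps.comp α)) ∈ φ.range := ⟨_, rfl⟩
      rw [hφB] at h3
      have := φ.range.mul_mem (φ.range.mul_mem h1 h3) h2
      refine (congrArg (· ∈ φ.range) ?_).mp this
      simp only [ContinuousMap.comp_apply]; group
  · intro k hk
    obtain ⟨x, -⟩ := K.f_surj ⟨o, fun h => hG.ne o h rfl⟩
    obtain ⟨α, a0, a1, hα⟩ := realize τ x0 hτ x x k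
    have e1 := hφB α
    have e2 := hz α
    rw [LS.push_f, hα, ← St_push hG z' z s hsz] at e2
    rw [hα, hk, a0, a1] at e1
    have e3 : (St hG z').f (K.f.comp α) = 1 := by
      have : (B x)⁻¹ * 1 * B x = (St hG z').f (K.f.comp α) := by rw [e1]; group
      rw [← this]; group
    rw [e3, map_one, a0, a1] at e2
    have e4 : mk k = 1 := by rw [e2]; group
    exact (QuotientGroup.eq_one_iff k).1 e4

end Cfg
end Oka
end

open MvPolynomial
noncomputable section
namespace Oka
open unitInterval Set Topology Filter

lemma LS.tri {Z Γ : Type*} [TopologicalSpace Z] [Group Γ] (L : LS Z Γ) (H : C(I × I, Z)) (a b d : C(I, Z))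
    (ha : ∀ t, a t = H (t, 0)) (hb : ∀ t, b t = H (1, t)) (hd : ∀ t, d t = H (t, t)) : L.f d = L.f a * L.f b := by
  have : ContractibleSpace (I × I) := sq_contractible
  obtain ⟨β, hβ⟩ := (L.comap H).triv
  have e1 := hβ ⟨fun t => (t, 0), by fun_prop⟩
  have e2 := hβ ⟨fun t => (1, t), by fun_prop⟩
  have e3 := hβ ⟨fun t => (t, t), by fun_prop⟩
  rw [LS.comap_f] at e1 e2 e3
  rw [show a = H.comp ⟨fun t => (t, 0), by fun_prop⟩ from ContinuousMap.ext ha,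
    show b = H.comp ⟨fun t => (1, t), by fun_prop⟩ from ContinuousMap.ext hb,
    show d = H.comp ⟨fun t => (t, t), by fun_prop⟩ from ContinuousMap.ext hd, e1, e2, e3]
  simp only [ContinuousMap.coe_mk]; group

namespace Cfg
variable {K : Cfg}

variable (K) in
/-- tube around a removed value -/
def PT (j : Fin (K.r + 1)) (r0 : ℝ) (Tr : ℂ → ℂ → E3 → E3) : Prop :=
  TubeAt K.p K.q K.m K.n K.fp K.fq K.i K.D (K.t j) r0 Tr ∧
    ∀ c ∈ Metric.ball (K.t j) r0, c ≠ K.t j → c ∉ K.A1 ∧ ∀ k, c ≠ K.t k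

variable (K) in
lemma pt_ex (j : Fin (K.r + 1)) {O : Set ℂ} (hO : O ∈ 𝓝 (K.t j)) : ∃ r0 Tr, K.PT j r0 Tr ∧ Metric.ball (K.t j) r0 ⊆ O := by
  classical
  obtain ⟨r0, Tr, hT⟩ := K.tube _ (K.ht j)
  obtain ⟨r1, hr1, h1⟩ := iso_pt (K.A1 ∪ Finset.univ.image K.t) (K.t j)
  obtain ⟨r2, hr2, h2⟩ := Metric.mem_nhds_iff.1 hO
  refine ⟨min r0 (min r1 r2), Tr, ⟨hT.mono (lt_min hT.1 (lt_min hr1 hr2)) (min_le_left _ _), fun c hc hne => ?_⟩, ?_⟩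
  · have hc' : ‖c - K.t j‖ < r1 := by
      rw [Metric.mem_ball, dist_eq_norm] at hc
      exact hc.trans_le ((min_le_right _ _).trans (min_le_left _ _))
    exact ⟨fun h => hne (h1 c (by simp [h]) hc'), fun k h => hne (h1 c (by simp [h]) hc')⟩
  · exact (Metric.ball_subset_ball ((min_le_right _ _).trans (min_le_right _ _))).trans h2

lemma PT.mem {j} {r0 : ℝ} {Tr} (h : K.PT j r0 Tr) (x : K.S) {c : ℂ}
    (hx : K.cx x ∈ Metric.ball (K.t j) r0) (hc : c ∈ Metric.ball (K.t j) r0) (hc' : c ≠ K.t j) :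
    Tr (K.cx x) c x ∈ K.S ∧ K.cx (Tr (K.cx x) c x) = c := by
  obtain ⟨h1, h2, -, -⟩ := h.1.2.2.2 (K.cx x) c x ⟨hx, hc, x.2.1, rfl⟩
  have h2' : K.cx (Tr (K.cx x) c x) = c := h2
  exact ⟨⟨h1, by rw [h2']; exact (h.2 c hc hc').1, by rw [h2']; exact (h.2 c hc hc').2⟩, h2'⟩

def PT.tr {j} {r0 : ℝ} {Tr} (h : K.PT j r0 Tr) {Z : Type*} [TopologicalSpace Z] (x : C(Z, K.S)) (c : C(Z, ℂ))
    (hx : ∀ z, K.cx (x z) ∈ Metric.ball (K.t j) r0) (hc : ∀ z, c z ∈ Metric.ball (K.t j) r0 ∧ c z ≠ K.t j) : C(Z, K.S) :=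
  ⟨fun z => ⟨Tr (K.cx (x z)) (c z) (x z), (h.mem (x z) (hx z) (hc z).1 (hc z).2).1⟩, by
    refine Continuous.subtype_mk ?_ _
    refine h.1.2.2.1.comp_continuous (f := fun z : Z => (K.cx (x z), c z, (x z : E3))) ?_
      (fun z => ⟨hx z, (hc z).1, (x z).2.1, rfl⟩)
    exact (K.cx_cont.comp x.continuous).prodMk (c.continuous.prodMk (continuous_subtype_val.comp x.continuous))⟩

lemma PT.self {j} {r0 : ℝ} {Tr} (h : K.PT j r0 Tr) (x : K.S)
    (hx : K.cx x ∈ Metric.ball (K.t j) r0) : Tr (K.cx x) (K.cx x) x = x :=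
  (h.1.2.2.2 (K.cx x) (K.cx x) x ⟨hx, hx, x.2.1, rfl⟩).2.2.2

/-- a small meridian is a product loop in a tube -/
theorem small_loop {r0 : Fin (K.r + 1) → ℝ} {Tr : Fin (K.r + 1) → ℂ → ℂ → E3 → E3} (T : ∀ j, K.PT j (r0 j) (Tr j))
    (e y : E3) (hy : eval y K.g = 0) (hy0 : eval y K.h0 ≠ 0) : ∃ j, ∃ ε0 > 0, ∀ ε : ℝ, 0 < ε → ε < ε0 →
      ∀ γ : C(I, XX K.g), (∀ t : I, (γ t : E3) = y + ((ε : ℂ) * Complex.exp (2 * Real.pi * Complex.I * t)) • e) →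
      ∃ (x : K.S) (c : C(I, ℂ)) (β : C(I, K.S)), c 0 = K.cx x ∧ c 1 = K.cx x ∧
        (∀ t, c t ∈ Metric.ball (K.t j) (r0 j) ∧ c t ≠ K.t j) ∧ (∀ t, (β t : E3) = Tr j (K.cx x) (c t) x) ∧
        ∀ (Γ : Type) [Group Γ] (M : LS (XX K.g) Γ), M.f (K.ι.comp β) = 1 → M.f γ = 1 := by
  obtain ⟨h1, h2, h3⟩ := (K.hh y).1 hy0
  obtain ⟨j, hj⟩ : ∃ j, K.cx y = K.t j := by
    by_contra h
    push Not at h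
    exact (K.g_eval_ne' h1).2 h hy
  let lm : E3 → ℂ := lam K.m K.n K.fp K.fq
  have hl0 : lm y ≠ 0 := lam_ne h1 h2
  have lcont : ∀ v : E3, eval v K.h0 ≠ 0 → ContinuousAt lm v := fun v hv => by
    obtain ⟨-, k2, -⟩ := (K.hh v).1 hv
    change ContinuousAt (fun x : E3 => eval x K.fp ^ K.m / eval x K.fq ^ K.n) v
    exact ((cont_eval K.fp).pow K.m).continuousAt.div ((cont_eval K.fq).pow K.n).continuousAt (pow_ne_zero _ k2)
  let v : ℂ → E3 := fun s => y + s • e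
  have vc : Continuous v := by fun_prop
  have v0 : v 0 = y := by simp [v]
  have vt : Tendsto v (𝓝 0) (𝓝 y) := by
    have := vc.tendsto 0
    rwa [v0] at this
  have E1 : ∀ᶠ s in 𝓝 (0:ℂ), eval (v s) K.h0 ≠ 0 :=
    vt.eventually ((cont_eval K.h0).continuousAt.eventually_ne hy0)
  have E2 : ∀ᶠ s in 𝓝 (0:ℂ), K.cx (v s) ∈ Metric.ball (K.t j) (r0 j) := by
    have : ContinuousAt K.cx y := cc_contAt h1
    exact vt.eventually (this.eventually (by rw [hj]; exact Metric.ball_mem_nhds _ (T j).1.1))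
  have E4 : ∀ᶠ s in 𝓝 (0:ℂ), lm (v s) / lm y ∈ Complex.slitPlane := by
    refine vt.eventually (((lcont y hy0).div_const (lm y)).eventually (Complex.isOpen_slitPlane.mem_nhds ?_))
    change lm y / lm y ∈ Complex.slitPlane
    rw [div_self hl0]; simp
  obtain ⟨R, hR, hB⟩ := Metric.eventually_nhds_iff_ball.1 (E1.and (E2.and E4))
  refine ⟨j, R, hR, fun ε hε hεR γ hγ => ?_⟩
  have hin : ∀ t : I, (ε : ℂ) * Complex.exp (2 * Real.pi * Complex.I * t) ∈ Metric.ball (0:ℂ) R := fun t => by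
    rw [mem_ball_zero_iff, circ_norm hε]; exact hεR
  let cir : C(I, Metric.ball (0:ℂ) R) := ⟨fun t => ⟨_, hin t⟩, by fun_prop⟩
  have hγ' : ∀ t, (γ t : E3) = v (cir t) := hγ
  have c01 : cir 0 = cir 1 := by
    apply Subtype.ext
    simp [cir, Complex.exp_two_pi_mul_I]
  have γ01 : γ 0 = γ 1 := Subtype.ext (by rw [hγ', hγ', c01])
  have hcx : ∀ s : Metric.ball (0:ℂ) R, K.cx (K.rt (v s)) = K.cx (v s) := fun s => by
    obtain ⟨k1, k2, -⟩ := (K.hh _).1 (hB s s.2).1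
    exact K.hd.cc_ret k1 k2
  have rcont : Continuous fun s : Metric.ball (0:ℂ) R => K.rt (v s) := by
    rw [continuous_iff_continuousAt]
    intro s
    obtain ⟨k1, k2, -⟩ := (K.hh _).1 (hB s s.2).1
    have : ContinuousAt K.rt (v s) := ret_contAt k1 k2
    exact this.comp (f := fun s : Metric.ball (0:ℂ) R => v s) (by fun_prop)
  have ccont : Continuous fun s : Metric.ball (0:ℂ) R => K.cx (v s) := by
    rw [continuous_iff_continuousAt]
    intro s
    obtain ⟨k1, k2, -⟩ := (K.hh _).1 (hB s s.2).1
    have : ContinuousAt K.cx (v s) := cc_contAt k1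
    exact this.comp (f := fun s : Metric.ball (0:ℂ) R => v s) (by fun_prop)
  have hSG : ∀ s : Metric.ball (0:ℂ) R, K.rt (v s) ∈ K.SG := fun s => ((K.hh _).1 (hB s s.2).1).2.2
  have hne : ∀ t, K.cx (v (cir t)) ≠ K.t j := fun t => by
    have h := (γ t).2
    rw [hγ'] at h
    exact (K.g_eval_ne' ((K.hh _).1 (hB _ (cir t).2).1).1).1 h j
  have hα : ∀ t, K.rt (v (cir t)) ∈ K.S := fun t => by
    have h := (T j).2 _ (hB _ (cir t).2).2.1 (hne t)
    refine ⟨hSG _, ?_, ?_⟩ <;> rw [hcx]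
    exacts [h.1, h.2]
  let α : C(I, K.S) := ⟨fun t => ⟨K.rt (v (cir t)), hα t⟩, (rcont.comp cir.continuous).subtype_mk _⟩
  let c : C(I, ℂ) := ⟨fun t => K.cx (v (cir t)), ccont.comp cir.continuous⟩
  have αc : ∀ t, K.cx (α t) = c t := fun t => hcx (cir t)
  have hc : ∀ t, c t ∈ Metric.ball (K.t j) (r0 j) ∧ c t ≠ K.t j := fun t => ⟨(hB _ (cir t).2).2.1, hne t⟩
  have α01 : α 1 = α 0 := Subtype.ext (by
    change K.rt (v (cir 1)) = K.rt (v (cir 0)); rw [c01])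
  have cc01 : c 1 = c 0 := by rw [← αc, α01, αc]
  have hαb : ∀ t, K.cx (α t) ∈ Metric.ball (K.t j) (r0 j) := fun t => by rw [αc]; exact (hc t).1
  let β : C(I, K.S) := (T j).tr (ContinuousMap.const I (α 0)) c (fun _ => hαb 0) hc
  refine ⟨α 0, c, β, (αc 0).symm, cc01.trans (αc 0).symm, hc, fun t => rfl, fun Γ _ M hM => ?_⟩
  -- step one : the fibre part is trivial
  have hd : ∀ s : Metric.ball (0:ℂ) R, (K.cx (v s), c 0, K.rt (v s)) ∈
      TrDom K.p K.q K.m K.n K.fp K.fq K.i K.D (Metric.ball (K.t j) (r0 j)) :=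
    fun s => ⟨(hB _ s.2).2.1, (hc 0).1, hSG s, hcx s⟩
  let Gd : C(Metric.ball (0:ℂ) R, K.S) := ⟨fun s => ⟨Tr j (K.cx (v s)) (c 0) (K.rt (v s)), by
      obtain ⟨k1, k2, -, -⟩ := (T j).1.2.2.2 _ _ _ (hd s)
      have h := (T j).2 _ (hc 0).1 (hc 0).2
      have k2' : K.cx (Tr j (K.cx (v s)) (c 0) (K.rt (v s))) = c 0 := k2
      exact ⟨k1, by rw [k2']; exact h.1, by rw [k2']; exact h.2⟩⟩, by
    refine Continuous.subtype_mk ?_ _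
    exact (T j).1.2.2.1.comp_continuous (f := fun s : Metric.ball (0:ℂ) R => (K.cx (v s), c 0, K.rt (v s)))
      (ccont.prodMk (continuous_const.prodMk rcont)) hd⟩
  have : SimplyConnectedSpace (Metric.ball (0:ℂ) R) := convex_sc (convex_ball _ _) ⟨0, Metric.mem_ball_self hR⟩
  have tr1 : (M.comap K.ι).f (Gd.comp cir) = 1 := by
    have := (M.comap K.ι).f_eq_of_sc Gd cir (ContinuousMap.const I (cir 0)) rfl (by rw [← c01]; rfl)
    rw [this]
    exact (M.comap K.ι).f_eq_one_of_const _ fun t => rfl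
  have e1 := (M.comap K.ι).tri ((T j).tr (α.comp ⟨Prod.fst, continuous_fst⟩) (c.comp ⟨Prod.snd, continuous_snd⟩)
    (fun z => hαb z.1) (fun z => hc z.2)) (Gd.comp cir) β α (fun t => Subtype.ext (by
      change Tr j (K.cx (v (cir t))) (c 0) (K.rt (v (cir t))) = Tr j (K.cx (α t)) (c 0) (α t)
      rw [αc]; rfl)) (fun t => Subtype.ext (by
      change Tr j (K.cx (α 0)) (c t) (α 0) = Tr j (K.cx (α 1)) (c t) (α 1)
      rw [α01])) (fun t => Subtype.ext (by
      change α t = Tr j (K.cx (α t)) (c t) (α t)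
      rw [← αc, (T j).self _ (hαb t)]))
  rw [tr1, one_mul, LS.comap_f, LS.comap_f, hM] at e1
  -- step two : scaling
  let l : I → ℂ := fun t => Complex.log (lm y) + Complex.log (lm (v (cir t)) / lm y)
  have hl : ∀ t, lm (v (cir t)) ≠ 0 := fun t => by
    obtain ⟨k1, k2, -⟩ := (K.hh _).1 (hB _ (cir t).2).1
    exact lam_ne k1 k2
  have lexp : ∀ t, Complex.exp (l t) = lm (v (cir t)) := fun t => by
    rw [Complex.exp_add, Complex.exp_log hl0, Complex.exp_log (div_ne_zero (hl t) hl0), mul_div_cancel₀ _ hl0]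
  have lc : Continuous l := by
    refine continuous_const.add (Continuous.clog (Continuous.div_const ?_ _) fun t => (hB _ (cir t).2).2.2)
    rw [continuous_iff_continuousAt]
    intro t
    exact (lcont _ (hB _ (cir t).2).1).comp (f := fun t : I => v (cir t)) (by fun_prop)
  let H : C(I × I, XX K.g) := ⟨fun z => ⟨Complex.exp (-(((z.2 : ℝ) : ℂ) * l z.1)) • (γ z.1 : E3),
    XX_smul K.g_hom (γ z.1).2 (Complex.exp_ne_zero _)⟩, by fun_prop⟩
  have l01 : l 1 = l 0 := by simp only [l]; rw [c01]
  have e2 := M.square H γ (H.comp ⟨fun t => (1, t), by fun_prop⟩) (H.comp ⟨fun t => (1, t), by fun_prop⟩) (K.ι.comp α)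
    (fun t => Subtype.ext (by simp [H])) (fun t => rfl) (fun t => Subtype.ext (by
      change Complex.exp (-(((t : ℝ) : ℂ) * l 1)) • (γ 1 : E3) = Complex.exp (-(((t : ℝ) : ℂ) * l 0)) • (γ 0 : E3)
      rw [l01, γ01])) (fun t => Subtype.ext (by
      change K.rt (v (cir t)) = Complex.exp (-((((1 : I) : ℝ) : ℂ) * l t)) • (γ t : E3)
      rw [Set.Icc.coe_one, Complex.ofReal_one, one_mul, Complex.exp_neg, lexp, hγ']; rfl))
  rw [e1, mul_one] at e2
  exact mul_eq_right.1 e2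

variable {N : Type} [Group N]

theorem R5 (τ : LS (UU K.g) N) (x0 : UU K.g) (hτ : ∀ n, ∃ α : Path x0 x0, τ.f α.toContinuousMap = n) :
    K.Kn τ ≤ Subgroup.center N := by
  have hKn : (K.Kn τ).Normal := Subgroup.normalClosure_normal
  let Z := Subgroup.centralizer (K.Kn τ : Set N)
  have hZ : Z.Normal := inferInstance
  let mk := QuotientGroup.mk' Z
  choose r0 Tr T using fun j => K.pt_ex j (O := univ) univ_mem
  obtain ⟨e, he⟩ := exists_eval_ne K.g_ne
  have key := ext_triv K.g_hom (IsRelPrime.symm (K.relprime_g fun j => (K.hcop j).symm)) he ((τ.push mk).comap K.pi) (by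
    intro y hy hy0
    obtain ⟨j, ε0, hε0, h⟩ := small_loop (fun j => (T j).1) e y hy hy0
    refine ⟨ε0, hε0, fun ε h1 h2 γ hγ => ?_⟩
    obtain ⟨x, c, β, c0, c1, hc, hβ, hM⟩ := h ε h1 h2 γ hγ
    apply hM
    rw [LS.comap_f, LS.push_f]
    refine (QuotientGroup.eq_one_iff _).2 ?_
    rw [Subgroup.mem_centralizer_iff]
    have hb : K.cx x ∈ Metric.ball (K.t j) (r0 j) := by rw [← c0]; exact (hc 0).1
    suffices hs : K.Kn τ ≤ Subgroup.centralizer {τ.f (K.ps.comp β)} from fun n hn =>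
      (Subgroup.mem_centralizer_iff.1 (hs hn) _ rfl).symm
    rw [Kn, Subgroup.normalClosure, Subgroup.closure_le]
    intro n hn
    obtain ⟨_, ⟨κ0, hκ0, rfl⟩, hn⟩ := Group.mem_conjugatesOfSet_iff.1 hn
    obtain ⟨a, rfl⟩ := isConj_iff.1 hn
    obtain ⟨δ, d0, d1, d2⟩ := realize τ x0 hτ (κ0 0) x a⁻¹
    obtain ⟨κ, k1, k2, k3⟩ := transport (τ.comap K.ps) δ κ0 hκ0 d0.symm
    rw [LS.comap_f, LS.comap_f, LS.comap_f, d2, inv_inv] at k3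
    have kx : κ 0 = x := k2.trans d1
    have kc : ∀ s, K.cx (κ s) = K.cx x := fun s => by rw [k1.2 s, kx]
    refine Subgroup.mem_centralizer_iff.2 fun w hw => ?_
    rw [mem_singleton_iff.1 hw, ← k3]
    have sq := (τ.comap K.ps).square ((T j).1.tr (κ.comp ⟨Prod.fst, continuous_fst⟩) (c.comp ⟨Prod.snd, continuous_snd⟩)
      (fun z => by change K.cx (κ z.1) ∈ _; rw [kc]; exact hb) (fun z => hc z.2)) κ β β κ
      (fun t => Subtype.ext (by
        change (κ t : E3) = Tr j (K.cx (κ t)) (c 0) (κ t)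
        rw [c0, ← kc t, (T j).1.self (κ t) (by rw [kc]; exact hb)]))
      (fun t => Subtype.ext (by
        refine (hβ t).trans ?_
        change _ = Tr j (K.cx (κ 1)) (c t) (κ 1)
        rw [← k1.1, kx]))
      (fun t => Subtype.ext (by
        refine (hβ t).trans ?_
        change _ = Tr j (K.cx (κ 0)) (c t) (κ 0)
        rw [kx]))
      (fun t => Subtype.ext (by
        change (κ t : E3) = Tr j (K.cx (κ t)) (c 1) (κ t)
        rw [c1, ← kc t, (T j).1.self (κ t) (by rw [kc]; exact hb)]))
    exact sq.symm)
  obtain ⟨o, ε, hG⟩ := exists_good K.P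
  obtain ⟨x, -⟩ := K.f_surj ⟨o, fun h => hG.ne o h rfl⟩
  intro k hk
  refine Subgroup.mem_center_iff.2 fun n => ?_
  obtain ⟨α, a0, a1, rfl⟩ := realize τ x0 hτ x x n
  have h := key (K.ι.comp α) (by rw [ContinuousMap.comp_apply, ContinuousMap.comp_apply, a0, a1])
  rw [LS.comap_f, LS.push_f] at h
  exact (Subgroup.mem_centralizer_iff.1 ((QuotientGroup.eq_one_iff _).1 h) k hk).symm

end Cfg
end Oka
end

open MvPolynomial
noncomputable section
namespace Oka
open unitInterval Set Topology Filter

def LS.cprod {Z B J : Type*} [TopologicalSpace Z] [CommGroup B] [Fintype J] (A : LS Z B) (Λ : J → LS Z B) : LS Z B where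
  f γ := A.f γ * ∏ j, (Λ j).f γ
  mul α β := by
    simp only [A.mul, fun j => (Λ j).mul α β, Finset.prod_mul_distrib]
    exact mul_mul_mul_comm _ _ _ _
  hom α β h := by simp only [A.hom α β h, fun j => (Λ j).hom α β h]

namespace Cfg
variable {K : Cfg}

variable (K) in
lemma gt_S (x : K.S) (c : ℂ) : eval (x : E3) (K.gt c) = (K.cx x ^ K.n) ^ K.q * (c - K.cx x) := by
  rw [K.gt_eval' c x.2.1.1.1, K.hd.sig_fp x.2.1.1]; rfl

/-- path in a punctured disc -/
lemma pball_path {p a b : ℂ} {r : ℝ} (ha : a ∈ Metric.ball p r ∧ a ≠ p) (hb : b ∈ Metric.ball p r ∧ b ≠ p) :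
    ∃ c : C(I, ℂ), c 0 = a ∧ c 1 = b ∧ ∀ t, c t ∈ Metric.ball p r ∧ c t ≠ p := by
  simp only [Metric.mem_ball, dist_eq_norm] at *
  have hr : 0 < r := (norm_nonneg _).trans_lt ha.1
  have h1 : (Complex.log (a - p)).re < Real.log r := re_lt_of_exp hr (by rw [Complex.exp_log (sub_ne_zero.2 ha.2)]; exact ha.1)
  have h2 : (Complex.log (b - p)).re < Real.log r := re_lt_of_exp hr (by rw [Complex.exp_log (sub_ne_zero.2 hb.2)]; exact hb.1)
  refine ⟨⟨fun t => p + Complex.exp (seg (Complex.log (a - p)) (Complex.log (b - p)) t), ?_⟩, ?_, ?_, fun t => ⟨?_, ?_⟩⟩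
  · unfold seg; fun_prop
  · simp [seg, Complex.exp_log (sub_ne_zero.2 ha.2)]
  · simp [seg, Complex.exp_log (sub_ne_zero.2 hb.2)]
  · rw [ContinuousMap.coe_mk, add_sub_cancel_left]
    refine exp_lt_of_re hr ?_
    exact seg_mem (B := {z : ℂ | z.re < Real.log r}) (convex_halfSpace_re_lt _) h1 h2 t
  · simp

variable {N : Type} [Group N]

theorem R6 (τ : LS (UU K.g) N) : K.Kn τ ≤ commutator N := by
  classical
  let ψ : N →* Abelianization N := Abelianization.of
  let A : LS (XX K.g) (Abelianization N) := (τ.push ψ).comap K.pi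
  obtain ⟨o, ε, hG⟩ := exists_good ({0} : Finset ℂ)
  have tn : ∀ j, ((K.t j) ^ K.n) ^ K.q ≠ 0 := fun j => pow_ne_zero _ (pow_ne_zero _ (K.t_ne j))
  choose r0 Tr T using fun j => K.pt_ex j (O := {c : ℂ | (c ^ K.n) ^ K.q / ((K.t j) ^ K.n) ^ K.q ∈ Complex.slitPlane}) (by
    have : ContinuousAt (fun c : ℂ => (c ^ K.n) ^ K.q / ((K.t j) ^ K.n) ^ K.q) (K.t j) := by fun_prop
    refine this (Complex.isOpen_slitPlane.mem_nhds ?_)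
    change _ / _ ∈ _
    rw [div_self (tn j)]; simp)
  have rpos : ∀ j, 0 < r0 j := fun j => (T j).1.1.1
  have rpos2 : ∀ j, 0 < r0 j / 2 := fun j => half_pos (rpos j)
  let PB : Fin (K.r + 1) → Set ℂ := fun j => {c : ℂ | c ∈ Metric.ball (K.t j) (r0 j) ∧ c ≠ K.t j}
  have hcir : ∀ j (t : I), K.t j + ((r0 j / 2 : ℝ) : ℂ) * Complex.exp (2 * Real.pi * Complex.I * t) ∈ PB j := fun j t => by
    have h := circ_norm (rpos2 j) t
    refine ⟨?_, fun h' => ?_⟩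
    · rw [Metric.mem_ball, dist_eq_norm, add_sub_cancel_left, h]; linarith [rpos j]
    · rw [add_eq_left.1 h', norm_zero] at h
      exact (rpos2 j).ne h
  let cir : ∀ j, C(I, PB j) := fun j => ⟨fun t => ⟨_, hcir j t⟩, by fun_prop⟩
  have hPex : ∀ j, ∃ x : K.S, K.cx x ∈ PB j := fun j => by
    have h := (T j).1.2 _ (hcir j 0).1 (hcir j 0).2
    obtain ⟨x, hx, -⟩ := K.fb _ h.1
    have hc : K.cx x = _ := hx.2
    exact ⟨⟨x, hx.1, by rw [hc]; exact h.1, by rw [hc]; exact h.2⟩, by change K.cx x ∈ _; rw [hc]; exact hcir j 0⟩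
  choose P hP using hPex
  let Φ : ∀ j, C(PB j, K.S) := fun j => (T j).1.tr (ContinuousMap.const _ (P j)) ⟨Subtype.val, continuous_subtype_val⟩
    (fun _ => (hP j).1) (fun c => c.2)
  have hΦ : ∀ j c, K.cx (Φ j c) = c := fun j c => ((T j).1.mem (P j) (hP j).1 c.2.1 c.2.2).2
  let d : Fin (K.r + 1) → Abelianization N := fun j => A.f (K.ι.comp ((Φ j).comp (cir j)))
  let gm : Fin (K.r + 1) → C(XX K.g, ↥((↑({0} : Finset ℂ) : Set ℂ)ᶜ)) := fun k =>
    ⟨fun x => ⟨eval (x : E3) (K.gt (K.t k)), by simpa using (K.g_eval_ne x).1 x.2 k⟩,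
      Continuous.subtype_mk ((cont_eval (K.gt (K.t k))).comp continuous_subtype_val) fun x => by simpa using (K.g_eval_ne x).1 x.2 k⟩
  let Λ : Fin (K.r + 1) → LS (XX K.g) (Abelianization N) := fun k => (St hG fun _ => d k).comap (gm k)
  let M := A.cprod Λ
  have Mf : ∀ γ, M.f γ = A.f γ * ∏ j, (Λ j).f γ := fun γ => rfl
  -- values on the circles
  have Mcir : ∀ j, M.f (K.ι.comp ((Φ j).comp (cir j))) = 1 := fun j => by
    rw [Mf, Finset.prod_eq_single j]
    · let u : ℂ → ℂ := fun s => -((K.t j + s) ^ K.n) ^ K.q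
      have uc : Continuous u := by fun_prop
      obtain ⟨ς, e1, e2⟩ := mfold u 1 _ (rpos2 j) (-((K.t j) ^ K.n) ^ K.q) (neg_ne_zero.2 (tn j)) (by fun_prop) (fun t => by
        simp only [u]
        rw [neg_div_neg_eq]
        exact (T j).2 (hcir j t).1)
      have hv : ∀ t, ((gm j).comp (K.ι.comp ((Φ j).comp (cir j))) t : ℂ) = 0 + Complex.exp (ς t) := fun t => by
        rw [e1, zero_add, pow_one]
        refine (K.gt_S (Φ j (cir j t)) (K.t j)).trans ?_
        rw [hΦ]
        simp only [u, cir, ContinuousMap.coe_mk]; ring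
      let F : C(I, ℂ) := ⟨fun t => ((gm j).comp (K.ι.comp ((Φ j).comp (cir j))) t : ℂ), by fun_prop⟩
      obtain ⟨g, hg⟩ := circ_rel hG (St hG fun _ => d j) (fun _ => d j) 1 (fun γ => by simp) 0 (by simp) (‖F‖ + 1)
        (by positivity) (by simp) _ ς hv (fun t => by
          rw [sub_zero]; exact (F.norm_coe_le_norm t).trans_lt (lt_add_one _)) 1 e2
      have hL : (Λ j).f (K.ι.comp ((Φ j).comp (cir j))) = (d j)⁻¹ := by
        refine hg.trans ?_
        rw [pow_one, mul_comm g, mul_assoc, mul_inv_cancel, mul_one]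
      rw [hL]
      exact mul_inv_cancel _
    · intro k _ hk
      have hne : ∀ c ∈ Metric.ball (K.t j) (r0 j), (c ^ K.n) ^ K.q * (K.t k - c) ≠ 0 := fun c hc => by
        refine mul_ne_zero (pow_ne_zero _ (pow_ne_zero _ ((T j).1.1.2.1 c hc))) (sub_ne_zero.2 fun h => ?_)
        by_cases hc' : c = K.t j
        · exact hk (K.hti (h.trans hc'))
        · exact ((T j).1.2 c hc hc').2 k h.symm
      let G : C(Metric.ball (K.t j) (r0 j), ↥((↑({0} : Finset ℂ) : Set ℂ)ᶜ)) :=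
        ⟨fun c => ⟨((c : ℂ) ^ K.n) ^ K.q * (K.t k - c), by simpa using hne c c.2⟩, by fun_prop⟩
      let cb : C(I, Metric.ball (K.t j) (r0 j)) := ⟨fun t => ⟨cir j t, (hcir j t).1⟩, by fun_prop⟩
      have : SimplyConnectedSpace (Metric.ball (K.t j) (r0 j)) := convex_sc (convex_ball _ _) ⟨_, Metric.mem_ball_self (rpos j)⟩
      have eq : (gm k).comp (K.ι.comp ((Φ j).comp (cir j))) = G.comp cb := by
        ext1 t
        apply Subtype.ext
        refine (K.gt_S (Φ j (cir j t)) (K.t k)).trans ?_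
        rw [hΦ]; rfl
      rw [LS.comap_f, eq, (St hG fun _ => d k).f_eq_of_sc G cb (ContinuousMap.const I (cb 0)) rfl (by
        apply Subtype.ext
        simp [cb, cir, Complex.exp_two_pi_mul_I])]
      exact LS.f_eq_one_of_const _ _ fun t => rfl
    · simp
  obtain ⟨e, he⟩ := exists_eval_ne K.g_ne
  have key := ext_triv K.g_hom (IsRelPrime.symm (K.relprime_g fun j => (K.hcop j).symm)) he M (by
    intro y hy hy0
    obtain ⟨j, ε0, hε0, h⟩ := small_loop (fun j => (T j).1) e y hy hy0
    refine ⟨ε0, hε0, fun ε h1 h2 γ hγ => ?_⟩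
    obtain ⟨x, c, β, c0, c1, hc, hβ, hM⟩ := h ε h1 h2 γ hγ
    apply hM
    have hb : K.cx x ∈ PB j := by rw [← c0]; exact hc 0
    -- path from x to the reference point
    obtain ⟨κ, k0, k1, k2⟩ := fibre_path x (Φ j ⟨_, hb⟩) (hΦ j ⟨_, hb⟩).symm
    obtain ⟨cp, p0, p1, p2⟩ := pball_path hb (hP j)
    let η : C(I, K.S) := (Φ j).comp ⟨fun t => ⟨cp t, p2 t⟩, by fun_prop⟩
    have hj : κ 1 = η 0 := by
      rw [k1]
      exact congrArg (Φ j) (Subtype.ext p0.symm)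
    let δ := ctrans κ η hj
    have hδ : ∀ t, K.cx (δ t) ∈ Metric.ball (K.t j) (r0 j) := by
      refine ctrans_mem κ η hj (S := {z : K.S | K.cx z ∈ Metric.ball (K.t j) (r0 j)}) (fun t => ?_) fun t => ?_
      · change K.cx (κ t) ∈ Metric.ball (K.t j) (r0 j)
        rw [k2]; exact hb.1
      · change K.cx (Φ j ⟨cp t, p2 t⟩) ∈ Metric.ball (K.t j) (r0 j)
        rw [hΦ]; exact (p2 t).1
    have δ0 : δ 0 = x := (ctrans_zero _ _ _).trans k0
    have δ1 : δ 1 = P j := by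
      refine (ctrans_one _ _ _).trans (Subtype.ext ?_)
      change Tr j (K.cx (P j)) (cp 1) (P j) = P j
      rw [p1, (T j).1.self _ (hP j).1]
    let cc' : C(I, PB j) := ⟨fun t => ⟨c t, hc t⟩, by fun_prop⟩
    have h3 := disc_triv_circle ((M.comap K.ι).comap (Φ j)) (K.t j) (r0 j) (rpos j) (fun z h1 h2 =>
      ⟨by rwa [Metric.mem_ball, dist_eq_norm], h1⟩) (r0 j / 2) (rpos2 j) (half_lt_self (rpos j)) (cir j) (fun t => rfl)
      (Mcir j) cc' (fun t => ⟨(hc t).2, by rw [← dist_eq_norm]; exact (hc t).1⟩) (Subtype.ext (c0.trans c1.symm))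
    let W : C(I × I, K.S) := (T j).1.tr (δ.comp ⟨Prod.fst, continuous_fst⟩) (c.comp ⟨Prod.snd, continuous_snd⟩)
      (fun z => hδ z.1) (fun z => hc z.2)
    have sq := (M.comap K.ι).square W (W.comp ⟨fun t => (t, 0), by fun_prop⟩) ((Φ j).comp cc') β
      (W.comp ⟨fun t => (t, 0), by fun_prop⟩) (fun t => rfl) (fun t => Subtype.ext (by
        change Tr j (K.cx (P j)) (c t) (P j) = Tr j (K.cx (δ 1)) (c t) (δ 1)
        rw [δ1])) (fun t => Subtype.ext (by
        refine (hβ t).trans ?_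
        change _ = Tr j (K.cx (δ 0)) (c t) (δ 0)
        rw [δ0])) (fun t => Subtype.ext (by
        change Tr j (K.cx (δ t)) (c 0) (δ t) = Tr j (K.cx (δ t)) (c 1) (δ t)
        rw [c0, c1]))
    rw [LS.comap_f] at h3
    rw [h3, mul_one] at sq
    exact right_eq_mul.1 sq)
  have hN : (commutator N).Normal := inferInstance
  refine Subgroup.normalClosure_le_normal ?_
  rintro _ ⟨κ, hκ, rfl⟩
  have h := key (K.ι.comp κ) (by rw [ContinuousMap.comp_apply, ContinuousMap.comp_apply, hκ.1])
  rw [Mf, Finset.prod_eq_one, mul_one] at h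
  · change _ ∈ commutator N
    rw [← Abelianization.ker_of]
    exact h
  · intro k _
    refine (St hG fun _ => d k).f_eq_one_of_const ((gm k).comp (K.ι.comp κ)) fun t => Subtype.ext ?_
    refine (K.gt_S (κ t) (K.t k)).trans (Eq.trans ?_ (K.gt_S (κ 0) (K.t k)).symm)
    rw [hκ.2 t]

end Cfg
end Oka
end

open MvPolynomial
noncomputable section
namespace Oka
open unitInterval Set Topology Filter

/-- the final group-theoretic step -/
theorem Cfg.final (K : Cfg) (U : Set P2) (hU : U = UU K.g) (x : U) :
    Nonempty (FundamentalGroup U x ≃* GG K.r K.p K.q) := by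
  subst hU
  obtain ⟨τ, hτ, huniv⟩ := exists_univ (UU K.g) x
  obtain ⟨hc⟩ := isCop_GG K.r K.p K.q
  obtain ⟨φ, hs, hk⟩ := K.phi_ex τ x hτ huniv hc
  have h5 := K.R5 τ x hτ
  have h6 := K.R6 τ
  have hp : K.p ≠ 0 := by have := K.hd.hp; omega
  have hq : K.q ≠ 0 := by have := K.hd.hq; omega
  have hinj := R7 hp hq hc φ hs (fun k h => h5 (hk k h)) (fun k h => h6 (hk k h))
  exact ⟨MulEquiv.ofBijective φ ⟨hinj, hs⟩⟩

lemma bezout {p q : ℕ} (hp : 1 ≤ p) (hq : 1 ≤ q) (h : Nat.Coprime p q) :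
    ∃ m n : ℕ, p * m = q * n + 1 := by
  rcases Nat.lt_or_ge 1 q with h1 | h1
  · obtain ⟨m, hm⟩ := Nat.exists_mul_mod_eq_one_of_coprime h h1
    exact ⟨m, p * m / q, by have := Nat.div_add_mod (p * m) q; omega⟩
  · have : q = 1 := by omega
    subst this
    exact ⟨1, p - 1, by omega⟩

lemma pt_ne (c : ℂ) : ![(1:ℂ), c] ≠ 0 := fun h => by simpa using congrFun h 0
lemma pt_ne0 : ![(0:ℂ), 1] ≠ 0 := fun h => by simpa using congrFun h 1

lemma pt_eq {a b : ℂ} (hab : ![a, b] ≠ 0) (ha : a ≠ 0) : pt a b hab = pt 1 (b / a) (pt_ne _) := by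
  rw [pt, pt, Projectivization.mk_eq_mk_iff']
  refine ⟨a, ?_⟩
  ext j; fin_cases j
  · simp
  · simp; field_simp

lemma pt_eq0 {b : ℂ} (hab : ![0, b] ≠ 0) : pt 0 b hab = pt 0 1 pt_ne0 := by
  rw [pt, pt, Projectivization.mk_eq_mk_iff']
  refine ⟨b, ?_⟩
  ext j; fin_cases j <;> simp

lemma pt_inj {c c' : ℂ} (h : pt 1 c (pt_ne c) = pt 1 c' (pt_ne c')) : c = c' := by
  rw [pt, pt, Projectivization.mk_eq_mk_iff'] at h
  obtain ⟨a, ha⟩ := h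
  have h0 : a = 1 := by simpa using congrFun ha 0
  have h1 := congrFun ha 1
  simpa [h0] using h1.symm

lemma pencil_cop {p q : ℕ} {fp fq : Pol} (hrel : IsRelPrime fp fq) {c c' : ℂ} (h : c ≠ c') :
    IsRelPrime (C c * fp ^ q - fq ^ p) (C c' * fp ^ q - fq ^ p) := by
  intro d h1 h2
  have e1 : (C c * fp ^ q - fq ^ p) - (C c' * fp ^ q - fq ^ p) = C (c - c') * fp ^ q := by
    rw [map_sub]; ring
  have hu : IsUnit (C (c - c') : Pol) := (isUnit_iff_ne_zero.2 (sub_ne_zero.2 h)).map C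
  have h3 : d ∣ fp ^ q := by
    have := dvd_sub h1 h2
    rw [e1] at this
    exact hu.dvd_mul_left.1 this
  have h4 : d ∣ fq ^ p := by
    have := (h3.mul_left (C c)).sub h1
    simpa using this
  exact (hrel.pow (m := q) (n := p)) h3 h4

lemma bad_finite {p q : ℕ} {fp fq h0 : Pol} (hrel : IsRelPrime fp fq) (hh0 : h0 ≠ 0) :
    {c : ℂ | ¬ IsRelPrime (C c * fp ^ q - fq ^ p) h0}.Finite := by
  classical
  have key : ∀ c : ℂ, ¬ IsRelPrime (C c * fp ^ q - fq ^ p) h0 →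
      ∃ π ∈ (UniqueFactorizationMonoid.factors h0).toFinset, ¬ IsUnit π ∧ π ∣ C c * fp ^ q - fq ^ p := by
    intro c hc
    rw [IsRelPrime] at hc
    push Not at hc
    obtain ⟨d, hd1, hd2, hd3⟩ := hc
    have hd0 : d ≠ 0 := fun h => hh0 (by rw [h] at hd2; exact zero_dvd_iff.1 hd2)
    obtain ⟨ρ, hρ, hρd⟩ := WfDvdMonoid.exists_irreducible_factor hd3 hd0
    obtain ⟨π, hπ, has⟩ := UniqueFactorizationMonoid.exists_mem_factors_of_dvd hh0 hρ (hρd.trans hd2)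
    exact ⟨π, Multiset.mem_toFinset.2 hπ, fun h => hρ.not_isUnit (has.isUnit_iff.2 h),
      (has.symm.dvd.trans hρd).trans hd1⟩
  choose! F hF1 hF2 hF3 using key
  refine Set.Finite.of_finite_image (f := F) ?_ ?_
  · refine (UniqueFactorizationMonoid.factors h0).toFinset.finite_toSet.subset ?_
    rintro _ ⟨c, hc, rfl⟩
    exact hF1 c hc
  · intro c hc c' hc' h
    by_contra hne
    refine hF2 c hc (pencil_cop hrel hne (hF3 c hc) ?_)
    rw [h]; exact hF3 c' hc'

theorem main (p q : ℕ) (hp : 1 ≤ p) (hq : 1 ≤ q) (hpq : Nat.Coprime p q)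
    (fp fq : Pol)
    (hfp0 : fp ≠ 0) (hfp : fp.IsHomogeneous p)
    (hfq0 : fq ≠ 0) (hfq : fq.IsHomogeneous q)
    (hpowp : ∀ k, 2 ≤ k → ∀ h : Pol, fp ≠ h ^ k)
    (hpowq : ∀ k, 2 ≤ k → ∀ h : Pol, fq ≠ h ^ k)
    (hcf : ∀ h : Pol, h ∣ fp → h ∣ fq → h.totalDegree = 0)
    (hconn : ∃ A₀ : Set P1, A₀.Finite ∧ ∀ (a b : ℂ) (hab : ![a, b] ≠ 0),
      pt a b hab ∉ A₀ →
      IsConnected {x : P2 | x ∉ V fp ∩ V fq ∧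
        b * eval x.rep (fp ^ q) = a * eval x.rep (fq ^ p)})
    (hmult : ∀ a b : ℂ, a ≠ 0 → b ≠ 0 → ∀ k, 2 ≤ k →
      ∀ h : Pol, C b * fp ^ q - C a * fq ^ p ≠ h ^ k) :
    ∃ A : Set P1, A.Finite ∧
      ∀ (r : ℕ) (a b : Fin (r + 1) → ℂ) (hab : ∀ i, ![a i, b i] ≠ 0),
        (∀ i, pt (a i) (b i) (hab i) ∉ A) →
        Function.Injective (fun i => pt (a i) (b i) (hab i)) →
        ∀ x : ↥(⋃ i, V (C (b i) * fp ^ q - C (a i) * fq ^ p))ᶜ,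
          Nonempty (FundamentalGroup (↥(⋃ i, V (C (b i) * fp ^ q - C (a i) * fq ^ p))ᶜ) x ≃*
            GG r p q) := by
  classical
  obtain ⟨m, n, hmn⟩ := bezout hp hq hpq
  have hd : Dat p q m n fp fq := ⟨hp, hq, hmn, hfp0, hfq0, hfp, hfq, relprime_of_cf hfp0 hcf⟩
  obtain ⟨i, D, h1, h2, h3⟩ := hd.alg
  obtain ⟨E, hE0, hE⟩ := hd.transport h1 h2 h3
  obtain ⟨h0, hh0, hh⟩ := exists_h0 hd i h3
  obtain ⟨A₀, hA₀, hconn⟩ := hconn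
  have hfin0 : {c : ℂ | pt 1 c (pt_ne c) ∈ A₀}.Finite :=
    hA₀.preimage (f := fun c => pt 1 c (pt_ne c)) (fun c _ c' _ h => pt_inj h)
  have hbad := bad_finite (p := p) (q := q) hd.hrel hh0
  let A1 : Finset ℂ := insert 0 (E.roots.toFinset ∪ hfin0.toFinset)
  have hA1 : ∀ c : ℂ, c ∉ A1 → c ≠ 0 ∧ E.eval c ≠ 0 ∧ pt 1 c (pt_ne c) ∉ A₀ := by
    intro c hc
    simp only [A1, Finset.mem_insert, Finset.mem_union, Multiset.mem_toFinset, Polynomial.mem_roots hE0,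
      Polynomial.IsRoot.def, Set.Finite.mem_toFinset, not_or] at hc
    exact ⟨hc.1, hc.2.1, hc.2.2⟩
  have tube : ∀ c, c ∉ A1 → ∃ r0 Tr, TubeAt p q m n fp fq i D c r0 Tr := by
    intro c hc
    obtain ⟨k1, k2, -⟩ := hA1 c hc
    obtain ⟨r0, hr0, hb, Tr, hT1, hT2⟩ := hE c k1 k2
    exact ⟨r0, Tr, hr0, hb, hT1, hT2⟩
  have fb : ∀ c, c ∉ A1 → IsPathConnected (Fb p q m n fp fq i D c) := by
    intro c hc
    obtain ⟨r0, Tr, hT⟩ := tube c hc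
    obtain ⟨k1, -, k3⟩ := hA1 c hc
    exact hd.fb_conn hT hh0 hh (hd.sigC_conn k1 (hconn 1 c (pt_ne c) k3))
  let B : Set ℂ := ↑A1 ∪ {c : ℂ | ¬ IsRelPrime (C c * fp ^ q - fq ^ p) h0}
  refine ⟨insert (pt 0 1 pt_ne0) ((fun c => pt 1 c (pt_ne c)) '' B),
    ((A1.finite_toSet.union hbad).image _).insert _, ?_⟩
  intro r a b hab hA hinj x
  have ha : ∀ j, a j ≠ 0 := by
    intro j hj
    apply hA j
    left
    have : ∀ (a b : ℂ) (h : ![a, b] ≠ 0), a = 0 → pt a b h = pt 0 1 pt_ne0 := by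
      rintro a b h rfl; exact pt_eq0 h
    exact this _ _ _ hj
  have hB : ∀ j, b j / a j ∉ B := by
    intro j hj
    apply hA j
    right
    exact ⟨_, hj, (pt_eq (hab j) (ha j)).symm⟩
  let K : Cfg := 
    { p := p, q := q, m := m, n := n, r := r, fp := fp, fq := fq, i := i, D := D, h0 := h0, A1 := A1
      t := fun j => b j / a j
      hd := hd, hh0 := hh0, hh := hh, tube := tube, fb := fb
      hA0 := Finset.mem_insert_self _ _
      ht := fun j h => hB j (Or.inl h)
      hti := fun j j' h => hinj (by
        have h' : b j / a j = b j' / a j' := h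
        change pt _ _ _ = pt _ _ _
        rw [pt_eq _ (ha j), pt_eq _ (ha j')]
        simp only [h'])
      hcop := fun j => by
        by_contra h
        exact hB j (Or.inr h)
      hpowp := hpowp, hpowq := hpowq
      hpowc := fun c hc k hk h => by
        have := hmult 1 c one_ne_zero hc k hk h
        rwa [map_one, one_mul] at this }
  refine K.final _ ?_ x
  ext y
  change _ ↔ eval y.rep K.g ≠ 0
  rw [K.g_eval_ne, mem_compl_iff, mem_iUnion, not_exists]
  refine forall_congr' fun j => not_congr ?_
  rw [K.gt_eval]
  change eval y.rep _ = 0 ↔ b j / a j * eval y.rep fp ^ q - eval y.rep fq ^ p = 0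
  have e : eval y.rep (C (b j) * fp ^ q - C (a j) * fq ^ p) =
      a j * (b j / a j * eval y.rep fp ^ q - eval y.rep fq ^ p) := by
    have := ha j
    simp only [map_sub, map_mul, map_pow, eval_C]
    field_simp
  rw [e, mul_eq_zero, or_iff_right (ha j)]

end Oka
end

/-- Generalized Oka theorem: for coprime `p, q ≥ 1` and homogeneous `f_p, f_q`
of degrees `p, q` that are not proper powers, share no nonconstant common factor, such that
the pencil `F = [f_p^q : f_q^p]` has connected generic fibers, and no fiber over a point
other than `[0:1]`, `[1:0]` is a multiple fiber, the complement of a union of `r+1` distinct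
generic fibers has fundamental group `𝔽_r * ℤ_p * ℤ_q`. -/
theorem stmt_1 (p q : ℕ) (hp : 1 ≤ p) (hq : 1 ≤ q) (hpq : Nat.Coprime p q)
    (fp fq : MvPolynomial (Fin 3) ℂ)
    (hfp0 : fp ≠ 0) (hfp : fp.IsHomogeneous p)
    (hfq0 : fq ≠ 0) (hfq : fq.IsHomogeneous q)
    -- (i) neither `f_p` nor `f_q` is a `k`-th power of another polynomial for `k ≥ 2`
    (hpowp : ∀ k, 2 ≤ k → ∀ h : MvPolynomial (Fin 3) ℂ, fp ≠ h ^ k)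
    (hpowq : ∀ k, 2 ≤ k → ∀ h : MvPolynomial (Fin 3) ℂ, fq ≠ h ^ k)
    -- (ii) no nonconstant common factor
    (hcf : ∀ h : MvPolynomial (Fin 3) ℂ, h ∣ fp → h ∣ fq → h.totalDegree = 0)
    -- (iii) the generic fibers of the pencil `F = [f_p^q : f_q^p]` are connected
    (hconn : ∃ A₀ : Set P1, A₀.Finite ∧ ∀ (a b : ℂ) (hab : ![a, b] ≠ 0),
      pt a b hab ∉ A₀ →
      IsConnected {x : P2 | x ∉ V fp ∩ V fq ∧
        b * eval x.rep (fp ^ q) = a * eval x.rep (fq ^ p)})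
    -- (iv) the multiple fibers of `F` lie over a subset of `{[0:1], [1:0]}`
    (hmult : ∀ a b : ℂ, a ≠ 0 → b ≠ 0 → ∀ k, 2 ≤ k →
      ∀ h : MvPolynomial (Fin 3) ℂ, C b * fp ^ q - C a * fq ^ p ≠ h ^ k) :
    ∃ A : Set P1, A.Finite ∧
      ∀ (r : ℕ) (a b : Fin (r + 1) → ℂ) (hab : ∀ i, ![a i, b i] ≠ 0),
        (∀ i, pt (a i) (b i) (hab i) ∉ A) →
        Function.Injective (fun i => pt (a i) (b i) (hab i)) →
        ∀ x : ↥(⋃ i, V (C (b i) * fp ^ q - C (a i) * fq ^ p))ᶜ,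
          Nonempty (FundamentalGroup (↥(⋃ i, V (C (b i) * fp ^ q - C (a i) * fq ^ p))ᶜ) x ≃*
            Monoid.Coprod
              (Monoid.Coprod (FreeGroup (Fin r)) (Multiplicative (ZMod p)))
              (Multiplicative (ZMod q))) := by
  exact Oka.main p q hp hq hpq fp fq hfp0 hfp hfq0 hfq hpowp hpowq hcf hconn hmult
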